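/- For a separable, unital, simple C*-algebra A, the following are equivalent: (i) A has nuclear dimension at most one and real rank zero; (ii) A has weak complexity rank at most one. -/

import Mathlib

universe u v

/-- A square matrix over a C*-algebra (or star ring) is positive iff it has the form
`star y * y`. -/
def MatIsPos {R : Type*} [NonUnitalSemiring R] [StarRing R] {k : ℕ}
    (x : Matrix (Fin k) (Fin k) R) : Prop :=
  ∃ y : Matrix (Fin k) (Fin k) R, x = star y * y

/-- A ℂ-linear map between C*-algebras is completely positive if, for every `k`, the induced
map on `k × k` matrices maps positive matrices to positive matrices. -/
def IsCP {A : Type u} {B : Type v} [NonUnitalCStarAlgebra A] [NonUnitalCStarAlgebra B]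
    (φ : A →ₗ[ℂ] B) : Prop :=
  ∀ (k : ℕ) (x : Matrix (Fin k) (Fin k) A), MatIsPos x → MatIsPos (x.map φ)

/-- The data witnessing one instance of the nuclear dimension condition: a finite-dimensional
C*-algebra `F = F₀ ⊕ ⋯ ⊕ F_n` (modeled as a finite product), a contractive completely
positive map `ψ : A → F`, and a completely positive map `φ : F → A` whose restriction to each
summand is contractive and order zero, with `φ ∘ ψ` `ε`-approximating the identity on `X`. -/
def NucDimWitness (A : Type u) [NonUnitalCStarAlgebra A] (n : ℕ) (X : Finset A) (ε : ℝ)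
    (F : Fin (n + 1) → Type v) [∀ i, NonUnitalCStarAlgebra (F i)] : Prop :=
  (∀ i, FiniteDimensional ℂ (F i)) ∧
  ∃ (ψ : A →ₗ[ℂ] (∀ i, F i)) (φ : (∀ i, F i) →ₗ[ℂ] A),
    IsCP ψ ∧ (∀ a : A, ‖ψ a‖ ≤ ‖a‖) ∧
    IsCP φ ∧
    (∀ i : Fin (n + 1),
      (∀ x : F i, ‖φ (Pi.single i x)‖ ≤ ‖x‖) ∧
      (∀ x y : F i, (∃ u, x = star u * u) → (∃ v, y = star v * v) → x * y = 0 →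
        φ (Pi.single i x) * φ (Pi.single i y) = 0)) ∧
    (∀ x ∈ X, ‖φ (ψ x) - x‖ < ε)

/-- A C*-algebra `A` has nuclear dimension at most `n`. -/
def NuclearDimLE (n : ℕ) (A : Type u) [NonUnitalCStarAlgebra A] : Prop :=
  ∀ (X : Finset A) (ε : ℝ), 0 < ε →
    ∃ (F : Fin (n + 1) → Type) (instF : ∀ i, NonUnitalCStarAlgebra (F i)),
      @NucDimWitness A _ n X ε F instF
/-- A C*-algebra has real rank zero if every self-adjoint element can be approximated in norm
by self-adjoint elements with finite spectrum. -/
def RealRankZero (A : Type u) [CStarAlgebra A] : Prop :=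
  ∀ a : A, IsSelfAdjoint a → ∀ ε : ℝ, 0 < ε →
    ∃ b : A, IsSelfAdjoint b ∧ (spectrum ℝ b).Finite ∧ ‖a - b‖ < ε
/-- `a ∈_ε S`: there is `s ∈ S` with `‖a - s‖ < ε`. -/
def MemEps {A : Type u} [CStarAlgebra A] (ε : ℝ) (S : Set A) (a : A) : Prop :=
  ∃ s ∈ S, ‖a - s‖ < ε

/-- A unital C*-algebra `A` has weak complexity rank at most one: for every finite subset
`X` of `A` and every `ε > 0` there are finite-dimensional C*-subalgebras `C`, `D` of `A` and
a positive contraction `h ∈ A` with `‖[h,x]‖ < ε`, `h x ∈_ε C` and `(1-h) x ∈_ε D` for all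
`x ∈ X`. -/
def WeakCRLeOne (A : Type u) [CStarAlgebra A] : Prop :=
  ∀ (X : Finset A) (ε : ℝ), 0 < ε →
    ∃ C D : NonUnitalStarSubalgebra ℂ A,
      FiniteDimensional ℂ C ∧ FiniteDimensional ℂ D ∧
      ∃ h : A, (∃ x : A, h = star x * x) ∧ ‖h‖ ≤ 1 ∧
        (∀ x ∈ X, ‖h * x - x * h‖ < ε) ∧
        (∀ x ∈ X, MemEps ε (C : Set A) (h * x)) ∧
        (∀ x ∈ X, MemEps ε (D : Set A) ((1 - h) * x))

/-- A C*-algebra is simple if its only closed two-sided ideals are `0` and the whole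
algebra. -/
def IsSimpleCStarAlgebra (A : Type u) [CStarAlgebra A] : Prop :=
  ∀ I : TwoSidedIdeal A, IsClosed (I : Set A) → I = ⊥ ∨ I = ⊤


universe w

section Helpers
set_option linter.style.haveILetI false
set_option linter.unusedSimpArgs false
set_option linter.unusedSectionVars false
open Filter Topology

section FDStruct

theorem finite_spectrum_of_aeval {B : Type*} [Ring B] [Algebra ℝ B] (b : B)
    (p : Polynomial ℝ) (hp : p ≠ 0) (h : Polynomial.aeval b p = 0) : (spectrum ℝ b).Finite := by
  refine Set.Finite.subset p.roots.toFinset.finite_toSet ?_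
  intro t ht
  rcases subsingleton_or_nontrivial B with hB | hB
  · simp [spectrum.of_subsingleton] at ht
  have := spectrum.subset_polynomial_aeval b p ⟨t, ht, rfl⟩
  rw [h, spectrum.zero_eq] at this
  simp only [Set.mem_singleton_iff] at this
  simp [hp, this]

theorem finite_spectrum_of_fd {B : Type*} [Ring B] [Algebra ℝ B] [FiniteDimensional ℝ B] (b : B) :
    (spectrum ℝ b).Finite := by
  obtain ⟨p, hp, h⟩ := Algebra.IsAlgebraic.isAlgebraic (R := ℝ) b
  exact finite_spectrum_of_aeval b p hp h

theorem finite_quasispectrum_of_fd {F : Type*} [NonUnitalCStarAlgebra F] [FiniteDimensional ℂ F]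
    (x : F) : (quasispectrum ℝ x).Finite := by
  have : FiniteDimensional ℝ F := Module.Finite.trans ℂ F
  rw [Unitization.quasispectrum_eq_spectrum_inr (R := ℝ)]
  have : FiniteDimensional ℝ (Unitization ℝ F) :=
    Module.Finite.equiv (Unitization.linearEquiv ℝ ℝ F).symm
  exact finite_spectrum_of_fd _

theorem exists_spectral_proj {F : Type*} [NonUnitalCStarAlgebra F] [FiniteDimensional ℂ F]
    (x : F) (hx : IsSelfAdjoint x) (h0 : x ≠ 0) :
    ∃ (l : ℝ) (q : F), l ≠ 0 ∧ q ≠ 0 ∧ IsStarProjection q ∧ x * q = l • q ∧ q * x = l • q := by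
  have hfin := finite_quasispectrum_of_fd x
  have hex : ∃ l ∈ quasispectrum ℝ x, l ≠ 0 := by
    by_contra! hcon
    apply h0
    rw [← cfcₙ_id ℝ x, ← cfcₙ_zero ℝ x]
    apply cfcₙ_congr
    intro t ht
    simp [hcon t ht]
  obtain ⟨l, hl, hl0⟩ := hex
  let g : ℝ → ℝ := fun t => if t = l then 1 else 0
  have hc : ∀ f : ℝ → ℝ, ContinuousOn f (quasispectrum ℝ x) := fun f => hfin.continuousOn f
  have hg0 : g 0 = 0 := by simp [g, hl0.symm]
  have e1 : x * cfcₙ g x = l • cfcₙ g x := by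
    conv_lhs => rw [← cfcₙ_id ℝ x, cfcₙ_id ℝ x]
    nth_rewrite 1 [← cfcₙ_id ℝ x]
    rw [← cfcₙ_mul _ _ x (hc _) rfl (hc _) hg0, ← cfcₙ_smul l g x (hc _) hg0]
    apply cfcₙ_congr
    intro t ht
    by_cases h : t = l <;> simp [g, h]
  have hsa : IsSelfAdjoint (cfcₙ g x) := cfcₙ_predicate g x
  refine ⟨l, cfcₙ g x, hl0, ?_, ⟨?_, hsa⟩, e1, ?_⟩
  · intro h
    rw [← cfcₙ_zero ℝ x] at h
    have := (cfcₙ_eq_cfcₙ_iff_eqOn (a := x) (f := g) (g := 0) (hf := hc _) (hg := hc _) (hf0 := hg0) (hg0 := rfl) hx).1 h hl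
    simp [g] at this
  · rw [IsIdempotentElem, ← cfcₙ_mul _ _ x (hc _) hg0 (hc _) hg0]
    apply cfcₙ_congr
    intro t ht
    by_cases h : t = l <;> simp [g, h]
  · have := congrArg star e1
    simpa [hx.star_eq, hsa.star_eq] using this


/-- partial systems of matrix units, encoded by partial isometries to class representatives -/
structure IsPreMU {F ι : Type*} [NonUnitalCStarAlgebra F] (r : ι → ι) (v : ι → F) : Prop where
  rr : ∀ i, r (r i) = r i
  off : ∀ i j, i ≠ j → star (v i) * v j = 0
  self : ∀ i, star (v i) * v i = v (r i)
  ne : ∀ i, v i ≠ 0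
  min : ∀ i x, ∃ c : ℂ, v (r i) * x * v (r i) = c • v (r i)
  cross : ∀ i j, r i ≠ r j → ∀ x, v (r i) * x * v (r j) = 0

namespace IsPreMU

variable {F ι : Type*} [NonUnitalCStarAlgebra F] {r : ι → ι} {v : ι → F}

theorem sa (H : IsPreMU r v) (i : ι) : star (v (r i)) = v (r i) := by
  rw [← H.self i]; simp

theorem idem (H : IsPreMU r v) (i : ι) : v (r i) * v (r i) = v (r i) := by
  have := H.self (r i)
  rwa [H.sa, H.rr] at this

theorem proj (H : IsPreMU r v) (i : ι) : IsStarProjection (v (r i)) := ⟨H.idem i, H.sa i⟩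

theorem eq_zero_of_star_mul {F : Type*} [NonUnitalCStarAlgebra F] {x : F} (h : star x * x = 0) :
    x = 0 := by
  simpa [CStarRing.star_mul_self_eq_zero_iff] using h

theorem mul_rep (H : IsPreMU r v) (i : ι) : v i * v (r i) = v i := by
  rw [← sub_eq_zero]
  apply eq_zero_of_star_mul
  simp only [star_sub, star_mul, H.sa, sub_mul, mul_sub]
  have e : v (r i) * star (v i) * (v i * v (r i)) = v (r i) := by
    rw [mul_assoc, ← mul_assoc (star (v i)), H.self, H.idem, H.idem]
  rw [e, mul_assoc, H.self, ← mul_assoc, H.self, H.idem]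
  simp

theorem rep_mul_star (H : IsPreMU r v) (i : ι) : v (r i) * star (v i) = star (v i) := by
  have := congrArg star (H.mul_rep i)
  simpa [H.sa] using this

theorem linInd (H : IsPreMU r v) : LinearIndependent ℂ v := by
  rw [linearIndependent_iff']
  intro s g hs i hi
  have h1 := congrArg (fun z => star (v i) * z) hs
  simp only [Finset.mul_sum, mul_smul_comm, mul_zero] at h1
  rw [Finset.sum_eq_single i] at h1
  · rw [H.self, smul_eq_zero] at h1
    exact h1.resolve_right (H.ne _)
  · intro j _ hj
    rw [H.off i j (Ne.symm hj), smul_zero]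
  · exact fun h => absurd hi h

/-- the unit of the partial system -/
noncomputable def unit [Fintype ι] (v : ι → F) : F := ∑ i, v i * star (v i)

theorem star_unit [Fintype ι] (v : ι → F) : star (unit v) = unit v := by
  simp [unit, star_sum]

theorem unit_mul [Fintype ι] (H : IsPreMU r v) (j : ι) : unit v * v j = v j := by
  rw [unit, Finset.sum_mul, Finset.sum_eq_single j]
  · rw [mul_assoc, H.self, H.mul_rep]
  · intro i _ hij
    rw [mul_assoc, H.off i j hij, mul_zero]
  · simp

theorem mul_unit [Fintype ι] (H : IsPreMU r v) (j : ι) : star (v j) * unit v = star (v j) := by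
  have := congrArg star (H.unit_mul j)
  simpa [star_unit] using this

theorem unit_idem [Fintype ι] (H : IsPreMU r v) : unit v * unit v = unit v := by
  have h : ∀ i, star (v i) * ∑ j, v j * star (v j) = star (v i) := H.mul_unit
  simp only [unit, Finset.sum_mul, mul_assoc, h]

end IsPreMU

theorem exists_min_proj {F : Type*} [NonUnitalCStarAlgebra F] [FiniteDimensional ℂ F]
    (p : F) (hp : IsStarProjection p) (h0 : p ≠ 0) :
    ∃ q : F, IsStarProjection q ∧ q ≠ 0 ∧ p * q = q ∧ q * p = q ∧
      ∀ x, ∃ c : ℂ, q * x * q = c • q := by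
  classical
  let S : F → Submodule ℂ F := fun q =>
    LinearMap.range ((LinearMap.mulRight ℂ q).comp (LinearMap.mulLeft ℂ q))
  have hS : ∀ q x : F, q * x * q ∈ S q := fun q x => ⟨x, by simp⟩
  let P : ℕ → Prop := fun n => ∃ q : F, IsStarProjection q ∧ q ≠ 0 ∧ p * q = q ∧ q * p = q ∧
    Module.finrank ℂ (S q) = n
  have hP : ∃ n, P n := ⟨_, p, hp, h0, hp.1, hp.1, rfl⟩
  obtain ⟨q, hq, hq0, hpq, hqp, hn⟩ := Nat.find_spec hP
  refine ⟨q, hq, hq0, hpq, hqp, ?_⟩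
  have qq : ∀ x, q * (q * x) = q * x := fun x => by rw [← mul_assoc, hq.1.eq]
  have key : ∀ x, IsSelfAdjoint x → q * x = x → x * q = x → ∃ c : ℂ, x = c • q := by
    intro x hx hqx hxq
    by_cases hx0 : x = 0
    · exact ⟨0, by simp [hx0]⟩
    obtain ⟨l, e, hl, he0, he, hxe, hex⟩ := exists_spectral_proj x hx hx0
    have hqe : q * e = e := by
      have : l • (q * e) = l • e := by rw [← mul_smul_comm, ← hxe, ← mul_assoc, hqx]
      exact smul_right_injective _ hl this
    have heq : e * q = e := by
      have := congrArg star hqe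
      simpa [he.2.star_eq, hq.2.star_eq] using this
    have hle : S e ≤ S q := by
      rintro _ ⟨z, rfl⟩
      refine ⟨e * z * e, ?_⟩
      simp only [LinearMap.comp_apply, LinearMap.mulLeft_apply, LinearMap.mulRight_apply]
      rw [← mul_assoc, ← mul_assoc, hqe, mul_assoc _ e q, heq]
    have hge : Module.finrank ℂ (S q) ≤ Module.finrank ℂ (S e) := by
      rw [hn]
      exact Nat.find_min' hP ⟨e, he, he0, by rw [← hqe, ← mul_assoc, hpq],
        by rw [← heq, mul_assoc, hqp], rfl⟩
    have hEq : S e = S q := Submodule.eq_of_le_of_finrank_le hle hge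
    have hqS : q ∈ S e := by
      rw [hEq]
      have := hS q q
      rwa [hq.1.eq, hq.1.eq] at this
    obtain ⟨z, hz⟩ := hqS
    simp only [LinearMap.comp_apply, LinearMap.mulLeft_apply, LinearMap.mulRight_apply] at hz
    have : e * q = q := by
      rw [← hz, ← mul_assoc, ← mul_assoc, he.1.eq]
    rw [heq] at this
    subst this
    refine ⟨l, ?_⟩
    rw [← hxq, hxe]
    simp
  intro x
  have h1 := key (q * (x + star x) * q) (by
    simp [isSelfAdjoint_iff, hq.2.star_eq, mul_assoc, add_comm]) (by simp [mul_assoc, qq])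
    (by simp [mul_assoc, hq.1.eq])
  have h2 := key (q * (Complex.I • (x - star x)) * q) (by
    simp only [isSelfAdjoint_iff, star_mul, hq.2.star_eq, star_smul, star_sub, star_star]
    rw [show star Complex.I = - Complex.I from Complex.conj_I, neg_smul, ← smul_neg, neg_sub,
      mul_assoc]) (by simp [mul_assoc, qq])
    (by simp [mul_assoc, hq.1.eq])
  obtain ⟨c, hc⟩ := h1
  obtain ⟨d, hd⟩ := h2
  refine ⟨c / 2 - Complex.I * d / 2, ?_⟩
  have : q * x * q = (1/2 : ℂ) • (q * (x + star x) * q) -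
      (Complex.I / 2) • (q * (Complex.I • (x - star x)) * q) := by
    simp only [mul_smul_comm, smul_mul_assoc, mul_add, mul_sub, add_mul, sub_mul, smul_smul]
    rw [show Complex.I / 2 * Complex.I = (-1/2 : ℂ) by
      rw [div_mul_eq_mul_div, Complex.I_mul_I]]
    module
  rw [this, hc, hd]
  module


theorem IsPreMU.extend_same {F ι : Type*} [NonUnitalCStarAlgebra F] {r : ι → ι} {v : ι → F}
    (H : IsPreMU r v) (k : ι) (u : F) (hu : star u * u = v (r k)) (huv : ∀ i, star u * v i = 0) :
    IsPreMU (fun o : Option ι => o.elim (some (r k)) (fun i => some (r i)))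
      (fun o : Option ι => o.elim u v) := by
  have huv' : ∀ i, star (v i) * u = 0 := fun i => by
    have := congrArg star (huv i); simpa using this
  constructor
  · rintro (_ | i) <;> simp [H.rr]
  · rintro (_ | i) (_ | j) hij
    · exact absurd rfl hij
    · simpa using huv j
    · simpa using huv' i
    · simpa using H.off i j (fun h => hij (by rw [h]))
  · rintro (_ | i)
    · simpa using hu
    · simpa using H.self i
  · rintro (_ | i)
    · simp only [Option.elim]
      rintro rfl
      rw [mul_zero] at hu
      exact H.ne _ hu.symm
    · simpa using H.ne i
  · rintro (_ | i) x
    · simpa using H.min k x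
    · simpa using H.min i x
  · rintro (_ | i) (_ | j) hij x
    · exact absurd rfl hij
    · simpa using H.cross k j (by simpa using hij) x
    · simpa using H.cross i k (by simpa using hij) x
    · simpa using H.cross i j (by simpa using hij) x

theorem IsPreMU.extend_new {F ι : Type*} [NonUnitalCStarAlgebra F] {r : ι → ι} {v : ι → F}
    (H : IsPreMU r v) (p : F) (hp : IsStarProjection p) (hp0 : p ≠ 0) (hpv : ∀ i, p * v i = 0)
    (hmin : ∀ x, ∃ c : ℂ, p * x * p = c • p) (hcr : ∀ i x, p * x * v (r i) = 0) :
    IsPreMU (fun o : Option ι => o.map r)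
      (fun o : Option ι => o.elim p v) := by
  have hpv' : ∀ i, star (v i) * p = 0 := fun i => by
    have := congrArg star (hpv i); simpa [hp.2.star_eq] using this
  have hcr' : ∀ i x, v (r i) * x * p = 0 := fun i x => by
    have := congrArg star (hcr i (star x)); simpa [hp.2.star_eq, H.sa, mul_assoc] using this
  constructor
  · rintro (_ | i) <;> simp [H.rr]
  · rintro (_ | i) (_ | j) hij
    · exact absurd rfl hij
    · simpa [hp.2.star_eq] using hpv j
    · simpa using hpv' i
    · simpa using H.off i j (fun h => hij (by rw [h]))
  · rintro (_ | i)
    · simpa [hp.2.star_eq] using hp.1.eq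
    · simpa using H.self i
  · rintro (_ | i)
    · simpa using hp0
    · simpa using H.ne i
  · rintro (_ | i) x
    · simpa using hmin x
    · simpa using H.min i x
  · rintro (_ | i) (_ | j) hij x
    · exact absurd rfl hij
    · simpa using hcr j x
    · simpa using hcr' i x
    · simpa using H.cross i j (by simpa using hij) x

theorem scal_pos {F : Type*} [NonUnitalCStarAlgebra F] {u p : F} {c : ℂ} (hp : IsStarProjection p)
    (h : star u * u = c • p) (hu : u ≠ 0) : ∃ t : ℝ, 0 < t ∧ c = (t : ℂ) := by
  letI := CStarAlgebra.spectralOrder F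
  letI := CStarAlgebra.spectralOrderedRing F
  have hne : star u * u ≠ 0 := by
    simpa [CStarRing.star_mul_self_eq_zero_iff] using hu
  have hp0 : p ≠ 0 := by rintro rfl; simp at h; exact hu h
  have h1 : star c • p = c • p := by
    have := congrArg star h
    simp only [star_mul, star_star, star_smul, hp.2.star_eq] at this
    rw [← this, h]
  have h2 : star c = c := by
    have : (star c - c) • p = 0 := by rw [sub_smul, h1, sub_self]
    exact sub_eq_zero.1 ((smul_eq_zero.1 this).resolve_right hp0)
  obtain ⟨t, rfl⟩ : ∃ t : ℝ, c = (t : ℂ) := ⟨c.re, (Complex.conj_eq_iff_re.1 h2).symm⟩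
  refine ⟨t, ?_, rfl⟩
  by_contra! hle
  apply hne
  have h3 : 0 ≤ star u * u := star_mul_self_nonneg u
  refine le_antisymm ?_ h3
  rw [h, Complex.coe_smul]
  have hpp : 0 ≤ p := by rw [← hp.1.eq]; nth_rewrite 1 [← hp.2.star_eq]; exact star_mul_self_nonneg p
  exact smul_nonpos_of_nonpos_of_nonneg hle hpp

/-- normalising an element with `u⋆u` a scalar multiple of a projection -/
theorem normalize_pi {F : Type*} [NonUnitalCStarAlgebra F] {u p : F} {c : ℂ}
    (hp : IsStarProjection p) (h : star u * u = c • p) (hu : u ≠ 0) :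
    ∃ s : ℝ, 0 < s ∧ star (s • u) * (s • u) = p := by
  obtain ⟨t, ht, rfl⟩ := scal_pos hp h hu
  refine ⟨(Real.sqrt t)⁻¹, by positivity, ?_⟩
  rw [star_smul, smul_mul_smul_comm, h, Complex.coe_smul, smul_smul]
  have : (star (Real.sqrt t)⁻¹ * (Real.sqrt t)⁻¹) * t = 1 := by
    have := Real.mul_self_sqrt ht.le
    simp only [star_trivial]
    field_simp
    rw [sq, this]
  rw [this, one_smul]

theorem exists_matUnits (F : Type*) [NonUnitalCStarAlgebra F] [FiniteDimensional ℂ F] :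
    ∃ (ι : Type) (_ : Fintype ι) (r : ι → ι) (v : ι → F), IsPreMU r v ∧
      ∀ x, IsPreMU.unit v * x = x := by
  classical
  let P : ℕ → Prop := fun n => ∃ (ι : Type) (_ : Fintype ι) (r : ι → ι) (v : ι → F),
    IsPreMU r v ∧ Fintype.card ι = n
  have hP0 : P 0 := ⟨Empty, inferInstance, fun e => e.elim, fun e => e.elim,
    ⟨fun e => e.elim, fun e => e.elim, fun e => e.elim, fun e => e.elim, fun e => e.elim,
      fun e => e.elim⟩, by simp⟩
  have hb : ∀ n, P n → n ≤ Module.finrank ℂ F := by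
    rintro n ⟨ι, _, r, v, H, rfl⟩
    exact H.linInd.fintype_card_le_finrank
  obtain ⟨ι, hι, r, v, H, hcard⟩ := Nat.findGreatest_spec (P := P) (Nat.zero_le (Module.finrank ℂ F)) hP0
  refine ⟨ι, hι, r, v, H, ?_⟩
  by_contra! hcon
  obtain ⟨x, hx⟩ := hcon
  have hmax : ∀ n, P n → n ≤ Fintype.card ι := fun n hn => by
    rw [hcard]; exact Nat.le_findGreatest (hb n hn) hn
  set e := IsPreMU.unit v with he
  have hee : ∀ z, e * (e * z) = e * z := fun z => by rw [← mul_assoc, H.unit_idem]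
  have hes : star e = e := IsPreMU.star_unit v
  set w := x - e * x with hw
  have hw0 : w ≠ 0 := by rw [hw, sub_ne_zero]; exact Ne.symm hx
  have hew : e * w = 0 := by rw [hw, mul_sub, hee, sub_self]
  have hy0 : w * star w ≠ 0 := by
    simpa [CStarRing.mul_star_self_eq_zero_iff] using hw0
  obtain ⟨l, p, hl, hp0, hp, hyp, hpy⟩ := exists_spectral_proj (w * star w)
    (by simp [isSelfAdjoint_iff]) hy0
  have hep : e * p = 0 := by
    have : l • (e * p) = 0 := by
      rw [← mul_smul_comm, ← hyp, ← mul_assoc, ← mul_assoc, hew]; simp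
    exact (smul_eq_zero.1 this).resolve_left hl
  obtain ⟨q, hq, hq0, hpq, hqp, hmin⟩ := exists_min_proj p hp hp0
  have heq : e * q = 0 := by rw [← hpq, ← mul_assoc, hep, zero_mul]
  have hqe : q * e = 0 := by
    have := congrArg star heq; simpa [hes, hq.2.star_eq] using this
  have hqv : ∀ i, q * v i = 0 := fun i => by
    rw [← H.unit_mul i, ← mul_assoc, hqe, zero_mul]
  by_cases hcr : ∀ i x, q * x * v (r i) = 0
  · have := hmax _ ⟨Option ι, inferInstance, _, _, H.extend_new q hq hq0 hqv hmin hcr, rfl⟩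
    simp at this
  · push Not at hcr
    obtain ⟨k, z, hz⟩ := hcr
    set u := q * z * v (r k) with hu
    obtain ⟨c, hc⟩ := H.min k (star z * q * z)
    have huu : star u * u = c • v (r k) := by
      rw [← hc, hu]
      simp only [star_mul, hq.2.star_eq, H.sa, mul_assoc]
      rw [← mul_assoc q q, hq.1.eq]
    obtain ⟨t, ht, hut⟩ := normalize_pi (H.proj k) huu hz
    have huq : ∀ i, star (t • u) * v i = 0 := fun i => by
      rw [hu]
      simp only [star_smul, star_mul, hq.2.star_eq, smul_mul_assoc, mul_assoc, hqv]
      simp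
    have := hmax _ ⟨Option ι, inferInstance, _, _, H.extend_same k (t • u) hut huq, rfl⟩
    simp at this

end FDStruct


section FDSub

structure IsMU {A ι : Type*} [CStarAlgebra A] (C : NonUnitalStarSubalgebra ℂ A) [Fintype ι]
    (r : ι → ι) (v : ι → A) : Prop where
  mem : ∀ i, v i ∈ C
  rr : ∀ i, r (r i) = r i
  off : ∀ i j, i ≠ j → star (v i) * v j = 0
  self : ∀ i, star (v i) * v i = v (r i)
  ne : ∀ i, v i ≠ 0
  proj : ∀ i, IsStarProjection (v (r i))
  mul_rep : ∀ i, v i * v (r i) = v i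
  coef : ∀ x ∈ C, ∀ i j, r i = r j → ∃ c : ℂ, star (v i) * x * v j = c • v (r i)
  cross : ∀ x ∈ C, ∀ i j, r i ≠ r j → star (v i) * x * v j = 0
  unit : ∀ x ∈ C, (∑ i, v i * star (v i)) * x = x

variable {A : Type*} [CStarAlgebra A]

theorem fd_isClosed (C : NonUnitalStarSubalgebra ℂ A) [FiniteDimensional ℂ C] :
    IsClosed (C : Set A) := by
  have : FiniteDimensional ℂ C.toSubmodule := ‹FiniteDimensional ℂ C›
  exact Submodule.closed_of_finiteDimensional C.toSubmodule

theorem exists_MU (C : NonUnitalStarSubalgebra ℂ A) [FiniteDimensional ℂ C] :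
    ∃ (ι : Type) (_ : Fintype ι) (r : ι → ι) (v : ι → A), IsMU C r v := by
  haveI : IsClosed (C : Set A) := fd_isClosed C
  obtain ⟨ι, hι, r, v, H, hu⟩ := exists_matUnits C
  have H2 : ∀ i, ((v (r i) : C) : A) = star (v i : A) * (v i : A) := fun i => by
    rw [← H.self i]; rfl
  refine ⟨ι, hι, r, fun i => (v i : A), ⟨fun i => (v i).2, H.rr, ?_, ?_, ?_, ?_, ?_, ?_, ?_, ?_⟩⟩
  · intro i j hij
    exact congrArg Subtype.val (H.off i j hij)
  · intro i
    exact congrArg Subtype.val (H.self i)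
  · intro i h
    exact H.ne i (Subtype.ext h)
  · intro i
    exact ⟨congrArg Subtype.val (H.idem i), congrArg Subtype.val (H.sa i)⟩
  · intro i
    exact congrArg Subtype.val (H.mul_rep i)
  · intro x hx i j hij
    obtain ⟨c, hc⟩ := H.min i (star (v i) * ⟨x, hx⟩ * v j)
    refine ⟨c, ?_⟩
    have h1 : v (r i) * (star (v i) * ⟨x, hx⟩ * v j) * v (r i) = star (v i) * ⟨x, hx⟩ * v j := by
      rw [hij, mul_assoc _ _ (v (r j)), mul_assoc _ (v j) (v (r j)), H.mul_rep, ← hij,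
        ← mul_assoc, ← mul_assoc, H.rep_mul_star]
    rw [h1] at hc
    exact congrArg Subtype.val hc
  · intro x hx i j hij
    have hc := H.cross i j hij (star (v i) * ⟨x, hx⟩ * v j)
    have h1 : v (r i) * (star (v i) * ⟨x, hx⟩ * v j) * v (r j) = star (v i) * ⟨x, hx⟩ * v j := by
      rw [mul_assoc _ _ (v (r j)), mul_assoc _ (v j) (v (r j)), H.mul_rep, 
        ← mul_assoc, ← mul_assoc, H.rep_mul_star]
    rw [h1] at hc
    exact congrArg Subtype.val hc
  · intro x hx
    have := congrArg Subtype.val (hu ⟨x, hx⟩)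
    rw [NonUnitalStarSubalgebra.coe_mul] at this
    have h2 : ((IsPreMU.unit v : C) : A) = ∑ i, (v i : A) * star (v i : A) := by
      simp [IsPreMU.unit]
    rwa [h2] at this

namespace IsMU
variable {ι : Type*} [Fintype ι] {C : NonUnitalStarSubalgebra ℂ A} {r : ι → ι} {v : ι → A}

theorem sa (H : IsMU C r v) (i : ι) : star (v (r i)) = v (r i) := (H.proj i).2

theorem idem (H : IsMU C r v) (i : ι) : v (r i) * v (r i) = v (r i) := (H.proj i).1

theorem rep_mul_star (H : IsMU C r v) (i : ι) : v (r i) * star (v i) = star (v i) := by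
  have := congrArg star (H.mul_rep i)
  simpa [H.sa] using this

theorem unit_right (H : IsMU C r v) (x : A) (hx : x ∈ C) : x * (∑ i, v i * star (v i)) = x := by
  have := congrArg star (H.unit (star x) (star_mem hx))
  simpa [star_sum] using this

end IsMU

/-- A positive functional peaking at a projection. -/
theorem exists_peak [PartialOrder A] [StarOrderedRing A] (e : A) (he : IsStarProjection e)
    (h0 : e ≠ 0) : ∃ ω : A →ₗ[ℂ] ℂ, (∀ a, 0 ≤ a → ∃ t : ℝ, 0 ≤ t ∧ ω a = t) ∧ ω e = 1 ∧
      ∀ a, ω (e * a * e) = ω a := by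
  have hne : ‖e‖ = 1 := by
    have h1 : ‖e‖ * ‖e‖ = ‖e‖ := by
      rw [← CStarRing.norm_star_mul_self, he.2.star_eq, he.1.eq]
    have h2 : ‖e‖ ≠ 0 := norm_ne_zero_iff.2 h0
    exact mul_right_cancel₀ h2 (by rw [h1, one_mul])
  obtain ⟨f, hf1, hfe⟩ := exists_dual_vector ℂ e (norm_ne_zero_iff.2 h0)
  rw [hne] at hfe
  have hfe : f e = 1 := by simpa using hfe
  have ee : ∀ x, e * (e * x) = e * x := fun x => by rw [← mul_assoc, he.1.eq]
  have hbound : ∀ x, ‖f x‖ ≤ ‖x‖ := fun x => by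
    simpa [hf1] using f.le_opNorm x
  have hreal : ∀ b : A, IsSelfAdjoint b → e * b = b → b * e = b → (f b).im = 0 := by
    intro b hb h1 h2
    have key : ∀ t : ℝ, ((f b).im + t) ^ 2 ≤ ‖b‖ ^ 2 + t ^ 2 := by
      intro t
      have hx := hbound (b + (Complex.I * t) • e)
      have hn : ‖b + (Complex.I * t) • e‖ ^ 2 ≤ ‖b‖ ^ 2 + t ^ 2 := by
        rw [sq, ← CStarRing.norm_star_mul_self]
        have : star (b + (Complex.I * t) • e) * (b + (Complex.I * t) • e) =
            b * b + ((t ^ 2 : ℝ) : ℂ) • e := by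
          simp only [star_add, star_smul, hb.star_eq, he.2.star_eq, add_mul, mul_add,
            smul_mul_assoc, mul_smul_comm, he.1.eq, h1, h2, smul_smul]
          have e1 : star (Complex.I * (t : ℂ)) = - (Complex.I * t) := by simp
          rw [e1]
          have e3 : -(Complex.I * (t : ℂ)) * (Complex.I * t) = ((t ^ 2 : ℝ) : ℂ) := by
            push_cast
            linear_combination (- (t : ℂ) ^ 2) * Complex.I_sq
          rw [← e3]
          module
        rw [this]
        refine (norm_add_le _ _).trans ?_
        rw [norm_smul, hne, Complex.norm_real, mul_one, Real.norm_of_nonneg (sq_nonneg t), sq ‖b‖]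
        gcongr
        exact norm_mul_le _ _
      have h3 : ‖f (b + (Complex.I * t) • e)‖ ^ 2 ≤ ‖b‖ ^ 2 + t ^ 2 :=
        (by gcongr : _ ≤ ‖b + (Complex.I * t) • e‖ ^ 2).trans hn
      have h4 : ((f b).im + t) ^ 2 ≤ ‖f (b + (Complex.I * t) • e)‖ ^ 2 := by
        rw [map_add, map_smul, hfe]
        have h5 := Complex.abs_im_le_norm (f b + (Complex.I * t) • (1:ℂ))
        have h6 : (f b + (Complex.I * t) • (1:ℂ)).im = (f b).im + t := by simp
        rw [h6] at h5
        rw [← sq_abs]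
        gcongr
      exact h4.trans h3
    by_contra hne0
    have hk := key ((‖b‖ ^ 2 + 1) / (f b).im)
    have : (f b).im * ((‖b‖ ^ 2 + 1) / (f b).im) = ‖b‖ ^ 2 + 1 := by field_simp
    nlinarith [sq_nonneg (f b).im, sq_nonneg ‖b‖]
  let ω : A →ₗ[ℂ] ℂ := f.toLinearMap.comp ((LinearMap.mulRight ℂ e).comp (LinearMap.mulLeft ℂ e))
  have hω : ∀ a, ω a = f (e * a * e) := fun a => rfl
  refine ⟨ω, ?_, ?_, ?_⟩
  · intro a ha
    have hb : 0 ≤ e * a * e := by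
      have := star_right_conjugate_nonneg ha e
      rwa [he.2.star_eq] at this
    set b := e * a * e with hbdef
    have hbs : IsSelfAdjoint b := IsSelfAdjoint.of_nonneg hb
    have h1 : e * b = b := by rw [hbdef, mul_assoc, ee, ]
    have h2 : b * e = b := by rw [hbdef, mul_assoc, he.1.eq]
    have him := hreal b hbs h1 h2
    refine ⟨(f b).re, ?_, by rw [hω, ← hbdef]; apply Complex.ext <;> simp [him]⟩
    have hle : b ≤ ‖b‖ • e := by
      have h3 := star_right_conjugate_le_conjugate (IsSelfAdjoint.le_algebraMap_norm_self hbs) e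
      rw [he.2.star_eq, h1, h2, Algebra.algebraMap_eq_smul_one] at h3
      simpa [he.1.eq] using h3
    have hn : ‖‖b‖ • e - b‖ ≤ ‖b‖ := by
      have h4 : ‖‖b‖ • e - b‖ ≤ ‖‖b‖ • e‖ := by
        apply CStarAlgebra.norm_le_norm_of_nonneg_of_le (sub_nonneg.2 hle)
        exact sub_le_self _ hb
      rwa [norm_smul, hne, mul_one, norm_norm] at h4
    have h5 := (hbound (‖b‖ • e - b)).trans hn
    have h6 : f (‖b‖ • e - b) = ((‖b‖ - (f b).re : ℝ) : ℂ) := by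
      rw [map_sub, ← Complex.coe_smul, map_smul, hfe]
      apply Complex.ext <;> simp [him]
    rw [h6, Complex.norm_real, Real.norm_eq_abs] at h5
    linarith [(abs_le.1 h5).2]
  · rw [hω, he.1.eq, he.1.eq, hfe]
  · intro a
    rw [hω, hω]
    simp only [mul_assoc, ee, he.1.eq]

end FDSub


section FDTrace

variable {A : Type*} [CStarAlgebra A]

/-- Tracial states, as real-linear functionals. -/
structure IsTr (τ : A →ₗ[ℝ] ℝ) : Prop where
  pos : ∀ x, 0 ≤ τ (star x * x)
  tr : ∀ x, τ (star x * x) = τ (x * star x)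
  one : τ 1 = 1

theorem pi_mul {F : Type*} [NonUnitalCStarAlgebra F] {u e : F} (he : IsStarProjection e)
    (h : star u * u = e) : u * e = u := by
  rw [← sub_eq_zero]
  apply IsPreMU.eq_zero_of_star_mul
  simp only [star_sub, star_mul, he.2.star_eq, sub_mul, mul_sub]
  have e1 : e * star u * (u * e) = e := by
    rw [mul_assoc, ← mul_assoc (star u), h, he.1.eq, he.1.eq]
  rw [e1, mul_assoc, h, ← mul_assoc, h, he.1.eq]
  simp

/-- Block traces and block structure on a finite-dimensional subalgebra. -/
structure FDData [PartialOrder A] (C : NonUnitalStarSubalgebra ℂ A) where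
  κ : Type
  fin : Fintype κ
  dec : DecidableEq κ
  T : κ → A →ₗ[ℝ] ℝ
  e : κ → A
  z : Finset κ → A
  pos : ∀ k a, 0 ≤ a → 0 ≤ T k a
  tr : ∀ k, ∀ x ∈ C, ∀ y ∈ C, T k (x * y) = T k (y * x)
  e_mem : ∀ k, e k ∈ C
  e_proj : ∀ k, IsStarProjection (e k)
  T_e : ∀ k l, T k (e l) = if k = l then 1 else 0
  decomp : ∀ p ∈ C, IsStarProjection p → ∃ (J : Type) (_ : Fintype J) (_ : DecidableEq J)
    (k : J → κ) (u : J → A), (∀ j, u j ∈ C) ∧ (∀ i j, i ≠ j → star (u i) * u j = 0) ∧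
      (∀ j, star (u j) * u j = e (k j)) ∧ p = ∑ j, u j * star (u j)
  z_mem : ∀ S, z S ∈ C
  z_proj : ∀ S, IsStarProjection (z S)
  z_comm : ∀ S, ∀ x ∈ C, z S * x = x * z S
  T_z : ∀ S k a, T k (z S * a) = if k ∈ S then T k a else 0

variable [PartialOrder A] [StarOrderedRing A]

theorem exists_FDData (C : NonUnitalStarSubalgebra ℂ A) [FiniteDimensional ℂ C] :
    Nonempty (FDData C) := by
  classical
  obtain ⟨ι, hι, r, v, H⟩ := exists_MU C
  choose ω0 hpos0 hone0 hcomp0 using fun i => exists_peak (v (r i)) (H.proj i) (H.ne _)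
  let ω : ι → A →ₗ[ℂ] ℂ := fun i => ω0 (r i)
  have hpos : ∀ i a, 0 ≤ a → ∃ t : ℝ, 0 ≤ t ∧ ω i a = t := fun i => hpos0 (r i)
  have hone : ∀ i, ω i (v (r i)) = 1 := fun i => by
    have := hone0 (r i); rwa [H.rr] at this
  let κ := {i : ι // r i = i}
  let cls : ι → κ := fun i => ⟨r i, H.rr i⟩
  have hcls : ∀ k : κ, cls k = k := fun k => Subtype.ext k.2
  have cls_eq : ∀ i j, cls i = cls j ↔ r i = r j := fun i j => Subtype.ext_iff
  let T0 : κ → A →ₗ[ℂ] ℂ := fun k =>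
    ∑ i with cls i = k, (ω k).comp ((LinearMap.mulRight ℂ (v i)).comp (LinearMap.mulLeft ℂ (star (v i))))
  have hT0 : ∀ k a, T0 k a = ∑ i with cls i = k, ω k (star (v i) * a * v i) := fun k a => by
    simp [T0, LinearMap.sum_apply]
  let T : κ → A →ₗ[ℝ] ℝ := fun k => Complex.reLm.comp ((T0 k).restrictScalars ℝ)
  have hT : ∀ k a, T k a = (T0 k a).re := fun k a => rfl
  let z : Finset κ → A := fun S => ∑ i with cls i ∈ S, v i * star (v i)
  have vz : ∀ S i, star (v i) * z S = if cls i ∈ S then star (v i) else 0 := by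
    intro S i
    simp only [z, Finset.mul_sum]
    split_ifs with h
    · rw [Finset.sum_eq_single i]
      · rw [← mul_assoc, H.self, H.rep_mul_star]
      · intro j _ hj
        rw [← mul_assoc, H.off _ _ (Ne.symm hj), zero_mul]
      · simp [h]
    · apply Finset.sum_eq_zero
      intro j hj
      have : i ≠ j := by rintro rfl; simp at hj; exact h hj
      rw [← mul_assoc, H.off _ _ this, zero_mul]
  have z_star : ∀ S, star (z S) = z S := fun S => by simp [z, star_sum]
  have z_mem : ∀ S, z S ∈ C := fun S =>
    sum_mem fun i _ => mul_mem (H.mem i) (star_mem (H.mem i))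
  have zv : ∀ S i, z S * v i = if cls i ∈ S then v i else 0 := by
    intro S i
    have := congrArg star (vz S i)
    rw [star_mul, star_star, z_star] at this
    rw [this]
    split_ifs <;> simp
  have pos : ∀ k a, 0 ≤ a → 0 ≤ T k a := by
    intro k a ha
    rw [hT, hT0, Complex.re_sum]
    refine Finset.sum_nonneg fun i _ => ?_
    obtain ⟨t, ht, h⟩ := hpos k _ (star_left_conjugate_nonneg ha (v i))
    rw [h]; simpa using ht
  -- coefficients
  have hco : ∀ x ∈ C, ∀ i j, r i = r j →
      star (v i) * x * v j = (ω i (star (v i) * x * v j)) • v (r i) := by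
    intro x hx i j hij
    obtain ⟨c, hc⟩ := H.coef x hx i j hij
    rw [hc, map_smul, hone]; simp
  have ω_cls : ∀ i, ω (cls i) = ω i := fun i => by
    show ω0 (r (r i)) = ω0 (r i)
    rw [H.rr]
  have htr0 : ∀ k, ∀ x ∈ C, ∀ y ∈ C, T0 k (x * y) = ∑ i with cls i = k, ∑ j with cls j = k,
      ω k (star (v i) * x * v j) * ω k (star (v j) * y * v i) := by
    intro k x hx y hy
    rw [hT0]
    refine Finset.sum_congr rfl fun i hi => ?_
    have hi' : cls i = k := by simpa using hi
    have h1 : star (v i) * (x * y) * v i =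
        ∑ j with cls j = k, (star (v i) * x * v j) * (star (v j) * y * v i) := by
      have h2 : x * y = ∑ j, x * (v j * star (v j)) * y := by
        rw [← Finset.sum_mul, ← Finset.mul_sum, H.unit_right x hx]
      rw [h2, Finset.mul_sum, Finset.sum_mul, Finset.sum_filter]
      refine Finset.sum_congr rfl fun j _ => ?_
      split_ifs with hj
      · simp only [mul_assoc]
      · have : r i ≠ r j := fun h => hj (by rw [← hi', cls_eq, h])
        have h3 := H.cross x hx i j this
        calc star (v i) * (x * (v j * star (v j)) * y) * v i
            = (star (v i) * x * v j) * (star (v j) * y * v i) := by simp only [mul_assoc]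
          _ = 0 := by rw [h3, zero_mul]
    rw [h1, map_sum]
    refine Finset.sum_congr rfl fun j hj => ?_
    have hj' : cls j = k := by simpa using hj
    have hij : r i = r j := by rw [← cls_eq, hi', hj']
    have e1 : ω i = ω k := by rw [← hi', ω_cls]
    have e2 : ω j = ω k := by rw [← hj', ω_cls]
    rw [hco x hx i j hij, hco y hy j i hij.symm, ← hij, smul_mul_smul_comm, H.idem, map_smul,
      map_smul, map_smul, ← e1, hone]
    simp
  have tr : ∀ k, ∀ x ∈ C, ∀ y ∈ C, T k (x * y) = T k (y * x) := by
    intro k x hx y hy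
    rw [hT, hT, htr0 k x hx y hy, htr0 k y hy x hx, Finset.sum_comm]
    congr 1
    refine Finset.sum_congr rfl fun i _ => Finset.sum_congr rfl fun j _ => mul_comm _ _
  have T_e : ∀ k l : κ, T k (v l) = if k = l then 1 else 0 := by
    intro k l
    rw [hT, hT0]
    have hl : star (v l.1) * v l.1 = v l.1 := by
      have := H.self l.1; rwa [l.2] at this
    have hl2 : v l.1 * v l.1 = v l.1 := by
      have := H.idem l.1; rwa [l.2] at this
    split_ifs with h
    · subst h
      rw [Finset.sum_eq_single k.1]
      · rw [hl, hl2]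
        have := hone k.1
        rw [k.2] at this
        rw [this]; simp
      · intro j _ hj
        rw [H.off _ _ hj, zero_mul, map_zero]
      · intro h; exact absurd (by simp [hcls]) h
    · rw [Finset.sum_eq_zero]; · simp
      intro j hj
      have : j ≠ l.1 := by
        rintro rfl
        simp only [Finset.mem_filter, Finset.mem_univ, true_and, hcls] at hj
        exact h hj.symm
      rw [H.off _ _ this, zero_mul, map_zero]
  have T_z : ∀ S k a, T k (z S * a) = if k ∈ S then T k a else 0 := by
    intro S k a
    have : T0 k (z S * a) = if k ∈ S then T0 k a else 0 := by
      rw [hT0, hT0]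
      split_ifs with h
      · refine Finset.sum_congr rfl fun i hi => ?_
        have hi' : cls i = k := by simpa using hi
        rw [← mul_assoc, vz, if_pos (by rwa [hi'])]
      · refine Finset.sum_eq_zero fun i hi => ?_
        have hi' : cls i = k := by simpa using hi
        rw [← mul_assoc, vz, if_neg (by rwa [hi'])]; simp
    rw [hT, this, hT]; split_ifs <;> simp
  have e_proj : ∀ k : κ, IsStarProjection (v k) := fun k => by
    have := H.proj k; rwa [k.2] at this
  have decomp : ∀ n : ℕ, ∀ p ∈ C, IsStarProjection p → ∑ k, T k p < n →
    ∃ (J : Type) (_ : Fintype J) (_ : DecidableEq J)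
    (k : J → κ) (u : J → A), (∀ j, u j ∈ C) ∧ (∀ i j, i ≠ j → star (u i) * u j = 0) ∧
      (∀ j, star (u j) * u j = v (k j)) ∧ p = ∑ j, u j * star (u j) := by
    intro n
    induction n with
    | zero =>
      intro p hp hpp hlt
      exfalso
      have : 0 ≤ ∑ k, T k p := Finset.sum_nonneg fun k _ => pos k p hpp.nonneg
      simp only [Nat.cast_zero] at hlt
      linarith
    | succ n ih =>
      intro p hp hpp hlt
      by_cases hp0 : p = 0
      · exact ⟨Empty, inferInstance, inferInstance, fun e => e.elim, fun e => e.elim,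
          fun e => e.elim, fun e => e.elim, fun e => e.elim, by simp [hp0]⟩
      have : ∃ i, p * v i ≠ 0 := by
        by_contra! hcon
        apply hp0
        rw [← H.unit_right p hp, Finset.mul_sum]
        refine Finset.sum_eq_zero fun i _ => ?_
        rw [← mul_assoc, hcon, zero_mul]
      obtain ⟨i, hi⟩ := this
      obtain ⟨c, hc⟩ := H.coef p hp i i rfl
      have huu : star (p * v i) * (p * v i) = c • v (r i) := by
        rw [← hc, star_mul, hpp.2.star_eq, mul_assoc, ← mul_assoc p p, hpp.1.eq, mul_assoc]
      obtain ⟨s, hs, hsu⟩ := normalize_pi (H.proj i) huu hi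
      set u := s • (p * v i) with hu
      have hpu : p * u = u := by rw [hu, mul_smul_comm, ← mul_assoc, hpp.1.eq]
      have hup : star u * p = star u := by
        have := congrArg star hpu; simpa [hpp.2.star_eq] using this
      have huC : u ∈ C := by
        have : u = (s : ℂ) • (p * v i) := by rw [Complex.coe_smul]
        rw [this]; exact SMulMemClass.smul_mem _ (mul_mem hp (H.mem i))
      have huCs : star u ∈ C := star_mem huC
      have hue : u * v (r i) = u := by rw [hu, smul_mul_assoc, mul_assoc, H.mul_rep]
      have huproj : IsStarProjection (u * star u) := by
        refine ⟨?_, by simp [isSelfAdjoint_iff]⟩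
        rw [IsIdempotentElem, mul_assoc, ← mul_assoc (star u), hsu, ← mul_assoc, hue]
      have hp1 : IsStarProjection (p - u * star u) := by
        apply IsStarProjection.sub_of_mul_eq_left huproj hpp
        rw [mul_assoc, hup]
      have hT1 : ∑ k, T k (p - u * star u) < n := by
        have h1 : ∀ k, T k (p - u * star u) = T k p - if k = cls i then 1 else 0 := fun k => by
          rw [map_sub, tr k u huC _ huCs, hsu, ← T_e k (cls i)]
        have h2 : ∑ k, (if k = cls i then (1 : ℝ) else 0) = 1 := by
          rw [Finset.sum_eq_single (cls i)]
          · simp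
          · intro b _ hb; simp [hb]
          · simp
        simp only [h1, Finset.sum_sub_distrib]
        rw [h2]
        push_cast at hlt
        linarith
      obtain ⟨J, hJ, hJd, k, w, hw1, hw2, hw3, hw4⟩ := ih _ (sub_mem hp (mul_mem huC huCs)) hp1 hT1
      have hwu : ∀ j, star u * w j = 0 := by
        intro j
        have h1 : (p - u * star u) * w j = w j := by
          rw [hw4, Finset.sum_mul, Finset.sum_eq_single j]
          · rw [mul_assoc, hw3]
            exact pi_mul (e_proj (k j)) (hw3 j)
          · intro l _ hl
            rw [mul_assoc, hw2 _ _ hl, mul_zero]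
          · simp
        rw [← h1, ← mul_assoc, mul_sub, hup, ← mul_assoc, hsu]
        have : v (r i) * star u = star u := by
          have := congrArg star hue; simpa [H.sa] using this
        rw [this, sub_self, zero_mul]
      have hwu' : ∀ j, star (w j) * u = 0 := fun j => by
        have := congrArg star (hwu j); simpa using this
      refine ⟨Option J, inferInstance, inferInstance, fun o => o.elim (cls i) k,
        fun o => o.elim u w, ?_, ?_, ?_, ?_⟩
      · rintro (_ | j)
        · exact huC
        · exact hw1 j
      · rintro (_ | a) (_ | b) hab
        · exact absurd rfl hab
        · exact hwu b
        · exact hwu' a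
        · exact hw2 a b (fun h => hab (by rw [h]))
      · rintro (_ | j)
        · exact hsu
        · exact hw3 j
      · rw [Fintype.sum_option]
        simp only [Option.elim]
        rw [← hw4]; abel
  refine ⟨⟨κ, inferInstance, inferInstance, T, fun k => v k, z, pos, tr, fun k => H.mem _, e_proj, T_e,
    ?_, z_mem, ?_, ?_, T_z⟩⟩
  · intro p hp hpp
    obtain ⟨n, hn⟩ := exists_nat_gt (∑ k, T k p)
    exact decomp n p hp hpp hn
  · intro S
    refine ⟨?_, z_star S⟩
    show z S * z S = z S
    conv_lhs => rhs; simp only [z]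
    rw [Finset.mul_sum]
    refine Finset.sum_congr rfl fun i hi => ?_
    rw [← mul_assoc, zv, if_pos (by simpa using hi)]
  · intro S x hx
    have hzx : ∀ x ∈ C, z S * x = ∑ i with cls i ∈ S, ∑ j with cls j ∈ S,
        v i * (star (v i) * x * v j) * star (v j) := by
      intro x hx
      conv_lhs => simp only [z]
      rw [Finset.sum_mul]
      refine Finset.sum_congr rfl fun i hi => ?_
      have hi' : cls i ∈ S := by simpa using hi
      nth_rewrite 1 [← H.unit_right x hx]
      rw [Finset.mul_sum, Finset.mul_sum, Finset.sum_filter]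
      refine Finset.sum_congr rfl fun j _ => ?_
      split_ifs with hj
      · simp only [mul_assoc]
      · have hij : r i ≠ r j := fun h => hj (by rwa [← (cls_eq i j).2 h])
        have := H.cross x hx i j hij
        calc v i * star (v i) * (x * (v j * star (v j)))
            = v i * (star (v i) * x * v j) * star (v j) := by simp only [mul_assoc]
          _ = 0 := by rw [this]; simp
    have h1 := hzx x hx
    have h2 := congrArg star (hzx (star x) (star_mem hx))
    rw [star_mul, star_star, z_star] at h2
    rw [h1, h2]
    simp only [star_sum, star_mul, star_star]
    rw [Finset.sum_comm]
    simp only [mul_assoc]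

end FDTrace


section FDComp

variable {A : Type*} [CStarAlgebra A] [PartialOrder A] [StarOrderedRing A]

namespace FDData
variable {C : NonUnitalStarSubalgebra ℂ A} (D : FDData C)

instance : Fintype D.κ := D.fin
instance : DecidableEq D.κ := D.dec

theorem T_decomp {J : Type} [Fintype J] {k : J → D.κ} {u : J → A} (hu : ∀ j, u j ∈ C)
    (h1 : ∀ j, star (u j) * u j = D.e (k j)) (s : Finset J) (l : D.κ) :
    D.T l (∑ j ∈ s, u j * star (u j)) = (s.filter (fun j => k j = l)).card := by
  rw [map_sum, Finset.card_filter, Nat.cast_sum]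
  refine Finset.sum_congr rfl fun j _ => ?_
  rw [D.tr l _ (hu j) _ (star_mem (hu j)), h1, D.T_e]
  by_cases h : l = k j
  · simp [h]
  · simp [h, Ne.symm h]

theorem sum_mul_pi {J : Type} [Fintype J] [DecidableEq J] {k : J → D.κ} {u : J → A}
    (h0 : ∀ i j, i ≠ j → star (u i) * u j = 0)
    (h1 : ∀ j, star (u j) * u j = D.e (k j)) (s : Finset J) (i : J) :
    (∑ j ∈ s, u j * star (u j)) * u i = if i ∈ s then u i else 0 := by
  rw [Finset.sum_mul]
  split_ifs with h
  · rw [Finset.sum_eq_single i]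
    · rw [mul_assoc, h1, pi_mul (D.e_proj _) (h1 i)]
    · intro j _ hj
      rw [mul_assoc, h0 _ _ hj, mul_zero]
    · intro h'; exact absurd h h'
  · refine Finset.sum_eq_zero fun j hj => ?_
    rw [mul_assoc, h0 _ _ (by rintro rfl; exact h hj), mul_zero]

theorem sum_proj {J : Type} [Fintype J] [DecidableEq J] {k : J → D.κ} {u : J → A}
    (h0 : ∀ i j, i ≠ j → star (u i) * u j = 0)
    (h1 : ∀ j, star (u j) * u j = D.e (k j)) (s : Finset J) :
    IsStarProjection (∑ j ∈ s, u j * star (u j)) := by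
  refine ⟨?_, by simp [isSelfAdjoint_iff, star_sum]⟩
  show (∑ j ∈ s, u j * star (u j)) * (∑ j ∈ s, u j * star (u j)) = _
  rw [Finset.mul_sum]
  refine Finset.sum_congr rfl fun j hj => ?_
  rw [← mul_assoc, D.sum_mul_pi h0 h1, if_pos hj]

theorem nat_T (p : A) (hp : p ∈ C) (hpp : IsStarProjection p) :
    ∃ n : D.κ → ℕ, ∀ l, D.T l p = n l := by
  obtain ⟨J, _, _, k, u, hu, h0, h1, rfl⟩ := D.decomp p hp hpp
  exact ⟨_, fun l => D.T_decomp hu h1 Finset.univ l⟩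

/-- comparison of projections -/
theorem compare (p q : A) (hp : p ∈ C) (hpp : IsStarProjection p) (hq : q ∈ C)
    (hqq : IsStarProjection q) (h : ∀ l, D.T l p ≤ D.T l q) :
    ∃ w ∈ C, star w * w = p ∧ q * w = w := by
  obtain ⟨J, _, _, k, u, hu, h0, h1, rfl⟩ := D.decomp p hp hpp
  obtain ⟨J', _, _, k', u', hu', h0', h1', rfl⟩ := D.decomp q hq hqq
  simp only [D.T_decomp hu h1, D.T_decomp hu' h1', Nat.cast_le] at h
  have hemb : ∀ l, Nonempty ({j // k j = l} ↪ {j // k' j = l}) := fun l => by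
    apply Function.Embedding.nonempty_of_card_le
    rw [Fintype.card_subtype, Fintype.card_subtype]
    exact h l
  have f : ∀ l, ({j // k j = l} ↪ {j // k' j = l}) := fun l => Classical.choice (hemb l)
  let σ : J → J' := fun j => (f (k j) ⟨j, rfl⟩).1
  have hσ : ∀ j, k' (σ j) = k j := fun j => (f (k j) ⟨j, rfl⟩).2
  have hinj : Function.Injective σ := by
    have aux : ∀ l l' (a : {j // k j = l}) (b : {j // k j = l'}), l = l' →
        (f l a).1 = (f l' b).1 → a.1 = b.1 := by
      rintro l _ a b rfl hab
      have := (f l).injective (Subtype.ext hab)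
      rw [this]
    intro a b hab
    have hk : k a = k b := by rw [← hσ a, ← hσ b, hab]
    exact aux _ _ ⟨a, rfl⟩ ⟨b, rfl⟩ hk hab
  refine ⟨∑ j, u' (σ j) * star (u j), sum_mem fun j _ => mul_mem (hu' _) (star_mem (hu j)), ?_, ?_⟩
  · rw [star_sum, Finset.sum_mul]
    refine Finset.sum_congr rfl fun i _ => ?_
    rw [Finset.mul_sum, Finset.sum_eq_single i]
    · rw [star_mul, star_star, mul_assoc, ← mul_assoc (star (u' _)), h1', hσ, ← mul_assoc,
        pi_mul (D.e_proj _) (h1 i)]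
    · intro j _ hj
      rw [star_mul, star_star, mul_assoc, ← mul_assoc (star (u' _)),
        h0' _ _ (fun h => hj (hinj h).symm)]
      simp
    · simp
  · rw [Finset.mul_sum]
    refine Finset.sum_congr rfl fun i _ => ?_
    rw [← mul_assoc, D.sum_mul_pi h0' h1', if_pos (Finset.mem_univ _)]

/-- subdivision of projections -/
theorem subdiv (p : A) (hp : p ∈ C) (hpp : IsStarProjection p) (n : D.κ → ℕ)
    (h : ∀ l, (n l : ℝ) ≤ D.T l p) :
    ∃ q ∈ C, IsStarProjection q ∧ p * q = q ∧ q * p = q ∧ ∀ l, D.T l q = n l := by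
  obtain ⟨J, _, _, k, u, hu, h0, h1, hpe⟩ := D.decomp p hp hpp
  rw [hpe] at h
  simp only [D.T_decomp hu h1, Nat.cast_le] at h
  choose s hs1 hs2 using fun l => Finset.exists_subset_card_eq (h l)
  let t : Finset J := Finset.univ.filter (fun j => j ∈ s (k j))
  have ht : ∀ l, t.filter (fun j => k j = l) = s l := by
    intro l
    ext j
    simp only [t, Finset.mem_filter, Finset.mem_univ, true_and]
    constructor
    · rintro ⟨h, rfl⟩; exact h
    · intro hj
      have := hs1 l hj
      simp only [Finset.mem_filter, Finset.mem_univ, true_and] at this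
      subst this
      exact ⟨hj, rfl⟩
  have hq := D.sum_proj h0 h1 t
  have hpq : p * (∑ j ∈ t, u j * star (u j)) = ∑ j ∈ t, u j * star (u j) := by
    rw [hpe, Finset.mul_sum]
    refine Finset.sum_congr rfl fun i _ => ?_
    rw [← mul_assoc, D.sum_mul_pi h0 h1, if_pos (Finset.mem_univ _)]
  refine ⟨∑ j ∈ t, u j * star (u j), sum_mem fun j _ => mul_mem (hu _) (star_mem (hu j)),
    hq, hpq, ?_, fun l => ?_⟩
  · have := congrArg star hpq
    rwa [star_mul, hq.2.star_eq, hpp.2.star_eq] at this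
  · rw [D.T_decomp hu h1, ht, hs2]

/-- trace formula -/
theorem trace_eq {τ : A →ₗ[ℝ] ℝ} (hτ : IsTr τ) (p : A) (hp : p ∈ C) (hpp : IsStarProjection p) :
    τ p = ∑ l, D.T l p * τ (D.e l) := by
  obtain ⟨J, _, _, k, u, hu, h0, h1, rfl⟩ := D.decomp p hp hpp
  simp only [D.T_decomp hu h1]
  rw [map_sum]
  have : ∀ j, τ (u j * star (u j)) = ∑ l, if k j = l then τ (D.e l) else 0 := fun j => by
    rw [← hτ.tr, h1]; simp
  simp only [this]
  rw [Finset.sum_comm]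
  refine Finset.sum_congr rfl fun l _ => ?_
  rw [Finset.sum_ite, Finset.sum_const_zero, add_zero, Finset.sum_const, nsmul_eq_mul]

theorem tau_e_nonneg {τ : A →ₗ[ℝ] ℝ} (hτ : IsTr τ) (l : D.κ) : 0 ≤ τ (D.e l) := by
  have := hτ.pos (D.e l)
  rwa [(D.e_proj l).2.star_eq, (D.e_proj l).1.eq] at this

/-- divisibility -/
theorem divide (p : A) (hp : p ∈ C) (hpp : IsStarProjection p)
    (h : ∀ l, D.T l p = 0 ∨ 2001 ≤ D.T l p) :
    ∃ p' pa pb : A, IsStarProjection p' ∧ IsStarProjection pa ∧ IsStarProjection pb ∧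
      p' * pa = 0 ∧ p' * pb = 0 ∧ pa * pb = 0 ∧ p * p' = p' ∧ p * pa = pa ∧ p * pb = pb ∧
      (∀ τ : A →ₗ[ℝ] ℝ, IsTr τ → τ pa = 1000 * τ p' ∧ τ pb = 1000 * τ p' ∧
        τ p ≤ 4002 * τ p') := by
  obtain ⟨n, hn⟩ := D.nat_T p hp hpp
  simp only [hn] at h
  let a : D.κ → ℕ := fun l => n l / 2001
  have ha : ∀ l, 2001 * a l ≤ n l := fun l => Nat.mul_div_le _ _
  have ha2 : ∀ l, n l ≤ 4002 * a l := fun l => by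
    have h1 : n l = 0 ∨ 2001 ≤ n l := by
      rcases h l with h | h
      · left; exact_mod_cast h
      · right; exact_mod_cast h
    simp only [a]
    omega
  have haR : ∀ l, 2001 * (a l : ℝ) ≤ n l := fun l => by exact_mod_cast ha l
  obtain ⟨p', hp'C, hp', h1, h1', hT1⟩ := D.subdiv p hp hpp a (fun l => by
    rw [hn]; have := haR l; have : (0:ℝ) ≤ a l := by positivity
    linarith)
  have hr1 := IsStarProjection.sub_of_mul_eq_left hp' hpp h1'
  obtain ⟨pa, hpaC, hpa, h2, h2', hT2⟩ := D.subdiv (p - p') (sub_mem hp hp'C) hr1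
    (fun l => 1000 * a l) (fun l => by
    rw [map_sub, hn, hT1]; have := haR l; push_cast; have : (0:ℝ) ≤ a l := by positivity
    linarith)
  have hr2 := IsStarProjection.sub_of_mul_eq_left hpa hr1 h2'
  obtain ⟨pb, hpbC, hpb, h3, h3', hT3⟩ := D.subdiv (p - p' - pa) (sub_mem (sub_mem hp hp'C) hpaC)
    hr2 (fun l => 1000 * a l) (fun l => by
    rw [map_sub, map_sub, hn, hT1, hT2]; have := haR l; push_cast
    have : (0:ℝ) ≤ a l := by positivity
    linarith)
  have o1 : p' * (p - p') = 0 := by rw [mul_sub, h1', hp'.1.eq, sub_self]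
  have o2 : p' * pa = 0 := by rw [← h2, ← mul_assoc, o1, zero_mul]
  have o3 : p' * pb = 0 := by
    rw [← h3, ← mul_assoc, mul_sub, o1, o2, sub_zero, zero_mul]
  have o4 : pa * (p - p' - pa) = 0 := by rw [mul_sub, h2', hpa.1.eq, sub_self]
  have o5 : pa * pb = 0 := by rw [← h3, ← mul_assoc, o4, zero_mul]
  have c1 : p * (p - p') = p - p' := by rw [mul_sub, h1, hpp.1.eq]
  have c2 : p * pa = pa := by rw [← h2, ← mul_assoc, c1]
  have c3 : p * pb = pb := by rw [← h3, ← mul_assoc, mul_sub, c1, c2]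
  refine ⟨p', pa, pb, hp', hpa, hpb, o2, o3, o5, h1, c2, c3, fun τ hτ => ⟨?_, ?_, ?_⟩⟩
  · rw [D.trace_eq hτ pa hpaC hpa, D.trace_eq hτ p' hp'C hp', Finset.mul_sum]
    refine Finset.sum_congr rfl fun l _ => ?_
    rw [hT1, hT2]; push_cast; ring
  · rw [D.trace_eq hτ pb hpbC hpb, D.trace_eq hτ p' hp'C hp', Finset.mul_sum]
    refine Finset.sum_congr rfl fun l _ => ?_
    rw [hT1, hT3]; push_cast; ring
  · rw [D.trace_eq hτ p hp hpp, D.trace_eq hτ p' hp'C hp', Finset.mul_sum]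
    refine Finset.sum_le_sum fun l _ => ?_
    rw [hT1, hn, ← mul_assoc]
    refine mul_le_mul_of_nonneg_right ?_ (D.tau_e_nonneg hτ l)
    exact_mod_cast ha2 l

end FDData

end FDComp


section Basics

variable {A : Type*} [CStarAlgebra A] [PartialOrder A] [StarOrderedRing A]

theorem le_smul_one {a : A} (ha : IsSelfAdjoint a) {r : ℝ} (h : ‖a‖ ≤ r) : a ≤ r • (1 : A) := by
  have h1 := IsSelfAdjoint.le_algebraMap_norm_self ha
  rw [Algebra.algebraMap_eq_smul_one] at h1
  exact h1.trans (smul_le_smul_of_nonneg_right h zero_le_one)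

theorem neg_smul_one_le {a : A} (ha : IsSelfAdjoint a) {r : ℝ} (h : ‖a‖ ≤ r) :
    -(r • (1 : A)) ≤ a := by
  have := le_smul_one ha.neg (r := r) (by rwa [norm_neg])
  exact neg_le.mp this

theorem norm_le_of_le_smul {a : A} (ha : 0 ≤ a) {r : ℝ} (hr : 0 ≤ r) (h : a ≤ r • (1 : A)) :
    ‖a‖ ≤ r := by
  rw [CStarAlgebra.norm_le_iff_le_algebraMap a hr ha, Algebra.algebraMap_eq_smul_one]
  exact h

theorem norm_le_one_of {a : A} (ha : 0 ≤ a) (h : a ≤ 1) : ‖a‖ ≤ 1 :=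
  norm_le_of_le_smul ha zero_le_one (by simpa using h)

theorem le_one_of {a : A} (ha : 0 ≤ a) (h : ‖a‖ ≤ 1) : a ≤ 1 := by
  simpa using le_smul_one (IsSelfAdjoint.of_nonneg ha) h

theorem IsStarProjection.nn {p : A} (hp : IsStarProjection p) : 0 ≤ p := by
  have := star_mul_self_nonneg p
  rwa [hp.2.star_eq, hp.1.eq] at this

theorem IsStarProjection.le1 {p : A} (hp : IsStarProjection p) : p ≤ 1 := by
  have := hp.one_sub.nn
  exact sub_nonneg.mp this

theorem IsStarProjection.nrm {p : A} (hp : IsStarProjection p) : ‖p‖ ≤ 1 :=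
  norm_le_one_of hp.nn hp.le1

theorem conj_le {a b : A} (h : a ≤ b) (c : A) : star c * a * c ≤ star c * b * c :=
  star_left_conjugate_le_conjugate h c

theorem conj_le' {a b : A} (h : a ≤ b) (c : A) : c * a * star c ≤ c * b * star c :=
  star_right_conjugate_le_conjugate h c

theorem corner_le {Q e : A} (hQ : IsStarProjection Q) (he : IsSelfAdjoint e) (h : Q * e * Q = e)
    {r : ℝ} (hr : ‖e‖ ≤ r) : e ≤ r • Q := by
  have := conj_le (le_smul_one he hr) Q
  rw [hQ.2.star_eq, h, mul_smul_comm, mul_one, smul_mul_assoc, hQ.1.eq] at this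
  exact this

theorem star_mul_le_one {a : A} {r : ℝ} (h : ‖a‖ ≤ r) : star a * a ≤ (r ^ 2) • (1 : A) := by
  apply le_smul_one (IsSelfAdjoint.star_mul_self a)
  rw [CStarRing.norm_star_mul_self, sq]
  exact mul_le_mul h h (norm_nonneg _) ((norm_nonneg _).trans h)

theorem mul_star_le_one {a : A} {r : ℝ} (h : ‖a‖ ≤ r) : a * star a ≤ (r ^ 2) • (1 : A) := by
  have := star_mul_le_one (a := star a) (r := r) (by rwa [norm_star])
  rwa [star_star] at this

/-- inverse square root lemma -/
theorem exists_inv_sqrt (z : A) {c : ℝ} (hc : 0 < c) (hz : c • (1 : A) ≤ z) :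
    ∃ w : A, 0 ≤ w ∧ w * z * w = 1 ∧ z * w * w = 1 ∧ (∀ x, Commute x z → Commute x w) ∧
      c • (w * w) ≤ 1 ∧ (‖z - 1‖ ≤ 1 / 2 → ‖w - 1‖ ≤ 2 * ‖z - 1‖) := by
  have hz0 : 0 ≤ z := le_trans (smul_nonneg hc.le zero_le_one) hz
  have hzs := IsSelfAdjoint.of_nonneg hz0
  have hsp : ∀ x ∈ spectrum ℝ z, c ≤ x := by
    rw [← algebraMap_le_iff_le_spectrum (a := z), Algebra.algebraMap_eq_smul_one]
    exact hz
  have hcont : ContinuousOn (fun x : ℝ => 1 / Real.sqrt x) (spectrum ℝ z) := by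
    apply ContinuousOn.div continuousOn_const (Real.continuous_sqrt.continuousOn)
    intro x hx
    exact (Real.sqrt_pos.mpr (hc.trans_le (hsp x hx))).ne'
  set w := cfc (fun x : ℝ => 1 / Real.sqrt x) z with hw
  have hcomm : ∀ x, Commute x z → Commute x w := fun x hx => (hx.symm.cfc_real _).symm
  have hw0 : 0 ≤ w := cfc_nonneg fun x _ => by positivity
  have h1 : w * z * w = 1 := by
    have : z = cfc (fun x : ℝ => x) z := (cfc_id' ℝ z).symm
    conv_lhs => rw [this]
    rw [← cfc_mul _ _ z hcont, hw, ← cfc_mul (fun x : ℝ => 1 / Real.sqrt x * x) _ z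
      (hcont.mul continuousOn_id) hcont]
    rw [← cfc_one ℝ z]
    apply cfc_congr
    intro x hx
    have hx0 : 0 < x := hc.trans_le (hsp x hx)
    have := Real.mul_self_sqrt hx0.le
    have h2 := Real.sqrt_pos.mpr hx0
    simp only [Pi.one_apply]
    field_simp
    nlinarith
  have hwz : w * z = z * w := (hcomm z (Commute.refl _)).symm
  refine ⟨w, hw0, h1, by rw [← hwz]; exact h1, hcomm, ?_, ?_⟩
  · have := conj_le hz w
    rw [(IsSelfAdjoint.of_nonneg hw0).star_eq, h1] at this
    simpa using this
  · intro hz1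
    have hw1 : w - 1 = cfc (fun x : ℝ => 1 / Real.sqrt x - 1) z := by
      rw [cfc_sub _ _ z hcont, cfc_const_one ℝ z]
    rw [hw1]
    apply norm_cfc_le (by positivity)
    intro x hx
    have h3 : |x - 1| ≤ ‖z - 1‖ := by
      have : Nontrivial A := by
        by_contra hn
        rw [not_nontrivial_iff_subsingleton] at hn
        simp at hx
      have : x - 1 ∈ spectrum ℝ (z - 1) := by
        have := spectrum.sub_singleton_eq z (1 : ℝ)
        rw [map_one] at this
        rw [← this]
        exact Set.sub_mem_sub hx rfl
      have := spectrum.norm_le_norm_of_mem this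
      simpa using this
    have h4 : 1 / 2 ≤ x := by
      have := abs_le.mp (h3.trans hz1)
      linarith
    have h5 : 1 / 2 ≤ Real.sqrt x := by
      apply Real.le_sqrt_of_sq_le; linarith
    have h6 : 1 / Real.sqrt x - 1 = (1 - x) / (Real.sqrt x * (1 + Real.sqrt x)) := by
      have h7 := Real.mul_self_sqrt (show 0 ≤ x by linarith)
      have : Real.sqrt x > 0 := by linarith
      have : 1 + Real.sqrt x > 0 := by linarith
      field_simp
      nlinarith
    rw [h6, Real.norm_eq_abs, abs_div, abs_of_pos (show 0 < Real.sqrt x * (1 + Real.sqrt x) by positivity),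
      abs_sub_comm]
    rw [div_le_iff₀ (by positivity)]
    have : 1 / 2 ≤ Real.sqrt x * (1 + Real.sqrt x) := by nlinarith
    nlinarith [abs_nonneg (x - 1), norm_nonneg (z - 1)]

/-- corner lemma -/
theorem corner {p t : A} (hp : IsStarProjection p) (ht : t * p = t) {c : ℝ} (hc : 0 < c)
    (h : c • p ≤ star t * t) :
    ∃ V w : A, star V * V = p ∧ V = t * w ∧ (∃ K : ℝ, 0 ≤ K ∧ V * star V ≤ K • (t * star t)) ∧
      (‖star t * t - p‖ ≤ 1 / 2 → ‖V - t‖ ≤ 2 * ‖t‖ * ‖star t * t - p‖) := by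
  have hpt : p * star t = star t := by
    have := congrArg star ht
    rwa [star_mul, hp.2.star_eq] at this
  have hp1 := hp.one_sub
  have hz : (min c 1) • (1 : A) ≤ star t * t + (1 - p) := by
    have e1 : (min c 1) • (1 : A) = (min c 1) • p + (min c 1) • (1 - p) := by
      rw [← smul_add]; congr 1; abel
    rw [e1]
    apply add_le_add
    · exact (smul_le_smul_of_nonneg_right (min_le_left _ _) hp.nn).trans h
    · have := smul_le_smul_of_nonneg_right (min_le_right c 1) hp1.nn
      rwa [one_smul] at this
  have hc' : 0 < min c 1 := lt_min hc one_pos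
  obtain ⟨w, hw0, hw1, hw2, hwc, hwn, hwd⟩ := exists_inv_sqrt _ hc' hz
  have hws := (IsSelfAdjoint.of_nonneg hw0).star_eq
  have hpz : p * (star t * t + (1 - p)) = star t * t := by
    rw [mul_add, ← mul_assoc, hpt, mul_sub, mul_one, hp.1.eq, sub_self, add_zero]
  have hzp : (star t * t + (1 - p)) * p = star t * t := by
    rw [add_mul, mul_assoc, ht, sub_mul, one_mul, hp.1.eq, sub_self, add_zero]
  have hcp : Commute p w := hwc p (hpz.trans hzp.symm)
  refine ⟨t * w, w, ?_, rfl, ⟨(min c 1)⁻¹, by positivity, ?_⟩, ?_⟩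
  · rw [star_mul, hws, mul_assoc, ← mul_assoc (star t), ← hpz, ← mul_assoc, ← mul_assoc, ← hcp.eq,
      mul_assoc p, mul_assoc p, hw1, mul_one]
  · have h1 : w * w ≤ (min c 1)⁻¹ • (1 : A) := by
      rw [le_inv_smul_iff_of_pos hc']; exact hwn
    have := conj_le' h1 t
    rw [mul_smul_comm, mul_one, smul_mul_assoc] at this
    calc t * w * star (t * w) = t * (w * w) * star t := by rw [star_mul, hws]; simp only [mul_assoc]
      _ ≤ _ := this
  · intro h
    have e : star t * t + (1 - p) - 1 = star t * t - p := by abel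
    rw [e] at hwd
    have := hwd h
    calc ‖t * w - t‖ = ‖t * (w - 1)‖ := by rw [mul_sub, mul_one]
      _ ≤ ‖t‖ * ‖w - 1‖ := norm_mul_le _ _
      _ ≤ ‖t‖ * (2 * ‖star t * t - p‖) := by gcongr
      _ = _ := by ring

theorem mul_cfc {y : A} (hy : IsSelfAdjoint y) (f : ℝ → ℝ) (hf : ContinuousOn f (spectrum ℝ y)) :
    y * cfc f y = cfc (fun x => x * f x) y := by
  rw [cfc_mul (fun x : ℝ => x) f y continuousOn_id hf, cfc_id' ℝ y]

theorem finite_spectrum_of_mem (C : NonUnitalStarSubalgebra ℂ A) [FiniteDimensional ℂ C] {y : A}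
    (hyC : y ∈ C) : (spectrum ℝ y).Finite := by
  have hmem : ∀ p : Polynomial ℝ, Polynomial.aeval y (Polynomial.X * p) ∈ C := by
    intro p
    induction p using Polynomial.induction_on' with
    | add p q hp hq => rw [mul_add, map_add]; exact add_mem hp hq
    | monomial n a =>
      rw [map_mul, Polynomial.aeval_X, Polynomial.aeval_monomial, Algebra.algebraMap_eq_smul_one,
        smul_mul_assoc, one_mul, mul_smul_comm, ← pow_succ']
      have hp : ∀ n, y ^ (n + 1) ∈ C := fun n => by
        induction n with
        | zero => simpa
        | succ n ih => rw [pow_succ]; exact mul_mem ih hyC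
      have := C.toSubmodule.smul_mem (a : ℂ) (hp n)
      simpa using this
  let f : Polynomial ℝ →ₗ[ℝ] C.toSubmodule.restrictScalars ℝ :=
    LinearMap.codRestrict _ ((Polynomial.aeval y).toLinearMap.comp
      (LinearMap.mulLeft ℝ (Polynomial.X : Polynomial ℝ))) hmem
  have hfd : FiniteDimensional ℝ (C.toSubmodule.restrictScalars ℝ) := by
    have : FiniteDimensional ℝ C := Module.Finite.trans ℂ C
    exact this
  have hni : ¬ Function.Injective f := fun h => by
    have := FiniteDimensional.of_injective f h
    exact Polynomial.not_finite this
  rw [← LinearMap.ker_eq_bot, Submodule.eq_bot_iff] at hni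
  push Not at hni
  obtain ⟨p, hp, hp0⟩ := hni
  refine finite_spectrum_of_aeval y (Polynomial.X * p) (mul_ne_zero Polynomial.X_ne_zero hp0) ?_
  exact congrArg Subtype.val hp

theorem cfc_mem_fd (C : NonUnitalStarSubalgebra ℂ A) [FiniteDimensional ℂ C] {y : A} (hyC : y ∈ C)
    (hy : IsSelfAdjoint y) (f : ℝ → ℝ) (h0 : f 0 = 0) : cfc f y ∈ C := by
  have hcl := fd_isClosed C
  have hfin := finite_spectrum_of_mem C hyC
  have hq : (quasispectrum ℝ y).Finite := by
    rw [quasispectrum_eq_spectrum_union_zero]; exact hfin.union (Set.finite_singleton 0)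
  have : CompleteSpace C := by infer_instance
  rw [← cfcₙ_eq_cfc (hf := hq.continuousOn f) (hf0 := h0)]
  exact cfcₙ_mem (S := NonUnitalStarSubalgebra ℂ A) (𝕜' := ℂ) f hyC

/-- spectral projections in f.d. subalgebras -/
theorem specproj (C : NonUnitalStarSubalgebra ℂ A) [FiniteDimensional ℂ C] {y : A} (hyC : y ∈ C)
    (hy : 0 ≤ y) {s : ℝ} (hs : 0 < s) :
    ∃ P L : A, P ∈ C ∧ L ∈ C ∧ IsStarProjection P ∧ y * L = P ∧ L * y = P ∧ 0 ≤ L ∧ ‖L‖ ≤ 1 / s ∧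
      y ≤ ‖y‖ • P + s • 1 ∧ y ≤ y * P + s • 1 ∧ y * P = P * y ∧ s • P ≤ y ∧
      ‖(1 - P) * y * (1 - P)‖ ≤ s := by
  classical
  have hys := IsSelfAdjoint.of_nonneg hy
  have hfin := finite_spectrum_of_mem C hyC
  have hc : ∀ f : ℝ → ℝ, ContinuousOn f (spectrum ℝ y) := fun f => hfin.continuousOn f
  have hnn : ∀ x ∈ spectrum ℝ y, 0 ≤ x := fun x hx => spectrum_nonneg_of_nonneg hy hx
  have hid : y = cfc (fun x : ℝ => x) y := (cfc_id' ℝ y).symm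
  have hle : ∀ x ∈ spectrum ℝ y, x ≤ ‖y‖ := fun x hx => by
    have : Nontrivial A := by
      by_contra hn
      rw [not_nontrivial_iff_subsingleton] at hn
      simp at hx
    have := spectrum.norm_le_norm_of_mem hx
    exact (le_abs_self x).trans (by simpa using this)
  let fP : ℝ → ℝ := fun x => if s < x then 1 else 0
  let fL : ℝ → ℝ := fun x => if s < x then 1 / x else 0
  have e1 : y * cfc fL y = cfc fP y := by
    rw [mul_cfc hys _ (hc _)]
    apply cfc_congr
    intro x hx
    simp only [fL, fP]
    split_ifs with h
    · have : x ≠ 0 := (hs.trans h).ne'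
      field_simp
    · simp
  have e2 : cfc fL y * y = cfc fP y := by
    rw [← e1]; exact ((Commute.refl y).cfc_real fL).symm.eq.symm
  have hPs : IsSelfAdjoint (cfc fP y) := cfc_predicate _ _
  have e3 : cfc fP y * cfc fP y = cfc fP y := by
    rw [← cfc_mul _ _ y (hc _) (hc _)]
    apply cfc_congr
    intro x hx
    simp only [fP]; split_ifs <;> simp
  have e4 : y * cfc fP y = cfc (fun x => x * fP x) y := by
    rw [mul_cfc hys _ (hc _)]
  have hs1 : s • (1 : A) = cfc (fun _ : ℝ => s) y := by
    rw [cfc_const s y, Algebra.algebraMap_eq_smul_one]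
  have e5 : y * cfc fP y = cfc fP y * y := ((Commute.refl y).cfc_real fP).eq.symm
  have e6 : y ≤ y * cfc fP y + s • 1 := by
    rw [e4, hs1, ← cfc_add y _ _ (hc _) (hc _)]
    conv_lhs => rw [hid]
    apply cfc_mono (hf := hc _) (hg := hc _)
    intro x hx
    simp only [fP]
    split_ifs with h
    · simpa using hs.le
    · simpa using h
  have hP : IsStarProjection (cfc fP y) := ⟨e3, hPs⟩
  refine ⟨cfc fP y, cfc fL y, cfc_mem_fd C hyC hys _ ?_, cfc_mem_fd C hyC hys _ ?_, hP,
    e1, e2, ?_, ?_, ?_, e6, e5, ?_, ?_⟩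
  · simp [fP, hs.le]
  · simp [fL, hs.le]
  · apply cfc_nonneg
    intro x hx
    simp only [fL]
    have := hnn x hx
    split_ifs <;> positivity
  · apply norm_cfc_le (by positivity)
    intro x hx
    simp only [fL]
    split_ifs with h
    · rw [Real.norm_eq_abs, abs_of_nonneg (by have := hs.trans h; positivity)]
      gcongr
    · simp [hs.le]
  · rw [hs1, ← cfc_smul _ _ y (hc _), ← cfc_add y _ _ (hc _) (hc _)]
    conv_lhs => rw [hid]
    apply cfc_mono (hf := hc _) (hg := hc _)
    intro x hx
    have := hle x hx
    simp only [fP]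
    split_ifs with h
    · simp; linarith
    · simpa using h
  · rw [← cfc_smul _ _ y (hc _)]
    conv_rhs => rw [hid]
    apply cfc_mono (hf := hc _) (hg := hc _)
    intro x hx
    have := hnn x hx
    simp only [fP]
    split_ifs with h
    · simpa using h.le
    · simpa using this
  · apply norm_le_of_le_smul _ hs.le
    · have := conj_le e6 (1 - cfc fP y)
      rw [hP.one_sub.2.star_eq] at this
      refine this.trans ?_
      rw [mul_add, add_mul, ← mul_assoc, mul_assoc _ _ (1 - cfc fP y), mul_sub (cfc fP y), mul_one, e3, sub_self, mul_zero,
        zero_add, mul_smul_comm, mul_one, smul_mul_assoc, hP.one_sub.1.eq]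
      exact smul_le_smul_of_nonneg_left hP.one_sub.le1 hs.le
    · have := star_left_conjugate_nonneg hy (1 - cfc fP y)
      rwa [hP.one_sub.2.star_eq] at this

end Basics


section Families

variable {A : Type*} [CStarAlgebra A]

theorem poly_comm (x : A) (p : Polynomial ℝ) : ∃ K : ℝ, 0 ≤ K ∧ ∀ h : A, ‖h‖ ≤ 1 →
    ‖Polynomial.aeval h p * x - x * Polynomial.aeval h p‖ ≤ K * ‖h * x - x * h‖ := by
  induction p using Polynomial.induction_on' with
  | add p q hp hq =>
    obtain ⟨K, hK, h1⟩ := hp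
    obtain ⟨L, hL, h2⟩ := hq
    refine ⟨K + L, by positivity, fun h hh => ?_⟩
    have e : Polynomial.aeval h (p + q) * x - x * Polynomial.aeval h (p + q) =
      (Polynomial.aeval h p * x - x * Polynomial.aeval h p) +
      (Polynomial.aeval h q * x - x * Polynomial.aeval h q) := by
      rw [map_add]; noncomm_ring
    rw [e, add_mul]
    exact (norm_add_le _ _).trans (add_le_add (h1 h hh) (h2 h hh))
  | monomial n a =>
    have key : ∀ n : ℕ, ∀ h : A, ‖h‖ ≤ 1 → ‖h ^ n * x - x * h ^ n‖ ≤ n * ‖h * x - x * h‖ := by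
      intro n h hh
      induction n with
      | zero => simp
      | succ n ih =>
        have e : h ^ (n + 1) * x - x * h ^ (n + 1) = h * (h ^ n * x - x * h ^ n)
          + (h * x - x * h) * h ^ n := by
          rw [pow_succ']; noncomm_ring
        rw [e]
        have hn : ‖(h * x - x * h) * h ^ n‖ ≤ ‖h * x - x * h‖ := by
          rcases Nat.eq_zero_or_pos n with rfl | hn
          · simp
          · refine (norm_mul_le _ _).trans ?_
            have := (norm_pow_le' h hn).trans (pow_le_one₀ (norm_nonneg _) hh)
            nlinarith [norm_nonneg (h * x - x * h)]
        have h2 := norm_mul_le h (h ^ n * x - x * h ^ n)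
        have h3 := norm_add_le (h * (h ^ n * x - x * h ^ n)) ((h * x - x * h) * h ^ n)
        push_cast
        nlinarith [norm_nonneg (h ^ n * x - x * h ^ n)]
    refine ⟨|a| * n, by positivity, fun h hh => ?_⟩
    rw [Polynomial.aeval_monomial, Algebra.algebraMap_eq_smul_one, smul_mul_assoc, one_mul,
      smul_mul_assoc, mul_smul_comm, ← smul_sub, norm_smul, mul_assoc]
    exact mul_le_mul_of_nonneg_left (key n h hh) (abs_nonneg _)

/-- bounded families -/
def bdFam (I A : Type*) [CStarAlgebra A] : StarSubalgebra ℂ (I → A) where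
  carrier := {f | ∃ M : ℝ, ∀ i, ‖f i‖ ≤ M}
  mul_mem' := by
    rintro f g ⟨M, hM⟩ ⟨N, hN⟩
    refine ⟨M * N, fun i => (norm_mul_le _ _).trans ?_⟩
    exact mul_le_mul (hM i) (hN i) (norm_nonneg _) ((norm_nonneg _).trans (hM i))
  add_mem' := by
    rintro f g ⟨M, hM⟩ ⟨N, hN⟩
    exact ⟨M + N, fun i => (norm_add_le _ _).trans (add_le_add (hM i) (hN i))⟩
  algebraMap_mem' := fun r => ⟨‖algebraMap ℂ A r‖, fun i => le_refl _⟩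
  star_mem' := by
    rintro f ⟨M, hM⟩
    exact ⟨M, fun i => by rw [Pi.star_apply, norm_star]; exact hM i⟩

variable {I : Type*} (l : Filter I)

theorem tendsto_zero_mul_bd {f g : I → A} (hf : Tendsto f l (𝓝 0)) (hg : ∃ M : ℝ, ∀ i, ‖g i‖ ≤ M) :
    Tendsto (fun i => f i * g i) l (𝓝 0) := by
  obtain ⟨M, hM⟩ := hg
  rw [tendsto_zero_iff_norm_tendsto_zero] at hf ⊢
  refine squeeze_zero (fun i => norm_nonneg _)
    (fun i => (norm_mul_le _ _).trans (mul_le_mul_of_nonneg_left (hM i) (norm_nonneg _))) ?_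
  simpa using hf.mul_const M

theorem tendsto_bd_mul_zero {f g : I → A} (hf : Tendsto f l (𝓝 0)) (hg : ∃ M : ℝ, ∀ i, ‖g i‖ ≤ M) :
    Tendsto (fun i => g i * f i) l (𝓝 0) := by
  obtain ⟨M, hM⟩ := hg
  rw [tendsto_zero_iff_norm_tendsto_zero] at hf ⊢
  refine squeeze_zero (fun i => norm_nonneg _)
    (fun i => (norm_mul_le _ _).trans (mul_le_mul_of_nonneg_right (hM i) (norm_nonneg _))) ?_
  simpa using hf.const_mul M

noncomputable def famCon (A : Type*) [CStarAlgebra A] : RingCon (bdFam I A) where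
  r x y := Tendsto (fun i => x.1 i - y.1 i) l (𝓝 0)
  iseqv := by
    refine ⟨fun x => by simp [tendsto_const_nhds], fun {x y} h => ?_, fun {x y z} h h' => ?_⟩
    · simpa using h.neg
    · simpa using h.add h'
  add' := by
    intro x y z w h h'
    have := h.add h'
    rw [add_zero] at this
    refine this.congr fun i => ?_
    change _ = (x.1 i + z.1 i) - (y.1 i + w.1 i)
    abel
  mul' := by
    intro x y z w h h'
    have := (tendsto_zero_mul_bd l h z.2).add (tendsto_bd_mul_zero l h' y.2)
    rw [add_zero] at this
    refine this.congr fun i => ?_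
    change _ = (x.1 i * z.1 i) - (y.1 i * w.1 i)
    noncomm_ring

/-- class modulo null families -/
noncomputable def cl : bdFam I A →+* (famCon (I := I) l A).Quotient := (famCon (I := I) l A).mk'

variable {l}

theorem cl_eq {x y : bdFam I A} : cl l x = cl l y ↔ Tendsto (fun i => x.1 i - y.1 i) l (𝓝 0) :=
  RingCon.eq _

theorem cl_star {x y : bdFam I A} (h : cl l x = cl l y) : cl l (star x) = cl l (star y) := by
  rw [cl_eq] at h ⊢
  have := (continuous_star (R := A)).tendsto 0 |>.comp h
  rw [star_zero] at this
  refine this.congr fun i => ?_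
  exact star_sub _ _

theorem cl_ev {x y : bdFam I A} (h : cl l x = cl l y) {η : ℝ} (hη : 0 < η) :
    ∀ᶠ i in l, ‖x.1 i - y.1 i‖ ≤ η := by
  rw [cl_eq, tendsto_zero_iff_norm_tendsto_zero] at h
  filter_upwards [h.eventually (gt_mem_nhds hη)] with i hi using hi.le

variable (I) in
/-- constant families -/
noncomputable def cst : A →+* bdFam I A where
  toFun a := ⟨fun _ => a, ‖a‖, fun _ => le_rfl⟩
  map_one' := rfl
  map_mul' _ _ := rfl
  map_zero' := rfl
  map_add' _ _ := rfl

theorem cst_star (a : A) : cst I (star a) = star (cst I a) := rfl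

@[simp] theorem cst_apply (a : A) (i : I) : (cst I a).1 i = a := rfl
@[simp] theorem bd_mul (x y : bdFam I A) (i : I) : (x * y).1 i = x.1 i * y.1 i := rfl
@[simp] theorem bd_add (x y : bdFam I A) (i : I) : (x + y).1 i = x.1 i + y.1 i := rfl
@[simp] theorem bd_sub (x y : bdFam I A) (i : I) : (x - y).1 i = x.1 i - y.1 i := rfl
@[simp] theorem bd_star (x : bdFam I A) (i : I) : (star x).1 i = star (x.1 i) := rfl
@[simp] theorem bd_sum {J : Type*} (s : Finset J) (x : J → bdFam I A) (i : I) :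
    (∑ j ∈ s, x j).1 i = ∑ j ∈ s, (x j).1 i := by
  classical
  induction s using Finset.induction_on with
  | empty => rfl
  | insert a s ha ih => rw [Finset.sum_insert ha, Finset.sum_insert ha, ← ih]; rfl

variable [PartialOrder A] [StarOrderedRing A]

theorem spec_Icc {h : A} (h0 : 0 ≤ h) (h1 : h ≤ 1) : ∀ x ∈ spectrum ℝ h, x ∈ Set.Icc (0:ℝ) 1 := by
  intro x hx
  refine ⟨spectrum_nonneg_of_nonneg h0 hx, ?_⟩
  have : h ≤ algebraMap ℝ A 1 := by simpa using h1
  rw [le_algebraMap_iff_spectrum_le] at this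
  exact this x hx

theorem cfc_comm (x : A) (f : ℝ → ℝ) (hf : ContinuousOn f (Set.Icc 0 1)) {η : ℝ} (hη : 0 < η) :
    ∃ ε > 0, ∀ h : A, 0 ≤ h → h ≤ 1 → ‖h * x - x * h‖ ≤ ε →
      ‖cfc f h * x - x * cfc f h‖ ≤ η := by
  have hη' : 0 < η / (4 * (‖x‖ + 1)) := by positivity
  obtain ⟨p, hp⟩ := exists_polynomial_near_of_continuousOn 0 1 f hf _ hη'
  obtain ⟨K, hK, h1⟩ := poly_comm x p
  refine ⟨η / (2 * (K + 1)), by positivity, fun h h0 hle hx => ?_⟩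
  have hs := IsSelfAdjoint.of_nonneg h0
  have hsp := spec_Icc h0 hle
  have hfc : ContinuousOn f (spectrum ℝ h) := hf.mono hsp
  have hd : ‖cfc f h - Polynomial.aeval h p‖ ≤ η / (4 * (‖x‖ + 1)) := by
    rw [← cfc_polynomial p h, ← cfc_sub _ _ h hfc (p.continuous.continuousOn)]
    apply norm_cfc_le hη'.le
    intro t ht
    rw [Real.norm_eq_abs, abs_sub_comm]
    exact (hp t (hsp t ht)).le
  have e : cfc f h * x - x * cfc f h = (cfc f h - Polynomial.aeval h p) * x
    - x * (cfc f h - Polynomial.aeval h p)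
    + (Polynomial.aeval h p * x - x * Polynomial.aeval h p) := by noncomm_ring
  rw [e]
  have n1 := norm_add_le ((cfc f h - Polynomial.aeval h p) * x
    - x * (cfc f h - Polynomial.aeval h p)) (Polynomial.aeval h p * x - x * Polynomial.aeval h p)
  have n2 := norm_sub_le ((cfc f h - Polynomial.aeval h p) * x)
    (x * (cfc f h - Polynomial.aeval h p))
  have n3 := norm_mul_le (cfc f h - Polynomial.aeval h p) x
  have n4 := norm_mul_le x (cfc f h - Polynomial.aeval h p)
  have n5 := h1 h (norm_le_one_of h0 hle)
  have n6 : K * ‖h * x - x * h‖ ≤ η / 2 := by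
    calc K * ‖h * x - x * h‖ ≤ (K + 1) * (η / (2 * (K + 1))) := by
          apply mul_le_mul _ hx (norm_nonneg _) (by positivity); linarith
      _ = η / 2 := by field_simp
  have n7 : ‖cfc f h - Polynomial.aeval h p‖ * ‖x‖ ≤ η / 4 := by
    calc _ ≤ η / (4 * (‖x‖ + 1)) * (‖x‖ + 1) := by
          apply mul_le_mul hd _ (norm_nonneg _) hη'.le; linarith
      _ = η / 4 := by field_simp
  nlinarith

variable (l) in
/-- one colour of the decomposition -/
structure IsCol (C : I → NonUnitalStarSubalgebra ℂ A) (e1 e2 e3 Q : bdFam I A) : Prop where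
  fd : ∀ i, FiniteDimensional ℂ (C i)
  m1 : ∀ i, e1.1 i ∈ C i
  m2 : ∀ i, e2.1 i ∈ C i
  m3 : ∀ i, e3.1 i ∈ C i
  mQ : ∀ i, Q.1 i ∈ C i
  p1 : ∀ i, 0 ≤ e1.1 i ∧ e1.1 i ≤ 1
  p2 : ∀ i, 0 ≤ e2.1 i ∧ e2.1 i ≤ 1
  p3 : ∀ i, 0 ≤ e3.1 i ∧ e3.1 i ≤ 1
  pQ : ∀ i, IsStarProjection (Q.1 i)
  h21 : e2 * e1 = e1
  h12 : e1 * e2 = e1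
  h32 : e3 * e2 = e2
  h23 : e2 * e3 = e2
  Q2 : Q * e2 = e2
  h2Q : e2 * Q = e2
  h3Q : e3 * Q = Q
  Q3 : Q * e3 = Q
  c1 : ∀ a, cl l (cst I a * e1) = cl l (e1 * cst I a)
  c2 : ∀ a, cl l (cst I a * e2) = cl l (e2 * cst I a)
  c3 : ∀ a, cl l (cst I a * e3) = cl l (e3 * cst I a)
  b1 : ∀ a, ∃ s : bdFam I A, (∀ i, s.1 i ∈ C i) ∧ cl l s = cl l (e1 * cst I a) ∧ e2 * s = s
  b2 : ∀ a, ∃ s : bdFam I A, (∀ i, s.1 i ∈ C i) ∧ cl l s = cl l (e2 * cst I a) ∧ Q * s = s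
  b3 : ∀ a, ∃ s : bdFam I A, (∀ i, s.1 i ∈ C i) ∧ cl l s = cl l (e3 * cst I a)

end Families


section Cols

variable {A : Type*} [CStarAlgebra A] [PartialOrder A] [StarOrderedRing A]
variable {I : Type*} {l : Filter I}

/-- piecewise linear ramp -/
noncomputable def ramp (a b t : ℝ) : ℝ := min 1 (max 0 ((t - a) / (b - a)))

theorem ramp_cont (a b : ℝ) : Continuous (ramp a b) := by
  unfold ramp; fun_prop

theorem ramp_nonneg (a b t : ℝ) : 0 ≤ ramp a b t := by
  unfold ramp; positivity

theorem ramp_le (a b t : ℝ) : ramp a b t ≤ 1 := min_le_left _ _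

theorem ramp_zero {a b t : ℝ} (hab : a < b) (h : t ≤ a) : ramp a b t = 0 := by
  unfold ramp
  have : (t - a) / (b - a) ≤ 0 := div_nonpos_of_nonpos_of_nonneg (by linarith) (by linarith)
  rw [max_eq_left this]; simp

theorem ramp_one {a b t : ℝ} (hab : a < b) (h : b ≤ t) : ramp a b t = 1 := by
  unfold ramp
  have : 1 ≤ (t - a) / (b - a) := by rw [le_div_iff₀ (by linarith)]; linarith
  rw [max_eq_right (by linarith)]; exact min_eq_left this

theorem bd_approx {C : I → NonUnitalStarSubalgebra ℂ A} {H : I → A}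
    (hH : ∃ M : ℝ, ∀ i, ‖H i‖ ≤ M) (h : ∃ c : I → A, (∀ i, c i ∈ C i) ∧
      Tendsto (fun i => H i - c i) l (𝓝 0)) :
    ∃ c : bdFam I A, (∀ i, c.1 i ∈ C i) ∧ Tendsto (fun i => H i - c.1 i) l (𝓝 0) := by
  classical
  obtain ⟨M, hM⟩ := hH
  obtain ⟨c, hc, ht⟩ := h
  refine ⟨⟨fun i => if ‖H i - c i‖ ≤ 1 then c i else 0, M + 1, fun i => ?_⟩, fun i => ?_, ?_⟩
  · dsimp only
    split_ifs with h
    · have := norm_sub_le (H i) (H i - c i)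
      rw [sub_sub_cancel] at this
      linarith [hM i]
    · rw [norm_zero]; linarith [hM i, norm_nonneg (H i)]
  · simp only
    split_ifs
    · exact hc i
    · exact zero_mem _
  · refine ht.congr' ?_
    have := (tendsto_zero_iff_norm_tendsto_zero.mp ht).eventually (gt_mem_nhds one_pos)
    filter_upwards [this] with i hi
    rw [if_pos hi.le]

theorem comm_family {h : I → A} (h0 : ∀ i, 0 ≤ h i) (h1 : ∀ i, h i ≤ 1) (a : A)
    (hc : Tendsto (fun i => h i * a - a * h i) l (𝓝 0)) (f : ℝ → ℝ)
    (hf : ContinuousOn f (Set.Icc 0 1)) :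
    Tendsto (fun i => cfc f (h i) * a - a * cfc f (h i)) l (𝓝 0) := by
  rw [Metric.tendsto_nhds]
  intro η hη
  obtain ⟨ε, hε, H⟩ := cfc_comm a f hf (half_pos hη)
  have := (tendsto_zero_iff_norm_tendsto_zero.mp hc).eventually (gt_mem_nhds hε)
  filter_upwards [this] with i hi
  rw [dist_zero_right]
  exact (H _ (h0 i) (h1 i) hi.le).trans_lt (by linarith)

theorem exists_col (C : I → NonUnitalStarSubalgebra ℂ A) (hfd : ∀ i, FiniteDimensional ℂ (C i))
    (h : I → A) (hm : ∀ i, h i ∈ C i) (h0 : ∀ i, 0 ≤ h i) (h1 : ∀ i, h i ≤ 1)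
    (hc : ∀ a, Tendsto (fun i => h i * a - a * h i) l (𝓝 0))
    (hb : ∀ a, ∃ c : I → A, (∀ i, c i ∈ C i) ∧ Tendsto (fun i => h i * a - c i) l (𝓝 0))
    {δ : ℝ} (hδ : 0 < δ) :
    ∃ e1 e2 e3 Q : bdFam I A, IsCol l C e1 e2 e3 Q ∧ ∀ i, h i ≤ e1.1 i * e1.1 i + δ • 1 := by
  classical
  have hs : ∀ i, IsSelfAdjoint (h i) := fun i => IsSelfAdjoint.of_nonneg (h0 i)
  have hfin : ∀ i, (spectrum ℝ (h i)).Finite := fun i => finite_spectrum_of_mem (C i) (hm i)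
  have hct : ∀ (f : ℝ → ℝ) i, ContinuousOn f (spectrum ℝ (h i)) := fun f i => (hfin i).continuousOn f
  have hmul : ∀ (f g : ℝ → ℝ) i, cfc f (h i) * cfc g (h i) = cfc (fun x => f x * g x) (h i) :=
    fun f g i => (cfc_mul f g (h i) (hct _ i) (hct _ i)).symm
  have hmem : ∀ (f : ℝ → ℝ), f 0 = 0 → ∀ i, cfc f (h i) ∈ C i := fun f hf i =>
    haveI := hfd i
    cfc_mem_fd (C i) (hm i) (hs i) f hf
  let F : (f : ℝ → ℝ) → (M : ℝ) → (∀ t, |f t| ≤ M) → bdFam I A := fun f M hM =>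
    ⟨fun i => cfc f (h i), M, fun i => norm_cfc_le ((abs_nonneg _).trans (hM 0)) fun x _ => hM x⟩
  have hr : ∀ a b t, |ramp a b t| ≤ 1 := fun a b t => by
    rw [abs_of_nonneg (ramp_nonneg _ _ _)]; exact ramp_le _ _ _
  have hp : ∀ a b i, 0 ≤ cfc (ramp a b) (h i) ∧ cfc (ramp a b) (h i) ≤ 1 := fun a b i =>
    ⟨cfc_nonneg fun x _ => ramp_nonneg _ _ _, cfc_le_one _ _ fun x _ => ramp_le _ _ _⟩
  let χ : ℝ → ℝ := fun t => if δ / 4 ≤ t then 1 else 0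
  have hχ : ∀ t, |χ t| ≤ 1 := fun t => by simp only [χ]; split_ifs <;> simp
  have hcomm : ∀ a b x, cl l (cst I x * F (ramp a b) 1 (hr a b)) =
      cl l (F (ramp a b) 1 (hr a b) * cst I x) := fun a b x => by
    symm
    rw [cl_eq]
    exact comm_family h0 h1 x (hc x) _ (ramp_cont a b).continuousOn
  have hk : ∀ a b, 0 < a → a < b → ∀ t, |ramp a b t / t| ≤ 1 / a := fun a b ha hab t => by
    rcases le_or_gt t a with h | h
    · rw [ramp_zero hab h]; simp [ha.le]
    · rw [abs_div, div_le_div_iff₀ (abs_pos.mpr (ha.trans h).ne') ha, abs_of_pos (ha.trans h)]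
      have := hr a b t
      nlinarith [abs_nonneg (ramp a b t)]
  have hbr : ∀ a b, ∀ (ha : 0 < a) (hab : a < b), ∀ x, ∃ c : bdFam I A, (∀ i, c.1 i ∈ C i) ∧
      cl l (F (fun t => ramp a b t / t) (1 / a) (hk a b ha hab) * c) =
        cl l (F (ramp a b) 1 (hr a b) * cst I x) := fun a b ha hab x => by
    obtain ⟨c, hcC, hct'⟩ := bd_approx (l := l) (C := C) (H := fun i => h i * x)
      ⟨‖x‖, fun i => (norm_mul_le _ _).trans (by
        have := norm_le_one_of (h0 i) (h1 i)
        nlinarith [norm_nonneg x])⟩ (hb x)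
    refine ⟨c, hcC, ?_⟩
    symm
    rw [cl_eq]
    have := tendsto_bd_mul_zero l hct' (F (fun t => ramp a b t / t) (1 / a) (hk a b ha hab)).2
    refine this.congr fun i => ?_
    simp only [bd_mul, cst_apply, F, mul_sub, ← mul_assoc]
    congr 2
    have e : h i = cfc (fun x : ℝ => x) (h i) := (cfc_id' ℝ (h i)).symm
    have e2 : cfc (fun t => ramp a b t / t) (h i) * h i
      = cfc (fun t => ramp a b t / t) (h i) * cfc (fun x : ℝ => x) (h i) := by rw [← e]
    rw [e2, hmul]
    apply cfc_congr
    intro t _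
    simp only
    rcases eq_or_ne t 0 with rfl | ht
    · rw [ramp_zero hab ha.le]; simp
    · field_simp
  have hδ1 : δ / 2 < δ := by linarith
  have hδ2 : δ / 4 < δ / 2 := by linarith
  have hδ3 : δ / 8 < δ / 4 := by linarith
  -- pointwise identities
  have q1 : ∀ a b c t, b ≤ c → a < b → 0 < a → ∀ d, c < d → ramp a b t * ramp c d t = ramp c d t := by
    intro a b c t hbc hab ha d hcd
    rcases le_or_gt t c with h | h
    · rw [ramp_zero hcd h, mul_zero]
    · rw [ramp_one hab (by linarith), one_mul]
  have q2 : ∀ t, χ t * ramp (δ / 4) (δ / 2) t = ramp (δ / 4) (δ / 2) t := by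
    intro t
    simp only [χ]
    split_ifs with h
    · rw [one_mul]
    · rw [ramp_zero hδ2 (by linarith), mul_zero]
  have q3 : ∀ t, ramp (δ / 8) (δ / 4) t * χ t = χ t := by
    intro t
    simp only [χ]
    split_ifs with h
    · rw [ramp_one hδ3 h, mul_one]
    · rw [mul_zero]
  have r0 : ∀ a b, 0 < a → a < b → ramp a b 0 = 0 := fun a b ha hab => ramp_zero hab ha.le
  have χ0 : χ 0 = 0 := by simp only [χ]; rw [if_neg (by linarith)]
  have hFe : ∀ (f g k : ℝ → ℝ) (M N L) (hM : ∀ t, |f t| ≤ M) (hN : ∀ t, |g t| ≤ N)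
      (hL : ∀ t, |k t| ≤ L), (∀ t, f t * g t = k t) → F f M hM * F g N hN = F k L hL := by
    intro f g k M N L hM hN hL hfg
    apply Subtype.ext
    funext i
    simp only [F]
    change cfc f (h i) * cfc g (h i) = _
    rw [hmul]
    congr 1; funext t; exact hfg t
  refine ⟨F (ramp (δ / 2) δ) 1 (hr _ _), F (ramp (δ / 4) (δ / 2)) 1 (hr _ _),
    F (ramp (δ / 8) (δ / 4)) 1 (hr _ _), F χ 1 hχ, ⟨hfd, hmem _ (r0 _ _ (by positivity) hδ1),
    hmem _ (r0 _ _ (by positivity) hδ2),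
    hmem _ (r0 _ _ (by positivity) hδ3), hmem _ χ0, hp _ _, hp _ _, hp _ _, fun i => ?_,
    ?_, ?_, ?_,
    ?_, ?_, ?_,
    ?_, ?_, hcomm _ _, hcomm _ _, hcomm _ _,
    fun a => ?_, fun a => ?_, fun a => ?_⟩, fun i => ?_⟩
  · refine ⟨?_, cfc_predicate _ _⟩
    change cfc χ (h i) * cfc χ (h i) = cfc χ (h i)
    rw [hmul]
    congr 1; funext t; simp only [χ]; split_ifs <;> simp
  · refine hFe _ _ _ _ _ _ (hr _ _) (hr _ _) (hr _ _) fun t => ?_; exact q1 _ _ _ t le_rfl hδ2 (by positivity) _ hδ1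
  · refine hFe _ _ _ _ _ _ (hr _ _) (hr _ _) (hr _ _) fun t => ?_; rw [mul_comm]; exact q1 _ _ _ t le_rfl hδ2 (by positivity) _ hδ1
  · refine hFe _ _ _ _ _ _ (hr _ _) (hr _ _) (hr _ _) fun t => ?_; exact q1 _ _ _ t le_rfl hδ3 (by positivity) _ hδ2
  · refine hFe _ _ _ _ _ _ (hr _ _) (hr _ _) (hr _ _) fun t => ?_; rw [mul_comm]; exact q1 _ _ _ t le_rfl hδ3 (by positivity) _ hδ2
  · exact hFe _ _ _ _ _ _ hχ (hr _ _) (hr _ _) q2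
  · refine hFe _ _ _ _ _ _ (hr _ _) hχ (hr _ _) fun t => ?_; rw [mul_comm]; exact q2 t
  · exact hFe _ _ _ _ _ _ (hr _ _) hχ hχ q3
  · refine hFe _ _ _ _ _ _ hχ (hr _ _) hχ fun t => ?_; rw [mul_comm]; exact q3 t
  · obtain ⟨c, hcC, hce⟩ := hbr (δ / 2) δ (by positivity) hδ1 a
    refine ⟨_, fun i => ?_, hce, ?_⟩
    · exact mul_mem (hmem _ (by simp) i) (hcC i)
    · rw [← mul_assoc]
      congr 1
      refine hFe _ _ _ _ _ _ (hr _ _) (hk _ _ (by positivity) hδ1) (hk _ _ (by positivity) hδ1) fun t => ?_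
      rw [← mul_div_assoc, q1 _ _ _ t le_rfl hδ2 (by positivity) _ hδ1]
  · obtain ⟨c, hcC, hce⟩ := hbr (δ / 4) (δ / 2) (by positivity) hδ2 a
    refine ⟨_, fun i => ?_, hce, ?_⟩
    · exact mul_mem (hmem _ (by simp) i) (hcC i)
    · rw [← mul_assoc]
      congr 1
      refine hFe _ _ _ _ _ _ hχ (hk _ _ (by positivity) hδ2) (hk _ _ (by positivity) hδ2) fun t => ?_
      rw [← mul_div_assoc, q2]
  · obtain ⟨c, hcC, hce⟩ := hbr (δ / 8) (δ / 4) (by positivity) hδ3 a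
    exact ⟨_, fun i => mul_mem (hmem _ (by simp) i) (hcC i), hce⟩
  · simp only [F]
    rw [hmul]
    have hs1 : δ • (1 : A) = cfc (fun _ : ℝ => δ) (h i) := by
      rw [cfc_const δ (h i), Algebra.algebraMap_eq_smul_one]
    rw [hs1, ← cfc_add (h i) _ _ (hct _ i) (hct _ i)]
    have e : h i = cfc (fun x : ℝ => x) (h i) := (cfc_id' ℝ (h i)).symm
    conv_lhs => rw [e]
    apply cfc_mono (hf := hct _ i) (hg := hct _ i)
    intro t ht
    have := (spec_Icc (h0 i) (h1 i) t ht).2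
    rcases le_or_gt δ t with h | h
    · rw [ramp_one hδ1 h]; linarith
    · have := ramp_nonneg (δ / 2) δ t
      nlinarith

/-- clamp -/
theorem exists_clamp (C : NonUnitalStarSubalgebra ℂ A) [FiniteDimensional ℂ C] {H c : A}
    (h0 : 0 ≤ H) (h1 : H ≤ 1) (hc : c ∈ C) :
    ∃ h ∈ C, 0 ≤ h ∧ h ≤ 1 ∧ ‖H - h‖ ≤ 2 * ‖H - c‖ := by
  set η := ‖H - c‖ with hη
  set b : A := (1 / 2 : ℝ) • (c + star c) with hb
  have hbC : b ∈ C := by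
    have hcs : c + star c ∈ C := add_mem hc (star_mem hc)
    have := C.toSubmodule.smul_mem ((1 / 2 : ℝ) : ℂ) hcs
    rw [hb]
    rwa [Complex.coe_smul] at this
  have hbs : IsSelfAdjoint b := by
    rw [hb]
    apply IsSelfAdjoint.smul (IsSelfAdjoint.all _)
    exact IsSelfAdjoint.add_star_self c
  have hHs := IsSelfAdjoint.of_nonneg h0
  have hHb : ‖H - b‖ ≤ η := by
    have e : H - b = (1 / 2 : ℝ) • ((H - c) + star (H - c)) := by
      rw [star_sub, hHs.star_eq, hb]; module
    rw [e, norm_smul]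
    have := norm_add_le (H - c) (star (H - c))
    rw [norm_star] at this
    rw [Real.norm_eq_abs, abs_of_pos (by norm_num)]
    linarith
  have hfin := finite_spectrum_of_mem C hbC
  have hct : ∀ f : ℝ → ℝ, ContinuousOn f (spectrum ℝ b) := fun f => hfin.continuousOn f
  let f : ℝ → ℝ := fun t => min 1 (max 0 t)
  have hsp : ∀ x ∈ spectrum ℝ b, -η ≤ x ∧ x ≤ 1 + η := by
    have k1 : algebraMap ℝ A (-η) ≤ b := by
      have := neg_smul_one_le (hbs.sub hHs) (r := η) (by rwa [norm_sub_rev])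
      rw [Algebra.algebraMap_eq_smul_one, neg_smul]
      have h3 := add_le_add this h0
      simpa using h3
    have k2 : b ≤ algebraMap ℝ A (1 + η) := by
      have := le_smul_one (hbs.sub hHs) (r := η) (by rwa [norm_sub_rev])
      rw [Algebra.algebraMap_eq_smul_one, add_smul, one_smul]
      have h3 := add_le_add this h1
      simpa [add_comm] using h3
    rw [algebraMap_le_iff_le_spectrum] at k1
    rw [le_algebraMap_iff_spectrum_le] at k2
    exact fun x hx => ⟨k1 x hx, k2 x hx⟩
  refine ⟨cfc f b, cfc_mem_fd C hbC hbs f (by simp [f]), cfc_nonneg fun x _ => ?_,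
    cfc_le_one _ _ fun x _ => min_le_left _ _, ?_⟩
  · simp only [f]; positivity
  · have : ‖b - cfc f b‖ ≤ η := by
      conv_lhs => rw [← cfc_id' ℝ b, cfc_id' ℝ b]
      have e : b - cfc f b = cfc (fun x : ℝ => x - f x) b := by
        rw [cfc_sub _ _ b (hct _) (hct _), cfc_id' ℝ b]
      rw [e]
      apply norm_cfc_le (norm_nonneg _)
      intro x hx
      have := hsp x hx
      have hη0 : 0 ≤ η := norm_nonneg _
      rw [Real.norm_eq_abs, abs_le]
      simp only [f]
      rcases le_total x 0 with h | h
      · rw [max_eq_left h, min_eq_right zero_le_one]; constructor <;> linarith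
      · rw [max_eq_right h]
        rcases le_total x 1 with h' | h'
        · rw [min_eq_right h']; constructor <;> linarith
        · rw [min_eq_left h']; constructor <;> linarith
    calc ‖H - cfc f b‖ = ‖(H - b) + (b - cfc f b)‖ := by congr 1; abel
      _ ≤ _ := norm_add_le _ _
      _ ≤ 2 * η := by linarith

theorem exists_col' (C : I → NonUnitalStarSubalgebra ℂ A) (hfd : ∀ i, FiniteDimensional ℂ (C i))
    (H : I → A) (h0 : ∀ i, 0 ≤ H i) (h1 : ∀ i, H i ≤ 1)
    (hc : ∀ a, Tendsto (fun i => H i * a - a * H i) l (𝓝 0))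
    (hb : ∀ a, ∃ c : I → A, (∀ i, c i ∈ C i) ∧ Tendsto (fun i => H i * a - c i) l (𝓝 0))
    {δ : ℝ} (hδ : 0 < δ) :
    ∃ e1 e2 e3 Q : bdFam I A, IsCol l C e1 e2 e3 Q ∧
      ∀ᶠ i in l, H i ≤ e1.1 i * e1.1 i + δ • 1 := by
  obtain ⟨c, hcC, hcH⟩ := hb 1
  choose h hhC hh0 hh1 hhH using fun i =>
    haveI := hfd i
    exists_clamp (C i) (h0 i) (h1 i) (hcC i)
  have hHh : Tendsto (fun i => H i - h i) l (𝓝 0) := by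
    rw [tendsto_zero_iff_norm_tendsto_zero]
    refine squeeze_zero (fun i => norm_nonneg _) hhH ?_
    simp only [mul_one] at hcH
    have := (tendsto_zero_iff_norm_tendsto_zero.mp hcH).const_mul 2
    simpa using this
  have hca : ∀ a, Tendsto (fun i => h i * a - a * h i) l (𝓝 0) := fun a => by
    have k1 := tendsto_zero_mul_bd l hHh (g := fun _ => a) ⟨‖a‖, fun _ => le_rfl⟩
    have k2 := tendsto_bd_mul_zero l hHh (g := fun _ => a) ⟨‖a‖, fun _ => le_rfl⟩
    have k3 := ((hc a).sub k1).add k2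
    simp only [sub_zero, add_zero] at k3
    refine k3.congr fun i => ?_
    noncomm_ring
  have hba : ∀ a, ∃ c : I → A, (∀ i, c i ∈ C i) ∧ Tendsto (fun i => h i * a - c i) l (𝓝 0) := by
    intro a
    obtain ⟨c, hcC, hca⟩ := hb a
    refine ⟨c, hcC, ?_⟩
    have k1 := tendsto_zero_mul_bd l hHh (g := fun _ => a) ⟨‖a‖, fun _ => le_rfl⟩
    have k3 := hca.sub k1
    simp only [sub_zero] at k3
    refine k3.congr fun i => ?_
    noncomm_ring
  obtain ⟨e1, e2, e3, Q, hcol, hle⟩ := exists_col (l := l) C hfd h hhC hh0 hh1 hca hba (half_pos hδ)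
  refine ⟨e1, e2, e3, Q, hcol, ?_⟩
  have := (tendsto_zero_iff_norm_tendsto_zero.mp hHh).eventually (gt_mem_nhds (half_pos hδ))
  filter_upwards [this] with i hi
  have k := le_smul_one ((IsSelfAdjoint.of_nonneg (h0 i)).sub (IsSelfAdjoint.of_nonneg (hh0 i)))
    hi.le
  have k2 := add_le_add k (hle i)
  rw [sub_add_cancel] at k2
  refine k2.trans (le_of_eq ?_)
  module

end Cols

theorem exists_two_cols {A : Type u} [CStarAlgebra A] [PartialOrder A] [StarOrderedRing A]
    (hW : WeakCRLeOne A) {δ : ℝ} (hδ : 0 < δ) :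
    ∃ (I : Type u) (l : Filter I) (_ : l.NeBot) (C D : I → NonUnitalStarSubalgebra ℂ A)
      (e1 e2 e3 Q e1' e2' e3' Q' : bdFam I A), IsCol l C e1 e2 e3 Q ∧ IsCol l D e1' e2' e3' Q' ∧
      ∀ᶠ i in l, 1 ≤ e1.1 i * e1.1 i + e1'.1 i * e1'.1 i + δ • 1 := by
  classical
  let I := Finset A × ℕ
  let l : Filter I := atTop
  choose C D hC hD h hpos hnorm hcomm hc hd using fun i : I =>
    hW i.1 (1 / ((i.2 : ℝ) + 1)) (by positivity)
  have h0 : ∀ i, 0 ≤ h i := fun i => by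
    obtain ⟨x, hx⟩ := hpos i; rw [hx]; exact star_mul_self_nonneg x
  have h1 : ∀ i, h i ≤ 1 := fun i => le_one_of (h0 i) (hnorm i)
  have hlim : Tendsto (fun i : I => 1 / ((i.2 : ℝ) + 1)) l (𝓝 0) := by
    have : Tendsto (fun i : I => i.2) l atTop := by
      have : l = (atTop : Filter (Finset A)) ×ˢ (atTop : Filter ℕ) := prod_atTop_atTop_eq.symm
      rw [this]
      exact tendsto_snd
    exact tendsto_one_div_add_atTop_nhds_zero_nat.comp this
  have hmem : ∀ a : A, ∀ᶠ i in l, a ∈ i.1 := fun a => by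
    filter_upwards [eventually_ge_atTop (({a}, 0) : I)] with i hi
    exact hi.1 (Finset.mem_singleton_self a)
  have key : ∀ f : I → A, (∀ᶠ i in l, ‖f i‖ < 1 / ((i.2 : ℝ) + 1)) → Tendsto f l (𝓝 0) := by
    intro f hf
    rw [tendsto_zero_iff_norm_tendsto_zero]
    exact squeeze_zero' (Eventually.of_forall fun i => norm_nonneg _) (hf.mono fun i hi => hi.le) hlim
  have hca : ∀ a, Tendsto (fun i => h i * a - a * h i) l (𝓝 0) := fun a =>
    key _ ((hmem a).mono fun i hi => hcomm i a hi)
  have hap : ∀ (E : I → NonUnitalStarSubalgebra ℂ A) (k : I → A), (∀ i, ∀ x ∈ i.1, MemEps (1 / ((i.2 : ℝ) + 1)) (E i : Set A) (k i * x)) →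
      ∀ a, ∃ c : I → A, (∀ i, c i ∈ E i) ∧ Tendsto (fun i => k i * a - c i) l (𝓝 0) := by
    intro E k hk a
    have : ∀ i, ∃ c ∈ E i, a ∈ i.1 → ‖k i * a - c‖ < 1 / ((i.2 : ℝ) + 1) := fun i => by
      by_cases h : a ∈ i.1
      · obtain ⟨c, hc, hc'⟩ := hk i a h
        exact ⟨c, hc, fun _ => hc'⟩
      · exact ⟨0, zero_mem _, fun h' => absurd h' h⟩
    choose c hc hc' using this
    exact ⟨c, hc, key _ ((hmem a).mono fun i hi => hc' i hi)⟩
  obtain ⟨e1, e2, e3, Q, H1, H2⟩ := exists_col' (l := l) C hC h h0 h1 hca (hap C h hc) (half_pos hδ)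
  obtain ⟨e1', e2', e3', Q', H1', H2'⟩ := exists_col' (l := l) D hD (fun i => 1 - h i)
    (fun i => sub_nonneg.mpr (h1 i)) (fun i => sub_le_self _ (h0 i)) (fun a => by
      have := (hca a).neg
      rw [neg_zero] at this
      refine this.congr fun i => ?_
      noncomm_ring) (hap D _ hd) (half_pos hδ)
  refine ⟨I, l, inferInstance, C, D, e1, e2, e3, Q, e1', e2', e3', Q', H1, H1', ?_⟩
  filter_upwards [H2, H2'] with i k k'
  have := add_le_add k k'
  rw [add_sub_cancel] at this
  refine this.trans (le_of_eq ?_)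
  module


section Full

variable {A : Type u} [CStarAlgebra A] [PartialOrder A] [StarOrderedRing A]

theorem IsTr.nonneg {τ : A →ₗ[ℝ] ℝ} (hτ : IsTr τ) {x : A} (hx : 0 ≤ x) : 0 ≤ τ x := by
  obtain ⟨b, rfl⟩ := CStarAlgebra.nonneg_iff_eq_star_mul_self.mp hx
  exact hτ.pos b

theorem IsTr.mono {τ : A →ₗ[ℝ] ℝ} (hτ : IsTr τ) {x y : A} (hxy : x ≤ y) : τ x ≤ τ y := by
  have := hτ.nonneg (sub_nonneg.mpr hxy)
  rw [map_sub] at this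
  linarith

/-- polarised inequality -/
theorem cross_le (a b : A) {y : A} (hy : 0 ≤ y) :
    a * y * b + star (a * y * b) ≤ a * y * star a + star b * y * b := by
  have h : 0 ≤ star (star a - b) * y * (star a - b) := by
    have := conj_le hy (star a - b)
    simpa using this
  have hs := (IsSelfAdjoint.of_nonneg hy).star_eq
  rw [← sub_nonneg]
  convert h using 1
  simp only [star_sub, star_mul, star_star, hs]
  noncomm_ring

theorem full_aux (hA : IsSimpleCStarAlgebra A) {y : A} (hy : 0 ≤ y) (hy0 : y ≠ 0) :
    ∃ (n : ℕ) (r : Fin n → A), 1 ≤ ∑ j, star (r j) * y * r j := by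
  let S : AddSubgroup A := AddSubgroup.closure {x | ∃ a b, x = a * y * b}
  have hl : ∀ c, ∀ x ∈ S, c * x ∈ S := by
    intro c x hx
    induction hx using AddSubgroup.closure_induction with
    | mem x hx =>
      obtain ⟨a, b, rfl⟩ := hx
      exact AddSubgroup.subset_closure ⟨c * a, b, by noncomm_ring⟩
    | zero => rw [mul_zero]; exact zero_mem _
    | add x z _ _ h1 h2 => rw [mul_add]; exact add_mem h1 h2
    | neg x _ h => rw [mul_neg]; exact neg_mem h
  have hr : ∀ c, ∀ x ∈ S, x * c ∈ S := by
    intro c x hx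
    induction hx using AddSubgroup.closure_induction with
    | mem x hx =>
      obtain ⟨a, b, rfl⟩ := hx
      exact AddSubgroup.subset_closure ⟨a, b * c, by noncomm_ring⟩
    | zero => rw [zero_mul]; exact zero_mem _
    | add x z _ _ h1 h2 => rw [add_mul]; exact add_mem h1 h2
    | neg x _ h => rw [neg_mul]; exact neg_mem h
  let J : TwoSidedIdeal A := TwoSidedIdeal.mk' (S.topologicalClosure : Set A)
    (zero_mem _) (fun h1 h2 => add_mem h1 h2) (fun h => neg_mem h)
    (fun {x z} h => map_mem_closure (continuous_const_mul x) h (fun z hz => hl x z hz))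
    (fun {x z} h => map_mem_closure (f := fun x => x * z) (continuous_mul_const z) h (fun x hx => hr z x hx))
  have hJ : ∀ x, x ∈ J ↔ x ∈ (S.topologicalClosure : Set A) := fun x => TwoSidedIdeal.mem_mk' _ _ _ _ _ _ _
  have hJc : (J : Set A) = (S.topologicalClosure : Set A) := TwoSidedIdeal.coe_mk' _ _ _ _ _ _
  have hyJ : y ∈ J := by
    rw [hJ]
    exact subset_closure (AddSubgroup.subset_closure ⟨1, 1, by simp⟩)
  have h1 : (1 : A) ∈ J := by
    rcases hA J (by rw [hJc]; exact isClosed_closure) with h | h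
    · rw [h] at hyJ
      exact absurd ((TwoSidedIdeal.mem_bot A).mp hyJ) hy0
    · rw [h]; trivial
  rw [hJ] at h1
  obtain ⟨s, hs, hd⟩ := Metric.mem_closure_iff.mp h1 (1 / 2) (by norm_num)
  have key : ∀ s ∈ S, ∃ (n : ℕ) (r : Fin n → A), s + star s ≤ ∑ j, star (r j) * y * r j ∧
      -(s + star s) ≤ ∑ j, star (r j) * y * r j := by
    intro s hs
    induction hs using AddSubgroup.closure_induction with
    | mem x hx =>
      obtain ⟨a, b, rfl⟩ := hx
      refine ⟨2, ![star a, b], ?_, ?_⟩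
      · simpa using cross_le a b hy
      · have := cross_le (-a) b hy
        simpa [add_comm] using this
    | zero => exact ⟨0, ![], by simp, by simp⟩
    | add x z _ _ h1 h2 =>
      obtain ⟨n, r, h1, h1'⟩ := h1
      obtain ⟨m, r', h2, h2'⟩ := h2
      refine ⟨n + m, Fin.append r r', ?_, ?_⟩
      · rw [Fin.sum_univ_add]
        simp only [Fin.append_left, Fin.append_right]
        refine le_trans (le_of_eq ?_) (add_le_add h1 h2)
        rw [star_add]; abel
      · rw [Fin.sum_univ_add]
        simp only [Fin.append_left, Fin.append_right]
        refine le_trans (le_of_eq ?_) (add_le_add h1' h2')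
        rw [star_add]; abel
    | neg x _ h =>
      obtain ⟨n, r, h1, h1'⟩ := h
      refine ⟨n, r, ?_, ?_⟩
      · convert h1' using 1; rw [star_neg]; abel
      · convert h1 using 1; rw [star_neg]; abel
  obtain ⟨n, r, h, -⟩ := key s hs
  refine ⟨n, r, le_trans ?_ h⟩
  have k := le_smul_one (IsSelfAdjoint.add_star_self (1 - s)) (r := 1) (by
    refine (norm_add_le _ _).trans ?_
    rw [norm_star]
    rw [dist_eq_norm] at hd
    linarith)
  rw [star_sub, star_one, one_smul] at k
  have e : (1 : A) - (1 - s + (1 - star s)) = s + star s - 1 := by abel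
  have k2 := sub_nonneg.mpr k
  rw [e] at k2
  exact sub_nonneg.mp k2

/-- Cuntz–Pedersen type decomposition -/
def CPpos (x : A) : Prop := ∃ γ : ℝ, 0 < γ ∧ ∃ (n : ℕ) (a : Fin n → A),
  γ • (1 : A) + ∑ k, (star (a k) * a k - a k * star (a k)) ≤ x

theorem CPpos.smul {x : A} (hx : CPpos x) {t : ℝ} (ht : 0 < t) : CPpos (t • x) := by
  obtain ⟨γ, hγ, n, a, h⟩ := hx
  refine ⟨t * γ, by positivity, n, fun k => Real.sqrt t • a k, ?_⟩
  have := smul_le_smul_of_nonneg_left h ht.le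
  refine le_trans (le_of_eq ?_) this
  rw [smul_add, Finset.smul_sum, smul_smul]
  congr 1
  refine Finset.sum_congr rfl fun k _ => ?_
  rw [star_smul, smul_mul_smul_comm, smul_mul_smul_comm, smul_sub]
  simp [Real.mul_self_sqrt ht.le]

theorem CPpos.add {x z : A} (hx : CPpos x) (hz : CPpos z) : CPpos (x + z) := by
  obtain ⟨γ, hγ, n, a, h⟩ := hx
  obtain ⟨γ', hγ', m, a', h'⟩ := hz
  refine ⟨γ + γ', by positivity, n + m, Fin.append a a', ?_⟩
  rw [Fin.sum_univ_add]
  simp only [Fin.append_left, Fin.append_right]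
  refine le_trans (le_of_eq ?_) (add_le_add h h')
  rw [add_smul]; abel

theorem CPpos.of_le {x : A} {γ : ℝ} (hγ : 0 < γ) (h : γ • (1 : A) ≤ x) : CPpos x :=
  ⟨γ, hγ, 0, ![], by simpa using h⟩

theorem cuntz_pedersen [Nontrivial A] {x : A} (hx : IsSelfAdjoint x)
    (h : ∀ τ : A →ₗ[ℝ] ℝ, IsTr τ → 0 < τ x) : CPpos x := by
  by_contra hn
  let K : Set A := {z | CPpos (z + star z)}
  have hKs : ∀ z ∈ K, ∀ t : ℝ, 0 < t → t • z ∈ K := by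
    intro z hz t ht
    change CPpos _
    rw [star_smul, star_trivial, ← smul_add]
    exact CPpos.smul hz ht
  have hKa : ∀ z ∈ K, ∀ w ∈ K, z + w ∈ K := by
    intro z hz w hw
    change CPpos _
    have := CPpos.add hz hw
    convert this using 1
    rw [star_add]; abel
  have hconv : Convex ℝ K := by
    rw [convex_iff_forall_pos]
    intro z hz w hw a b ha hb _
    exact hKa _ (hKs _ hz a ha) _ (hKs _ hw b hb)
  have hopen : IsOpen K := by
    rw [Metric.isOpen_iff]
    rintro z ⟨γ, hγ, n, a, hz⟩
    refine ⟨γ / 4, by positivity, fun w hw => ⟨γ / 2, by positivity, n, a, ?_⟩⟩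
    have hw' : ‖w - z‖ < γ / 4 := by rw [← dist_eq_norm]; exact hw
    have k := neg_smul_one_le (IsSelfAdjoint.add_star_self (w - z)) (r := γ / 2) (by
      refine (norm_add_le _ _).trans ?_
      rw [norm_star]
      linarith)
    have := add_le_add hz k
    refine le_trans (le_of_eq ?_) (le_trans this (le_of_eq ?_))
    · module
    · rw [star_sub]; abel
  have hxK : x ∉ K := by
    intro hx'
    apply hn
    have : CPpos (x + star x) := hx'
    rw [hx.star_eq] at this
    have := this.smul (t := 1 / 2) (by norm_num)
    convert this using 1
    module
  obtain ⟨f, hf⟩ := geometric_hahn_banach_open_point hconv hopen hxK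
  have hfK : ∀ z ∈ K, f z ≤ 0 := by
    intro z hz
    by_contra hpos
    push Not at hpos
    have hk := hf _ (hKs z hz ((|f x| + 1) / f z) (by positivity))
    rw [map_smul, smul_eq_mul, div_mul_cancel₀ _ hpos.ne'] at hk
    linarith [le_abs_self (f x)]
  have h1K : (1 : A) ∈ K := CPpos.of_le (γ := 2) (by norm_num) (le_of_eq (by rw [star_one]; module))
  -- f(z) + t f(1) ≤ 0 for all t>0 implies f z ≤ 0
  have lim : ∀ z : A, (∀ t : ℝ, 0 < t → z + t • (1 : A) ∈ K) → f z ≤ 0 := by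
    intro z hz
    by_contra hpos
    push Not at hpos
    have h1 := hfK 1 h1K
    have hk := hfK _ (hz (f z / (2 * (|f 1| + 1))) (by positivity))
    rw [map_add, map_smul, smul_eq_mul] at hk
    have : f z / (2 * (|f 1| + 1)) * f 1 ≥ - (f z / 2) := by
      rw [ge_iff_le, div_mul_eq_mul_div, le_div_iff₀ (by positivity)]
      have := neg_abs_le (f 1)
      nlinarith
    linarith
  have hposf : ∀ z, 0 ≤ z → f z ≤ 0 := fun z hz => lim z fun t ht =>
    CPpos.of_le (γ := 2 * t) (by positivity) (by
      rw [star_add, (IsSelfAdjoint.of_nonneg hz).star_eq, star_smul, star_one, star_trivial]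
      have := add_nonneg hz hz
      rw [← sub_nonneg]
      convert this using 1
      module)
  have htr0 : ∀ z : A, f (star z * z - z * star z) ≤ 0 := fun z => lim _ fun t ht => by
    refine ⟨2 * t, by positivity, 2, ![z, z], le_of_eq ?_⟩
    simp only [Fin.sum_univ_two, Matrix.cons_val_zero, Matrix.cons_val_one, star_add, star_sub,
      star_mul, star_star, star_smul, star_one, star_trivial]
    module
  have htr : ∀ z : A, f (star z * z) = f (z * star z) := by
    intro z
    have h1 := htr0 z
    have h2 := htr0 (star z)
    rw [star_star] at h2
    rw [map_sub] at h1 h2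
    linarith
  have hskew : ∀ z : A, f (z - star z) = 0 := by
    have : ∀ z : A, f (z - star z) ≤ 0 := fun z => lim _ fun t ht =>
      CPpos.of_le (γ := 2 * t) (by positivity) (le_of_eq (by
        simp only [star_add, star_sub, star_star, star_smul, star_one, star_trivial]; module))
    intro z
    have h1 := this z
    have h2 := this (star z)
    rw [star_star] at h2
    rw [map_sub] at h1 h2 ⊢
    linarith
  have hf1 : f 1 < 0 := by
    refine lt_of_le_of_ne (hfK 1 h1K) fun h0 => ?_
    have hsa : ∀ z : A, IsSelfAdjoint z → f z = 0 := by
      have : ∀ z : A, IsSelfAdjoint z → f z ≥ 0 := by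
        intro z hz
        have := hposf _ (sub_nonneg.mpr (le_smul_one hz le_rfl))
        rw [map_sub, map_smul, h0, smul_zero] at this
        linarith
      intro z hz
      have h1 := this z hz
      have h2 := this (-z) hz.neg
      rw [map_neg] at h2
      linarith
    have := hf 1 h1K
    rw [hsa x hx, h0] at this
    exact lt_irrefl _ this
  let τ : A →ₗ[ℝ] ℝ := (f 1)⁻¹ • (f : A →ₗ[ℝ] ℝ)
  have hτ : ∀ z, τ z = (f 1)⁻¹ * f z := fun z => rfl
  have hT : IsTr τ := by
    refine ⟨fun z => ?_, fun z => ?_, ?_⟩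
    · rw [hτ]
      exact mul_nonneg_of_nonpos_of_nonpos (inv_nonpos.mpr hf1.le) (hposf _ (star_mul_self_nonneg z))
    · rw [hτ, hτ, htr]
    · rw [hτ, inv_mul_cancel₀ hf1.ne]
  have hx1 := h τ hT
  have h2 : 0 ≤ f x := by
    by_contra hneg
    push Not at hneg
    have := hf ((f x / (2 * f 1)) • 1) (hKs _ h1K _ (div_pos_of_neg_of_neg hneg (by linarith)))
    rw [map_smul, smul_eq_mul] at this
    have e : f x / (2 * f 1) * f 1 = f x / 2 := by
      have := hf1.ne
      field_simp
    rw [e] at this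
    linarith
  rw [hτ] at hx1
  have := mul_nonpos_of_nonpos_of_nonneg (inv_nonpos.mpr hf1.le) h2
  linarith

end Full


namespace FDData
section Tr
variable {A : Type u} [CStarAlgebra A] [PartialOrder A] [StarOrderedRing A]
  {C : NonUnitalStarSubalgebra ℂ A} (D : FDData C)

theorem T_mono (l : D.κ) {x y : A} (h : x ≤ y) : D.T l x ≤ D.T l y := by
  have := D.pos l _ (sub_nonneg.mpr h)
  rw [map_sub] at this
  linarith

/-- `T (x* P x) = T (P x x* P)` -/
theorem T_swap (l : D.κ) {x P : A} (hx : x ∈ C) (hP : P ∈ C) (hPP : IsStarProjection P) :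
    D.T l (star x * P * x) = D.T l (P * (x * star x) * P) := by
  have h1 : star x * P * x = (star x * P) * (P * x) := by
    rw [mul_assoc (star x) P (P * x), ← mul_assoc P P x, hPP.isIdempotentElem, ← mul_assoc]
  rw [h1, D.tr l _ (mul_mem (star_mem hx) hP) _ (mul_mem hP hx)]
  congr 1
  noncomm_ring

theorem T_full (l : D.κ) {m : ℕ} {d : Fin m → A} {Q y0 P : A} {η δ' M : ℝ} (hM : 0 ≤ M)
    (hd : ∀ j, d j ∈ C) (hdM : ∀ j, ‖d j‖ ≤ M) (hQ : Q ∈ C) (hQp : IsStarProjection Q)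
    (hP : P ∈ C) (hPp : IsStarProjection P) (hy : y0 ≤ (1 + η) • P + δ' • 1)
    (hη : 0 ≤ η) (hη1 : η ≤ 1 / 4) (hδ : 0 ≤ δ') (hδ' : δ' * (m * M ^ 2) ≤ 1 / 4)
    (hfull : Q - η • Q ≤ ∑ j, star (d j * Q) * y0 * (d j * Q)) :
    D.T l Q ≤ (4 * (m * M ^ 2)) * D.T l P := by
  have hQ0 := D.pos l Q hQp.nn
  have hP0 := D.pos l P hPp.nn
  have h1 := D.T_mono l hfull
  rw [map_sub, map_smul, map_sum, smul_eq_mul] at h1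
  have h2 : ∀ j, D.T l (star (d j * Q) * y0 * (d j * Q)) ≤
      (1 + η) * (M ^ 2 * D.T l P) + δ' * (M ^ 2 * D.T l Q) := by
    intro j
    have hdQ : d j * Q ∈ C := mul_mem (hd j) hQ
    have k := D.T_mono l (conj_le hy (d j * Q))
    have e : star (d j * Q) * ((1 + η) • P + δ' • 1) * (d j * Q) =
        (1 + η) • (star (d j * Q) * P * (d j * Q)) + δ' • (star (d j * Q) * (d j * Q)) := by
      simp only [mul_add, add_mul, mul_smul_comm, smul_mul_assoc, mul_one]
    rw [e, map_add, map_smul, map_smul, smul_eq_mul, smul_eq_mul, D.T_swap l hdQ hP hPp] at k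
    have hn : ‖d j * Q‖ ≤ M := (norm_mul_le _ _).trans (by
      have := hQp.nrm; nlinarith [hdM j, norm_nonneg (d j), norm_nonneg Q])
    have k2 : D.T l (P * (d j * Q * star (d j * Q)) * P) ≤ M ^ 2 * D.T l P := by
      have := D.T_mono l (conj_le (mul_star_le_one hn) P)
      rw [hPp.isSelfAdjoint.star_eq] at this
      refine this.trans (le_of_eq ?_)
      rw [mul_smul_comm, mul_one, smul_mul_assoc, hPp.isIdempotentElem, map_smul, smul_eq_mul]
    have k3 : D.T l (star (d j * Q) * (d j * Q)) ≤ M ^ 2 * D.T l Q := by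
      have := D.T_mono l (conj_le (star_mul_le_one (hdM j)) Q)
      rw [hQp.isSelfAdjoint.star_eq] at this
      refine le_trans (le_of_eq ?_) (this.trans (le_of_eq ?_))
      · rw [star_mul, hQp.isSelfAdjoint.star_eq]; congr 1; noncomm_ring
      · rw [mul_smul_comm, mul_one, smul_mul_assoc, hQp.isIdempotentElem, map_smul, smul_eq_mul]
    nlinarith
  have h3 := h1.trans (Finset.sum_le_sum fun j _ => h2 j)
  rw [Finset.sum_const, Finset.card_univ, Fintype.card_fin, nsmul_eq_mul] at h3
  have e : (m : ℝ) * ((1 + η) * (M ^ 2 * D.T l P) + δ' * (M ^ 2 * D.T l Q)) =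
    (1 + η) * ((m * M ^ 2) * D.T l P) + (δ' * (m * M ^ 2)) * D.T l Q := by ring
  rw [e] at h3
  have hz : 0 ≤ (m * M ^ 2) * D.T l P := by positivity
  have k1 : (1 + η) * ((m * M ^ 2) * D.T l P) ≤ (5 / 4) * ((m * M ^ 2) * D.T l P) :=
    mul_le_mul_of_nonneg_right (by linarith) hz
  have k2 : (δ' * (m * M ^ 2)) * D.T l Q ≤ (1 / 4) * D.T l Q := mul_le_mul_of_nonneg_right hδ' hQ0
  have k3 : η * D.T l Q ≤ (1 / 4) * D.T l Q := mul_le_mul_of_nonneg_right hη1 hQ0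
  linarith

theorem T_comp (l : D.κ) {N : ℕ} {b : Fin N → A} {e n Q y0 t Py Pq : A} {γ η δ' K : ℝ}
    (hb : ∀ k, b k ∈ C) (he : e ∈ C) (he0 : 0 ≤ e) (he1 : e ≤ 1) (hn : n = e * e) (hQp : IsStarProjection Q)
    (ht : t ∈ C) (hPy : Py ∈ C) (hPyp : IsStarProjection Py) (hPq : Pq ∈ C)
    (hPqp : IsStarProjection Pq) (hy : y0 ≤ (1 + η) • Py + δ' • 1)
    (hη : 0 < η) (hδ' : 0 < δ') (hδγ : δ' ≤ γ / 2) (hK : 0 ≤ K) (hηK : η * (2 + K) ≤ γ / 2)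
    (heP : e * Pq = Pq) (hPe : Pq * e = Pq) (htP : (1 - η) • Pq ≤ Pq * (t * star t) * Pq)
    (hQK : D.T l Q ≤ K * D.T l Py)
    (hY : -(η • Q) ≤ n * y0 * n - t * star t - γ • (n * n) -
      ∑ k, (star (b k) * b k - b k * star (b k))) :
    D.T l Pq ≤ D.T l Py := by
  have hes := (IsSelfAdjoint.of_nonneg he0).star_eq
  have hns : star n = n := by rw [hn, star_mul, hes]
  have hnC : n ∈ C := hn ▸ mul_mem he he
  have hnn : ‖n‖ ≤ 1 := by
    rw [hn]
    refine (norm_mul_le _ _).trans ?_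
    have := norm_le_one_of he0 he1
    nlinarith [norm_nonneg e]
  have hn2 : n * n ≤ 1 := by
    have := mul_star_le_one hnn
    rw [hns] at this
    simpa using this
  have h1 := D.T_mono l hY
  rw [map_neg, map_smul, map_sub, map_sub, map_sub, map_smul, map_sum, smul_eq_mul, smul_eq_mul] at h1
  have hz : ∑ k, D.T l (star (b k) * b k - b k * star (b k)) = 0 :=
    Finset.sum_eq_zero fun k _ => by
      rw [map_sub, D.tr l _ (star_mem (hb k)) _ (hb k), sub_self]
  rw [hz] at h1
  have h2 : D.T l (n * y0 * n) ≤ (1 + η) * D.T l Py + δ' * D.T l (n * n) := by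
    have k := D.T_mono l (conj_le hy n)
    rw [hns] at k
    have e : n * ((1 + η) • Py + δ' • 1) * n =
        (1 + η) • (n * Py * n) + δ' • (n * n) := by
      simp only [mul_add, add_mul, mul_smul_comm, smul_mul_assoc, mul_one]
    rw [e, map_add, map_smul, map_smul, smul_eq_mul, smul_eq_mul] at k
    have k2 := D.T_swap l hnC hPy hPyp
    rw [hns] at k2
    rw [k2] at k
    have k3 := D.T_mono l (conj_le hn2 Py)
    rw [hPyp.isSelfAdjoint.star_eq, mul_one, hPyp.isIdempotentElem] at k3
    nlinarith
  have h3 : (1 - η) * D.T l Pq ≤ D.T l (t * star t) := by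
    have k := D.T_mono l htP
    rw [map_smul, smul_eq_mul, ← D.T_swap l ht hPq hPqp] at k
    have k3 := D.T_mono l (conj_le hPqp.le1 t)
    rw [mul_one, D.tr l _ (star_mem ht) _ ht] at k3
    linarith
  have h4 : D.T l Pq ≤ D.T l (n * n) := by
    have k3 := D.T_mono l (conj_le hPqp.le1 n)
    rw [hns, mul_one] at k3
    have e : n * Pq * n = Pq := by
      rw [hn, mul_assoc e e, heP, heP, ← mul_assoc, hPe, hPe]
    rwa [e] at k3
  have hP0 := D.pos l _ hPqp.nn
  have hy0 := D.pos l _ hPyp.nn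
  have h5 : (γ / 2) * D.T l Pq ≤ (γ - δ') * D.T l (n * n) := by
    have : (γ / 2) * D.T l (n * n) ≤ (γ - δ') * D.T l (n * n) :=
      mul_le_mul_of_nonneg_right (by linarith) (hP0.trans h4)
    have : (γ / 2) * D.T l Pq ≤ (γ / 2) * D.T l (n * n) :=
      mul_le_mul_of_nonneg_left h4 (by linarith)
    linarith
  have h6 : η * D.T l Q ≤ η * (K * D.T l Py) := mul_le_mul_of_nonneg_left hQK hη.le
  have h7 : (1 - η + γ / 2) * D.T l Pq ≤ (1 + η + η * K) * D.T l Py := by nlinarith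
  have h8 : (1 + η + η * K) * D.T l Py ≤ (1 - η + γ / 2) * D.T l Py :=
    mul_le_mul_of_nonneg_right (by linarith) hy0
  have h9 : 0 < 1 - η + γ / 2 := by nlinarith
  exact le_of_mul_le_mul_left (h7.trans h8) h9

end Tr
end FDData


section ColComp
variable {A : Type u} [CStarAlgebra A] [PartialOrder A] [StarOrderedRing A]
variable {I : Type*} {l : Filter I} {C : I → NonUnitalStarSubalgebra ℂ A} {e1 e2 e3 Q : bdFam I A}

theorem bd_star_eq {e : bdFam I A} (h : ∀ i, 0 ≤ e.1 i) : star e = e := by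
  apply Subtype.ext
  funext i
  exact (IsSelfAdjoint.of_nonneg (h i)).star_eq

theorem cl_star_br {s e : bdFam I A} {a : A} (hs : cl l s = cl l (e * cst I a)) (he : star e = e)
    (hc : ∀ a, cl l (cst I a * e) = cl l (e * cst I a)) : cl l (star s) = cl l (e * cst I (star a)) := by
  rw [cl_star hs, star_mul, ← cst_star, he, hc]

/-- commutation rules in the quotient ring -/
theorem cl_comm {e : bdFam I A} (hc : ∀ a, cl l (cst I a * e) = cl l (e * cst I a)) (a : A) :
    cl l (cst I a) * cl l e = cl l e * cl l (cst I a) := by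
  have := hc a
  rwa [map_mul, map_mul] at this

theorem cl_comm' {e : bdFam I A} (hc : ∀ a, cl l (cst I a * e) = cl l (e * cst I a)) (a : A)
    (z : (famCon (I := I) l A).Quotient) :
    cl l (cst I a) * (cl l e * z) = cl l e * (cl l (cst I a) * z) := by
  rw [← mul_assoc, cl_comm hc, mul_assoc]

theorem IsCol.n3 (h : IsCol l C e1 e2 e3 Q) (i : I) : ‖e3.1 i‖ ≤ 1 := norm_le_one_of (h.p3 i).1 (h.p3 i).2
theorem IsCol.n2 (h : IsCol l C e1 e2 e3 Q) (i : I) : ‖e2.1 i‖ ≤ 1 := norm_le_one_of (h.p2 i).1 (h.p2 i).2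
theorem IsCol.n1 (h : IsCol l C e1 e2 e3 Q) (i : I) : ‖e1.1 i‖ ≤ 1 := norm_le_one_of (h.p1 i).1 (h.p1 i).2

theorem norm_sandwich {e x : A} (he : ‖e‖ ≤ 1) (hx : ‖x‖ ≤ 1) : ‖e * x * e‖ ≤ 1 := by
  refine (norm_mul_le _ _).trans ?_
  have h := norm_mul_le e x
  have h2 : ‖e‖ * ‖x‖ ≤ 1 := by nlinarith [norm_nonneg e, norm_nonneg x]
  have h3 : ‖e * x‖ ≤ 1 := h.trans h2
  nlinarith [norm_nonneg e, norm_nonneg (e * x)]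

theorem le_of_norm_sub {a b : A} {η : ℝ} (ha : IsSelfAdjoint a) (hb : IsSelfAdjoint b)
    (h : ‖a - b‖ ≤ η) : a ≤ b + η • 1 := by
  have := le_smul_one (ha.sub hb) h
  exact sub_le_iff_le_add'.mp this

theorem col_full (hcol : IsCol l C e1 e2 e3 Q) {x : A} (hx0 : 0 ≤ x) (hx1 : x ≤ 1)
    (hfull : ∃ (m : ℕ) (r : Fin m → A), 1 ≤ ∑ j, star (r j) * x * r j) :
    ∃ y0 : bdFam I A, (∀ i, y0.1 i ∈ C i) ∧ (∀ i, 0 ≤ y0.1 i) ∧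
      cl l y0 = cl l (e3 * cst I x * e3) ∧ (∀ η > 0, ∀ᶠ i in l, ‖y0.1 i‖ ≤ 1 + η) ∧
      ∃ K : ℝ, 0 ≤ K ∧ ∃ δ0 : ℝ, 0 < δ0 ∧ ∀ᶠ i in l, ∀ (D : FDData (C i)), ∀ P ∈ C i,
        IsStarProjection P → ∀ δ' : ℝ, 0 ≤ δ' → δ' ≤ δ0 →
        y0.1 i ≤ (1 + 1 / 4 : ℝ) • P + δ' • 1 → ∀ k, D.T k (Q.1 i) ≤ K * D.T k P := by
  obtain ⟨m, r, hr⟩ := hfull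
  obtain ⟨g, hg⟩ := CStarAlgebra.nonneg_iff_eq_star_mul_self.mp hx0
  obtain ⟨s0, hs0C, hs0⟩ := hcol.b3 (star g)
  choose d hdC hd using fun j => hcol.b3 (r j)
  have he3 : star e3 = e3 := bd_star_eq fun i => (hcol.p3 i).1
  have hs0' := cl_star_br hs0 he3 hcol.c3
  have hd' := fun j => cl_star_br (hd j) he3 hcol.c3
  have hcc := cl_comm hcol.c3
  have hcc' := cl_comm' hcol.c3
  have hy : cl l (s0 * star s0) = cl l (e3 * cst I x * e3) := by
    rw [hg]
    rw [map_mul, hs0, hs0', star_star]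
    simp only [map_mul, mul_assoc, hcc, hcc']
  choose Mj hMj using fun j => (d j).2
  set M : ℝ := ∑ j, |Mj j| with hM
  have hM0 : 0 ≤ M := Finset.sum_nonneg fun j _ => abs_nonneg _
  have hdM : ∀ j i, ‖(d j).1 i‖ ≤ M := fun j i => (hMj j i).trans ((le_abs_self _).trans
    (Finset.single_le_sum (f := fun j => |Mj j|) (fun j _ => abs_nonneg _) (Finset.mem_univ j)))
  refine ⟨s0 * star s0, fun i => mul_mem (hs0C i) (star_mem (hs0C i)), fun i => mul_star_self_nonneg _,
    hy, fun η hη => ?_, 4 * (m * M ^ 2), by positivity, 1 / (4 * (m * M ^ 2 + 1)), by positivity, ?_⟩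
  · filter_upwards [cl_ev hy hη] with i hi
    have h1 := norm_sandwich (hcol.n3 i) (norm_le_one_of hx0 hx1)
    have h2 := norm_le_norm_add_norm_sub' ((s0 * star s0).1 i) ((e3 * cst I x * e3).1 i)
    have : (e3 * cst I x * e3).1 i = e3.1 i * x * e3.1 i := rfl
    rw [this] at h2 hi
    linarith
  · have hF : cl l (∑ j, star (d j) * (s0 * star s0) * d j) =
        cl l (e3 * e3 * cst I (∑ j, star (r j) * x * r j) * (e3 * e3)) := by
      have : ∀ j, cl l (star (d j) * (s0 * star s0) * d j) =
        cl l (e3 * e3 * cst I (star (r j) * x * r j) * (e3 * e3)) := by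
        intro j
        rw [map_mul, map_mul, hy, hd', hd]
        simp only [map_mul, mul_assoc, hcc, hcc']
      rw [map_sum, Finset.sum_congr rfl fun j _ => this j, ← map_sum, map_sum (cst I), Finset.mul_sum,
        Finset.sum_mul]
    filter_upwards [cl_ev hF (show (0:ℝ) < 1 / 4 by norm_num)] with i hi D P hP hPp δ' hδ' hδ0 hle k
    have hQp := hcol.pQ i
    refine D.T_full k (d := fun j => (d j).1 i) (y0 := (s0 * star s0).1 i) (η := 1 / 4) (δ' := δ') hM0
      (fun j => hdC j i) (fun j => hdM j i) (hcol.mQ i) hQp hP hPp hle (by norm_num) le_rfl hδ' ?_ ?_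
    · have : δ' * (m * M ^ 2) ≤ 1 / (4 * (m * M ^ 2 + 1)) * (m * M ^ 2) :=
        mul_le_mul_of_nonneg_right hδ0 (by positivity)
      refine this.trans ?_
      rw [div_mul_eq_mul_div, div_le_iff₀ (by positivity)]
      have : 0 ≤ m * M ^ 2 := by positivity
      linarith
    · have e : (∑ j, star (d j) * (s0 * star s0) * d j : bdFam I A).1 i =
        ∑ j, star ((d j).1 i) * ((s0 * star s0).1 i) * (d j).1 i := by rw [bd_sum]; rfl
      set W := (e3 * e3 * cst I (∑ j, star (r j) * x * r j) * (e3 * e3)).1 i with hW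
      have hsx := (IsSelfAdjoint.of_nonneg hx0).star_eq
      have hes := (IsSelfAdjoint.of_nonneg (hcol.p3 i).1).star_eq
      have hW1 : (e3.1 i * e3.1 i) * (e3.1 i * e3.1 i) ≤ W := by
        have := conj_le hr (e3.1 i * e3.1 i)
        rw [star_mul, hes, mul_one] at this
        exact this
      have hWs : IsSelfAdjoint W := by
        have h0 : 0 ≤ (e3.1 i * e3.1 i) * (e3.1 i * e3.1 i) := by
          have := star_mul_self_nonneg (e3.1 i * e3.1 i)
          rwa [star_mul, hes] at this
        exact IsSelfAdjoint.of_nonneg (h0.trans hW1)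
      have hSs : IsSelfAdjoint (∑ j, star ((d j).1 i) * ((s0 * star s0).1 i) * (d j).1 i) := by
        apply IsSelfAdjoint.of_nonneg
        refine Finset.sum_nonneg fun j _ => ?_
        have := conj_le (show 0 ≤ (s0 * star s0).1 i from mul_star_self_nonneg _) ((d j).1 i)
        simpa using this
      rw [e, norm_sub_rev] at hi
      have h1 := le_of_norm_sub hWs hSs hi
      have h2 := conj_le (hW1.trans h1) (Q.1 i)
      rw [hQp.isSelfAdjoint.star_eq] at h2
      have h3Q : e3.1 i * Q.1 i = Q.1 i := congrFun (congrArg Subtype.val hcol.h3Q) i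
      have hQ3 : Q.1 i * e3.1 i = Q.1 i := congrFun (congrArg Subtype.val hcol.Q3) i
      have e1 : Q.1 i * (e3.1 i * e3.1 i * (e3.1 i * e3.1 i)) * Q.1 i = Q.1 i := by
        simp only [← mul_assoc, hQ3]
        exact hQp.isIdempotentElem
      rw [e1] at h2
      rw [sub_le_iff_le_add]
      refine h2.trans (le_of_eq ?_)
      rw [mul_add, add_mul, mul_smul_comm, mul_one, smul_mul_assoc, hQp.isIdempotentElem,
        Finset.mul_sum, Finset.sum_mul]
      congr 1
      refine Finset.sum_congr rfl fun j _ => ?_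
      rw [star_mul, hQp.isSelfAdjoint.star_eq]
      noncomm_ring

end ColComp


section ColComp
variable {A : Type u} [CStarAlgebra A] [PartialOrder A] [StarOrderedRing A]
variable {I : Type*} {l : Filter I} {C : I → NonUnitalStarSubalgebra ℂ A} {e1 e2 e3 Q : bdFam I A}

theorem norm_sq_diff {u v : A} {ζ M : ℝ} (h : ‖u - v‖ ≤ ζ) (hv : ‖v‖ ≤ M) :
    ‖star u * u - star v * v‖ ≤ ζ * (2 * M + ζ) := by
  have e : star u * u - star v * v = star (u - v) * (u - v) + star (u - v) * v + star v * (u - v) := by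
    rw [star_sub]; noncomm_ring
  rw [e]
  have h1 : ‖star (u - v) * (u - v)‖ ≤ ζ * ζ := by
    refine (norm_mul_le _ _).trans ?_
    rw [norm_star]
    exact mul_le_mul h h (norm_nonneg _) ((norm_nonneg _).trans h)
  have h2 : ‖star (u - v) * v‖ ≤ ζ * M := by
    refine (norm_mul_le _ _).trans ?_
    rw [norm_star]
    exact mul_le_mul h hv (norm_nonneg _) ((norm_nonneg _).trans h)
  have h3 : ‖star v * (u - v)‖ ≤ M * ζ := by
    refine (norm_mul_le _ _).trans ?_
    rw [norm_star]
    exact mul_le_mul hv h (norm_nonneg _) ((norm_nonneg _).trans hv)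
  have := norm_add_le (star (u - v) * (u - v) + star (u - v) * v) (star v * (u - v))
  have := norm_add_le (star (u - v) * (u - v)) (star (u - v) * v)
  linarith

theorem norm_pi_le {w p : A} (h : star w * w = p) (hp : ‖p‖ ≤ 1) : ‖w‖ ≤ 1 := by
  have := CStarRing.norm_star_mul_self (x := w)
  rw [h] at this
  nlinarith [norm_nonneg w]

set_option maxHeartbeats 2000000 in
theorem color_comp (hcol : IsCol l C e1 e2 e3 Q) {q y : A} (hq : IsStarProjection q)
    (hy0 : 0 ≤ y) (hy1 : y ≤ 1) (hcp : CPpos (y - q))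
    (hfull : ∃ (m : ℕ) (r : Fin m → A), 1 ≤ ∑ j, star (r j) * y * r j) {δ : ℝ} (hδ : 0 < δ) :
    ∀ᶠ i in l, ∃ B : A, q * (e1.1 i * e1.1 i) * q ≤ star B * (y * y) * B + δ • 1 := by
  obtain ⟨y0, hyC, hynn, hycl, hynorm, K, hK, δ0, hδ0, hF⟩ := col_full hcol hy0 hy1 hfull
  obtain ⟨γ, hγ, N, a, ha⟩ := hcp
  obtain ⟨s, hsC, hs, hes⟩ := hcol.b1 q
  obtain ⟨c, hcC, hc, hQc⟩ := hcol.b2 q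
  choose g hgC hg hQg using fun k => hcol.b2 (a k)
  have hE1 : star e1 = e1 := bd_star_eq fun i => (hcol.p1 i).1
  have hE2 : star e2 = e2 := bd_star_eq fun i => (hcol.p2 i).1
  have hE3 : star e3 = e3 := bd_star_eq fun i => (hcol.p3 i).1
  have hqs := hq.isSelfAdjoint.star_eq
  have hqq : q * q = q := hq.isIdempotentElem
  have hys := (IsSelfAdjoint.of_nonneg hy0).star_eq
  have hs' := cl_star_br hs hE1 hcol.c1
  have hc' := cl_star_br hc hE2 hcol.c2
  have hg' := fun k => cl_star_br (hg k) hE2 hcol.c2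
  rw [hqs] at hs' hc'
  have k1 := cl_comm hcol.c1
  have k1' := cl_comm' hcol.c1
  have k2 := cl_comm hcol.c2
  have k2' := cl_comm' hcol.c2
  have k3 := cl_comm hcol.c3
  have k3' := cl_comm' hcol.c3
  have h21 : cl l e2 * cl l e1 = cl l e1 := by rw [← map_mul, hcol.h21]
  have h21' : ∀ z, cl l e2 * (cl l e1 * z) = cl l e1 * z := fun z => by rw [← mul_assoc, h21]
  have h23 : cl l e2 * cl l e3 = cl l e2 := by rw [← map_mul, hcol.h23]
  have h32 : cl l e3 * cl l e2 = cl l e2 := by rw [← map_mul, hcol.h32]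
  have h23' : ∀ z, cl l e2 * (cl l e3 * z) = cl l e2 * z := fun z => by rw [← mul_assoc, h23]
  have h32' : ∀ z, cl l e3 * (cl l e2 * z) = cl l e2 * z := fun z => by rw [← mul_assoc, h32]
  have hqqc : ∀ z, cl l (cst I q) * (cl l (cst I q) * z) = cl l (cst I q) * z := fun z => by
    rw [← mul_assoc, ← map_mul, ← map_mul, hqq]
  have hqqc0 : cl l (cst I q) * cl l (cst I q) = cl l (cst I q) := by
    rw [← map_mul, ← map_mul, hqq]
  set t := e2 * c with ht
  set b := fun k => g k * e2 with hb
  set n := e2 * e2 with hn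
  set w0 := y - q - γ • (1 : A) - ∑ k, (star (a k) * a k - a k * star (a k)) with hw0
  have hw0n : 0 ≤ w0 := by
    have := sub_nonneg.mpr ha
    convert this using 1
    rw [hw0]; abel
  set Z : bdFam I A := n * y0 * n - t * star t - cst I (γ • 1) * (n * n) -
    ∑ k, (star (b k) * b k - b k * star (b k)) with hZd
  have hZ : cl l Z = cl l (n * cst I w0 * n) := by
    have z1 : cl l (n * y0 * n) = cl l (n * cst I y * n) := by
      rw [map_mul, map_mul, hycl, hn]
      simp only [map_mul, mul_assoc, k2, k2', k3, k3', h23, h32, h23', h32']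
    have z2 : cl l (t * star t) = cl l (n * cst I q * n) := by
      rw [ht, star_mul, hE2, map_mul, map_mul, map_mul, hc, hc', hn]
      simp only [map_mul, mul_assoc, k2, k2', hqqc, hqqc0]
    have z3 : cl l (cst I (γ • 1) * (n * n)) = cl l (n * cst I (γ • 1) * n) := by
      rw [hn]
      simp only [map_mul, mul_assoc, k2, k2']
    have z4 : ∀ k, cl l (star (b k) * b k - b k * star (b k)) =
        cl l (n * cst I (star (a k) * a k - a k * star (a k)) * n) := by
      intro k
      rw [hb, hn]
      simp only [star_mul, hE2, map_sub, map_mul, hg, hg', star_star, mul_sub, sub_mul]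
      simp only [mul_assoc, k2, k2']
    rw [hZd, map_sub, map_sub, map_sub, z1, z2, z3, map_sum, Finset.sum_congr rfl fun k _ => z4 k,
      ← map_sum, ← map_sub, ← map_sub, ← map_sub, hw0]
    congr 1
    rw [map_sub, map_sub, map_sub, map_sum]
    simp only [mul_sub, sub_mul, Finset.mul_sum, Finset.sum_mul]
  have hI4 : cl l (t * star t * (s * star s)) = cl l (s * star s) := by
    rw [ht, star_mul, hE2]
    simp only [map_mul, hc, hc', hs, hs']
    simp only [mul_assoc, k1, k1', k2, k2', h21, h21', hqqc, hqqc0]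
  have hI1 : cl l (star s * s) = cl l (cst I q * (e1 * e1) * cst I q) := by
    simp only [map_mul, hs, hs']
    simp only [mul_assoc, k1, k1', hqqc, hqqc0]
  have hI6 : cl l (cst I y * (e3 * e3)) = cl l y0 := by
    rw [hycl]
    simp only [map_mul, mul_assoc, k3, k3']
  obtain ⟨Ms, hMs⟩ := s.2
  set M := max Ms 0 with hM
  have hM0 : 0 ≤ M := le_max_right _ _
  have hsM : ∀ i, ‖s.1 i‖ ≤ M := fun i => (hMs i).trans (le_max_left _ _)
  set δ' := min (γ / 2) δ0 with hδ'
  have hδ'0 : 0 < δ' := lt_min (by positivity) hδ0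
  set η := min (1 / 4) (γ / 2 / (2 + K)) with hη
  have hη0 : 0 < η := lt_min (by norm_num) (by positivity)
  have hηK : η * (2 + K) ≤ γ / 2 := by
    rw [← le_div_iff₀ (by positivity)]; exact min_le_right _ _
  set ζ := min 1 (δ / 4 / (2 * M + 1)) with hζ
  have hζ0 : 0 < ζ := lt_min (by norm_num) (by positivity)
  have hζM : ζ * (2 * M + ζ) ≤ δ / 4 := by
    have h1 : ζ * (2 * M + 1) ≤ δ / 4 := by
      rw [← le_div_iff₀ (by positivity)]; exact min_le_right _ _
    have h2 : ζ ≤ 1 := min_le_left _ _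
    nlinarith
  filter_upwards [hF, hynorm η hη0, cl_ev hZ hη0, cl_ev hI4 (show 0 < η * (δ / 4) by positivity),
    cl_ev hI1 (show 0 < δ / 4 by positivity),
    cl_ev hI6 (show 0 < ζ * δ' / (M + 1) by positivity)] with i fF fn fZ f4 f1 f6
  haveI := hcol.fd i
  obtain ⟨D⟩ := exists_FDData (C i)
  obtain ⟨Pq, Lq, hPq, hLq, hPqp, q1, -, -, q3, -, -, -, -, q5⟩ := specproj (C i)
    (mul_mem (hsC i) (star_mem (hsC i))) (mul_star_self_nonneg (s.1 i)) (show 0 < δ / 4 by positivity)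
  obtain ⟨Py, L, hPy, hL, hPyp, y1, -, -, y3, y4, -, -, -, -⟩ := specproj (C i) (hyC i) (hynn i) hδ'0
  have hyle : y0.1 i ≤ (1 + η) • Py + δ' • 1 := by
    refine y4.trans ?_
    exact add_le_add (smul_le_smul_of_nonneg_right fn hPyp.nn) le_rfl
  have hyle' : y0.1 i ≤ (1 + 1 / 4 : ℝ) • Py + δ' • 1 := by
    refine hyle.trans ?_
    refine add_le_add (smul_le_smul_of_nonneg_right ?_ hPyp.nn) le_rfl
    have := min_le_left (1 / 4) (γ / 2 / (2 + K))
    linarith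
  have hQK := fF D Py hPy hPyp δ' hδ'0.le (min_le_right _ _) hyle'
  have ev : ∀ {x z : bdFam I A}, x = z → x.1 i = z.1 i := fun h => by rw [h]
  have hes_i : e2.1 i * s.1 i = s.1 i := ev hes
  have heP : e2.1 i * Pq = Pq := by
    rw [← q1, ← mul_assoc, ← mul_assoc, hes_i]
  have hPe : Pq * e2.1 i = Pq := by
    have := congrArg star heP
    rwa [star_mul, hPqp.isSelfAdjoint.star_eq, (IsSelfAdjoint.of_nonneg (hcol.p2 i).1).star_eq] at this
  have hQp := hcol.pQ i
  have htP : (1 - η) • Pq ≤ Pq * (t.1 i * star (t.1 i)) * Pq := by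
    have h1 : ‖t.1 i * star (t.1 i) * Pq - Pq‖ ≤ η := by
      have e : t.1 i * star (t.1 i) * Pq - Pq =
        ((t * star t * (s * star s)).1 i - (s * star s).1 i) * Lq := by
        simp only [bd_mul, bd_star]
        rw [sub_mul, mul_assoc (t.1 i * star (t.1 i)), q1]
      rw [e]
      refine (norm_mul_le _ _).trans ((mul_le_mul f4 q3 (norm_nonneg _) (by positivity)).trans (le_of_eq ?_))
      field_simp
    set X := Pq - Pq * (t.1 i * star (t.1 i)) * Pq with hX
    have hXs : IsSelfAdjoint X := by
      refine hPqp.isSelfAdjoint.sub ?_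
      rw [IsSelfAdjoint, star_mul, star_mul, star_mul, star_star, hPqp.isSelfAdjoint.star_eq, mul_assoc,
        mul_assoc, mul_assoc]
    have hXn : ‖X‖ ≤ η := by
      have e : X = - (Pq * (t.1 i * star (t.1 i) * Pq - Pq)) := by
        rw [mul_sub, hPqp.isIdempotentElem, hX]; noncomm_ring
      rw [e, norm_neg]
      refine (norm_mul_le _ _).trans ?_
      have := hPqp.nrm
      nlinarith [norm_nonneg (t.1 i * star (t.1 i) * Pq - Pq)]
    have hPP : Pq * Pq = Pq := hPqp.isIdempotentElem
    have := corner_le hPqp hXs (by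
      rw [hX, mul_sub, sub_mul, hPP, hPP]
      congr 1
      rw [← mul_assoc, ← mul_assoc, hPP, mul_assoc _ Pq Pq, hPP]) hXn
    rw [hX] at this
    rw [sub_smul, one_smul]
    exact sub_le_comm.mp this
  have hY : -(η • Q.1 i) ≤ n.1 i * y0.1 i * n.1 i - t.1 i * star (t.1 i) - γ • (n.1 i * n.1 i) -
      ∑ k, (star ((b k).1 i) * (b k).1 i - (b k).1 i * star ((b k).1 i)) := by
    have hZi : Z.1 i = n.1 i * y0.1 i * n.1 i - t.1 i * star (t.1 i) - γ • (n.1 i * n.1 i) -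
      ∑ k, (star ((b k).1 i) * (b k).1 i - (b k).1 i * star ((b k).1 i)) := by
      rw [hZd]
      simp only [bd_sub, bd_mul, bd_sum, bd_star, cst_apply, smul_mul_assoc, one_mul]
    rw [← hZi]
    have hns : star n = n := by rw [hn, star_mul, hE2]
    have hy0s : star y0 = y0 := bd_star_eq hynn
    have hZs : star Z = Z := by
      have hγs : star (cst I (γ • (1 : A))) = cst I (γ • 1) := by
        rw [← cst_star, star_smul, star_one, star_trivial]
      have hγn : (n * n) * cst I (γ • (1 : A)) = cst I (γ • 1) * (n * n) := by
        apply Subtype.ext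
        funext j
        simp only [bd_mul, cst_apply, mul_smul_comm, smul_mul_assoc, mul_one, one_mul]
      rw [hZd]
      simp only [star_sub, star_mul, star_sum, hns, hy0s, star_star, hγs, hγn, mul_assoc]
    have hQs : star Q = Q := bd_star_eq fun i => (hcol.pQ i).nn
    have hQn : Q * n = n := by rw [hn, ← mul_assoc, hcol.Q2]
    have hnQ : n * Q = n := by rw [hn, mul_assoc, hcol.h2Q]
    have hQt : Q * t = t := by rw [ht, ← mul_assoc, hcol.Q2]
    have hbQ : ∀ k, b k * Q = b k := fun k => by rw [hb]; simp only [mul_assoc, hcol.h2Q]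
    have hQb : ∀ k, Q * b k = b k := fun k => by rw [hb]; simp only [← mul_assoc, hQg]
    have hQb' : ∀ k, Q * star (b k) = star (b k) := fun k => by
      have := congrArg star (hbQ k); rwa [star_mul, hQs] at this
    have hQZ : Q * Z = Z := by
      have hγn : Q * (cst I (γ • (1 : A)) * (n * n)) = cst I (γ • 1) * (n * n) := by
        have : Q * cst I (γ • (1 : A)) = cst I (γ • 1) * Q := by
          apply Subtype.ext
          funext j
          simp only [bd_mul, cst_apply, mul_smul_comm, smul_mul_assoc, mul_one, one_mul]
        rw [← mul_assoc, this, mul_assoc, ← mul_assoc Q, hQn]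
      rw [hZd]
      simp only [mul_sub, Finset.mul_sum, hγn]
      simp only [← mul_assoc, hQn, hQt, hQb, hQb']
    have hZQ : Z * Q = Z := by
      have := congrArg star hQZ; rwa [star_mul, hQs, hZs] at this
    have hWn : 0 ≤ (n * cst I w0 * n).1 i := by
      have := conj_le hw0n (n.1 i)
      have e : star (n.1 i) = n.1 i := ev hns
      rw [e] at this
      simpa using this
    have hZsi : IsSelfAdjoint (Z.1 i) := ev hZs
    have h1 := le_of_norm_sub (IsSelfAdjoint.of_nonneg hWn) hZsi (η := η) (by rw [norm_sub_rev]; exact fZ)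
    have h2 := conj_le (hWn.trans h1) (Q.1 i)
    rw [hQp.isSelfAdjoint.star_eq, mul_zero, zero_mul, mul_add, add_mul, mul_smul_comm, smul_mul_assoc,
      mul_one, hQp.isIdempotentElem, show Q.1 i * Z.1 i = Z.1 i from ev hQZ,
      show Z.1 i * Q.1 i = Z.1 i from ev hZQ] at h2
    rwa [neg_le_iff_add_nonneg]
  have hTT : ∀ k, D.T k Pq ≤ D.T k Py := fun k =>
    D.T_comp k (b := fun k => (b k).1 i) (e := e2.1 i) (n := n.1 i) (Q := Q.1 i) (y0 := y0.1 i)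
      (t := t.1 i) (γ := γ) (η := η) (δ' := δ') (K := K)
      (fun k => mul_mem (hgC k i) (hcol.m2 i)) (hcol.m2 i) (hcol.p2 i).1 (hcol.p2 i).2 rfl hQp
      (mul_mem (hcol.m2 i) (hcC i)) hPy hPyp hPq hPqp hyle hη0 hδ'0 (min_le_left _ _) hK hηK heP hPe htP
      (hQK k) hY
  obtain ⟨w, hwC, hw1, hw2⟩ := D.compare Pq Py hPq hPqp hPy hPyp hTT
  have hwn := norm_pi_le hw1 hPqp.nrm
  refine ⟨e3.1 i * e3.1 i * L * w * s.1 i, ?_⟩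
  set B := e3.1 i * e3.1 i * L * w * s.1 i with hB
  have hd : ‖y * B - w * s.1 i‖ ≤ ζ := by
    have e : y * B - w * s.1 i = ((cst I y * (e3 * e3)).1 i - y0.1 i) * L * (w * s.1 i) := by
      simp only [bd_mul, cst_apply]
      rw [sub_mul, y1, sub_mul, ← mul_assoc Py, hw2, hB]
      simp only [mul_assoc]
    rw [e]
    have h1 : ‖w * s.1 i‖ ≤ M := (norm_mul_le _ _).trans (by nlinarith [norm_nonneg (s.1 i), hsM i])
    refine (norm_mul_le _ _).trans ((mul_le_mul ((norm_mul_le _ _).trans (mul_le_mul f6 y3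
      (norm_nonneg _) (by positivity))) h1 (norm_nonneg _) (by positivity)).trans ?_)
    have : ζ * δ' / (M + 1) * (1 / δ') * M = ζ * (M / (M + 1)) := by field_simp
    rw [this]
    have : M / (M + 1) ≤ 1 := by rw [div_le_one (by positivity)]; linarith
    nlinarith
  have hwsM : ‖w * s.1 i‖ ≤ M := (norm_mul_le _ _).trans (by nlinarith [norm_nonneg (s.1 i), hsM i])
  have hdd := (norm_sq_diff hd hwsM).trans hζM
  have g1 : star (y * B) * (y * B) = star B * (y * y) * B := by rw [star_mul, hys]; noncomm_ring
  have g2 : star (w * s.1 i) * (w * s.1 i) = star (s.1 i) * Pq * s.1 i := by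
    rw [star_mul, ← hw1]; noncomm_ring
  have a1 : q * (e1.1 i * e1.1 i) * q ≤ star (s.1 i) * s.1 i + (δ / 4) • 1 := by
    refine le_of_norm_sub ?_ (IsSelfAdjoint.star_mul_self _) ?_
    · have := mul_star_self_nonneg (q * e1.1 i)
      rw [star_mul, hqs, (IsSelfAdjoint.of_nonneg (hcol.p1 i).1).star_eq] at this
      have h := IsSelfAdjoint.of_nonneg this
      convert h using 1
      noncomm_ring
    · rw [norm_sub_rev]; exact f1
  have a2 : star (s.1 i) * s.1 i ≤ star (s.1 i) * Pq * s.1 i + (δ / 4) • 1 := by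
    have e : star (s.1 i) * s.1 i - star (s.1 i) * Pq * s.1 i =
      star ((1 - Pq) * s.1 i) * ((1 - Pq) * s.1 i) := by
      rw [star_mul, star_sub, star_one, hPqp.isSelfAdjoint.star_eq]
      have : star (s.1 i) * (1 - Pq) * ((1 - Pq) * s.1 i) = star (s.1 i) * ((1 - Pq) * (1 - Pq)) * s.1 i := by
        noncomm_ring
      rw [this, hPqp.one_sub.isIdempotentElem]
      noncomm_ring
    have : ‖star ((1 - Pq) * s.1 i) * ((1 - Pq) * s.1 i)‖ ≤ δ / 4 := by
      rw [CStarRing.norm_star_mul_self, ← CStarRing.norm_self_mul_star, star_mul, star_sub, star_one,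
        hPqp.isSelfAdjoint.star_eq]
      refine le_trans (le_of_eq ?_) q5
      congr 1
      noncomm_ring
    have := le_smul_one (IsSelfAdjoint.star_mul_self _) this
    rw [← e] at this
    exact sub_le_iff_le_add'.mp this
  have a3 : star (s.1 i) * Pq * s.1 i ≤ star B * (y * y) * B + (δ / 4) • 1 := by
    rw [← g1, ← g2]
    refine le_of_norm_sub (IsSelfAdjoint.star_mul_self _) (IsSelfAdjoint.star_mul_self _) ?_
    rw [norm_sub_rev]; exact hdd
  calc q * (e1.1 i * e1.1 i) * q ≤ ((star B * (y * y) * B + (δ / 4) • 1) + (δ / 4) • 1) + (δ / 4) • 1 :=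
        a1.trans (by gcongr; exact a2.trans (by gcongr))
    _ ≤ star B * (y * y) * B + δ • 1 := by
        have : (0 : A) ≤ (δ / 4) • 1 := smul_nonneg (by positivity) zero_le_one
        rw [← sub_nonneg]
        convert this using 1
        module

end ColComp


section Comp
variable {A : Type u} [CStarAlgebra A] [PartialOrder A] [StarOrderedRing A]

theorem add_mul_star_le (a b : A) : (a + b) * star (a + b) ≤ (2 : ℝ) • (a * star a + b * star b) := by
  have := mul_star_self_nonneg (a - b)
  rw [← sub_nonneg]
  convert this using 1
  rw [star_add, star_sub]
  simp only [mul_add, add_mul, mul_sub, sub_mul]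
  module

theorem comp_proj [Nontrivial A] (hW : WeakCRLeOne A) (hS : IsSimpleCStarAlgebra A) {q y1 y2 : A}
    (hq : IsStarProjection q) (h10 : 0 ≤ y1) (h11 : y1 ≤ 1) (h20 : 0 ≤ y2) (h21 : y2 ≤ 1)
    (h1n : y1 ≠ 0) (h2n : y2 ≠ 0) (h12 : y1 * y2 = 0)
    (ht1 : ∀ τ : A →ₗ[ℝ] ℝ, IsTr τ → τ q < τ y1) (ht2 : ∀ τ : A →ₗ[ℝ] ℝ, IsTr τ → τ q < τ y2) :
    ∃ V : A, star V * V = q ∧ ∃ K : ℝ, 0 ≤ K ∧ V * star V ≤ K • ((y1 + y2) * (y1 + y2)) := by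
  obtain ⟨I, l, hl, C, D, e1, e2, e3, Q, f1, f2, f3, R, hC, hD, hsum⟩ :=
    exists_two_cols hW (show (0:ℝ) < 1 / 4 by norm_num)
  have hs1 := (IsSelfAdjoint.of_nonneg h10)
  have hs2 := (IsSelfAdjoint.of_nonneg h20)
  have hqs := hq.isSelfAdjoint
  have cp : ∀ y : A, IsSelfAdjoint y → (∀ τ : A →ₗ[ℝ] ℝ, IsTr τ → τ q < τ y) → CPpos (y - q) :=
    fun y hy h => cuntz_pedersen (hy.sub hqs) fun τ hτ => by
      rw [map_sub]; linarith [h τ hτ]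
  have ev1 := color_comp hC hq h10 h11 (cp y1 hs1 ht1) (full_aux hS h10 h1n) (show (0:ℝ) < 1 / 8 by norm_num)
  have ev2 := color_comp hD hq h20 h21 (cp y2 hs2 ht2) (full_aux hS h20 h2n) (show (0:ℝ) < 1 / 8 by norm_num)
  obtain ⟨i, ⟨B, hB⟩, ⟨B', hB'⟩, hi⟩ := (ev1.and (ev2.and hsum)).exists
  have h21' : y2 * y1 = 0 := by
    have := congrArg star h12
    rwa [star_mul, hs1.star_eq, hs2.star_eq, star_zero] at this
  have hqq : q * q = q := hq.isIdempotentElem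
  set r := y1 * B + y2 * B' with hr
  have hrr : star r * r = star B * (y1 * y1) * B + star B' * (y2 * y2) * B' := by
    rw [hr, star_add, star_mul, star_mul, hs1.star_eq, hs2.star_eq]
    have e : (star B * y1 + star B' * y2) * (y1 * B + y2 * B') =
      star B * (y1 * y1) * B + star B' * (y2 * y2) * B' + star B * (y1 * y2) * B' + star B' * (y2 * y1) * B := by
      noncomm_ring
    rw [e, h12, h21']
    simp
  have k1 : q ≤ star r * r + (1 / 2 : ℝ) • 1 := by
    have h := conj_le hi q
    rw [hqs.star_eq, mul_one, hqq] at h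
    have e : q * (e1.1 i * e1.1 i + f1.1 i * f1.1 i + (1 / 4 : ℝ) • 1) * q =
      q * (e1.1 i * e1.1 i) * q + q * (f1.1 i * f1.1 i) * q + (1 / 4 : ℝ) • q := by
      simp only [mul_add, add_mul, mul_smul_comm, smul_mul_assoc, mul_one, hqq]
    rw [e] at h
    refine h.trans ((add_le_add (add_le_add hB hB') (smul_le_smul_of_nonneg_left hq.le1
      (by norm_num))).trans (le_of_eq ?_))
    rw [hrr]; module
  have k2 : (1 / 2 : ℝ) • q ≤ star (r * q) * (r * q) := by
    have h := conj_le k1 q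
    rw [hqs.star_eq, hqq, hqq, mul_add, add_mul, mul_smul_comm, smul_mul_assoc, mul_one, hqq] at h
    have e : star (r * q) * (r * q) = q * (star r * r) * q := by
      rw [star_mul, hqs.star_eq]; noncomm_ring
    rw [e]
    rw [← sub_nonneg] at h ⊢
    convert h using 1
    module
  obtain ⟨V, w, hV, -, ⟨K, hK, hVK⟩, -⟩ := corner hq (t := r * q) (by rw [mul_assoc, hqq])
    (show (0:ℝ) < 1 / 2 by norm_num) k2
  set M := max ‖B‖ ‖B'‖ with hM
  refine ⟨V, hV, K * (2 * M ^ 2), by positivity, hVK.trans ?_⟩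
  rw [mul_smul]
  refine smul_le_smul_of_nonneg_left ?_ hK
  have a1 : r * q * star (r * q) ≤ r * star r := by
    have := conj_le' hq.le1 r
    rw [mul_one] at this
    refine le_trans (le_of_eq ?_) this
    rw [star_mul, hqs.star_eq, ← mul_assoc, mul_assoc r q q, hqq]
  have a2 := add_mul_star_le (y1 * B) (y2 * B')
  have a3 : ∀ y X : A, IsSelfAdjoint y → ‖X‖ ≤ M → y * X * star (y * X) ≤ M ^ 2 • (y * y) := by
    intro y X hy hX
    have := conj_le' (mul_star_le_one hX) y
    rw [hy.star_eq] at this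
    refine le_trans (le_of_eq ?_) (this.trans (le_of_eq ?_))
    · rw [star_mul, hy.star_eq]; noncomm_ring
    · rw [mul_smul_comm, mul_one, smul_mul_assoc]
  have a4 := add_le_add (a3 y1 B hs1 (le_max_left _ _)) (a3 y2 B' hs2 (le_max_right _ _))
  have e : (y1 + y2) * (y1 + y2) = y1 * y1 + y2 * y2 := by
    simp only [mul_add, add_mul, h12, h21']; abel
  rw [e]
  refine a1.trans (a2.trans ?_)
  rw [mul_smul]
  refine smul_le_smul_of_nonneg_left ?_ (by norm_num)
  rw [smul_add]
  exact a4

end Comp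


section Pieces
variable {A : Type u} [CStarAlgebra A] [PartialOrder A] [StarOrderedRing A]

theorem mul_zero_of_le {x y z : A} (hx : 0 ≤ x) {c : ℝ} (h : x ≤ c • y) (hz : y * z = 0) : x * z = 0 := by
  obtain ⟨g, hg⟩ := CStarAlgebra.nonneg_iff_eq_star_mul_self.mp hx
  have h1 := conj_le h z
  have h2 : star z * (c • y) * z = 0 := by
    rw [mul_smul_comm, smul_mul_assoc, mul_assoc, hz, mul_zero, smul_zero]
  have h3 : star (g * z) * (g * z) = 0 := by
    have e : star (g * z) * (g * z) = star z * x * z := by rw [hg, star_mul]; noncomm_ring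
    refine le_antisymm ?_ (star_mul_self_nonneg _)
    rw [e]; exact h1.trans_eq h2
  have h4 : g * z = 0 := by rwa [CStarRing.star_mul_self_eq_zero_iff] at h3
  rw [hg, mul_assoc, h4, mul_zero]

theorem zero_mul_of_le {x y z : A} (hx : 0 ≤ x) (hy : IsSelfAdjoint y) {c : ℝ} (h : x ≤ c • y) (hz : z * y = 0) :
    z * x = 0 := by
  have h1 : y * star z = 0 := by
    have := congrArg star hz
    rwa [star_mul, hy.star_eq, star_zero] at this
  have := congrArg star (mul_zero_of_le hx h h1)
  rwa [star_mul, star_star, star_zero, (IsSelfAdjoint.of_nonneg hx).star_eq] at this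

theorem mul_proj_of_le {x p : A} (hx : 0 ≤ x) (hp : IsStarProjection p) {c : ℝ} (h : x ≤ c • p) :
    x * p = x ∧ p * x = x := by
  have hpp : p * p = p := hp.isIdempotentElem
  have h1 : x * (1 - p) = 0 := mul_zero_of_le hx h (by rw [mul_sub, mul_one, hpp, sub_self])
  have h2 : (1 - p) * x = 0 := zero_mul_of_le hx hp.isSelfAdjoint h (by rw [sub_mul, one_mul, hpp, sub_self])
  rw [mul_sub, mul_one, sub_eq_zero] at h1
  rw [sub_mul, one_mul, sub_eq_zero] at h2
  exact ⟨h1.symm, h2.symm⟩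

def HasPieces (y : A) : Prop := ∃ a b : A, 0 ≤ a ∧ 0 ≤ b ∧ a ≠ 0 ∧ b ≠ 0 ∧ a * b = 0 ∧ a + b ≤ y

theorem HasPieces.scale {y z : A} {c : ℝ} (hc : 0 < c) (h : HasPieces z) (hz : z ≤ c • y) : HasPieces y := by
  obtain ⟨a, b, ha, hb, ha0, hb0, hab, hle⟩ := h
  refine ⟨c⁻¹ • a, c⁻¹ • b, smul_nonneg (by positivity) ha, smul_nonneg (by positivity) hb,
    smul_ne_zero (by positivity) ha0, smul_ne_zero (by positivity) hb0, ?_, ?_⟩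
  · rw [smul_mul_smul_comm, hab, smul_zero]
  · rw [← smul_add]
    have := smul_le_smul_of_nonneg_left (hle.trans hz) (show 0 ≤ c⁻¹ by positivity)
    rwa [smul_smul, inv_mul_cancel₀ hc.ne', one_smul] at this

theorem proj_of_no_pieces [Nontrivial A] {y : A} (hy : 0 ≤ y) (hy0 : y ≠ 0) (h : ¬ HasPieces y) :
    ∃ (c : ℝ) (p : A), 0 < c ∧ IsStarProjection p ∧ y = c • p := by
  have hys := IsSelfAdjoint.of_nonneg hy
  have hpos : 0 < ‖y‖ := norm_pos_iff.mpr hy0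
  have key : ∀ s ∈ spectrum ℝ y, s = 0 ∨ s = ‖y‖ := by
    intro s hs
    by_contra hcon
    push Not at hcon
    have hs0 : 0 ≤ s := spectrum_nonneg_of_nonneg hy hs
    have hs1 : s ≤ ‖y‖ := (Real.le_norm_self s).trans (spectrum.norm_le_norm_of_mem hs)
    have hs0' : 0 < s := lt_of_le_of_ne hs0 (Ne.symm hcon.1)
    have hs1' : s < ‖y‖ := lt_of_le_of_ne hs1 hcon.2
    set m := (s + ‖y‖) / 2 with hm
    let f1 : ℝ → ℝ := fun t => max (t - m) 0
    let f2 : ℝ → ℝ := fun t => max (min t (m - t)) 0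
    have c1 : Continuous f1 := by fun_prop
    have c2 : Continuous f2 := by fun_prop
    apply h
    have ne : ∀ f : ℝ → ℝ, Continuous f → ∀ t ∈ spectrum ℝ y, f t ≠ 0 → cfc f y ≠ 0 := by
      intro f hf t ht hft hc
      have e : cfc f y = cfc (fun _ : ℝ => (0:ℝ)) y := by rw [hc, cfc_const_zero]
      have := (cfc_eq_cfc_iff_eqOn (R := ℝ) (a := y) (f := f) (g := fun _ => 0) (hf := hf.continuousOn)
        (hg := continuousOn_const) (ha := hys)).mp e ht
      exact hft this
    refine ⟨cfc f1 y, cfc f2 y, cfc_nonneg fun t _ => le_max_right _ _, cfc_nonneg fun t _ => le_max_right _ _,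
      ne f1 c1 ‖y‖ (CStarAlgebra.norm_mem_spectrum_of_nonneg hy) ?_, ne f2 c2 s hs ?_, ?_, ?_⟩
    · have : 0 < ‖y‖ - m := by rw [hm]; linarith
      exact (lt_max_of_lt_left this).ne'
    · have : 0 < min s (m - s) := lt_min hs0' (by rw [hm]; linarith)
      exact (lt_max_of_lt_left this).ne'
    · rw [← cfc_mul f1 f2 y c1.continuousOn c2.continuousOn]
      rw [← cfc_const_zero ℝ y]
      apply cfc_congr
      intro t _
      simp only [f1, f2]
      rcases le_total t m with h | h
      · rw [max_eq_right (by linarith : t - m ≤ 0), zero_mul]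
      · rw [max_eq_right ((min_le_right _ _).trans (by linarith)), mul_zero]
    · rw [← cfc_add y f1 f2 c1.continuousOn c2.continuousOn]
      conv_rhs => rw [← cfc_id' ℝ y]
      refine cfc_mono (fun t ht => ?_) (by fun_prop) (by fun_prop)
      have ht0 : 0 ≤ t := spectrum_nonneg_of_nonneg hy ht
      have hm0 : 0 < m := by rw [hm]; linarith
      simp only [f1, f2]
      rcases le_total t m with h | h
      · rw [max_eq_right (by linarith : t - m ≤ 0), zero_add]
        exact max_le (min_le_left _ _) ht0
      · rw [max_eq_right ((min_le_right _ _).trans (by linarith) : min t (m - t) ≤ 0), add_zero]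
        exact max_le (by linarith) ht0
  refine ⟨‖y‖, ‖y‖⁻¹ • y, hpos, ⟨?_, ?_⟩, by rw [smul_smul, mul_inv_cancel₀ hpos.ne', one_smul]⟩
  · have e : y * y = ‖y‖ • y := by
      have h1 : y * y = cfc (fun t : ℝ => t * t) y := by
        rw [cfc_mul (fun t : ℝ => t) (fun t => t) y, cfc_id' ℝ y]
      have h2 : ‖y‖ • y = cfc (fun t : ℝ => ‖y‖ * t) y := by
        rw [cfc_const_mul ‖y‖ (fun t : ℝ => t) y, cfc_id' ℝ y]
      rw [h1, h2]
      apply cfc_congr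
      intro t ht
      rcases key t ht with h | h <;> simp [h]
    rw [IsIdempotentElem, smul_mul_smul_comm, e, smul_smul, mul_assoc, inv_mul_cancel₀ hpos.ne', mul_one]
  · rw [IsSelfAdjoint, star_smul, hys.star_eq, star_trivial]

/-- If some nonzero positive element has no orthogonal pieces then `A` is finite dimensional. -/
theorem fd_of_no_pieces [Nontrivial A] (hS : IsSimpleCStarAlgebra A) {y : A} (hy : 0 ≤ y) (hy0 : y ≠ 0)
    (h : ¬ HasPieces y) : FiniteDimensional ℂ A := by
  obtain ⟨c, p, hc, hp, rfl⟩ := proj_of_no_pieces hy hy0 h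
  have hp0 : p ≠ 0 := by rintro rfl; simp at hy0
  have hpp : p * p = p := hp.isIdempotentElem
  have hps := hp.isSelfAdjoint
  have hnp : ¬ HasPieces p := fun hh => h (hh.scale (c := c⁻¹) (by positivity) (by
    rw [smul_smul, inv_mul_cancel₀ hc.ne', one_smul]))
  -- positive compressions are scalars
  have key : ∀ a : A, 0 ≤ a → ∃ z : ℂ, p * a * p = z • p := by
    intro a ha
    by_cases h0 : p * a * p = 0
    · exact ⟨0, by rw [h0, zero_smul]⟩
    have hz : 0 ≤ p * a * p := by
      have := conj_le ha p; rwa [hps.star_eq, mul_zero, zero_mul] at this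
    have hle : p * a * p ≤ (‖a‖ + 1) • p := by
      have h1 := conj_le (le_smul_one (IsSelfAdjoint.of_nonneg ha) (show ‖a‖ ≤ ‖a‖ + 1 by linarith)) p
      rwa [hps.star_eq, mul_smul_comm, mul_one, smul_mul_assoc, hpp] at h1
    obtain ⟨d, q, hd, hq, e⟩ := proj_of_no_pieces hz h0 fun hh => hnp (hh.scale (by positivity) hle)
    have hqle : q ≤ ((‖a‖ + 1) / d) • p := by
      rw [e] at hle
      have := smul_le_smul_of_nonneg_left hle (show 0 ≤ d⁻¹ by positivity)
      rw [smul_smul, inv_mul_cancel₀ hd.ne', one_smul, smul_smul] at this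
      rwa [div_eq_inv_mul]
    obtain ⟨h1, h2⟩ := mul_proj_of_le hq.nn hp hqle
    have hqq : q * q = q := hq.isIdempotentElem
    have hq0 : q ≠ 0 := by rintro rfl; rw [smul_zero] at e; exact h0 e
    have : p - q = 0 := by
      by_contra hne
      refine hnp ⟨q, p - q, hq.nn, ?_, hq0, hne, by rw [mul_sub, h1, hqq, sub_self], by simp⟩
      have e2 : p - q = star (p - q) * (p - q) := by
        rw [star_sub, hps.star_eq, hq.isSelfAdjoint.star_eq, mul_sub, sub_mul, sub_mul, hpp, h1, h2, hqq]; abel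
      rw [e2]; exact star_mul_self_nonneg _
    refine ⟨(d : ℂ), ?_⟩
    rw [e, sub_eq_zero.mp this]
    exact (Complex.coe_smul d q).symm
  have key2 : ∀ a : A, ∃ z : ℂ, p * a * p = z • p := by
    intro a
    have hsp : a ∈ Submodule.span ℂ {x : A | 0 ≤ x} := by
      rw [CStarAlgebra.span_nonneg]; trivial
    induction hsp using Submodule.span_induction with
    | mem x hx => exact key x hx
    | zero => exact ⟨0, by simp⟩
    | add x y _ _ hx hy =>
      obtain ⟨z, hz⟩ := hx
      obtain ⟨w, hw⟩ := hy
      exact ⟨z + w, by rw [mul_add, add_mul, hz, hw, add_smul]⟩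
    | smul t x _ hx =>
      obtain ⟨z, hz⟩ := hx
      exact ⟨t * z, by rw [mul_smul_comm, smul_mul_assoc, hz, smul_smul]⟩
  obtain ⟨n, r, hr⟩ := full_aux hS hp.nn hp0
  have hg : IsUnit (∑ j, star (r j) * p * r j) := CStarAlgebra.isUnit_of_le 1 hr
  obtain ⟨g, hg⟩ := hg
  let B : Fin n × Fin n → A := fun ij => ↑g⁻¹ * star (r ij.1) * p * r ij.2
  have htop : Submodule.span ℂ (Set.range B) = ⊤ := by
    rw [eq_top_iff]
    intro a _
    have e1 : (1 : A) = ∑ j, ↑g⁻¹ * star (r j) * p * r j := by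
      rw [← Units.inv_mul g, hg, Finset.mul_sum]
      exact Finset.sum_congr rfl fun j _ => by noncomm_ring
    have e : a = ∑ i, ∑ j, (↑g⁻¹ * star (r i)) * (p * (r i * a * ↑g⁻¹ * star (r j)) * p) * r j := by
      calc a = 1 * a * 1 := by rw [one_mul, mul_one]
        _ = _ := by
          conv_lhs => rw [e1]
          rw [Finset.sum_mul, Finset.sum_mul]
          refine Finset.sum_congr rfl fun i _ => ?_
          rw [Finset.mul_sum]
          refine Finset.sum_congr rfl fun j _ => ?_
          noncomm_ring
    rw [e]
    refine Submodule.sum_mem _ fun i _ => Submodule.sum_mem _ fun j _ => ?_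
    obtain ⟨z, hz⟩ := key2 (r i * a * ↑g⁻¹ * star (r j))
    rw [hz, mul_smul_comm, smul_mul_assoc]
    exact Submodule.smul_mem _ _ (Submodule.subset_span ⟨(i, j), rfl⟩)
  exact ⟨by rw [← htop]; exact Submodule.fg_span (Set.finite_range B)⟩


theorem many_pieces (h : ∀ y : A, 0 ≤ y → y ≠ 0 → HasPieces y) (n : ℕ) : ∀ y : A, 0 ≤ y → y ≠ 0 →
    ∃ x : Fin n → A, (∀ k, 0 ≤ x k) ∧ (∀ k, x k ≠ 0) ∧ ∑ k, x k ≤ y ∧ ∀ i j, i ≠ j → x i * x j = 0 := by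
  induction n with
  | zero => exact fun y hy _ => ⟨fun _ => 0, fun k => k.elim0, fun k => k.elim0, by simpa using hy, fun i => i.elim0⟩
  | succ n ih =>
    intro y hy hy0
    obtain ⟨a, b, ha, hb, ha0, hb0, hab, hle⟩ := h y hy hy0
    obtain ⟨x, hx, hx0, hxs, hxo⟩ := ih b hb hb0
    have hxb : ∀ k, x k ≤ (1:ℝ) • b := fun k => by
      rw [one_smul]
      exact (Finset.single_le_sum (fun k _ => hx k) (Finset.mem_univ k)).trans hxs
    have hax : ∀ k, a * x k = 0 := fun k => zero_mul_of_le (hx k) (IsSelfAdjoint.of_nonneg hb) (hxb k) hab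
    have hxa : ∀ k, x k * a = 0 := fun k => by
      have := congrArg star (hax k)
      rwa [star_mul, (IsSelfAdjoint.of_nonneg ha).star_eq, (IsSelfAdjoint.of_nonneg (hx k)).star_eq, star_zero] at this
    refine ⟨Fin.cons a x, fun k => ?_, fun k => ?_, ?_, fun i j hij => ?_⟩
    · refine Fin.cases ?_ (fun k => ?_) k
      · simpa using ha
      · simpa using hx k
    · refine Fin.cases ?_ (fun k => ?_) k
      · simpa using ha0
      · simpa using hx0 k
    · rw [Fin.sum_univ_succ]
      simp only [Fin.cons_zero, Fin.cons_succ]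
      exact (add_le_add le_rfl hxs).trans hle
    · induction i using Fin.cases with
      | zero =>
        induction j using Fin.cases with
        | zero => exact absurd rfl hij
        | succ j => simpa using hax j
      | succ i =>
        induction j using Fin.cases with
        | zero => simpa using hxa i
        | succ j => simpa using hxo i j (fun h => hij (by rw [h]))

end Pieces


section ColProj
variable {A : Type u} [CStarAlgebra A] [PartialOrder A] [StarOrderedRing A]

theorem perturb_proj {P t : A} (hP : IsStarProjection P) (ht : t * P = t) {ζ : ℝ} (hζ : ζ ≤ 1 / 100)
    (h : ‖t - P‖ ≤ ζ) : ∃ V : A, star V * V = P ∧ (∃ K : ℝ, 0 ≤ K ∧ V * star V ≤ K • (t * star t)) ∧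
      ‖V * star V - P‖ ≤ 24 * ζ := by
  have hζ0 : 0 ≤ ζ := (norm_nonneg _).trans h
  have hPP : P * P = P := hP.isIdempotentElem
  have hPs : star P = P := hP.isSelfAdjoint.star_eq
  have hn := hP.nrm
  have h1 : ‖star t * t - P‖ ≤ 3 * ζ := by
    have := norm_sq_diff h hn
    rw [hPs, hPP] at this
    nlinarith
  have htn : ‖t‖ ≤ 1 + ζ := by
    have := norm_le_insert' t P
    linarith
  have hPt : P * star t = star t := by
    have := congrArg star ht
    rwa [star_mul, hPs] at this
  have hle : (1 / 2 : ℝ) • P ≤ star t * t := by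
    have hs : IsSelfAdjoint (P - star t * t) := hP.isSelfAdjoint.sub (IsSelfAdjoint.star_mul_self t)
    have := corner_le (r := 1 / 2) hP hs (by
      rw [mul_sub, sub_mul, hPP, hPP, ← mul_assoc, hPt, mul_assoc, ht]) (by rw [norm_sub_rev]; linarith)
    have h3 : P = (1 / 2 : ℝ) • P + (1 / 2 : ℝ) • P := by rw [← add_smul]; norm_num
    calc (1 / 2 : ℝ) • P = P - (1 / 2 : ℝ) • P := by nth_rw 2 [h3]; abel
      _ ≤ star t * t := by rw [sub_le_comm]; exact this
  obtain ⟨V, w, hV, -, hK, hd⟩ := corner hP ht (by norm_num : (0:ℝ) < 1 / 2) hle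
  refine ⟨V, hV, hK, ?_⟩
  have hd' := hd (by linarith)
  have h4 : ‖V - t‖ ≤ 7 * ζ := by
    refine hd'.trans ?_
    have : 2 * ‖t‖ * ‖star t * t - P‖ ≤ 2 * (1 + ζ) * (3 * ζ) := by gcongr
    nlinarith
  have h5 : ‖V - P‖ ≤ 8 * ζ := by
    have : V - P = (V - t) + (t - P) := by abel
    rw [this]; exact (norm_add_le _ _).trans (by linarith)
  have h6 : ‖star V - P‖ ≤ 8 * ζ := by
    rw [← norm_star, star_sub, star_star, hPs]; exact h5
  have := norm_sq_diff h6 hn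
  rw [star_star, hPs, hPP] at this
  nlinarith

/-- the data produced by `divide` -/
structure Divided (p p' pa pb : A) : Prop where
  hp : IsStarProjection p
  hp' : IsStarProjection p'
  hpa : IsStarProjection pa
  hpb : IsStarProjection pb
  o1 : p' * pa = 0
  o2 : p' * pb = 0
  o3 : pa * pb = 0
  s1 : p * p' = p'
  s2 : p * pa = pa
  s3 : p * pb = pb
  tr : ∀ τ : A →ₗ[ℝ] ℝ, IsTr τ → τ pa = 1000 * τ p' ∧ τ pb = 1000 * τ p' ∧ τ p ≤ 4002 * τ p'

theorem proj_transport {P V x : A} (hP : IsStarProjection P) (hV : star V * V = P) (hx : IsStarProjection x)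
    (hPx : P * x = x) : IsStarProjection (V * x * star V) := by
  have hxx : x * x = x := hx.isIdempotentElem
  constructor
  · rw [IsIdempotentElem]
    calc V * x * star V * (V * x * star V) = V * (x * ((star V * V) * x)) * star V := by noncomm_ring
      _ = _ := by rw [hV, hPx, hxx]
  · rw [IsSelfAdjoint, star_mul, star_mul, star_star, hx.isSelfAdjoint.star_eq, mul_assoc]

theorem Divided.transport {p p' pa pb V : A} (h : Divided p p' pa pb) (hV : star V * V = p) :
    Divided (V * star V) (V * p' * star V) (V * pa * star V) (V * pb * star V) := by
  have hpp : p * p = p := h.hp.isIdempotentElem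
  have hVp : V * p = V := pi_mul h.hp hV
  have mulz : ∀ x z : A, p * z = z → V * x * star V * (V * z * star V) = V * (x * z) * star V := by
    intro x z hz
    calc V * x * star V * (V * z * star V) = V * (x * ((star V * V) * z)) * star V := by noncomm_ring
      _ = _ := by rw [hV, hz]
  have e : V * star V = V * p * star V := by rw [hVp]
  have trz : ∀ x, IsStarProjection x → p * x = x → ∀ τ : A →ₗ[ℝ] ℝ, IsTr τ → τ (V * x * star V) = τ x := by
    intro x hx hpx τ hτ
    have hxx : x * x = x := hx.isIdempotentElem
    have := hτ.tr (V * x)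
    rw [star_mul, hx.isSelfAdjoint.star_eq] at this
    have e1 : V * x * (x * star V) = V * x * star V := by rw [mul_assoc V, ← mul_assoc x x, hxx, mul_assoc]
    have e2 : x * star V * (V * x) = x := by rw [mul_assoc, ← mul_assoc (star V), hV, hpx, hxx]
    rw [e1, e2] at this
    exact this.symm
  refine ⟨?_, proj_transport h.hp hV h.hp' h.s1, proj_transport h.hp hV h.hpa h.s2,
    proj_transport h.hp hV h.hpb h.s3, ?_, ?_, ?_, ?_, ?_, ?_, ?_⟩
  · rw [e]; exact proj_transport h.hp hV h.hp hpp
  · rw [mulz _ _ h.s2, h.o1, mul_zero, zero_mul]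
  · rw [mulz _ _ h.s3, h.o2, mul_zero, zero_mul]
  · rw [mulz _ _ h.s3, h.o3, mul_zero, zero_mul]
  · rw [e, mulz _ _ h.s1, h.s1]
  · rw [e, mulz _ _ h.s2, h.s2]
  · rw [e, mulz _ _ h.s3, h.s3]
  · intro τ hτ
    rw [trz _ h.hpa h.s2 τ hτ, trz _ h.hpb h.s3 τ hτ, trz _ h.hp' h.s1 τ hτ, e, trz _ h.hp hpp τ hτ]
    exact h.tr τ hτ

theorem T_lower {C : NonUnitalStarSubalgebra ℂ A} (D : FDData C) {P : A} (hPC : P ∈ C)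
    (hP : IsStarProjection P) {M : ℕ} (hM : (M : ℝ) = 8004) (R : Fin M → A) (hRC : ∀ j, R j ∈ C) (hR : ∀ j, IsStarProjection (R j))
    (h1 : ∀ j, ‖(1 - P) * R j * (1 - P)‖ ≤ 1 / 2)
    (h2 : ∀ i j, i ≠ j → ‖R i * R j‖ ≤ 1 / 8004 / 8004) (k : D.κ) (h3 : ∀ j, 1 ≤ D.T k (R j)) :
    2001 ≤ D.T k P := by
  classical
  have hPP : P * P = P := hP.isIdempotentElem
  have hPs : star P = P := hP.isSelfAdjoint.star_eq
  set S := ∑ j, R j with hS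
  have hS0 : 0 ≤ S := Finset.sum_nonneg fun j _ => (hR j).nn
  have hSs := IsSelfAdjoint.of_nonneg hS0
  have hSn : ‖S‖ ≤ 2 := by
    have e : S * S - S = ∑ i, ∑ j, if i = j then 0 else R i * R j := by
      have : S * S = ∑ i, ∑ j, ((if i = j then R i else 0) + if i = j then 0 else R i * R j) := by
        rw [hS, Finset.sum_mul]
        refine Finset.sum_congr rfl fun i _ => ?_
        rw [Finset.mul_sum]
        refine Finset.sum_congr rfl fun j _ => ?_
        by_cases h : i = j
        · subst h; simp [(hR i).isIdempotentElem.eq]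
        · simp [h]
      rw [this]
      simp only [Finset.sum_add_distrib]
      rw [sub_eq_iff_eq_add, add_comm]
      congr 1
      rw [hS]
      exact Finset.sum_congr rfl fun i _ => by simp
    have hn : ‖S * S - S‖ ≤ 1 := by
      rw [e]
      have hb : ∀ i j, ‖if i = j then 0 else R i * R j‖ ≤ (1 / 8004 / 8004 : ℝ) := by
        intro i j
        split_ifs with h
        · rw [norm_zero]; norm_num
        · exact h2 i j h
      refine (norm_sum_le_of_le _ fun i _ => norm_sum_le_of_le _ fun j _ => hb i j).trans ?_
      simp only [Finset.sum_const, Finset.card_univ, Fintype.card_fin, nsmul_eq_mul, hM]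
      norm_num
    have hsq : ‖S * S‖ = ‖S‖ * ‖S‖ := by
      have := CStarRing.norm_star_mul_self (x := S)
      rwa [hSs.star_eq] at this
    have : ‖S * S‖ ≤ 1 + ‖S‖ := by
      have e2 : S * S = (S * S - S) + S := by abel
      rw [e2]; exact (norm_add_le _ _).trans (by linarith)
    nlinarith [norm_nonneg S]
  have hup : D.T k (P * S * P) ≤ 2 * D.T k P := by
    have := conj_le (le_smul_one hSs hSn) P
    rw [hPs, mul_smul_comm, mul_one, smul_mul_assoc, hPP] at this
    have := D.T_mono k this
    rwa [map_smul, smul_eq_mul] at this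
  have hlow : ∀ j, 1 / 2 ≤ D.T k (P * R j * P) := by
    intro j
    have hRR : R j * R j = R j := (hR j).isIdempotentElem
    have hRs : star (R j) = R j := (hR j).isSelfAdjoint.star_eq
    have hQ := hP.one_sub
    have hn : ‖R j * (1 - P) * R j‖ ≤ 1 / 2 := by
      have a1 := CStarRing.norm_star_mul_self (x := (1 - P) * R j)
      have a2 := CStarRing.norm_self_mul_star (x := (1 - P) * R j)
      rw [star_mul, hRs, hQ.isSelfAdjoint.star_eq] at a1 a2
      have b1 : R j * (1 - P) * ((1 - P) * R j) = R j * (1 - P) * R j := by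
        rw [mul_assoc, ← mul_assoc (1 - P), hQ.isIdempotentElem.eq, ← mul_assoc]
      have b2 : (1 - P) * R j * (R j * (1 - P)) = (1 - P) * R j * (1 - P) := by
        rw [mul_assoc, ← mul_assoc (R j), hRR, ← mul_assoc]
      rw [b1] at a1
      rw [b2] at a2
      rw [a1, ← a2]; exact h1 j
    have hs : IsSelfAdjoint (R j * (1 - P) * R j) := by
      rw [IsSelfAdjoint, star_mul, star_mul, hRs, hQ.isSelfAdjoint.star_eq, mul_assoc]
    have hle := corner_le (hR j) hs (by
      calc R j * (R j * (1 - P) * R j) * R j = (R j * R j) * (1 - P) * (R j * R j) := by noncomm_ring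
        _ = _ := by rw [hRR]) hn
    have e : R j * (1 - P) * R j = R j - R j * P * R j := by
      rw [mul_sub, sub_mul, mul_one, hRR]
    rw [e] at hle
    have := D.T_mono k hle
    rw [map_sub, map_smul, smul_eq_mul] at this
    have t1 : D.T k (R j * P * R j) = D.T k (P * R j) := by
      rw [D.tr k _ (mul_mem (hRC j) hPC) _ (hRC j), ← mul_assoc, hRR, D.tr k _ (hRC j) _ hPC]
    have t2 : D.T k (P * R j * P) = D.T k (P * R j) := by
      rw [D.tr k _ (mul_mem hPC (hRC j)) _ hPC, ← mul_assoc, hPP]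
    rw [t2, ← t1]
    linarith [h3 j]
  have hsum : D.T k (P * S * P) = ∑ j, D.T k (P * R j * P) := by
    rw [hS, Finset.mul_sum, Finset.sum_mul, map_sum]
  have : ∑ j : Fin M, (1 / 2 : ℝ) ≤ ∑ j, D.T k (P * R j * P) := Finset.sum_le_sum fun j _ => hlow j
  simp only [Finset.sum_const, Finset.card_univ, Fintype.card_fin, nsmul_eq_mul, hM] at this
  norm_num at this
  linarith

theorem good_block {C : NonUnitalStarSubalgebra ℂ A} (D : FDData C) {Q : A} (hQC : Q ∈ C)
    (hQ : IsStarProjection Q) (S : Finset D.κ) (hS : ∀ k, k ∉ S → D.T k Q = 0) : D.z S * Q = Q := by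
  have hz := D.z_proj S
  have hc := D.z_comm S Q hQC
  have hQQ : Q * Q = Q := hQ.isIdempotentElem
  have hzz : D.z S * D.z S = D.z S := hz.isIdempotentElem
  have hpr : IsStarProjection (Q - D.z S * Q) := by
    constructor
    · rw [IsIdempotentElem, mul_sub, sub_mul, sub_mul, hQQ]
      have e1 : D.z S * Q * Q = D.z S * Q := by rw [mul_assoc, hQQ]
      have e2 : Q * (D.z S * Q) = D.z S * Q := by rw [← mul_assoc, ← hc, e1]
      have e3 : D.z S * Q * (D.z S * Q) = D.z S * Q := by
        rw [mul_assoc, e2, ← mul_assoc, hzz]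
      rw [e1, e2, e3]; abel
    · rw [IsSelfAdjoint, star_sub, star_mul, hQ.isSelfAdjoint.star_eq, hz.isSelfAdjoint.star_eq, hc]
  obtain ⟨w, -, hw, h0⟩ := D.compare (Q - D.z S * Q) 0 (sub_mem hQC (mul_mem (D.z_mem S) hQC)) hpr
    (zero_mem C) ⟨by simp [IsIdempotentElem], by simp⟩ (fun k => by
      rw [map_sub, D.T_z, map_zero]
      split_ifs with h
      · simp
      · rw [hS k h]; simp)
  rw [zero_mul] at h0
  rw [← h0, mul_zero] at hw
  exact (sub_eq_zero.mp hw.symm).symm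

variable {I : Type*} {l : Filter I} {C : I → NonUnitalStarSubalgebra ℂ A} {e1 e2 e3 Q : bdFam I A}

set_option maxHeartbeats 1000000 in
theorem color_proj [Nontrivial A] (hcol : IsCol l C e1 e2 e3 Q) (hS : IsSimpleCStarAlgebra A)
    (hpc : ∀ y : A, 0 ≤ y → y ≠ 0 → HasPieces y) {y g : A} (hy0 : 0 ≤ y) (hy1 : y ≤ 1) (hyn : y ≠ 0)
    (hg : IsSelfAdjoint g) (hgg : g * g = y) {δ : ℝ} (hδ : 0 < δ) :
    ∀ᶠ i in l, ∃ p p' pa pb : A, Divided p p' pa pb ∧ (∃ K : ℝ, 0 ≤ K ∧ p ≤ K • (y * y)) ∧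
      g * (e1.1 i * e1.1 i) * g ≤ p + δ • 1 := by
  obtain ⟨M, hM⟩ : ∃ M : ℕ, (M : ℝ) = 8004 := ⟨8004, by norm_num⟩
  have hM0 : 0 < M := by
    rcases Nat.eq_zero_or_pos M with h | h
    · rw [h] at hM; norm_num at hM
    · exact h
  obtain ⟨y0, hyC, hynn, hycl, hynorm, -⟩ := col_full hcol hy0 hy1 (full_aux hS hy0 hyn)
  obtain ⟨x, hx0, hxn, hxs, hxo⟩ := many_pieces hpc M y hy0 hyn
  have hxy : ∀ j, x j ≤ y := fun j => (Finset.single_le_sum (fun k _ => hx0 k) (Finset.mem_univ j)).trans hxs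
  choose X hXC hXnn hXcl hXnorm K hK δ0 hδ0 hF using fun j =>
    col_full hcol (hx0 j) ((hxy j).trans hy1) (full_aux hS (hx0 j) (hxn j))
  haveI : Nonempty (Fin M) := ⟨⟨0, hM0⟩⟩
  obtain ⟨δ1, hδ1, hδ1le⟩ : ∃ δ1 : ℝ, 0 < δ1 ∧ ∀ j, δ1 ≤ δ0 j := by
    obtain ⟨j0, h⟩ := Finite.exists_min δ0
    exact ⟨δ0 j0, hδ0 j0, h⟩
  obtain ⟨s, hsC, hs, hQs⟩ := hcol.b2 g
  have hE2 : star e2 = e2 := bd_star_eq fun i => (hcol.p2 i).1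
  have hs' := cl_star_br hs hE2 hcol.c2
  rw [hg.star_eq] at hs'
  have k2 := cl_comm hcol.c2
  have k2' := cl_comm' hcol.c2
  have k3 := cl_comm hcol.c3
  have k3' := cl_comm' hcol.c3
  have hI1 : cl l (s * star s) = cl l (cst I g * (e2 * e2) * cst I g) := by
    simp only [map_mul, hs, hs']
    simp only [mul_assoc, k2, k2']
  have hI2 : cl l y0 = cl l (cst I g * (e3 * e3) * cst I g) := by
    rw [hycl, ← hgg]
    simp only [map_mul, mul_assoc, k3, k3']
  have hI4 : ∀ i j, i ≠ j → cl l (X i * X j) = cl l 0 := by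
    intro i j hij
    have h0 : cl l (cst I (x i)) * cl l (cst I (x j)) = 0 := by
      rw [← map_mul, ← map_mul, hxo i j hij, map_zero, map_zero]
    rw [map_mul, hXcl, hXcl, map_zero]
    simp only [map_mul, mul_assoc, k3, k3', h0, mul_zero]
  have hI6 : cl l (cst I y * (e3 * e3)) = cl l y0 := by
    rw [hycl]
    simp only [map_mul, mul_assoc, k3, k3']
  set δ2 := min (δ / 8) (δ1 / 8) with hδ2d
  have hδ2 : 0 < δ2 := lt_min (by positivity) (by positivity)
  have hδ2a : δ2 ≤ δ / 8 := min_le_left _ _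
  have hδ2b : δ2 ≤ δ1 / 8 := min_le_right _ _
  set η := min (δ / 16) (min (δ1 / 8) (1 / 4)) with hηd
  have hη : 0 < η := lt_min (by positivity) (lt_min (by positivity) (by norm_num))
  have hηa : η ≤ δ / 16 := min_le_left _ _
  have hηb : η ≤ δ1 / 8 := (min_le_right _ _).trans (min_le_left _ _)
  have hηc : η ≤ 1 / 4 := (min_le_right _ _).trans (min_le_right _ _)
  set ζ := min (δ / 96) (1 / 100) with hζd
  have hζ : 0 < ζ := lt_min (by positivity) (by norm_num)
  have hζa : ζ ≤ δ / 96 := min_le_left _ _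
  have hζb : ζ ≤ 1 / 100 := min_le_right _ _
  have evX : ∀ᶠ i in l, ∀ a b, a ≠ b → ‖(X a * X b).1 i - (0 : bdFam I A).1 i‖ ≤ δ1 * δ1 * (1 / 8004 / 8004) :=
    eventually_all.mpr fun a => eventually_all.mpr fun b => by
      by_cases h : a = b
      · exact Eventually.of_forall fun i hh => absurd h hh
      · filter_upwards [cl_ev (hI4 a b h) (show 0 < δ1 * δ1 * (1 / 8004 / 8004) by positivity)] with i hi _
        exact hi
  filter_upwards [eventually_all.mpr hF, eventually_all.mpr fun j => hXnorm j (1 / 4) (by norm_num),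
    eventually_all.mpr fun j => cl_ev (hXcl j) hη, cl_ev hycl hη, evX, hynorm η hη, cl_ev hI1 hη, cl_ev hI2 hη,
    cl_ev hI6 (show 0 < ζ * δ2 by positivity)] with i fF fXn fX fy fXX fn f1 f2 f6
  haveI := hcol.fd i
  obtain ⟨D⟩ := exists_FDData (C i)
  classical
  letI := D.fin
  set S : Finset D.κ := Finset.univ.filter fun k => D.T k (Q.1 i) ≠ 0 with hSd
  have ev : ∀ {x z : bdFam I A}, x = z → x.1 i = z.1 i := fun h => by rw [h]
  have hzQ := good_block D (hcol.mQ i) (hcol.pQ i) S (fun k hk => by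
    by_contra h; exact hk (by rw [hSd]; simp [h]))
  have hz := D.z_proj S
  have hzs := hz.isSelfAdjoint.star_eq
  have hzz : D.z S * D.z S = D.z S := hz.isIdempotentElem
  have hzsS : D.z S * s.1 i = s.1 i := by
    have h1 : Q.1 i * s.1 i = s.1 i := ev hQs
    rw [← h1, ← mul_assoc, hzQ]
  obtain ⟨P, L, hPC, hLC, hP, q1, -, -, q3, q4, -, -, -, q5⟩ := specproj (C i) (hyC i) (hynn i) hδ2
  have hPP : P * P = P := hP.isIdempotentElem
  have hPs : star P = P := hP.isSelfAdjoint.star_eq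
  choose R LR hRC hLRC hR r1 r2 r2' r3 r4 _r5 _r6 r7 _r8 using fun j => specproj (C i) (hXC j i) (hXnn j i) hδ1
  have hzP := D.z_comm S P hPC
  -- the trace of P is large on good blocks
  have hbig : ∀ k ∈ S, 2001 ≤ D.T k P := by
    intro k hk
    refine T_lower D hPC hP hM R hRC hR (fun j => ?_) (fun a b hab => ?_) k (fun j => ?_)
    · have hN := hP.one_sub
      have hNs := hN.isSelfAdjoint.star_eq
      have hsX := IsSelfAdjoint.of_nonneg (hXnn j i)
      have hsy := IsSelfAdjoint.of_nonneg (hynn i)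
      have hse := (IsSelfAdjoint.of_nonneg (hcol.p3 i).1).star_eq
      have hse3 : ∀ a : A, IsSelfAdjoint a → IsSelfAdjoint (e3.1 i * a * e3.1 i) := fun a ha => by
        rw [IsSelfAdjoint, star_mul, star_mul, hse, ha.star_eq, mul_assoc]
      have a1 : (X j).1 i ≤ e3.1 i * x j * e3.1 i + η • 1 :=
        le_of_norm_sub (η := η) hsX (hse3 _ (IsSelfAdjoint.of_nonneg (hx0 j))) (fX j)
      have a2 : e3.1 i * x j * e3.1 i ≤ e3.1 i * y * e3.1 i := by
        have := conj_le (hxy j) (e3.1 i); rwa [hse] at this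
      have a3 : e3.1 i * y * e3.1 i ≤ y0.1 i + η • 1 :=
        le_of_norm_sub (η := η) (hse3 _ (IsSelfAdjoint.of_nonneg hy0)) hsy (by rw [norm_sub_rev]; exact fy)
      have a4 : δ1 • R j ≤ y0.1 i + η • 1 + η • 1 :=
        (r7 j).trans (a1.trans (add_le_add (a2.trans a3) le_rfl))
      have a5 := conj_le a4 (1 - P)
      rw [hNs] at a5
      have a6 : (1 - P) * (y0.1 i + η • 1 + η • 1) * (1 - P) =
          (1 - P) * y0.1 i * (1 - P) + (2 * η) • (1 - P) := by
        have : (1 - P) * (1 - P) = 1 - P := hN.isIdempotentElem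
        rw [mul_add, mul_add, add_mul, add_mul, mul_smul_comm, mul_one, smul_mul_assoc, this, two_mul, add_smul]
        abel
      have a7 : (1 - P) * y0.1 i * (1 - P) ≤ δ2 • 1 := by
        refine le_smul_one ?_ q5
        rw [IsSelfAdjoint, star_mul, star_mul, hNs, hsy.star_eq, mul_assoc]
      have a8 : (2 * η) • (1 - P) ≤ (2 * η) • (1 : A) := smul_le_smul_of_nonneg_left hN.le1 (by positivity)
      have a9 : δ1 • ((1 - P) * R j * (1 - P)) ≤ (δ2 + 2 * η) • (1 : A) := by
        rw [add_smul, ← smul_mul_assoc, ← mul_smul_comm]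
        rw [a6] at a5
        exact a5.trans (add_le_add a7 a8)
      refine norm_le_of_le_smul ?_ (by norm_num) ?_
      · have := conj_le (hR j).nn (1 - P)
        rwa [hNs, mul_zero, zero_mul] at this
      · have b1 := smul_le_smul_of_nonneg_left a9 (show 0 ≤ δ1⁻¹ by positivity)
        rw [smul_smul, inv_mul_cancel₀ hδ1.ne', one_smul, smul_smul] at b1
        refine b1.trans (smul_le_smul_of_nonneg_right ?_ zero_le_one)
        rw [inv_mul_le_iff₀ hδ1]; linarith
    · have e : R a * R b = LR a * (X a * X b).1 i * LR b := by
        rw [bd_mul, ← r1 b, ← r2 a]; noncomm_ring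
      have h0 : ‖(X a * X b).1 i‖ ≤ δ1 * δ1 * (1 / 8004 / 8004) := by
        have := fXX a b hab
        have e0 : (0 : bdFam I A).1 i = 0 := rfl
        rwa [e0, sub_zero] at this
      rw [e]
      calc ‖LR a * (X a * X b).1 i * LR b‖ ≤ ‖LR a‖ * ‖(X a * X b).1 i‖ * ‖LR b‖ :=
            (norm_mul_le _ _).trans (mul_le_mul_of_nonneg_right (norm_mul_le _ _) (norm_nonneg _))
        _ ≤ (1 / δ1) * (δ1 * δ1 * (1 / 8004 / 8004)) * (1 / δ1) := by
            refine mul_le_mul (mul_le_mul (r3 a) h0 (norm_nonneg _) (by positivity)) (r3 b) (norm_nonneg _) (by positivity)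
        _ = 1 / 8004 / 8004 := by field_simp
    · have h1 := fF j D (R j) (hRC j) (hR j) δ1 hδ1.le (hδ1le j) ((r4 j).trans
        (add_le_add (smul_le_smul_of_nonneg_right (fXn j) (hR j).nn) le_rfl)) k
      have h2 : D.T k (Q.1 i) ≠ 0 := by rw [hSd] at hk; simpa using hk
      have h3 := D.pos k _ (hcol.pQ i).nn
      obtain ⟨n, hn⟩ := D.nat_T (R j) (hRC j) (hR j)
      rw [hn k] at h1 ⊢
      rcases Nat.eq_zero_or_pos (n k) with h | h
      · rw [h] at h1; simp at h1; exact absurd (le_antisymm h1 h3) h2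
      · exact_mod_cast h
  obtain ⟨Pt, hPt⟩ : ∃ Pt, Pt = D.z S * P := ⟨_, rfl⟩
  have hPtC : Pt ∈ C i := hPt ▸ mul_mem (D.z_mem S) hPC
  have hPtp : IsStarProjection Pt := by
    constructor
    · rw [IsIdempotentElem, hPt]
      calc D.z S * P * (D.z S * P) = D.z S * (P * D.z S) * P := by noncomm_ring
        _ = (D.z S * D.z S) * (P * P) := by rw [← hzP]; simp only [mul_assoc]
        _ = _ := by rw [hzz, hPP]
    · rw [IsSelfAdjoint, hPt, star_mul, hPs, hzs, hzP]
  obtain ⟨p', pa, pb, hp', hpa, hpb, o1, o2, o3, s1, s2, s3, htr⟩ := D.divide Pt hPtC hPtp (fun k => by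
    rw [hPt, D.T_z]
    split_ifs with h
    · exact Or.inr (hbig k h)
    · exact Or.inl rfl)
  have hDiv : Divided Pt p' pa pb := ⟨hPtp, hp', hpa, hpb, o1, o2, o3, s1, s2, s3, htr⟩
  -- perturb into the hereditary subalgebra of y
  have hPtP : Pt = y0.1 i * (L * D.z S) := by rw [← mul_assoc, q1, hPt, hzP]
  have hPtt : Pt * Pt = Pt := hPtp.isIdempotentElem
  set W := e3.1 i * e3.1 i * (L * D.z S) * Pt with hW
  set t := y * W with ht
  have htP : t * Pt = t := by rw [ht, hW, mul_assoc, mul_assoc, hPtt]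
  have htn : ‖t - Pt‖ ≤ ζ := by
    have e : t - Pt = (((cst I y * (e3 * e3)).1 i - y0.1 i) * L) * (D.z S * Pt) := by
      have : Pt = y0.1 i * (L * D.z S) * Pt := by rw [← hPtP, hPtt]
      nth_rw 1 [this]
      rw [ht, hW]
      simp only [bd_mul, cst_apply]
      noncomm_ring
    rw [e]
    have n1 : ‖D.z S * Pt‖ ≤ 1 := by
      refine (norm_mul_le _ _).trans ?_
      have := hz.nrm; have := hPtp.nrm
      nlinarith [norm_nonneg (D.z S), norm_nonneg Pt]
    have n2 : ‖((cst I y * (e3 * e3)).1 i - y0.1 i) * L‖ ≤ ζ := by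
      refine (norm_mul_le _ _).trans ((mul_le_mul f6 q3 (norm_nonneg _) (by positivity)).trans (le_of_eq ?_))
      field_simp
    refine (norm_mul_le _ _).trans ?_
    nlinarith [norm_nonneg (((cst I y * (e3 * e3)).1 i - y0.1 i) * L), norm_nonneg (D.z S * Pt)]
  obtain ⟨V, hV, ⟨K1, hK1, hVK⟩, hVn⟩ := perturb_proj hPtp htP hζb htn
  refine ⟨V * star V, _, _, _, hDiv.transport hV, ⟨K1 * ‖W‖ ^ 2, by positivity, ?_⟩, ?_⟩
  · refine hVK.trans ?_
    rw [mul_smul]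
    refine smul_le_smul_of_nonneg_left ?_ hK1
    have := conj_le' (mul_star_le_one (a := W) le_rfl) y
    rw [(IsSelfAdjoint.of_nonneg hy0).star_eq, mul_smul_comm, mul_one, smul_mul_assoc] at this
    refine le_trans (le_of_eq ?_) this
    rw [ht, star_mul, (IsSelfAdjoint.of_nonneg hy0).star_eq]; noncomm_ring
  · have se2 := (IsSelfAdjoint.of_nonneg (hcol.p2 i).1).star_eq
    have se3 := (IsSelfAdjoint.of_nonneg (hcol.p3 i).1).star_eq
    have sg : ∀ a : A, IsSelfAdjoint a → IsSelfAdjoint (g * a * g) := fun a ha => by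
      rw [IsSelfAdjoint, star_mul, star_mul, hg.star_eq, ha.star_eq, mul_assoc]
    have sq2 : IsSelfAdjoint (e2.1 i * e2.1 i) := by rw [IsSelfAdjoint, star_mul, se2]
    have sq3 : IsSelfAdjoint (e3.1 i * e3.1 i) := by rw [IsSelfAdjoint, star_mul, se3]
    have sqle : ∀ e : A, 0 ≤ e → e ≤ 1 → e * e ≤ 1 := fun e h0 h1 => by
      have := star_mul_le_one (a := e) (r := 1) (norm_le_one_of h0 h1)
      rwa [(IsSelfAdjoint.of_nonneg h0).star_eq, one_pow, one_smul] at this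
    have b1 : e1.1 i * e1.1 i ≤ e2.1 i * e2.1 i := by
      have h := conj_le (sqle _ (hcol.p1 i).1 (hcol.p1 i).2) (e2.1 i)
      rw [se2, mul_one] at h
      have x1 : e2.1 i * e1.1 i = e1.1 i := ev hcol.h21
      have x2 : e1.1 i * e2.1 i = e1.1 i := ev hcol.h12
      refine le_trans (le_of_eq ?_) h
      rw [← mul_assoc, x1, mul_assoc, x2]
    have b2 : e2.1 i * e2.1 i ≤ e3.1 i * e3.1 i := by
      have h := conj_le (sqle _ (hcol.p2 i).1 (hcol.p2 i).2) (e3.1 i)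
      rw [se3, mul_one] at h
      have x1 : e3.1 i * e2.1 i = e2.1 i := ev hcol.h32
      have x2 : e2.1 i * e3.1 i = e2.1 i := ev hcol.h23
      refine le_trans (le_of_eq ?_) h
      rw [← mul_assoc, x1, mul_assoc, x2]
    have cg : ∀ {a b : A}, a ≤ b → g * a * g ≤ g * b * g := fun h => by
      have := conj_le h g; rwa [hg.star_eq] at this
    have ss : IsSelfAdjoint (s.1 i * star (s.1 i)) := IsSelfAdjoint.mul_star_self _
    simp only [bd_mul, bd_star, cst_apply] at f1 f2
    have c1 : g * (e2.1 i * e2.1 i) * g ≤ s.1 i * star (s.1 i) + η • 1 :=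
      le_of_norm_sub (η := η) (sg _ sq2) ss (by rw [norm_sub_rev]; exact f1)
    have c2 : s.1 i * star (s.1 i) ≤ g * (e2.1 i * e2.1 i) * g + η • 1 :=
      le_of_norm_sub (η := η) ss (sg _ sq2) f1
    have c3 : g * (e3.1 i * e3.1 i) * g ≤ y0.1 i + η • 1 :=
      le_of_norm_sub (η := η) (sg _ sq3) (IsSelfAdjoint.of_nonneg (hynn i)) (by rw [norm_sub_rev]; exact f2)
    have c4 : s.1 i * star (s.1 i) ≤ (1 + η) • P + (δ2 + 2 * η) • 1 := by
      refine c2.trans ((add_le_add ((cg b2).trans c3) le_rfl).trans ?_)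
      have := q4.trans (add_le_add (smul_le_smul_of_nonneg_right fn hP.nn) le_rfl)
      refine (add_le_add (add_le_add this le_rfl) le_rfl).trans (le_of_eq ?_)
      module
    have c5 : s.1 i * star (s.1 i) ≤ (1 + η) • Pt + (δ2 + 2 * η) • 1 := by
      have h := conj_le c4 (D.z S)
      have e : star (D.z S) * (s.1 i * star (s.1 i)) * D.z S = s.1 i * star (s.1 i) := by
        have h2 : star (s.1 i) * D.z S = star (s.1 i) := by
          have := congrArg star hzsS
          rwa [star_mul, hzs] at this
        rw [hzs, ← mul_assoc, hzsS, mul_assoc, h2]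
      rw [e] at h
      refine h.trans ?_
      have e2 : star (D.z S) * ((1 + η) • P + (δ2 + 2 * η) • 1) * D.z S =
          (1 + η) • Pt + (δ2 + 2 * η) • D.z S := by
        have e3 : D.z S * P * D.z S = Pt := by rw [mul_assoc, ← hzP, ← mul_assoc, hzz, hPt]
        rw [hzs, mul_add, add_mul, mul_smul_comm, mul_smul_comm, smul_mul_assoc, smul_mul_assoc, mul_one, hzz, e3]
      rw [e2]
      exact add_le_add le_rfl (smul_le_smul_of_nonneg_left hz.le1 (by positivity))
    have c6 : Pt ≤ V * star V + (24 * ζ) • 1 :=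
      le_of_norm_sub (η := 24 * ζ) hPtp.isSelfAdjoint (IsSelfAdjoint.mul_star_self _) (by rw [norm_sub_rev]; exact hVn)
    have c7 : η • Pt ≤ η • (1 : A) := smul_le_smul_of_nonneg_left hPtp.le1 hη.le
    calc g * (e1.1 i * e1.1 i) * g ≤ s.1 i * star (s.1 i) + η • 1 := (cg b1).trans c1
      _ ≤ (1 + η) • Pt + (δ2 + 2 * η) • 1 + η • 1 := add_le_add c5 le_rfl
      _ = Pt + η • Pt + (δ2 + 3 * η) • 1 := by module
      _ ≤ (V * star V + (24 * ζ) • 1) + η • 1 + (δ2 + 3 * η) • 1 := add_le_add (add_le_add c6 c7) le_rfl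
      _ = V * star V + (24 * ζ + δ2 + 4 * η) • 1 := by module
      _ ≤ V * star V + δ • 1 := add_le_add le_rfl (smul_le_smul_of_nonneg_right (by linarith) zero_le_one)
end ColProj


section Frac
variable {A : Type u} [CStarAlgebra A] [PartialOrder A] [StarOrderedRing A]

/-- domination up to a scalar -/
def Dom (x y : A) : Prop := ∃ c : ℝ, 0 ≤ c ∧ x ≤ c • y

theorem Dom.of_le {x y : A} (h : x ≤ y) : Dom x y := ⟨1, zero_le_one, by rwa [one_smul]⟩
theorem Dom.trans {x y z : A} (h1 : Dom x y) (h2 : Dom y z) : Dom x z := by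
  obtain ⟨a, ha, h1⟩ := h1
  obtain ⟨b, hb, h2⟩ := h2
  exact ⟨a * b, by positivity, h1.trans (by rw [mul_smul]; exact smul_le_smul_of_nonneg_left h2 ha)⟩
theorem Dom.add {x y z : A} (h1 : Dom x z) (h2 : Dom y z) : Dom (x + y) z := by
  obtain ⟨a, ha, h1⟩ := h1
  obtain ⟨b, hb, h2⟩ := h2
  exact ⟨a + b, by positivity, by rw [add_smul]; exact add_le_add h1 h2⟩
theorem Dom.smul {x z : A} (h1 : Dom x z) {c : ℝ} (hc : 0 ≤ c) : Dom (c • x) z := by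
  obtain ⟨a, ha, h1⟩ := h1
  exact ⟨c * a, by positivity, by rw [mul_smul]; exact smul_le_smul_of_nonneg_left h1 hc⟩
theorem Dom.left {x y : A} (hy : 0 ≤ y) : Dom x (x + y) := Dom.of_le (le_add_of_nonneg_right hy)
theorem Dom.right {x y : A} (hx : 0 ≤ x) : Dom y (x + y) := Dom.of_le (le_add_of_nonneg_left hx)
theorem Dom.rfl' (x : A) : Dom x x := Dom.of_le le_rfl

theorem Dom.mul_zero {x y z : A} (h : Dom x y) (hx : 0 ≤ x) (hz : y * z = 0) : x * z = 0 := by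
  obtain ⟨c, -, h⟩ := h
  exact mul_zero_of_le hx h hz
theorem Dom.zero_mul {x y z : A} (h : Dom x y) (hx : 0 ≤ x) (hy : IsSelfAdjoint y) (hz : z * y = 0) : z * x = 0 := by
  obtain ⟨c, -, h⟩ := h
  exact zero_mul_of_le hx hy h hz

theorem sq_le_self {y : A} (h0 : 0 ≤ y) (h1 : y ≤ 1) : y * y ≤ y := by
  obtain ⟨g, hg⟩ := CStarAlgebra.nonneg_iff_eq_star_mul_self.mp h0
  have hn : ‖g‖ ≤ 1 := by
    have := norm_le_one_of h0 h1
    rw [hg, CStarRing.norm_star_mul_self] at this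
    nlinarith [norm_nonneg g]
  have := conj_le (mul_star_le_one (a := g) (r := 1) hn) g
  rw [one_pow, one_smul, mul_one, ← hg] at this
  refine le_trans (le_of_eq ?_) this
  nth_rw 1 [hg]; nth_rw 1 [hg]; noncomm_ring

theorem conj_add_le {x : A} (hx : 0 ≤ x) (c d : A) :
    star (c + d) * x * (c + d) ≤ (2:ℝ) • (star c * x * c) + (2:ℝ) • (star d * x * d) := by
  have h := conj_le hx (c - d)
  rw [mul_zero, zero_mul] at h
  have e : (2:ℝ) • (star c * x * c) + (2:ℝ) • (star d * x * d) - star (c + d) * x * (c + d) =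
      star (c - d) * x * (c - d) := by
    rw [two_smul, two_smul, star_add, star_sub]; noncomm_ring
  rw [← sub_nonneg, e]; exact h

theorem IsTr.conj_le {τ : A →ₗ[ℝ] ℝ} (hτ : IsTr τ) {x c : A} (hx : 0 ≤ x) (hc : IsStarProjection c) :
    τ (c * x * c) ≤ τ x := by
  obtain ⟨g, hg⟩ := CStarAlgebra.nonneg_iff_eq_star_mul_self.mp hx
  have hcc : c * c = c := hc.isIdempotentElem
  have hcs := hc.isSelfAdjoint.star_eq
  have h1 := hτ.tr (g * c)
  have e1 : star (g * c) * (g * c) = c * x * c := by rw [hg, star_mul, hcs]; noncomm_ring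
  have e2 : (g * c) * star (g * c) = g * c * star g := by
    rw [star_mul, hcs]
    calc g * c * (c * star g) = g * (c * c) * star g := by noncomm_ring
      _ = _ := by rw [hcc]
  rw [e1, e2] at h1
  rw [h1, hg, hτ.tr g]
  apply hτ.mono
  have := conj_le' hc.le1 g
  rwa [mul_one] at this

theorem trace_sub {τ : A →ₗ[ℝ] ℝ} (hτ : IsTr τ) {f p q : A} (hf : IsStarProjection f) (hp : IsStarProjection p)
    (hq : IsStarProjection q) (h : Dom f (p + q)) : τ f ≤ τ p + τ q := by
  obtain ⟨c, hc, h⟩ := h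
  have hff : f * f = f := hf.isIdempotentElem
  have hfs := hf.isSelfAdjoint.star_eq
  set z := f * (p + q) * f + (1 - f) with hz
  have hle : (1 / (c + 1)) • (1 : A) ≤ z := by
    have h1 : f ≤ (c + 1) • (f * (p + q) * f) := by
      have h2 : f ≤ (c + 1) • (p + q) := h.trans
        (smul_le_smul_of_nonneg_right (by linarith) (add_nonneg hp.nn hq.nn))
      have := _root_.conj_le h2 f
      rwa [hfs, hff, hff, mul_smul_comm, smul_mul_assoc] at this
    have h2 : (1 / (c + 1)) • f ≤ f * (p + q) * f := by
      have := smul_le_smul_of_nonneg_left h1 (show 0 ≤ 1 / (c + 1) by positivity)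
      rwa [smul_smul, one_div_mul_cancel (by positivity), one_smul] at this
    have h3 : (1 / (c + 1)) • (1 - f) ≤ (1:ℝ) • (1 - f) :=
      smul_le_smul_of_nonneg_right (by rw [div_le_one (by positivity)]; linarith) hf.one_sub.nn
    calc (1 / (c + 1)) • (1 : A) = (1 / (c + 1)) • f + (1 / (c + 1)) • (1 - f) := by rw [← smul_add]; simp
      _ ≤ z := by rw [hz]; rw [one_smul] at h3; exact add_le_add h2 h3
  obtain ⟨w, hw, w1, -, hcomm, -⟩ := exists_inv_sqrt z (by positivity) hle
  have hfz : Commute f z := by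
    rw [Commute, SemiconjBy, hz, mul_add, add_mul, mul_sub, sub_mul, mul_one, one_mul, hff, ← mul_assoc, ← mul_assoc, hff,
      mul_assoc _ f f, hff]
  have hfw := hcomm f hfz
  have hws := (IsSelfAdjoint.of_nonneg hw).star_eq
  have key : star (p * f * w) * (p * f * w) + star (q * f * w) * (q * f * w) = f := by
    have hpp : p * p = p := hp.isIdempotentElem
    have hqq : q * q = q := hq.isIdempotentElem
    simp only [star_mul, hws, hfs, hp.isSelfAdjoint.star_eq, hq.isSelfAdjoint.star_eq]
    calc w * (f * p) * (p * f * w) + w * (f * q) * (q * f * w)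
        = w * (f * (p * p + q * q) * f) * w := by noncomm_ring
      _ = w * (f * z) * w := by
          rw [hpp, hqq, hz]
          congr 2
          rw [mul_add f (f * (p + q) * f), mul_sub, mul_one, hff, sub_self, add_zero, ← mul_assoc, ← mul_assoc, hff]
      _ = f * (w * z * w) := by rw [← mul_assoc, ← hfw.eq]; noncomm_ring
      _ = f := by rw [w1, mul_one]
  have aux : ∀ r, IsStarProjection r → star (r * f * w) * (r * f * w) ≤ f →
      τ (star (r * f * w) * (r * f * w)) ≤ τ r := by
    intro r hr hle
    set a := r * f * w with ha
    have hra : r * a = a := by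
      rw [ha, ← mul_assoc, ← mul_assoc, hr.isIdempotentElem.eq]
    have hn : ‖a‖ ≤ 1 := by
      have h1 := norm_le_one_of (star_mul_self_nonneg a) (hle.trans hf.le1)
      rw [CStarRing.norm_star_mul_self] at h1
      nlinarith [norm_nonneg a]
    rw [hτ.tr]
    apply hτ.mono
    have := conj_le' (mul_star_le_one (r := 1) hn) r
    rw [one_pow, one_smul, mul_one, hr.isSelfAdjoint.star_eq, hr.isIdempotentElem.eq] at this
    refine le_trans (le_of_eq ?_) this
    have h2 : star a * r = star a := by
      have := congrArg star hra
      rwa [star_mul, hr.isSelfAdjoint.star_eq] at this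
    rw [← mul_assoc r a, hra, mul_assoc a (star a) r, h2]
  have e := congrArg τ key
  rw [map_add] at e
  rw [← e]
  refine add_le_add (aux p hp ?_) (aux q hq ?_)
  · nth_rw 3 [← key]; exact le_add_of_nonneg_right (star_mul_self_nonneg _)
  · nth_rw 3 [← key]; exact le_add_of_nonneg_left (star_mul_self_nonneg _)

theorem two_proj [Nontrivial A] (hW : WeakCRLeOne A) (hS : IsSimpleCStarAlgebra A)
    (hpc : ∀ y : A, 0 ≤ y → y ≠ 0 → HasPieces y) {y : A} (hy0 : 0 ≤ y) (hy1 : y ≤ 1) (hyn : y ≠ 0)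
    {δ : ℝ} (hδ : 0 < δ) :
    ∃ p p' pa pb q q' qa qb : A, Divided p p' pa pb ∧ Divided q q' qa qb ∧ Dom p y ∧ Dom q y ∧
      y ≤ p + q + δ • 1 := by
  obtain ⟨I, l, hl, C, D, e1, e2, e3, Q, f1, f2, f3, R, hC, hD, hsum⟩ :=
    exists_two_cols hW (show (0:ℝ) < δ / 3 by positivity)
  set g := CFC.sqrt y with hg
  have hgs : IsSelfAdjoint g := IsSelfAdjoint.of_nonneg (CFC.sqrt_nonneg y)
  have hgg : g * g = y := CFC.sqrt_mul_sqrt_self y hy0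
  have h1 := color_proj hC hS hpc hy0 hy1 hyn hgs hgg (show (0:ℝ) < δ / 3 by positivity)
  have h2 := color_proj hD hS hpc hy0 hy1 hyn hgs hgg (show (0:ℝ) < δ / 3 by positivity)
  obtain ⟨i, hi, ⟨p, p', pa, pb, hp, ⟨K, hK, hpK⟩, hple⟩, ⟨q, q', qa, qb, hq, ⟨K', hK', hqK⟩, hqle⟩⟩ :=
    (hsum.and (h1.and h2)).exists
  have hsq := sq_le_self hy0 hy1
  refine ⟨p, p', pa, pb, q, q', qa, qb, hp, hq, Dom.trans ⟨K, hK, hpK⟩ (Dom.of_le hsq),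
    Dom.trans ⟨K', hK', hqK⟩ (Dom.of_le hsq), ?_⟩
  have h := conj_le hi g
  rw [hgs.star_eq, mul_one, hgg] at h
  refine h.trans ?_
  have e : g * (e1.1 i * e1.1 i + f1.1 i * f1.1 i + (δ / 3) • 1) * g =
      g * (e1.1 i * e1.1 i) * g + g * (f1.1 i * f1.1 i) * g + (δ / 3) • y := by
    rw [mul_add, mul_add, add_mul, add_mul, mul_smul_comm, mul_one, smul_mul_assoc, hgg]
  rw [e]
  have h3 : (δ / 3) • y ≤ (δ / 3) • (1 : A) := smul_le_smul_of_nonneg_left hy1 (by positivity)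
  refine (add_le_add (add_le_add hple hqle) h3).trans (le_of_eq ?_)
  module

theorem IsTr.faithful (hS : IsSimpleCStarAlgebra A) {τ : A →ₗ[ℝ] ℝ} (hτ : IsTr τ) {x : A} (hx : 0 ≤ x)
    (hx0 : x ≠ 0) : 0 < τ x := by
  obtain ⟨n, r, hr⟩ := full_aux hS hx hx0
  obtain ⟨g, hg⟩ := CStarAlgebra.nonneg_iff_eq_star_mul_self.mp hx
  have h1 : ∀ j, τ (star (r j) * x * r j) ≤ ‖r j‖ ^ 2 * τ x := by
    intro j
    have e : star (r j) * x * r j = star (g * r j) * (g * r j) := by rw [hg, star_mul]; noncomm_ring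
    have h2 : (g * r j) * star (g * r j) ≤ (‖r j‖ ^ 2) • (g * star g) := by
      have := conj_le' (mul_star_le_one (a := r j) le_rfl) g
      rw [mul_smul_comm, mul_one, smul_mul_assoc] at this
      refine le_trans (le_of_eq ?_) this
      rw [star_mul]; noncomm_ring
    rw [e, hτ.tr]
    refine (hτ.mono h2).trans (le_of_eq ?_)
    rw [map_smul, smul_eq_mul, ← hτ.tr, ← hg]
  have h2 := hτ.mono hr
  rw [hτ.one, map_sum] at h2
  have h3 : (1:ℝ) ≤ (∑ j, ‖r j‖ ^ 2) * τ x := by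
    rw [Finset.sum_mul]; exact h2.trans (Finset.sum_le_sum fun j _ => h1 j)
  by_contra h
  have h0 : τ x = 0 := le_antisymm (not_lt.mp h) (hτ.nonneg hx)
  rw [h0, mul_zero] at h3
  linarith

theorem sq_diff_proj {a b : A} (ha : IsStarProjection a) (hb : IsStarProjection b) (hab : a * b = 0) :
    (a - b) * (a - b) = a + b ∧ ‖a - b‖ ≤ 1 ∧ b * a = 0 := by
  have hba : b * a = 0 := by
    have := congrArg star hab
    rwa [star_mul, ha.isSelfAdjoint.star_eq, hb.isSelfAdjoint.star_eq, star_zero] at this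
  have e : (a - b) * (a - b) = a + b := by
    rw [mul_sub, sub_mul, sub_mul, hab, hba, ha.isIdempotentElem.eq, hb.isIdempotentElem.eq]; abel
  have hpr : IsStarProjection (a + b) := by
    refine ⟨?_, ha.isSelfAdjoint.add hb.isSelfAdjoint⟩
    rw [IsIdempotentElem, mul_add, add_mul, add_mul, hab, hba, ha.isIdempotentElem.eq, hb.isIdempotentElem.eq]; abel
  refine ⟨e, ?_, hba⟩
  have h := CStarRing.norm_star_mul_self (x := a - b)
  rw [star_sub, ha.isSelfAdjoint.star_eq, hb.isSelfAdjoint.star_eq, e] at h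
  have := hpr.nrm
  nlinarith [norm_nonneg (a - b)]

theorem neg_smul_one_le' {a : A} (ha : IsSelfAdjoint a) {r : ℝ} (h : ‖a‖ ≤ r) : -(r • (1 : A)) ≤ a := by
  have := le_smul_one ha.neg (r := r) (by rwa [norm_neg])
  rwa [neg_le] at this

/-- lower bound for the positive part of a compression -/
theorem plus_aux {τ : A →ₗ[ℝ] ℝ} (hτ : IsTr τ) {p' T c : A} (hp : IsStarProjection p') (hT : IsSelfAdjoint T)
    (hTn : ‖T‖ ≤ 11) (hc : IsStarProjection c) :
    τ (c * T * c) - 33 * τ p' ≤ τ (((1 - p') * T * (1 - p'))⁺) := by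
  have hps := hp.isSelfAdjoint.star_eq
  have hpp : p' * p' = p' := hp.isIdempotentElem
  set k := (1 - p') * T * (1 - p') with hk
  have hks : IsSelfAdjoint k := by
    rw [IsSelfAdjoint, hk, star_mul, star_mul, star_sub, star_one, hps, hT.star_eq, mul_assoc]
  set E := (22:ℝ) • p' + (1 / 11 : ℝ) • (T * p' * T) with hE
  have hE0 : 0 ≤ E := by
    have := conj_le hp.nn T
    rw [hT.star_eq, mul_zero, zero_mul] at this
    exact add_nonneg (smul_nonneg (by norm_num) hp.nn) (smul_nonneg (by norm_num) this)
  have h1 : T - E ≤ k := by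
    have a1 := conj_le hp.nn (T - (11:ℝ) • 1)
    rw [mul_zero, zero_mul] at a1
    have a2 := conj_le (neg_smul_one_le' hT hTn) p'
    have e1 : star p' * -((11:ℝ) • (1:A)) * p' = -((11:ℝ) • p') := by
      rw [hps, mul_neg, neg_mul, mul_smul_comm, mul_one, smul_mul_assoc, hpp]
    have e2 : star (T - (11:ℝ) • (1:A)) * p' * (T - (11:ℝ) • 1) =
        T * p' * T - (11:ℝ) • (p' * T + T * p') + (121:ℝ) • p' := by
      rw [star_sub, star_smul, star_one, hT.star_eq, star_trivial]
      simp only [sub_mul, mul_sub, smul_mul_assoc, mul_smul_comm, one_mul, mul_one, smul_add]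
      module
    rw [e2] at a1
    rw [e1, hps] at a2
    have a3 := smul_nonneg (show (0:ℝ) ≤ 1 / 11 by norm_num) a1
    rw [← sub_nonneg] at a2 ⊢
    refine (add_nonneg a2 a3).trans_eq ?_
    rw [hk, hE]
    simp only [sub_mul, mul_sub, mul_one, one_mul, smul_add, smul_sub, smul_smul]
    module
  have h2 : τ E ≤ 33 * τ p' := by
    have b1 : τ (T * p' * T) ≤ 121 * τ p' := by
      have b2 := hτ.tr (p' * T)
      have b3 : star (p' * T) * (p' * T) = T * p' * T := by
        rw [star_mul, hps, hT.star_eq]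
        calc T * p' * (p' * T) = T * (p' * p') * T := by noncomm_ring
          _ = _ := by rw [hpp]
      have b4 : p' * T * star (p' * T) ≤ (121:ℝ) • p' := by
        have := conj_le (mul_star_le_one hTn) p'
        rw [hps, mul_smul_comm, mul_one, smul_mul_assoc, hpp] at this
        norm_num at this
        refine le_trans (le_of_eq ?_) this
        rw [star_mul, hps]; noncomm_ring
      rw [b3] at b2
      rw [b2]
      have := hτ.mono b4
      rwa [map_smul, smul_eq_mul] at this
    rw [hE, map_add, map_smul, map_smul, smul_eq_mul, smul_eq_mul]
    linarith
  have hkp : k ≤ k⁺ := by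
    conv_lhs => rw [← CFC.posPart_sub_negPart k hks]
    exact sub_le_self _ (CFC.negPart_nonneg k)
  have h3 : τ (c * T * c) - τ (c * E * c) ≤ τ (c * k⁺ * c) := by
    rw [← map_sub]
    apply hτ.mono
    have := conj_le (h1.trans hkp) c
    rwa [hc.isSelfAdjoint.star_eq, mul_sub, sub_mul] at this
  have h4 := hτ.conj_le (CFC.posPart_nonneg k) hc
  have h5 := hτ.conj_le hE0 hc
  linarith

theorem plus_bound {τ : A →ₗ[ℝ] ℝ} (hτ : IsTr τ) {p' pa pb qa qb : A} (hp : IsStarProjection p')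
    (hpa : IsStarProjection pa) (hpb : IsStarProjection pb) (hqa : IsStarProjection qa)
    (hqb : IsStarProjection qb) (hpab : pa * pb = 0) (hqab : qa * qb = 0)
    (t1 : τ pa = 1000 * τ p') (t3 : τ qb = τ qa) :
    8 * τ qa ≤ τ (((1 - p') * ((pa - pb) + (10:ℝ) • (qa - qb)) * (1 - p'))⁺) := by
  obtain ⟨-, n1, hpba⟩ := sq_diff_proj hpa hpb hpab
  obtain ⟨-, n2, hqba⟩ := sq_diff_proj hqa hqb hqab
  have sS : IsSelfAdjoint (pa - pb) := hpa.isSelfAdjoint.sub hpb.isSelfAdjoint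
  have sR : IsSelfAdjoint (qa - qb) := hqa.isSelfAdjoint.sub hqb.isSelfAdjoint
  have sT : IsSelfAdjoint ((pa - pb) + (10:ℝ) • (qa - qb)) := sS.add (by
    rw [IsSelfAdjoint, star_smul, sR.star_eq, star_trivial])
  have nT : ‖(pa - pb) + (10:ℝ) • (qa - qb)‖ ≤ 11 := by
    refine (norm_add_le _ _).trans ?_
    rw [norm_smul]; norm_num; linarith
  have b1 := plus_aux hτ hp sT nT hqa
  have b2 := plus_aux hτ hp sT nT hpa
  have hpp := hpa.isIdempotentElem.eq
  have hqq := hqa.isIdempotentElem.eq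
  have c1 : 9 * τ qa ≤ τ (qa * ((pa - pb) + (10:ℝ) • (qa - qb)) * qa) := by
    have e : qa * ((pa - pb) + (10:ℝ) • (qa - qb)) * qa = qa * (pa - pb) * qa + (10:ℝ) • qa := by
      rw [mul_add, add_mul, mul_smul_comm, smul_mul_assoc, mul_sub qa qa, hqq, hqab, sub_zero, hqq]
    have h := conj_le (neg_smul_one_le' sS n1) qa
    rw [hqa.isSelfAdjoint.star_eq, one_smul, mul_neg, mul_one, neg_mul, hqq] at h
    have := hτ.mono h
    rw [map_neg] at this
    rw [e, map_add, map_smul, smul_eq_mul]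
    linarith
  have c2 : τ pa - 10 * τ qa ≤ τ (pa * ((pa - pb) + (10:ℝ) • (qa - qb)) * pa) := by
    have e : pa * ((pa - pb) + (10:ℝ) • (qa - qb)) * pa = pa + (10:ℝ) • (pa * qa * pa) - (10:ℝ) • (pa * qb * pa) := by
      rw [mul_add, add_mul, mul_smul_comm, smul_mul_assoc, mul_sub pa pa, hpp, hpab, sub_zero, hpp, mul_sub, sub_mul,
        smul_sub]
      abel
    have h1 : 0 ≤ τ (pa * qa * pa) := by
      have := conj_le hqa.nn pa
      rw [hpa.isSelfAdjoint.star_eq, mul_zero, zero_mul] at this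
      exact hτ.nonneg this
    have h2 := hτ.conj_le hqb.nn hpa
    rw [e, map_sub, map_add, map_smul, map_smul, smul_eq_mul, smul_eq_mul]
    linarith
  have := hτ.nonneg hqa.nn
  have := hτ.nonneg hp.nn
  rcases le_total (τ p' * 50) (τ qa) with h | h <;> linarith
end Frac


section Frac2
variable {A : Type u} [CStarAlgebra A] [PartialOrder A] [StarOrderedRing A]

theorem Dom.conj {x y : A} (h : Dom x y) (c : A) : Dom (star c * x * c) (star c * y * c) := by
  obtain ⟨a, ha, h⟩ := h
  refine ⟨a, ha, (conj_le h c).trans (le_of_eq ?_)⟩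
  rw [mul_smul_comm, smul_mul_assoc]

theorem Dom.one {x : A} (hx : IsSelfAdjoint x) : Dom x 1 := ⟨‖x‖, norm_nonneg _, le_smul_one hx le_rfl⟩

theorem IsStarProjection.le_of_mul {p q : A} (hp : IsStarProjection p) (hq : IsStarProjection q) (h : p * q = q) :
    q ≤ p := by
  have h2 : q * p = q := by
    have := congrArg star h
    rwa [star_mul, hp.isSelfAdjoint.star_eq, hq.isSelfAdjoint.star_eq] at this
  have := conj_le hq.le1 p
  rwa [hp.isSelfAdjoint.star_eq, h, h2, mul_one, hp.isIdempotentElem.eq] at this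

theorem IsStarProjection.add' {p q : A} (hp : IsStarProjection p) (hq : IsStarProjection q) (h : p * q = 0) :
    IsStarProjection (p + q) := by
  have h2 : q * p = 0 := by
    have := congrArg star h
    rwa [star_mul, hp.isSelfAdjoint.star_eq, hq.isSelfAdjoint.star_eq, star_zero] at this
  refine ⟨?_, hp.isSelfAdjoint.add hq.isSelfAdjoint⟩
  rw [IsIdempotentElem, mul_add, add_mul, add_mul, h, h2, hp.isIdempotentElem.eq, hq.isIdempotentElem.eq]; abel

theorem pi_proj {V q : A} (hq : IsStarProjection q) (h : star V * V = q) : IsStarProjection (V * star V) := by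
  have := proj_transport hq h hq hq.isIdempotentElem.eq
  rwa [pi_mul hq h] at this

theorem pos_scaled {k : A} (hk : IsSelfAdjoint k) (hn : ‖k‖ ≤ 11) :
    0 ≤ (1/11:ℝ) • k⁺ ∧ (1/11:ℝ) • k⁺ ≤ 1 ∧ 0 ≤ (1/11:ℝ) • k⁻ ∧ (1/11:ℝ) • k⁻ ≤ 1 ∧
    ((1/11:ℝ) • k⁺) * ((1/11:ℝ) • k⁻) = 0 ∧
    ((1/11:ℝ) • k⁺ + (1/11:ℝ) • k⁻) * ((1/11:ℝ) • k⁺ + (1/11:ℝ) • k⁻) = (1/121:ℝ) • (k * k) := by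
  have a0 := CFC.posPart_nonneg k
  have b0 := CFC.negPart_nonneg k
  have ab := CFC.posPart_mul_negPart k
  have ba := CFC.negPart_mul_posPart k
  have hkk := CFC.posPart_sub_negPart k hk
  have na := CStarAlgebra.norm_posPart_le k
  have nb := CStarAlgebra.norm_negPart_le k
  refine ⟨smul_nonneg (by norm_num) a0, le_one_of (smul_nonneg (by norm_num) a0) ?_,
    smul_nonneg (by norm_num) b0, le_one_of (smul_nonneg (by norm_num) b0) ?_, ?_, ?_⟩
  · rw [norm_smul]; norm_num; linarith
  · rw [norm_smul]; norm_num; linarith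
  · rw [smul_mul_smul_comm, ab, smul_zero]
  · have e1 : k * k = k⁺ * k⁺ + k⁻ * k⁻ := by
      nth_rw 1 2 [← hkk]
      rw [mul_sub, sub_mul, sub_mul, ab, ba]; abel
    rw [e1]
    simp only [mul_add, add_mul, smul_mul_smul_comm, ab, ba, smul_zero, smul_add]
    norm_num

theorem frac_e [Nontrivial A] (hW : WeakCRLeOne A) (hS : IsSimpleCStarAlgebra A)
    (hex : ∃ τ : A →ₗ[ℝ] ℝ, IsTr τ) {p p' pa pb q q' qa qb : A} (hp : Divided p p' pa pb)
    (hq : Divided q q' qa qb) :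
    ∃ e : A, IsStarProjection e ∧ Dom e (p + q) ∧ ∀ τ : A →ₗ[ℝ] ℝ, IsTr τ → τ e = τ p' + τ q' := by
  have pp := hp.hp.le_of_mul hp.hp' hp.s1
  have dp' : Dom p' (p + q) := (Dom.of_le pp).trans (Dom.left hq.hp.nn)
  by_cases hq0 : q' = 0
  · exact ⟨p', hp.hp', dp', fun τ _ => by rw [hq0, map_zero, add_zero]⟩
  obtain ⟨S, hSd⟩ : ∃ S, S = pa - pb := ⟨_, rfl⟩
  obtain ⟨R, hRd⟩ : ∃ S, S = qa - qb := ⟨_, rfl⟩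
  obtain ⟨T, hT⟩ : ∃ T, T = S + (10:ℝ) • R := ⟨_, rfl⟩
  obtain ⟨u, hu⟩ : ∃ u, u = 1 - p' := ⟨_, rfl⟩
  obtain ⟨k, hk⟩ : ∃ k, k = u * T * u := ⟨_, rfl⟩
  obtain ⟨qS, nS, -⟩ := sq_diff_proj hp.hpa hp.hpb hp.o3
  obtain ⟨qR, nR, -⟩ := sq_diff_proj hq.hpa hq.hpb hq.o3
  rw [← hSd] at qS nS
  rw [← hRd] at qR nR
  have sS : IsSelfAdjoint S := hSd ▸ hp.hpa.isSelfAdjoint.sub hp.hpb.isSelfAdjoint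
  have sR : IsSelfAdjoint R := hRd ▸ hq.hpa.isSelfAdjoint.sub hq.hpb.isSelfAdjoint
  have sR' : IsSelfAdjoint ((10:ℝ) • R) := by rw [IsSelfAdjoint, star_smul, sR.star_eq, star_trivial]
  have sT : IsSelfAdjoint T := hT ▸ sS.add sR'
  have hup : IsStarProjection u := hu ▸ hp.hp'.one_sub
  have us := hup.isSelfAdjoint.star_eq
  have nT : ‖T‖ ≤ 11 := by
    rw [hT]
    refine (norm_add_le _ _).trans ?_
    rw [norm_smul]; norm_num; linarith
  have nu := hup.nrm
  have sk : IsSelfAdjoint k := by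
    rw [hk, IsSelfAdjoint, star_mul, star_mul, us, sT.star_eq, mul_assoc]
  have nk : ‖k‖ ≤ 11 := by
    rw [hk]
    calc ‖u * T * u‖ ≤ ‖u‖ * ‖T‖ * ‖u‖ := (norm_mul_le _ _).trans (mul_le_mul_of_nonneg_right (norm_mul_le _ _) (norm_nonneg _))
      _ ≤ 1 * 11 * 1 := by gcongr
      _ = 11 := by norm_num
  obtain ⟨a0, a1, b0, b1, ab, hsq⟩ := pos_scaled sk nk
  have tp : ∀ τ : A →ₗ[ℝ] ℝ, IsTr τ → τ q' < τ ((1/11:ℝ) • k⁺) ∧ τ q' < τ ((1/11:ℝ) • k⁻) := by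
    intro τ hτ
    obtain ⟨t1, t2, t3⟩ := hp.tr τ hτ
    obtain ⟨t4, t5, t6⟩ := hq.tr τ hτ
    have f := hτ.faithful hS hq.hp'.nn hq0
    have h1 := plus_bound hτ hp.hp' hp.hpa hp.hpb hq.hpa hq.hpb hp.o3 hq.o3 t1 (by rw [t4, t5])
    have h2 := plus_bound hτ hp.hp' hp.hpb hp.hpa hq.hpb hq.hpa (sq_diff_proj hp.hpa hp.hpb hp.o3).2.2
      (sq_diff_proj hq.hpa hq.hpb hq.o3).2.2 t2 (by rw [t4, t5])
    rw [← hSd, ← hRd, ← hT, ← hu, ← hk] at h1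
    have e : (1 - p') * ((pb - pa) + (10:ℝ) • (qb - qa)) * (1 - p') = -k := by
      rw [hk, hT, hSd, hRd, hu, ← neg_sub pa pb, ← neg_sub qa qb, smul_neg, ← neg_add]
      rw [mul_neg, neg_mul]
    rw [e, CFC.posPart_neg] at h2
    rw [map_smul, map_smul, smul_eq_mul, smul_eq_mul]
    constructor <;> linarith
  obtain ⟨τ0, hτ0⟩ := hex
  have ne : ∀ x : A, τ0 q' < τ0 x → x ≠ 0 := by
    rintro x hx rfl
    rw [map_zero] at hx
    have := hτ0.nonneg hq.hp'.nn
    linarith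
  obtain ⟨V, hV, K, hK, hVK⟩ := comp_proj hW hS hq.hp' a0 a1 b0 b1 (ne _ (tp τ0 hτ0).1) (ne _ (tp τ0 hτ0).2) ab
    (fun τ hτ => (tp τ hτ).1) (fun τ hτ => (tp τ hτ).2)
  rw [hsq, smul_smul] at hVK
  have hVp := pi_proj hq.hp' hV
  have d1 : Dom (V * star V) (k * k) := ⟨K * (1/121), by positivity, hVK⟩
  have ppz : p' * u = 0 := by rw [hu, mul_sub, mul_one, hp.hp'.isIdempotentElem.eq, sub_self]
  have z : p' * (V * star V) = 0 := by
    refine d1.zero_mul hVp.nn (by rw [IsSelfAdjoint, star_mul, sk.star_eq]) ?_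
    rw [hk]
    calc p' * (u * T * u * (u * T * u)) = (p' * u) * (T * u * (u * T * u)) := by noncomm_ring
      _ = 0 := by rw [ppz, zero_mul]
  have d2 : Dom (k * k) (star u * (T * T) * u) := by
    have h := conj_le hup.le1 (T * u)
    refine Dom.of_le ?_
    rw [mul_one, star_mul, us, sT.star_eq] at h
    rw [hk, us]
    refine le_trans (le_of_eq ?_) (h.trans (le_of_eq ?_))
    · calc u * T * u * (u * T * u) = u * T * (u * u) * (T * u) := by noncomm_ring
        _ = _ := by rw [hup.isIdempotentElem.eq]
    · noncomm_ring
  have dT : Dom (T * T) (p + q) := by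
    have h := conj_add_le (zero_le_one (α := A)) S ((10:ℝ) • R)
    rw [← hT, mul_one, mul_one, mul_one, sT.star_eq, sS.star_eq, sR'.star_eq, smul_mul_smul_comm, qS, qR] at h
    refine (Dom.of_le h).trans ?_
    have h1 : Dom (pa + pb) (p + q) :=
      ((Dom.of_le (hp.hp.le_of_mul hp.hpa hp.s2)).add (Dom.of_le (hp.hp.le_of_mul hp.hpb hp.s3))).trans (Dom.left hq.hp.nn)
    have h2 : Dom (qa + qb) (p + q) :=
      ((Dom.of_le (hq.hp.le_of_mul hq.hpa hq.s2)).add (Dom.of_le (hq.hp.le_of_mul hq.hpb hq.s3))).trans (Dom.right hp.hp.nn)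
    exact (h1.smul (by norm_num)).add ((h2.smul (by norm_num)).smul (by norm_num))
  have hTT : 0 ≤ T * T := by have := star_mul_self_nonneg T; rwa [sT.star_eq] at this
  have d3 : Dom (star u * (T * T) * u) (p + q) := by
    have h := conj_add_le hTT 1 (-p')
    rw [← sub_eq_add_neg, ← hu, star_one, one_mul, mul_one, star_neg, neg_mul, neg_mul_neg] at h
    refine (Dom.of_le h).trans ?_
    refine (dT.smul (by norm_num)).add (Dom.smul ?_ (by norm_num))
    have := ((Dom.one (IsSelfAdjoint.of_nonneg hTT)).conj p')
    rw [mul_one, hp.hp'.isSelfAdjoint.star_eq, hp.hp'.isIdempotentElem.eq] at this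
    rw [hp.hp'.isSelfAdjoint.star_eq]
    exact this.trans dp'
  refine ⟨p' + V * star V, hp.hp'.add' hVp z, dp'.add (d1.trans (d2.trans d3)), fun τ hτ => ?_⟩
  rw [map_add, ← hτ.tr, hV]

theorem frac [Nontrivial A] (hW : WeakCRLeOne A) (hS : IsSimpleCStarAlgebra A)
    (hpc : ∀ y : A, 0 ≤ y → y ≠ 0 → HasPieces y) (hex : ∃ τ : A →ₗ[ℝ] ℝ, IsTr τ)
    {y : A} (hy0 : 0 ≤ y) (hy1 : y ≤ 1) (hyn : y ≠ 0) {δ : ℝ} (hδ : 0 < δ) :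
    ∃ e w : A, IsStarProjection e ∧ 0 ≤ w ∧ e * w = 0 ∧ Dom e y ∧ Dom w y ∧
      y ≤ (4:ℝ) • e + (2:ℝ) • w + δ • 1 ∧
      ∀ f : A, IsStarProjection f → Dom f w → ∀ τ : A →ₗ[ℝ] ℝ, IsTr τ → τ f ≤ 4002 * τ e := by
  obtain ⟨p, p', pa, pb, q, q', qa, qb, hp, hq, dp, dq, hle⟩ := two_proj hW hS hpc hy0 hy1 hyn hδ
  obtain ⟨e, he, de, te⟩ := frac_e hW hS hex hp hq
  have hpq : 0 ≤ p + q := add_nonneg hp.hp.nn hq.hp.nn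
  have es := he.isSelfAdjoint.star_eq
  have hpq2 : p + q ≤ (2:ℝ) • 1 := by rw [two_smul]; exact add_le_add hp.hp.le1 hq.hp.le1
  have hupr := he.one_sub
  have hc : e * (p + q) * e ≤ (2:ℝ) • e := by
    have := conj_le hpq2 e
    rwa [es, mul_smul_comm, mul_one, smul_mul_assoc, he.isIdempotentElem.eq] at this
  obtain ⟨w, hw⟩ : ∃ w, w = (1 - e) * (p + q) * (1 - e) := ⟨_, rfl⟩
  have w0 : 0 ≤ w := by
    have := conj_le hpq (1 - e)
    rwa [mul_zero, zero_mul, hupr.isSelfAdjoint.star_eq, ← hw] at this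
  have dw : Dom w (p + q) := by
    have h := conj_add_le hpq 1 (-e)
    rw [← sub_eq_add_neg, hupr.isSelfAdjoint.star_eq, ← hw, star_one, one_mul, mul_one, star_neg, neg_mul, neg_mul_neg, es] at h
    refine (Dom.of_le h).trans (((Dom.rfl' _).smul (by norm_num)).add (Dom.smul ?_ (by norm_num)))
    exact (Dom.of_le hc).trans (de.smul (by norm_num))
  have h2 : p + q ≤ (4:ℝ) • e + (2:ℝ) • w := by
    have h := conj_add_le hpq e (1 - e)
    rw [add_sub_cancel, star_one, one_mul, mul_one, hupr.isSelfAdjoint.star_eq, ← hw, es] at h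
    refine h.trans (add_le_add ?_ le_rfl)
    refine (smul_le_smul_of_nonneg_left hc (by norm_num)).trans (le_of_eq ?_)
    rw [smul_smul]; norm_num
  refine ⟨e, w, he, w0, ?_, de.trans (dp.add dq), dw.trans (dp.add dq), hle.trans (add_le_add h2 le_rfl), ?_⟩
  · rw [hw]
    calc e * ((1 - e) * (p + q) * (1 - e)) = (e - e * e) * ((p + q) * (1 - e)) := by noncomm_ring
      _ = 0 := by rw [he.isIdempotentElem.eq, sub_self, zero_mul]
  · intro f hf df τ hτ
    have := trace_sub hτ hf hp.hp hq.hp (df.trans dw)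
    have := (hp.tr τ hτ).2.2
    have := (hq.tr τ hτ).2.2
    rw [te τ hτ]
    linarith
end Frac2


section HP
variable {A : Type u} [CStarAlgebra A] [PartialOrder A] [StarOrderedRing A]

theorem Dom.refl_of_zero {x y : A} (hx : x = 0) (hy : 0 ≤ y) : Dom x y := ⟨0, le_rfl, by rw [hx, zero_smul]⟩

theorem glue {p q V : A} (hp : IsStarProjection p) (hq : IsStarProjection q) (hV : star V * V = q)
    (hpV : p * V = 0) (hqV : q * V = 0) {δ : ℝ} (hδ : 0 < δ) :
    ∃ e : A, IsStarProjection e ∧ Dom e ((1 - p) * q * (1 - p) + V * star V) ∧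
      (1 - p) * q * (1 - p) ≤ e + δ • 1 := by
  obtain ⟨x, hx⟩ : ∃ x, x = (1 - p) * q := ⟨_, rfl⟩
  obtain ⟨b, hb⟩ : ∃ b, b = (1 - p) * q * (1 - p) := ⟨_, rfl⟩
  rw [← hb]
  have hup := hp.one_sub
  have us := hup.isSelfAdjoint.star_eq
  have hxb : x * star x = b := by
    rw [hx, hb, star_mul, us, hq.isSelfAdjoint.star_eq]
    calc (1 - p) * q * (q * (1 - p)) = (1 - p) * (q * q) * (1 - p) := by noncomm_ring
      _ = _ := by rw [hq.isIdempotentElem.eq]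
  have b0 : 0 ≤ b := hxb ▸ mul_star_self_nonneg x
  have b1 : b ≤ 1 := by
    have := conj_le hq.le1 (1 - p)
    rw [us, mul_one, hup.isIdempotentElem.eq, ← hb] at this
    exact this.trans hup.le1
  have bs := IsSelfAdjoint.of_nonneg b0
  have hbV : b * V = 0 := by
    rw [hb]
    calc (1 - p) * q * (1 - p) * V = (1 - p) * (q * V - q * (p * V)) := by noncomm_ring
      _ = 0 := by rw [hpV, hqV]; simp
  have hspec := spec_Icc b0 b1
  obtain ⟨G, hG⟩ : ∃ G : ℝ → ℝ, G = fun t => 1 / √(max δ t) := ⟨_, rfl⟩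
  have hpos : ∀ t, 0 < max δ t := fun t => lt_max_of_lt_left hδ
  have Gc : Continuous G := by
    rw [hG]
    refine continuous_const.div (by fun_prop) fun t => (Real.sqrt_pos.mpr (hpos t)).ne'
  have GG : ∀ t, G t * (t * G t) = t / max δ t := by
    intro t
    have : √(max δ t) * √(max δ t) = max δ t := Real.mul_self_sqrt (hpos t).le
    have h3 := (Real.sqrt_pos.mpr (hpos t)).ne'
    rw [hG]
    change 1 / √(max δ t) * (t * (1 / √(max δ t))) = _
    calc 1 / √(max δ t) * (t * (1 / √(max δ t))) = t / (√(max δ t) * √(max δ t)) := by field_simp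
      _ = _ := by rw [this]
  obtain ⟨g, hg⟩ : ∃ g, g = cfc G b := ⟨_, rfl⟩
  have gs : IsSelfAdjoint g := hg ▸ cfc_predicate G b
  obtain ⟨z, hz⟩ : ∃ z, z = g * x := ⟨_, rfl⟩
  obtain ⟨m0, hm0⟩ : ∃ m0, m0 = cfc (fun t : ℝ => t / max δ t) b := ⟨_, rfl⟩
  have cm0 : Continuous (fun t : ℝ => t / max δ t) := by
    refine continuous_id.div (by fun_prop) fun t => (hpos t).ne'
  have hzz : z * star z = m0 := by
    rw [hz, star_mul, gs.star_eq]
    calc g * x * (star x * g) = g * ((x * star x) * g) := by noncomm_ring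
      _ = g * (b * g) := by rw [hxb]
      _ = _ := by
        rw [hg, mul_cfc bs G Gc.continuousOn, ← cfc_mul _ _ b Gc.continuousOn (by fun_prop), hm0]
        exact cfc_congr fun t _ => GG t
  have m1 : m0 ≤ 1 := by
    rw [hm0]
    exact cfc_le_one _ _ fun t _ => (div_le_one (hpos t)).mpr (le_max_right _ _)
  have dm : Dom m0 b := by
    refine ⟨1 / δ, by positivity, ?_⟩
    have : (1 / δ) • b = cfc (fun t : ℝ => (1 / δ) * t) b := by
      rw [cfc_const_mul (1 / δ) (fun t : ℝ => t) b, cfc_id' ℝ b]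
    rw [this, hm0]
    refine cfc_mono (fun t ht => ?_) (hf := cm0.continuousOn)
    have := (hspec t ht).1
    rw [div_eq_mul_inv, mul_comm, one_div]
    exact mul_le_mul_of_nonneg_right (inv_anti₀ hδ (le_max_left _ _)) this
  have m00 : 0 ≤ m0 := hzz ▸ mul_star_self_nonneg z
  have hzV : star z * V = 0 := by
    apply IsPreMU.eq_zero_of_star_mul
    have := dm.mul_zero m00 hbV
    rw [← hzz] at this
    calc star (star z * V) * (star z * V) = star V * (z * star z * V) := by rw [star_mul, star_star]; noncomm_ring
      _ = 0 := by rw [this, mul_zero]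
  have hVz : star V * z = 0 := by
    have := congrArg star hzV
    rwa [star_mul, star_star, star_zero] at this
  have hzq : z * q = z := by
    rw [hz, hx, mul_assoc, mul_assoc, hq.isIdempotentElem.eq]
  have hqz : q * star z = star z := by
    have := congrArg star hzq
    rwa [star_mul, hq.isSelfAdjoint.star_eq] at this
  have nz : ‖z‖ ≤ 1 := by
    have := CStarRing.norm_self_mul_star (x := z)
    rw [hzz] at this
    have h := norm_le_one_of m00 m1
    nlinarith [norm_nonneg z]
  have hzq1 : star z * z ≤ q := by
    have h1 := star_mul_le_one nz
    rw [one_pow, one_smul] at h1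
    have := conj_le h1 q
    rw [mul_one, hq.isSelfAdjoint.star_eq, hq.isIdempotentElem.eq] at this
    refine le_trans (le_of_eq ?_) this
    calc star z * z = (q * star z) * (z * q) := by rw [hqz, hzq]
      _ = _ := by noncomm_ring
  obtain ⟨s, hs⟩ : ∃ s, s = CFC.sqrt (q - star z * z) := ⟨_, rfl⟩
  have s0 : 0 ≤ s := hs ▸ CFC.sqrt_nonneg _
  have ss := (IsSelfAdjoint.of_nonneg s0).star_eq
  have hss : s * s = q - star z * z := by rw [hs]; exact CFC.sqrt_mul_sqrt_self _ (sub_nonneg.mpr hzq1)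
  have hsk : ∀ m : A, (q - star z * z) * m = 0 → s * m = 0 := by
    intro m hm
    apply IsPreMU.eq_zero_of_star_mul
    calc star (s * m) * (s * m) = star m * (s * s * m) := by rw [star_mul, ss]; noncomm_ring
      _ = 0 := by rw [hss, hm, mul_zero]
  have hsq : s * q = s := by
    have := hsk (1 - q) (by
      rw [mul_sub, mul_one, sub_mul, hq.isIdempotentElem.eq, mul_assoc, hzq, sub_self])
    rw [mul_sub, mul_one, sub_eq_zero] at this
    exact this.symm
  obtain ⟨Y, hY⟩ : ∃ Y, Y = z + V * s := ⟨_, rfl⟩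
  have hYY : star Y * Y = q := by
    rw [hY, star_add, star_mul, ss]
    calc (star z + s * star V) * (z + V * s) = star z * z + (star z * V) * s + s * (star V * z) + s * (star V * V) * s := by
          noncomm_ring
      _ = star z * z + s * q * s := by rw [hzV, hVz, hV]; simp
      _ = q := by rw [hsq, hss]; abel
  have he := pi_proj hq hYY
  obtain ⟨m, hm⟩ : ∃ m, m = cfc (fun t : ℝ => max (t - δ) 0) b := ⟨_, rfl⟩
  have m0' : 0 ≤ m := hm ▸ cfc_nonneg fun t _ => le_max_right _ _
  have m1' : m ≤ 1 := by
    rw [hm]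
    refine cfc_le_one _ _ fun t ht => max_le ?_ zero_le_one
    have := (hspec t ht).2
    linarith
  have dmb : Dom m b := by
    refine ⟨1, zero_le_one, ?_⟩
    rw [one_smul, hm]
    conv_rhs => rw [← cfc_id' ℝ b]
    exact cfc_mono fun t ht => max_le (by linarith) (hspec t ht).1
  have hVb : star V * b = 0 := by
    have := congrArg star hbV
    rwa [star_mul, bs.star_eq, star_zero] at this
  have hVm : star V * m = 0 := dmb.zero_mul m0' bs hVb
  have hmm : m0 * m = m := by
    rw [hm0, hm, ← cfc_mul _ _ b cm0.continuousOn (by fun_prop)]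
    refine cfc_congr fun t _ => ?_
    rcases le_total t δ with h | h
    · simp [max_eq_right (show t - δ ≤ 0 by linarith)]
    · have : t ≠ 0 := by intro h0; linarith
      simp only [max_eq_right h, div_self this, one_mul]
  have hzm : s * (star z * m) = 0 := by
    apply hsk
    calc (q - star z * z) * (star z * m) = q * star z * m - star z * ((z * star z) * m) := by noncomm_ring
      _ = 0 := by rw [hqz, hzz, hmm, sub_self]
  have hem : Y * star Y * m = m := by
    rw [hY, star_add, star_mul, ss]
    calc (z + V * s) * (star z + s * star V) * m
        = z * star z * m + z * s * (star V * m) + V * (s * (star z * m)) + V * s * s * (star V * m) := by noncomm_ring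
      _ = m := by rw [hVm, hzm, hzz, hmm]; simp
  have hme : m * (Y * star Y) = m := by
    have := congrArg star hem
    rwa [star_mul, he.isSelfAdjoint.star_eq, (IsSelfAdjoint.of_nonneg m0').star_eq] at this
  refine ⟨Y * star Y, he, ?_, ?_⟩
  · have h := add_mul_star_le z (V * s)
    rw [← hY] at h
    refine (Dom.of_le h).trans (Dom.smul (Dom.add ?_ ?_) (by norm_num))
    · rw [hzz]; exact dm.trans (Dom.left (mul_star_self_nonneg V))
    · refine Dom.trans (Dom.of_le ?_) (Dom.right b0)
      have h1 : s * s ≤ 1 := by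
        rw [hss]; exact (sub_le_self _ (star_mul_self_nonneg z)).trans hq.le1
      have := conj_le' h1 V
      rw [mul_one] at this
      refine le_trans (le_of_eq ?_) this
      rw [star_mul, ss]; noncomm_ring
  · have h1 : m ≤ Y * star Y := by
      have := conj_le m1' (Y * star Y)
      rwa [he.isSelfAdjoint.star_eq, hem, hme, mul_one, he.isIdempotentElem.eq] at this
    have h2 : b ≤ m + δ • 1 := by
      rw [hm]
      have : cfc (fun t : ℝ => max (t - δ) 0) b + δ • 1 = cfc (fun t : ℝ => max (t - δ) 0 + δ) b := by
        rw [cfc_add_const δ (fun t : ℝ => max (t - δ) 0) b, Algebra.algebraMap_eq_smul_one]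
      rw [this]
      conv_lhs => rw [← cfc_id' ℝ b]
      exact cfc_mono fun t _ => by linarith [le_max_left (t - δ) 0]
    exact h2.trans (add_le_add h1 le_rfl)
end HP


section HP
variable {A : Type u} [CStarAlgebra A] [PartialOrder A] [StarOrderedRing A]

theorem normalize_pos {y : A} (hy0 : 0 ≤ y) (hyn : y ≠ 0) :
    ∃ y' : A, 0 ≤ y' ∧ y' ≤ 1 ∧ y' ≠ 0 ∧ Dom y' y ∧ y = ‖y‖ • y' ∧ 0 < ‖y‖ := by
  have hn : 0 < ‖y‖ := norm_pos_iff.mpr hyn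
  have h0 : 0 ≤ ‖y‖⁻¹ • y := smul_nonneg (by positivity) hy0
  refine ⟨‖y‖⁻¹ • y, h0, le_one_of h0 ?_, ?_, ⟨‖y‖⁻¹, by positivity, le_rfl⟩, ?_, hn⟩
  · rw [norm_smul, norm_inv, norm_norm, inv_mul_cancel₀ hn.ne']
  · exact smul_ne_zero (by positivity) hyn
  · rw [smul_smul, mul_inv_cancel₀ hn.ne', one_smul]

theorem frac' [Nontrivial A] (hW : WeakCRLeOne A) (hS : IsSimpleCStarAlgebra A)
    (hpc : ∀ y : A, 0 ≤ y → y ≠ 0 → HasPieces y) (hex : ∃ τ : A →ₗ[ℝ] ℝ, IsTr τ)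
    {y : A} (hy0 : 0 ≤ y) {δ : ℝ} (hδ : 0 < δ) :
    ∃ (e w : A) (C : ℝ), IsStarProjection e ∧ 0 ≤ w ∧ e * w = 0 ∧ Dom e y ∧ Dom w y ∧ 0 ≤ C ∧
      y ≤ C • (e + w) + δ • 1 ∧
      ∀ f : A, IsStarProjection f → Dom f w → ∀ τ : A →ₗ[ℝ] ℝ, IsTr τ → τ f ≤ 4002 * τ e := by
  by_cases hyn : y = 0
  · refine ⟨0, 0, 0, IsStarProjection.zero A, le_rfl, by simp, Dom.refl_of_zero rfl hy0, Dom.refl_of_zero rfl hy0, le_rfl, ?_, ?_⟩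
    · rw [hyn]; simp only [zero_smul, zero_add]; exact smul_nonneg hδ.le zero_le_one
    · rintro f hf ⟨c, hc, hfc⟩ τ hτ
      rw [smul_zero] at hfc
      rw [le_antisymm hfc hf.nn]; simp
  obtain ⟨y', h0, h1, hn, hd, hy, hp⟩ := normalize_pos hy0 hyn
  obtain ⟨e, w, he, hw, ew, de, dw, hle, ht⟩ := frac hW hS hpc hex h0 h1 hn (show 0 < δ / ‖y‖ by positivity)
  refine ⟨e, w, ‖y‖ * 4, he, hw, ew, de.trans hd, dw.trans hd, by positivity, ?_, ht⟩
  have h2 : y' ≤ (4:ℝ) • (e + w) + (δ / ‖y‖) • 1 := by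
    refine hle.trans (add_le_add ?_ le_rfl)
    rw [smul_add]
    refine add_le_add le_rfl ?_
    exact smul_le_smul_of_nonneg_right (by norm_num) hw
  have := smul_le_smul_of_nonneg_left h2 hp.le
  rw [← hy, smul_add, smul_smul, smul_smul, mul_div_cancel₀ _ hp.ne'] at this
  exact this

theorem two_proj' [Nontrivial A] (hW : WeakCRLeOne A) (hS : IsSimpleCStarAlgebra A)
    (hpc : ∀ y : A, 0 ≤ y → y ≠ 0 → HasPieces y) {y : A} (hy0 : 0 ≤ y)
    {δ : ℝ} (hδ : 0 < δ) :
    ∃ (p q : A) (C : ℝ), IsStarProjection p ∧ IsStarProjection q ∧ Dom p y ∧ Dom q y ∧ 0 ≤ C ∧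
      y ≤ C • (p + q) + δ • 1 := by
  by_cases hyn : y = 0
  · refine ⟨0, 0, 0, IsStarProjection.zero A, IsStarProjection.zero A, Dom.refl_of_zero rfl hy0, Dom.refl_of_zero rfl hy0, le_rfl, ?_⟩
    rw [hyn]; simp only [zero_smul, zero_add]; exact smul_nonneg hδ.le zero_le_one
  obtain ⟨y', h0, h1, hn, hd, hy, hp⟩ := normalize_pos hy0 hyn
  obtain ⟨p, p', pa, pb, q, q', qa, qb, hpd, hq, dp, dq, hle⟩ := two_proj hW hS hpc h0 h1 hn (show 0 < δ / ‖y‖ by positivity)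
  refine ⟨p, q, ‖y‖, hpd.hp, hq.hp, dp.trans hd, dq.trans hd, hp.le, ?_⟩
  have := smul_le_smul_of_nonneg_left hle hp.le
  rw [← hy, smul_add, smul_smul, mul_div_cancel₀ _ hp.ne'] at this
  exact this

theorem frac_iter [Nontrivial A] (hW : WeakCRLeOne A) (hS : IsSimpleCStarAlgebra A)
    (hpc : ∀ y : A, 0 ≤ y → y ≠ 0 → HasPieces y) {y : A} (hy0 : 0 ≤ y) (n : ℕ) : ∀ {δ : ℝ}, 0 < δ → 
    ∃ (e w : A) (C : ℝ), IsStarProjection e ∧ 0 ≤ w ∧ e * w = 0 ∧ Dom e y ∧ Dom w y ∧ 0 ≤ C ∧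
      y ≤ C • (e + w) + δ • 1 ∧
      ∀ f : A, IsStarProjection f → Dom f w → ∀ τ : A →ₗ[ℝ] ℝ, IsTr τ → n * τ f ≤ 4002 * τ e := by
  induction n with
  | zero =>
    intro δ hδ
    refine ⟨0, y, 1, IsStarProjection.zero A, hy0, by simp, Dom.refl_of_zero rfl hy0, Dom.rfl' _, zero_le_one, ?_, ?_⟩
    · rw [zero_add, one_smul]; exact le_add_of_nonneg_right (smul_nonneg hδ.le zero_le_one)
    · intros; simp
  | succ n ih =>
    intro δ hδ
    obtain ⟨e, w, C, he, hw, ew, de, dw, hC, hle, ht⟩ := ih (half_pos hδ)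
    by_cases hex : ∃ τ : A →ₗ[ℝ] ℝ, IsTr τ
    swap
    · exact ⟨e, w, C, he, hw, ew, de, dw, hC, hle.trans (add_le_add le_rfl
        (smul_le_smul_of_nonneg_right (by linarith) zero_le_one)), fun f hf df τ hτ => (hex ⟨τ, hτ⟩).elim⟩
    obtain ⟨e', w', C', he', hw', ew', de', dw', hC', hle', ht'⟩ := frac' hW hS hpc hex hw
      (show 0 < δ / 2 / (C + 1) by positivity)
    have z1 : e * e' = 0 := de'.zero_mul he'.nn (IsSelfAdjoint.of_nonneg hw) ew
    have z2 : e * w' = 0 := dw'.zero_mul hw' (IsSelfAdjoint.of_nonneg hw) ew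
    refine ⟨e + e', w', C + C * C', he.add' he' z1, hw', by rw [add_mul, z2, ew', add_zero], de.add (de'.trans dw),
      dw'.trans dw, by positivity, ?_, ?_⟩
    · refine hle.trans ?_
      have h1 : C • (e + w) ≤ C • (e + (C' • (e' + w') + (δ / 2 / (C + 1)) • 1)) :=
        smul_le_smul_of_nonneg_left (add_le_add le_rfl hle') hC
      have h2 : (C * (δ / 2 / (C + 1))) • (1:A) ≤ (δ / 2) • (1:A) := by
        refine smul_le_smul_of_nonneg_right ?_ zero_le_one
        rw [← mul_div_assoc, div_le_iff₀ (by positivity)]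
        nlinarith
      have h3 : (0:A) ≤ (C * C') • e := smul_nonneg (by positivity) he.nn
      have h4 : (0:A) ≤ C • e' := smul_nonneg (by positivity) he'.nn
      have h5 : (0:A) ≤ C • w' := smul_nonneg (by positivity) hw'
      have h6 := add_le_add (add_le_add h1 h2) (add_nonneg (add_nonneg h3 h4) h5)
      rw [← sub_nonneg] at h6 ⊢
      refine h6.trans (le_of_eq ?_)
      module
    · intro f hf df τ hτ
      have a1 := ht f hf (df.trans dw') τ hτ
      have a2 := ht' f hf df τ hτ
      rw [map_add]; push_cast; linarith

theorem unif_lower (hS : IsSimpleCStarAlgebra A) {x : A} (hx : 0 ≤ x) (hx0 : x ≠ 0) :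
    ∃ c : ℝ, 0 < c ∧ ∀ τ : A →ₗ[ℝ] ℝ, IsTr τ → c ≤ τ x := by
  obtain ⟨n, r, hr⟩ := full_aux hS hx hx0
  obtain ⟨g, hg⟩ := CStarAlgebra.nonneg_iff_eq_star_mul_self.mp hx
  have h0 : 0 ≤ ∑ j, ‖r j‖ ^ 2 := Finset.sum_nonneg fun _ _ => by positivity
  refine ⟨1 / (∑ j, ‖r j‖ ^ 2 + 1), by positivity, fun τ hτ => ?_⟩
  have h1 : ∀ j, τ (star (r j) * x * r j) ≤ ‖r j‖ ^ 2 * τ x := by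
    intro j
    have e : star (r j) * x * r j = star (g * r j) * (g * r j) := by rw [hg, star_mul]; noncomm_ring
    have h2 : (g * r j) * star (g * r j) ≤ (‖r j‖ ^ 2) • (g * star g) := by
      have := conj_le' (mul_star_le_one (a := r j) le_rfl) g
      rw [mul_smul_comm, mul_one, smul_mul_assoc] at this
      refine le_trans (le_of_eq ?_) this
      rw [star_mul]; noncomm_ring
    rw [e, hτ.tr]
    refine (hτ.mono h2).trans (le_of_eq ?_)
    rw [map_smul, smul_eq_mul, ← hτ.tr, ← hg]
  have h2 := hτ.mono hr
  rw [hτ.one, map_sum] at h2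
  have h3 : (1:ℝ) ≤ (∑ j, ‖r j‖ ^ 2) * τ x := by
    rw [Finset.sum_mul]; exact h2.trans (Finset.sum_le_sum fun j _ => h1 j)
  rw [div_le_iff₀ (by positivity)]
  have := hτ.nonneg hx
  nlinarith

/-- core of HP: orthogonal room available -/
theorem hp_room [Nontrivial A] (hW : WeakCRLeOne A) (hS : IsSimpleCStarAlgebra A)
    (hpc : ∀ y : A, 0 ≤ y → y ≠ 0 → HasPieces y) {y z : A} (hy0 : 0 ≤ y) (hz0 : 0 ≤ z) (hz1 : z ≤ 1)
    (hzn : z ≠ 0) (hyz : y * z = 0) {δ : ℝ} (hδ : 0 < δ) :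
    ∃ (r : A) (C : ℝ), IsStarProjection r ∧ Dom r (y + z) ∧ 0 ≤ C ∧ y ≤ C • r + δ • 1 := by
  obtain ⟨y1, y2, h10, h20, h1n, h2n, h12, hle⟩ := hpc z hz0 hzn
  obtain ⟨c1, hc1, ht1⟩ := unif_lower hS h10 h1n
  obtain ⟨c2, hc2, ht2⟩ := unif_lower hS h20 h2n
  have hc : 0 < min c1 c2 := lt_min hc1 hc2
  obtain ⟨n, hn⟩ := exists_nat_gt (4002 / min c1 c2)
  have hn0 : (0:ℝ) < n := lt_trans (by positivity) hn
  obtain ⟨e, w, C, he, hw, ew, de, dw, hC, hley, ht⟩ := frac_iter hW hS hpc hy0 n (show 0 < δ / 3 by positivity)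
  obtain ⟨p, q, C', hp, hq, dp, dq, hC', hlew⟩ := two_proj' hW hS hpc hw (show 0 < δ / 3 / (C + 1) by positivity)
  have tq : ∀ τ : A →ₗ[ℝ] ℝ, IsTr τ → τ q < min c1 c2 := by
    intro τ hτ
    have h1 := ht q hq dq τ hτ
    have h2 := hτ.mono he.le1
    rw [hτ.one] at h2
    rw [div_lt_iff₀ hc] at hn
    by_contra h
    push Not at h
    nlinarith
  have h11 : y1 ≤ 1 := (le_add_of_nonneg_right h20).trans (hle.trans hz1)
  have h21 : y2 ≤ 1 := (le_add_of_nonneg_left h10).trans (hle.trans hz1)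
  obtain ⟨V, hV, K, hK, hVK⟩ := comp_proj hW hS hq h10 h11 h20 h21 h1n h2n h12
    (fun τ hτ => (tq τ hτ).trans_le ((min_le_left _ _).trans (ht1 τ hτ)))
    (fun τ hτ => (tq τ hτ).trans_le ((min_le_right _ _).trans (ht2 τ hτ)))
  have dV : Dom (V * star V) z := Dom.trans ⟨K, hK, hVK⟩ (Dom.of_le
    ((sq_le_self (add_nonneg h10 h20) (hle.trans hz1)).trans hle))
  have ys := IsSelfAdjoint.of_nonneg hy0
  have zs := IsSelfAdjoint.of_nonneg hz0
  have hVp := pi_proj hq hV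
  have yV : y * (V * star V) = 0 := dV.zero_mul hVp.nn zs hyz
  have yV' : y * V = 0 := by
    have := congrArg (· * V) yV
    simp only [zero_mul] at this
    rwa [mul_assoc, mul_assoc, hV, pi_mul hq hV] at this
  have pV : p * V = 0 := (dp.trans dw).mul_zero hp.nn yV'
  have qV : q * V = 0 := (dq.trans dw).mul_zero hq.nn yV'
  have eV : e * V = 0 := de.mul_zero he.nn yV'
  obtain ⟨e', he', de', hle'⟩ := glue hp hq hV pV qV (show 0 < δ / 3 / (C * C' * 2 + 1) by positivity)
  obtain ⟨b, hb⟩ : ∃ b, b = (1 - p) * q * (1 - p) := ⟨_, rfl⟩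
  rw [← hb] at de' hle'
  have us := hp.one_sub.isSelfAdjoint.star_eq
  have b0 : 0 ≤ b := by
    have := conj_le hq.nn (1 - p)
    rwa [mul_zero, zero_mul, us, ← hb] at this
  have pb : p * (b + V * star V) = 0 := by
    rw [mul_add, ← mul_assoc p V, pV, zero_mul, add_zero, hb]
    calc p * ((1 - p) * q * (1 - p)) = (p - p * p) * q * (1 - p) := by noncomm_ring
      _ = 0 := by rw [hp.isIdempotentElem.eq, sub_self, zero_mul, zero_mul]
  have ep : e * p = 0 := dp.zero_mul hp.nn (IsSelfAdjoint.of_nonneg hw) ew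
  have eq' : e * q = 0 := dq.zero_mul hq.nn (IsSelfAdjoint.of_nonneg hw) ew
  have eb : e * (b + V * star V) = 0 := by
    rw [mul_add, ← mul_assoc e V, eV, zero_mul, add_zero, hb]
    calc e * ((1 - p) * q * (1 - p)) = (e * q - e * p * q) * (1 - p) := by noncomm_ring
      _ = 0 := by rw [ep, eq']; simp
  have bVs : IsSelfAdjoint (b + V * star V) := (IsSelfAdjoint.of_nonneg b0).add hVp.isSelfAdjoint
  have pe' : p * e' = 0 := de'.zero_mul he'.nn bVs pb
  have ee' : e * e' = 0 := de'.zero_mul he'.nn bVs eb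
  have hpq : 0 ≤ p + q := add_nonneg hp.nn hq.nn
  have pc : p * q * p ≤ p := by
    have := conj_le hq.le1 p
    rwa [hp.isSelfAdjoint.star_eq, mul_one, hp.isIdempotentElem.eq] at this
  have hqle : q ≤ (2:ℝ) • p + (2:ℝ) • b := by
    have h := conj_add_le hq.nn p (1 - p)
    rw [add_sub_cancel, star_one, one_mul, mul_one, us, ← hb, hp.isSelfAdjoint.star_eq] at h
    exact h.trans (add_le_add (smul_le_smul_of_nonneg_left pc (by norm_num)) le_rfl)
  have db : Dom b (y + z) := by
    have h := conj_add_le hq.nn 1 (-p)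
    rw [← sub_eq_add_neg, us, ← hb, star_one, one_mul, mul_one, star_neg, neg_mul, neg_mul_neg, hp.isSelfAdjoint.star_eq] at h
    refine ((Dom.of_le h).trans (((dq.trans dw).smul (by norm_num)).add (Dom.smul ?_ (by norm_num)))).trans (Dom.left hz0)
    exact (Dom.of_le pc).trans (dp.trans dw)
  have hpe := hp.add' he' pe'
  refine ⟨e + (p + e'), C + C * C' * 3, he.add' hpe (by rw [mul_add, ep, ee', add_zero]),
    (de.trans (Dom.left hz0)).add (((dp.trans dw).trans (Dom.left hz0)).add (de'.trans (db.add (dV.trans (Dom.right hy0))))),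
    by positivity, ?_⟩
  have h1 : y ≤ C • (e + (C' • (p + ((2:ℝ) • p + (2:ℝ) • (e' + (δ / 3 / (C * C' * 2 + 1)) • 1)))
      + (δ / 3 / (C + 1)) • 1)) + (δ / 3) • 1 := by
    refine hley.trans (add_le_add (smul_le_smul_of_nonneg_left (add_le_add le_rfl (hlew.trans (add_le_add
      (smul_le_smul_of_nonneg_left (add_le_add le_rfl (hqle.trans (add_le_add le_rfl ?_))) hC') le_rfl))) hC) le_rfl)
    exact smul_le_smul_of_nonneg_left hle' (by norm_num)
  have h2 : (C * (δ / 3 / (C + 1))) • (1:A) ≤ (δ / 3) • (1:A) := by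
    refine smul_le_smul_of_nonneg_right ?_ zero_le_one
    rw [← mul_div_assoc, div_le_iff₀ (by positivity)]
    nlinarith
  have h3 : ((C * C' * 2) * (δ / 3 / (C * C' * 2 + 1))) • (1:A) ≤ (δ / 3) • (1:A) := by
    refine smul_le_smul_of_nonneg_right ?_ zero_le_one
    have : 0 ≤ C * C' := by positivity
    rw [← mul_div_assoc, div_le_iff₀ (by positivity)]
    nlinarith
  have h4 : (0:A) ≤ (C * C' * 3) • e := smul_nonneg (by positivity) he.nn
  have h5 : (0:A) ≤ C • p := smul_nonneg (by positivity) hp.nn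
  have h6 : (0:A) ≤ (C + C * C') • e' := smul_nonneg (by positivity) he'.nn
  have h7 := add_le_add (add_le_add (add_le_add h1 h2) h3) (add_nonneg (add_nonneg h4 h5) h6)
  rw [← sub_nonneg] at h7 ⊢
  refine h7.trans (le_of_eq ?_)
  module
end HP


section RR
variable {A : Type u} [CStarAlgebra A] [PartialOrder A] [StarOrderedRing A]

theorem hp_main [Nontrivial A] (hW : WeakCRLeOne A) (hS : IsSimpleCStarAlgebra A)
    (hpc : ∀ y : A, 0 ≤ y → y ≠ 0 → HasPieces y) {y : A} (hy0 : 0 ≤ y) {δ : ℝ} (hδ : 0 < δ) :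
    ∃ (r : A) (C : ℝ), IsStarProjection r ∧ Dom r y ∧ 0 ≤ C ∧ y ≤ C • r + δ • 1 := by
  have ys := IsSelfAdjoint.of_nonneg hy0
  have hsp : ∀ t ∈ spectrum ℝ y, 0 ≤ t := fun t ht => spectrum_nonneg_of_nonneg hy0 ht
  obtain ⟨g, hg⟩ : ∃ g : ℝ → ℝ, g = fun t => max 0 (min (min t (δ / 2 - t)) 1) := ⟨_, rfl⟩
  have gc : Continuous g := by rw [hg]; fun_prop
  obtain ⟨f, hf⟩ : ∃ f : ℝ → ℝ, f = fun t => max (t - δ / 2) 0 := ⟨_, rfl⟩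
  have fc : Continuous f := by rw [hf]; fun_prop
  have hfy : y ≤ cfc f y + (δ / 2) • 1 := by
    have : cfc f y + (δ / 2) • 1 = cfc (fun t : ℝ => f t + δ / 2) y := by
      rw [cfc_add_const (δ / 2) f y, Algebra.algebraMap_eq_smul_one]
    rw [this]
    conv_lhs => rw [← cfc_id' ℝ y]
    refine cfc_mono fun t _ => ?_
    rw [hf]; linarith [le_max_left (t - δ / 2) 0]
  have df : Dom (cfc f y) y := by
    refine Dom.of_le ?_
    conv_rhs => rw [← cfc_id' ℝ y]
    refine cfc_mono fun t ht => ?_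
    rw [hf]; exact max_le (by linarith) (hsp t ht)
  have dg : Dom (cfc g y) y := by
    refine Dom.of_le ?_
    conv_rhs => rw [← cfc_id' ℝ y]
    refine cfc_mono fun t ht => ?_
    rw [hg]; exact max_le (hsp t ht) ((min_le_left _ _).trans (min_le_left _ _))
  by_cases h0 : cfc g y = 0
  · have hz : ∀ t ∈ spectrum ℝ y, t = 0 ∨ δ / 2 ≤ t := by
      intro t ht
      have h1 : g t ∈ spectrum ℝ (cfc g y) := by
        rw [cfc_map_spectrum g y]; exact ⟨t, ht, rfl⟩
      rw [h0, spectrum.zero_eq, Set.mem_singleton_iff, hg] at h1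
      by_contra h
      push Not at h
      have hp := lt_of_le_of_ne (hsp t ht) (Ne.symm h.1)
      have : 0 < min (min t (δ / 2 - t)) 1 := lt_min (lt_min hp (by linarith)) one_pos
      have h2 := le_max_right 0 (min (min t (δ / 2 - t)) 1)
      simp only at h1
      linarith
    obtain ⟨k, hk⟩ : ∃ k : ℝ → ℝ, k = fun t => min (t / (δ / 2)) 1 := ⟨_, rfl⟩
    have kc : Continuous k := by rw [hk]; fun_prop
    have hk1 : ∀ t ∈ spectrum ℝ y, (t = 0 ∧ k t = 0) ∨ k t = 1 := by
      intro t ht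
      rcases hz t ht with h | h
      · left; exact ⟨h, by rw [hk, h]; simp⟩
      · right
        rw [hk]
        exact min_eq_right ((one_le_div (by positivity)).mpr h)
    have hr : IsStarProjection (cfc k y) := by
      refine ⟨?_, cfc_predicate k y⟩
      rw [IsIdempotentElem, ← cfc_mul k k y]
      refine cfc_congr fun t ht => ?_
      rcases hk1 t ht with h | h
      · simp [h.2]
      · simp [h]
    have yr : y * cfc k y = y := by
      rw [mul_cfc ys k kc.continuousOn]
      conv_rhs => rw [← cfc_id' ℝ y]
      refine cfc_congr fun t ht => ?_
      rcases hk1 t ht with h | h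
      · simp [h.1]
      · simp [h]
    have ry : cfc k y * y = y := by
      have := congrArg star yr
      rwa [star_mul, hr.isSelfAdjoint.star_eq, ys.star_eq] at this
    refine ⟨cfc k y, ‖y‖, hr, ⟨1 / (δ / 2), by positivity, ?_⟩, norm_nonneg _, ?_⟩
    · have : (1 / (δ / 2)) • y = cfc (fun t : ℝ => (1 / (δ / 2)) * t) y := by
        rw [cfc_const_mul (1 / (δ / 2)) (fun t : ℝ => t) y, cfc_id' ℝ y]
      rw [this]
      refine cfc_mono (fun t ht => ?_)
      rw [hk]
      exact (min_le_left _ _).trans (le_of_eq (by ring))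
    · have := corner_le hr ys (by rw [ry, yr]) le_rfl
      exact this.trans (le_add_of_nonneg_right (smul_nonneg hδ.le zero_le_one))
  · have hz0 : 0 ≤ cfc g y := cfc_nonneg fun t _ => by rw [hg]; exact le_max_left _ _
    have hz1 : cfc g y ≤ 1 := cfc_le_one _ _ fun t _ => by
      rw [hg]; exact max_le zero_le_one (min_le_right _ _)
    have hf0 : 0 ≤ cfc f y := cfc_nonneg fun t _ => by rw [hf]; exact le_max_right _ _
    have hfg : cfc f y * cfc g y = 0 := by
      rw [← cfc_mul f g y, ← cfc_zero ℝ y]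
      refine cfc_congr fun t _ => ?_
      rw [hf, hg]
      rcases le_total t (δ / 2) with h | h
      · simp [max_eq_right (show t - δ / 2 ≤ 0 by linarith)]
      · have : min (min t (δ / 2 - t)) 1 ≤ 0 := ((min_le_left _ _).trans (min_le_right _ _)).trans (by linarith)
        simp [max_eq_left this]
    obtain ⟨r, C, hr, dr, hC, hle⟩ := hp_room hW hS hpc hf0 hz0 hz1 h0 hfg (half_pos hδ)
    refine ⟨r, C, hr, dr.trans (df.add dg), hC, hfy.trans ?_⟩
    refine (add_le_add hle le_rfl).trans (le_of_eq ?_)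
    module

theorem conj_add_le_m {x : A} (hx : 0 ≤ x) (c d : A) {m : ℝ} (hm : 0 < m) :
    star (c + d) * x * (c + d) ≤ (1 + m ^ 2) • (star c * x * c) + (1 + (m⁻¹) ^ 2) • (star d * x * d) := by
  have h := conj_le hx (m • c - m⁻¹ • d)
  rw [mul_zero, zero_mul] at h
  have e : (1 + m ^ 2) • (star c * x * c) + (1 + (m⁻¹) ^ 2) • (star d * x * d) - star (c + d) * x * (c + d) =
      star (m • c - m⁻¹ • d) * x * (m • c - m⁻¹ • d) := by
    simp only [star_add, star_sub, star_smul, star_trivial, mul_add, mul_sub, add_mul, sub_mul, smul_mul_assoc,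
      mul_smul_comm, smul_smul, smul_sub]
    rw [mul_inv_cancel₀ hm.ne', inv_mul_cancel₀ hm.ne']
    module
  rw [← sub_nonneg, e]; exact h

theorem algebraic_add {s : ℝ} {r b : A} (hr : IsStarProjection r) (h1 : r * b = 0) (h2 : b * r = 0)
    {p : Polynomial ℝ} (hp : p ≠ 0) (hpb : Polynomial.aeval b p = 0) :
    ∃ q : Polynomial ℝ, q ≠ 0 ∧ Polynomial.aeval (s • r + b) q = 0 := by
  open Polynomial in
  have hpow : ∀ n : ℕ, (s • r + b) ^ (n + 1) = (s • r) ^ (n + 1) + b ^ (n + 1) := by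
    intro n
    induction n with
    | zero => simp
    | succ n ih =>
      rw [pow_succ, ih, pow_succ (s • r) (n + 1), pow_succ b (n + 1), mul_add, add_mul, add_mul]
      have e1 : b ^ (n + 1) * (s • r) = 0 := by rw [pow_succ, mul_smul_comm, mul_assoc, h2, mul_zero, smul_zero]
      have e2 : (s • r) ^ (n + 1) * b = 0 := by rw [pow_succ, mul_assoc, smul_mul_assoc, h1, smul_zero, mul_zero]
      rw [e1, e2]; abel
  have hX : ∀ f : Polynomial ℝ, Polynomial.aeval (s • r + b) (Polynomial.X * f) =
      Polynomial.aeval (s • r) (Polynomial.X * f) + Polynomial.aeval b (Polynomial.X * f) := by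
    intro f
    induction f using Polynomial.induction_on' with
    | add f g hf hg => rw [mul_add, map_add, map_add, map_add, hf, hg]; abel
    | monomial n c =>
      rw [Polynomial.X_mul_monomial, Polynomial.aeval_monomial, Polynomial.aeval_monomial, Polynomial.aeval_monomial,
        hpow, mul_add]
  refine ⟨Polynomial.X * ((Polynomial.X - Polynomial.C s) * p),
    mul_ne_zero Polynomial.X_ne_zero (mul_ne_zero (Polynomial.X_sub_C_ne_zero s) hp), ?_⟩
  rw [hX]
  have e1 : Polynomial.aeval b (Polynomial.X * ((Polynomial.X - Polynomial.C s) * p)) = 0 := by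
    rw [map_mul, map_mul, hpb, mul_zero, mul_zero]
  have e2 : Polynomial.aeval (s • r) (Polynomial.X * ((Polynomial.X - Polynomial.C s) * p)) = 0 := by
    rw [← mul_assoc, map_mul, map_mul, map_sub, Polynomial.aeval_X, Polynomial.aeval_C,
      Algebra.algebraMap_eq_smul_one, mul_sub, smul_mul_smul_comm, smul_mul_smul_comm, hr.isIdempotentElem.eq, mul_one,
      sub_self, zero_mul]
  rw [e1, e2, add_zero]

theorem rr_step [Nontrivial A] (hW : WeakCRLeOne A) (hS : IsSimpleCStarAlgebra A)
    (hpc : ∀ y : A, 0 ≤ y → y ≠ 0 → HasPieces y) {t : ℝ} (ht : 0 < t) (N : ℕ) :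
    ∀ {a : A}, 0 ≤ a → a ≤ (N * t) • 1 → ∀ {η : ℝ}, 0 < η →
    ∃ b : A, 0 ≤ b ∧ Dom b a ∧ b ≤ a + η • 1 ∧ a ≤ b + (t + η) • 1 ∧
      ∃ p : Polynomial ℝ, p ≠ 0 ∧ Polynomial.aeval b p = 0 := by
  induction N with
  | zero =>
    intro a ha ha1 η hη
    have : a = 0 := le_antisymm (by simpa using ha1) ha
    subst this
    have h1 : (0:A) ≤ η • 1 := smul_nonneg hη.le zero_le_one
    have h2 : (0:A) ≤ (t + η) • 1 := smul_nonneg (by positivity) zero_le_one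
    exact ⟨0, le_rfl, Dom.rfl' _, by rwa [zero_add], by rwa [zero_add], Polynomial.X, Polynomial.X_ne_zero, by simp⟩
  | succ N ih =>
    intro a ha ha1 η hη
    have as := IsSelfAdjoint.of_nonneg ha
    obtain ⟨s, hs⟩ : ∃ s : ℝ, s = N * t := ⟨_, rfl⟩
    have s0 : 0 ≤ s := hs ▸ by positivity
    have hsp : ∀ x ∈ spectrum ℝ a, 0 ≤ x ∧ x ≤ s + t := by
      intro x hx
      refine ⟨spectrum_nonneg_of_nonneg ha hx, ?_⟩
      have : a ≤ algebraMap ℝ A (s + t) := by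
        rw [Algebra.algebraMap_eq_smul_one, hs]
        refine ha1.trans (le_of_eq ?_)
        push_cast; congr 1; ring
      rw [le_algebraMap_iff_spectrum_le] at this
      exact this x hx
    obtain ⟨y, hy⟩ : ∃ y, y = cfc (fun x : ℝ => max (x - s) 0) a := ⟨_, rfl⟩
    obtain ⟨c, hc⟩ : ∃ c, c = cfc (fun x : ℝ => min x s) a := ⟨_, rfl⟩
    have y0 : 0 ≤ y := hy ▸ cfc_nonneg fun x _ => le_max_right _ _
    have c0 : 0 ≤ c := hc ▸ cfc_nonneg fun x hx => le_min (hsp x hx).1 s0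
    have ys := IsSelfAdjoint.of_nonneg y0
    have cs := IsSelfAdjoint.of_nonneg c0
    have hyt : y ≤ t • 1 := by
      have : (t • 1 : A) = algebraMap ℝ A t := (Algebra.algebraMap_eq_smul_one t).symm
      rw [this, hy]
      refine cfc_le_algebraMap _ _ _ fun x hx => max_le (by linarith [(hsp x hx).2]) ht.le
    have hcs : c ≤ s • 1 := by
      have : (s • 1 : A) = algebraMap ℝ A s := (Algebra.algebraMap_eq_smul_one s).symm
      rw [this, hc]
      exact cfc_le_algebraMap _ _ _ fun x hx => min_le_right _ _
    have hcy : c + y = a := by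
      rw [hc, hy, ← cfc_add (a := a) (fun x : ℝ => min x s) (fun x : ℝ => max (x - s) 0)]
      conv_rhs => rw [← cfc_id' ℝ a]
      refine cfc_congr fun x _ => ?_
      rcases le_total x s with h | h
      · rw [min_eq_left h, max_eq_right (by linarith)]; ring
      · rw [min_eq_right h, max_eq_left (by linarith)]; ring
    have hsc : (c - s • 1) * y = 0 := by
      have : c - s • 1 = cfc (fun x : ℝ => min x s - s) a := by
        rw [cfc_sub (a := a) (fun x : ℝ => min x s) (fun _ => s), cfc_const s a, Algebra.algebraMap_eq_smul_one, hc]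
      rw [this, hy, ← cfc_mul _ _ a, ← cfc_zero ℝ a]
      refine cfc_congr fun x _ => ?_
      rcases le_total x s with h | h
      · simp [max_eq_right (show x - s ≤ 0 by linarith)]
      · simp [min_eq_right h]
    have hca : c ≤ a := by rw [← hcy]; exact le_add_of_nonneg_right y0
    have dya : Dom y a := by rw [← hcy]; exact Dom.right c0
    obtain ⟨m, hm⟩ : ∃ m : ℝ, m = √(η / 4 / t) := ⟨_, rfl⟩
    have m0 : 0 < m := hm ▸ Real.sqrt_pos.mpr (by positivity)
    have m2 : m ^ 2 * t = η / 4 := by rw [hm, Real.sq_sqrt (by positivity)]; field_simp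
    obtain ⟨r, K, hr, dr, hK, hle⟩ := hp_main hW hS hpc y0 (show 0 < η / 4 / (1 + (m⁻¹) ^ 2) by positivity)
    have rs := hr.isSelfAdjoint.star_eq
    have rr := hr.isIdempotentElem.eq
    have hur := hr.one_sub
    have hcr : c * r = s • r := by
      have := dr.zero_mul hr.nn ys hsc
      rw [sub_mul, smul_mul_assoc, one_mul, sub_eq_zero] at this
      exact this
    have hrc : r * c = s • r := by
      have := congrArg star hcr
      rwa [star_mul, star_smul, rs, cs.star_eq, star_trivial] at this
    obtain ⟨a', ha'⟩ : ∃ a', a' = c - s • r := ⟨_, rfl⟩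
    have ea' : a' = star (1 - r) * c * (1 - r) := by
      rw [hur.isSelfAdjoint.star_eq, sub_mul, one_mul, hrc, mul_sub, mul_one, sub_mul, hcr, smul_mul_assoc, rr, ha']
      abel
    have a'0 : 0 ≤ a' := by
      have := conj_le c0 (1 - r)
      rwa [mul_zero, zero_mul, ← ea'] at this
    have a'c : a' ≤ c := by rw [ha']; exact sub_le_self _ (smul_nonneg s0 hr.nn)
    have hra' : r * a' = 0 := by rw [ha', mul_sub, hrc, mul_smul_comm, rr, sub_self]
    have ha'r : a' * r = 0 := by rw [ha', sub_mul, hcr, smul_mul_assoc, rr, sub_self]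
    obtain ⟨b, b0, db, hb1, hb2, p, hp0, hp⟩ := ih a'0 (a'c.trans (by rwa [← hs])) (half_pos hη)
    have hrb : r * b = 0 := db.zero_mul b0 (IsSelfAdjoint.of_nonneg a'0) hra'
    have hbr : b * r = 0 := db.mul_zero b0 ha'r
    refine ⟨s • r + b, add_nonneg (smul_nonneg s0 hr.nn) b0, ((dr.trans dya).smul s0).add
      (db.trans (Dom.of_le (a'c.trans hca))), ?_, ?_, algebraic_add hr hrb hbr hp0 hp⟩
    · have h1 : s • r + b ≤ s • r + (a' + (η / 2) • 1) := add_le_add le_rfl hb1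
      have h2 : (η / 2) • (1:A) ≤ η • 1 := smul_le_smul_of_nonneg_right (by linarith) zero_le_one
      have h3 := add_le_add (add_le_add h1 hca) h2
      rw [ha'] at h3
      rw [← sub_nonneg] at h3 ⊢
      refine h3.trans (le_of_eq ?_)
      module
    · have k1 : a' ≤ b + (t + η / 2) • (1 - r) := by
        have := conj_le hb2 (1 - r)
        have e : star (1 - r) * a' * (1 - r) = a' := by
          rw [hur.isSelfAdjoint.star_eq, sub_mul, one_mul, hra', sub_zero, mul_sub, ha'r, mul_one, sub_zero]
        rw [e] at this
        refine this.trans (le_of_eq ?_)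
        rw [hur.isSelfAdjoint.star_eq, mul_add, add_mul, mul_smul_comm, smul_mul_assoc, mul_one, hur.isIdempotentElem.eq,
          sub_mul, one_mul, hrb, sub_zero, mul_sub, mul_one, hbr, sub_zero]
      have k2 : r * y * r ≤ t • r := by
        have := conj_le hyt r
        rwa [rs, mul_smul_comm, mul_one, smul_mul_assoc, rr] at this
      have k3 : (1 - r) * y * (1 - r) ≤ (η / 4 / (1 + (m⁻¹) ^ 2)) • (1 - r) := by
        have := conj_le hle (1 - r)
        rw [hur.isSelfAdjoint.star_eq] at this
        refine this.trans (le_of_eq ?_)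
        have z : (1 - r) * r = 0 := by rw [sub_mul, one_mul, rr, sub_self]
        rw [mul_add, mul_smul_comm, z, smul_zero, zero_add, mul_smul_comm, mul_one, smul_mul_assoc, hur.isIdempotentElem.eq]
      have k4 : y ≤ (1 + m ^ 2) • (t • r) + (η / 4) • (1 - r) := by
        have h := conj_add_le_m y0 r (1 - r) m0
        rw [add_sub_cancel, star_one, one_mul, mul_one, hur.isSelfAdjoint.star_eq, rs] at h
        refine h.trans (add_le_add (smul_le_smul_of_nonneg_left k2 (by positivity)) ?_)
        refine (smul_le_smul_of_nonneg_left k3 (by positivity)).trans (le_of_eq ?_)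
        rw [smul_smul, mul_div_cancel₀ _ (by positivity)]
      have k5 : (0:A) ≤ (η / 4) • 1 := smul_nonneg (by positivity) zero_le_one
      have k6 : (0:A) ≤ (η / 2) • r := smul_nonneg (by positivity) hr.nn
      have e1 : (1 + m ^ 2) • (t • r) = t • r + (η / 4) • r := by rw [smul_smul, add_mul, one_mul, m2, add_smul]
      rw [e1] at k4
      have e2 : a = s • r + a' + y := by rw [ha', ← hcy]; abel
      have h7 := add_le_add (add_le_add k1 k4) (add_nonneg k5 k6)
      rw [e2]
      rw [← sub_nonneg] at h7 ⊢
      refine h7.trans (le_of_eq ?_)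
      module

theorem rr0_of_W (hW : WeakCRLeOne A) (hS : IsSimpleCStarAlgebra A) : RealRankZero A := by
  intro a ha ε hε
  rcases subsingleton_or_nontrivial A with hsub | hnt
  · refine ⟨a, ha, ?_, by simpa using hε⟩
    have : spectrum ℝ a = ∅ := by
      rw [Set.eq_empty_iff_forall_notMem]
      intro x hx
      exact hx (isUnit_of_subsingleton _)
    rw [this]; exact Set.finite_empty
  by_cases hpc : ∀ y : A, 0 ≤ y → y ≠ 0 → HasPieces y
  · obtain ⟨a', ha'⟩ : ∃ a', a' = a + ‖a‖ • 1 := ⟨_, rfl⟩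
    have a0 : 0 ≤ a' := by
      have := neg_smul_one_le' ha le_rfl
      rw [ha', ← neg_le_iff_add_nonneg]; exact this
    obtain ⟨N, hN⟩ := exists_nat_ge (‖a'‖ / (ε / 8))
    rw [div_le_iff₀ (by positivity)] at hN
    obtain ⟨b, b0, -, h1, h2, p, hp0, hp⟩ := rr_step hW hS hpc (show 0 < ε / 8 by positivity) N a0
      (le_smul_one (IsSelfAdjoint.of_nonneg a0) hN) (show 0 < ε / 8 by positivity)
    have hfin := finite_spectrum_of_aeval b p hp0 hp
    have bs := IsSelfAdjoint.of_nonneg b0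
    refine ⟨b - ‖a‖ • 1, bs.sub (by rw [IsSelfAdjoint, star_smul, star_one, star_trivial]), ?_, ?_⟩
    · rw [← Algebra.algebraMap_eq_smul_one, ← spectrum.sub_singleton_eq]
      exact hfin.sub (Set.finite_singleton _)
    · have e : a - (b - ‖a‖ • 1) = a' - b := by rw [ha']; abel
      rw [e]
      have h3 : (a' - b) ≤ (ε / 4) • 1 := by
        rw [sub_le_iff_le_add']
        refine h2.trans (le_of_eq ?_)
        congr 2; ring
      have h4 : -((ε / 4) • 1) ≤ a' - b := by
        rw [neg_le_sub_iff_le_add]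
        refine h1.trans (add_le_add le_rfl (smul_le_smul_of_nonneg_right (by linarith) zero_le_one))
      have h5 : 0 ≤ (a' - b) + (ε / 4) • 1 := neg_le_iff_add_nonneg.mp h4
      have h6 := norm_le_of_le_smul h5 (show 0 ≤ ε / 2 by positivity) (by
        refine (add_le_add h3 le_rfl).trans (le_of_eq ?_)
        rw [← add_smul]; congr 1; ring)
      have h7 := norm_sub_le ((a' - b) + (ε / 4) • 1) ((ε / 4) • 1)
      rw [add_sub_cancel_right, norm_smul, norm_one, mul_one, Real.norm_of_nonneg (by positivity)] at h7
      linarith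
  · push Not at hpc
    obtain ⟨y, hy, hy0, hn⟩ := hpc
    have := fd_of_no_pieces hS hy hy0 hn
    have : FiniteDimensional ℝ A := FiniteDimensional.complexToReal A
    exact ⟨a, ha, finite_spectrum_of_fd a, by simpa using hε⟩
end RR


section MP

theorem exists_star_add {M : Type*} [NonUnitalCStarAlgebra M] (a b : M) :
    ∃ c : M, star a * a + star b * b = star c * c := by
  letI := CStarAlgebra.spectralOrder M
  haveI := CStarAlgebra.spectralOrderedRing M
  exact CStarAlgebra.nonneg_iff_eq_star_mul_self.mp
    (add_nonneg (star_mul_self_nonneg a) (star_mul_self_nonneg b))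

theorem MatIsPos.add {R : Type*} [NonUnitalCStarAlgebra R] {k : ℕ} {x y : Matrix (Fin k) (Fin k) R}
    (hx : MatIsPos x) (hy : MatIsPos y) : MatIsPos (x + y) := by
  letI := CStarAlgebra.spectralOrder R
  haveI := CStarAlgebra.spectralOrderedRing R
  obtain ⟨a, ha⟩ := hx
  obtain ⟨b, hb⟩ := hy
  obtain ⟨c, hc⟩ := exists_star_add (M := CStarMatrix (Fin k) (Fin k) R) (CStarMatrix.ofMatrix a)
    (CStarMatrix.ofMatrix b)
  refine ⟨CStarMatrix.ofMatrix.symm c, ?_⟩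
  rw [ha, hb]
  exact hc

theorem MatIsPos.zero {R : Type*} [NonUnitalCStarAlgebra R] {k : ℕ} : MatIsPos (0 : Matrix (Fin k) (Fin k) R) :=
  ⟨0, by simp⟩

theorem MatIsPos.sum {R : Type*} [NonUnitalCStarAlgebra R] {k : ℕ} {κ : Type*} (s : Finset κ)
    (f : κ → Matrix (Fin k) (Fin k) R)
    (hx : ∀ i ∈ s, MatIsPos (f i)) : MatIsPos (∑ i ∈ s, f i) :=
  Finset.sum_induction f MatIsPos (fun _ _ => MatIsPos.add) MatIsPos.zero hx

theorem MatIsPos.row {R : Type*} [NonUnitalCStarAlgebra R] {k : ℕ} (w : Fin k → R) :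
    MatIsPos (Matrix.of fun i j => star (w i) * w j) := by
  cases k with
  | zero => exact ⟨0, by ext i; exact i.elim0⟩
  | succ k =>
    refine ⟨Matrix.of fun i j => if i = 0 then w j else 0, ?_⟩
    ext i j
    rw [Matrix.mul_apply, Finset.sum_eq_single 0]
    · simp [Matrix.star_apply]
    · intro b _ hb; simp [Matrix.star_apply, hb]
    · simp

/-- transport of the structure along a bijection -/
noncomputable def cstarTransport {F : Type*} {G : Type} [NonUnitalCStarAlgebra F] (e : G ≃ F) :
    NonUnitalCStarAlgebra G := by
  letI r1 : NonUnitalRing G := e.nonUnitalRing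
  letI : Module ℂ G := e.module ℂ
  letI : StarRing G :=
    { star := fun x => e.symm (star (e x))
      star_involutive := fun x => by simp [star]
      star_mul := fun x y => e.injective (by simp [star, Equiv.mul_def])
      star_add := fun x y => e.injective (by simp [star, Equiv.add_def]) }
  let f : G →ₙ+* F :=
    { toFun := e
      map_mul' := fun x y => by simp [Equiv.mul_def]
      map_zero' := by simp [Equiv.zero_def]
      map_add' := fun x y => by simp [Equiv.add_def] }
  let fl : G →ₗ[ℂ] F :=
    { toFun := e
      map_smul' := fun x y => by simp [Equiv.smul_def]
      map_add' := fun x y => by simp [Equiv.add_def] }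
  letI n1 : NonUnitalNormedRing G := { r1, NonUnitalNormedRing.induced G F f e.injective with }
  letI : NormedSpace ℂ G := ⟨fun c x => by
    change ‖e (c • x)‖ ≤ _ * ‖e x‖
    have : e (c • x) = c • e x := by simp [Equiv.smul_def]
    rw [this, norm_smul]⟩
  have hiso : Isometry e := AddMonoidHomClass.isometry_of_norm f fun x => rfl
  haveI : CompleteSpace G := by
    have h1 : IsUniformInducing e := hiso.isUniformInducing
    exact (h1.completeSpace_congr e.surjective).2 inferInstance
  have hs : ∀ x, e (star x) = star (e x) := fun x => e.apply_symm_apply _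
  have hm : ∀ x y, e (x * y) = e x * e y := fun x y => e.apply_symm_apply _
  have hc : ∀ (c : ℂ) x, e (c • x) = c • e x := fun c x => e.apply_symm_apply _
  haveI : CStarRing G := ⟨fun x => by
    change ‖e x‖ * ‖e x‖ ≤ ‖e (star x * x)‖
    rw [hm, hs, CStarRing.norm_star_mul_self]⟩
  haveI : IsScalarTower ℂ G G := ⟨fun c x y => e.injective (by
    change e ((c • x) * y) = e (c • (x * y))
    rw [hm, hc, hc, hm, smul_mul_assoc])⟩
  haveI : SMulCommClass ℂ G G := ⟨fun c x y => e.injective (by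
    change e (c • (x * y)) = e (x * (c • y))
    rw [hc, hm, hm, hc, mul_smul_comm])⟩
  haveI : StarModule ℂ G := ⟨fun c x => e.injective (by rw [hs, hc, hc, hs, star_smul])⟩
  exact {}
end MP


section T0
variable {A : Type u} [CStarAlgebra A]

theorem exists_type0_aux {F : Type u} [NonUnitalCStarAlgebra F] {G : Type} (e : G ≃ F) :
    ∃ (_ : NonUnitalCStarAlgebra G) (j : G →ₗ[ℂ] F), (∀ x, j x = e x) ∧
      (∀ x y, j (x * y) = j x * j y) ∧ (∀ x, j (star x) = star (j x)) ∧ (∀ x, ‖j x‖ = ‖x‖) := by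
  letI := cstarTransport e
  refine ⟨cstarTransport e, ⟨⟨e, fun x y => e.apply_symm_apply _⟩, fun x y => e.apply_symm_apply _⟩,
    fun _ => rfl, fun x y => e.apply_symm_apply _, fun x => e.apply_symm_apply _, fun x => rfl⟩

theorem exists_type0 (C : NonUnitalStarSubalgebra ℂ A) [FiniteDimensional ℂ C] :
    ∃ (G : Type) (_ : NonUnitalCStarAlgebra G) (j : G →ₗ[ℂ] A), FiniteDimensional ℂ G ∧
      (∀ x y, j (x * y) = j x * j y) ∧ (∀ x, j (star x) = star (j x)) ∧ (∀ x, ‖j x‖ = ‖x‖) ∧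
      (∀ x, j x ∈ C) ∧ ∀ a ∈ C, ∃ g, j g = a := by
  haveI : IsClosed (C : Set A) := fd_isClosed C
  obtain ⟨G, ⟨e⟩⟩ : ∃ G : Type, Nonempty (G ≃ C) :=
    ⟨_, ⟨(Module.finBasis ℂ C).equivFun.toEquiv.symm⟩⟩
  obtain ⟨i, j, h1, h2, h3, h4⟩ := exists_type0_aux e
  let S : C →ₗ[ℂ] A := C.toSubmodule.subtype
  refine ⟨G, i, S ∘ₗ j, ?_, ?_, ?_, ?_, ?_, ?_⟩
  · have : Function.Injective j := by
      have := e.injective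
      rwa [show (e : G → C) = j from funext fun x => (h1 x).symm] at this
    exact FiniteDimensional.of_injective j this
  · intro x y
    exact congrArg Subtype.val (h2 x y)
  · intro x
    exact congrArg Subtype.val (h3 x)
  · intro x
    exact h4 x
  · intro x
    exact (j x).2
  · intro a ha
    refine ⟨e.symm ⟨a, ha⟩, ?_⟩
    change ((j _ : C) : A) = a
    rw [h1]; simp
end T0


section CE
variable {A : Type u} [CStarAlgebra A]

open scoped ComplexOrder in
theorem pos_fun_star [PartialOrder A] [StarOrderedRing A] (ω : A →ₗ[ℂ] ℂ)
    (hω : ∀ a, 0 ≤ a → ∃ t : ℝ, 0 ≤ t ∧ ω a = t) (a : A) : ω (star a) = star (ω a) := by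
  let f : A →ₚ[ℂ] ℂ := PositiveLinearMap.mk₀ ω (fun a ha => by
    obtain ⟨t, ht, h⟩ := hω a ha
    rw [h]; exact_mod_cast ht)
  exact map_star f a

open scoped ComplexOrder MatrixOrder in
theorem gram [PartialOrder A] [StarOrderedRing A] (ω : A →ₗ[ℂ] ℂ)
    (hω : ∀ a, 0 ≤ a → ∃ t : ℝ, 0 ≤ t ∧ ω a = t) {κ : Type} [Fintype κ] (w : κ → A) :
    ∃ B : κ → κ → ℂ, ∀ a b, ω (star (w a) * w b) = ∑ t, star (B t a) * B t b := by
  classical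
  have hP : (Matrix.of fun a b => ω (star (w a) * w b)).PosSemidef := by
    refine .of_dotProduct_mulVec_nonneg ?_ ?_
    · ext a b
      simp only [Matrix.conjTranspose_apply, Matrix.of_apply]
      rw [← pos_fun_star ω hω]; simp
    · intro c
      obtain ⟨t, ht, h⟩ := hω _ (star_mul_self_nonneg (∑ a, c a • w a))
      have : star c ⬝ᵥ (Matrix.of fun a b => ω (star (w a) * w b)).mulVec c = t := by
        rw [← h, star_sum, Finset.sum_mul_sum, map_sum]
        simp only [dotProduct, Matrix.mulVec, Matrix.of_apply, Finset.mul_sum, Pi.star_apply]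
        refine Finset.sum_congr rfl fun a _ => ?_
        rw [map_sum]
        refine Finset.sum_congr rfl fun b _ => ?_
        rw [star_smul, smul_mul_smul_comm, map_smul, smul_eq_mul]; ring
      rw [this]; exact_mod_cast ht
  obtain ⟨B, hB⟩ := CStarAlgebra.nonneg_iff_eq_star_mul_self.mp hP.nonneg
  refine ⟨fun t a => B t a, fun a b => ?_⟩
  have := congrFun (congrFun hB a) b
  simpa [Matrix.mul_apply] using this

theorem cp_row {B : Type v} [NonUnitalCStarAlgebra B] (E : A →ₗ[ℂ] B)
    (h : ∀ k (w : Fin k → A), MatIsPos (Matrix.of fun i j => E (star (w i) * w j))) : IsCP E := by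
  rintro k _ ⟨y, rfl⟩
  have := MatIsPos.sum Finset.univ (fun c => Matrix.of fun i j => E (star (y c i) * y c j))
    (fun c _ => h k (y c))
  convert this using 1
  ext i j
  simp [Matrix.mul_apply, Matrix.sum_apply]

theorem cp_schwarz {B : Type v} [NonUnitalCStarAlgebra B] [PartialOrder B] [StarOrderedRing B]
    (E : A →ₗ[ℂ] B) (h : IsCP E) (a g : B) (x : A) (hx : E x = a) :
    star g * a + star a * g ≤ star g * E 1 * g + E (star x * x) := by
  obtain ⟨Y, hY⟩ := h 2 _ ⟨!![1, x; 0, 0], rfl⟩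
  have e00 := congrFun (congrFun hY 0) 0
  have e01 := congrFun (congrFun hY 0) 1
  have e10 := congrFun (congrFun hY 1) 0
  have e11 := congrFun (congrFun hY 1) 1
  simp [Matrix.mul_apply, Fin.sum_univ_two] at e00 e01 e10 e11
  have e10' : star a = star (Y 0 1) * Y 0 0 + star (Y 1 1) * Y 1 0 := by
    rw [← hx, e01]; simp
  rw [hx] at e01
  rw [← sub_nonneg, e10', e01, e00, e11]
  have := add_nonneg (star_mul_self_nonneg (Y 0 0 * g - Y 0 1))
    (star_mul_self_nonneg (Y 1 0 * g - Y 1 1))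
  refine this.trans (le_of_eq ?_)
  simp only [star_sub, star_mul]
  noncomm_ring

theorem cp_contr {B : Type v} [NonUnitalCStarAlgebra B]
    (E : A →ₗ[ℂ] B) (h : IsCP E) (h1 : ‖E 1‖ ≤ 1) (x : A) : ‖E x‖ ≤ ‖x‖ := by
  letI := CStarAlgebra.spectralOrder A
  haveI := CStarAlgebra.spectralOrderedRing A
  letI := CStarAlgebra.spectralOrder B
  haveI := CStarAlgebra.spectralOrderedRing B
  have hpos : ∀ a : A, 0 ≤ a → 0 ≤ E a := by
    intro a ha
    obtain ⟨y, hy⟩ := CStarAlgebra.nonneg_iff_eq_star_mul_self.mp ha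
    obtain ⟨Y, hY⟩ := h 1 !![a] ⟨!![y], by ext i j; simp [hy, Matrix.mul_apply, Matrix.star_apply]⟩
    have e00 := congrFun (congrFun hY 0) 0
    simp [Matrix.mul_apply] at e00
    rw [e00]; exact star_mul_self_nonneg _
  have h2 := cp_schwarz E h (E x) (E x) x rfl
  have h3 : star (E x) * E 1 * E x ≤ star (E x) * E x := by
    refine (CStarAlgebra.star_left_conjugate_le_norm_smul
      (IsSelfAdjoint.of_nonneg (hpos 1 zero_le_one))).trans ?_
    have : 0 ≤ (1 - ‖E 1‖) • (star (E x) * E x) :=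
      smul_nonneg (by linarith) (star_mul_self_nonneg _)
    rw [← sub_nonneg]
    refine this.trans (le_of_eq (by module))
  have h4 : star (E x) * E x ≤ E (star x * x) := by
    have := h2.trans (add_le_add_left h3 _)
    simpa using this
  have h5 := hpos _ (sub_nonneg.2 (star_mul_le_one (le_refl ‖x‖)))
  have h6 : E ((‖x‖ ^ 2) • (1 : A)) = (‖x‖ ^ 2) • E 1 := by
    rw [← Complex.coe_smul, map_smul, Complex.coe_smul]
  rw [map_sub, sub_nonneg, h6] at h5
  have h7 := CStarAlgebra.norm_le_norm_of_nonneg_of_le (star_mul_self_nonneg (E x)) (h4.trans h5)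
  rw [CStarRing.norm_star_mul_self, norm_smul, Real.norm_of_nonneg (by positivity)] at h7
  have h8 : ‖E x‖ * ‖E x‖ ≤ ‖x‖ * ‖x‖ := by nlinarith [sq_nonneg ‖x‖]
  exact le_of_not_gt fun hlt => absurd h8 (not_le.2 (mul_self_lt_mul_self (norm_nonneg _) hlt))
end CE


section CE
variable {A : Type u} [CStarAlgebra A]

theorem exists_E [PartialOrder A] [StarOrderedRing A] (C : NonUnitalStarSubalgebra ℂ A)
    [FiniteDimensional ℂ C] :
    ∃ (G : Type) (_ : NonUnitalCStarAlgebra G) (j : G →ₗ[ℂ] A) (E : A →ₗ[ℂ] G),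
      FiniteDimensional ℂ G ∧
      (∀ x y, j (x * y) = j x * j y) ∧ (∀ x, j (star x) = star (j x)) ∧ (∀ x, ‖j x‖ = ‖x‖) ∧
      IsCP E ∧ (∀ x, ‖E x‖ ≤ ‖x‖) ∧ ∀ a ∈ C, j (E a) = a := by
  classical
  obtain ⟨G, iG, j, hfd, hmul, hstar, hnorm, hmem, hsurj⟩ := exists_type0 C
  obtain ⟨ι, _, r, v, H⟩ := exists_MU C
  have hinj : ∀ x y, j x = j y → x = y := by
    intro x y hxy
    rw [← sub_eq_zero, ← norm_eq_zero, ← hnorm, map_sub, hxy, sub_self, norm_zero]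
  choose u hu using fun i => hsurj (v i) (H.mem i)
  choose ω hω hω1 hωc using fun i => exists_peak (v (r i)) (H.proj i) (H.ne _)
  let E : A →ₗ[ℂ] G := ∑ i, ∑ k, if r i = r k then
    ((ω (r i)) ∘ₗ (LinearMap.mulLeft ℂ (star (v i))) ∘ₗ
      LinearMap.mulRight ℂ (v k)).smulRight (u i * star (u k)) else 0
  have hE : ∀ a, E a = ∑ i, ∑ k, if r i = r k then
      ω (r i) (star (v i) * (a * v k)) • (u i * star (u k)) else 0 := by
    intro a
    simp only [E, LinearMap.sum_apply]
    refine Finset.sum_congr rfl fun i _ => Finset.sum_congr rfl fun k _ => ?_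
    split_ifs <;> simp
  have ω1 : ∀ i, ω (r i) (v (r i)) = 1 := fun i => by
    have := hω1 (r i)
    rwa [H.rr] at this
  have hu2 : ∀ i, u i * u (r i) = u i := fun i => hinj _ _ (by rw [hmul, hu, hu, H.mul_rep])
  have hu3 : ∀ i, star (u (r i)) * u (r i) = u (r i) := fun i => hinj _ _ (by
    rw [hmul, hstar, hu, H.self, H.rr])
  have hu4 : ∀ i, star (u (r i)) = u (r i) := fun i => by rw [← hu3]; simp
  have hCP : IsCP E := by
    apply cp_row
    intro k w
    choose B hB using fun ρ => gram (ω ρ) (hω ρ) (fun α : Fin k × ι => w α.1 * v α.2)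
    let Z : ι → (Fin k × ι) → Fin k → G := fun ρ t b =>
      ∑ j, if r j = ρ then B ρ t (b, j) • (u ρ * star (u j)) else 0
    have := MatIsPos.sum Finset.univ (fun ρ => ∑ t, Matrix.of fun a b => star (Z ρ t a) * Z ρ t b)
      (fun ρ _ => MatIsPos.sum Finset.univ _ (fun t _ => MatIsPos.row (Z ρ t)))
    convert this using 1
    ext a b
    rw [Matrix.of_apply, hE]
    simp only [Matrix.sum_apply, Matrix.of_apply]
    have e1 : ∀ ρ, ∑ t, star (Z ρ t a) * Z ρ t b = ∑ i, ∑ j, if r i = ρ then (if r j = ρ then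
        ω ρ (star (v i) * (star (w a) * w b * v j)) • (u i * star (u j)) else 0) else 0 := by
      intro ρ
      simp only [Z, star_sum, Finset.sum_mul_sum]
      rw [Finset.sum_comm]
      refine Finset.sum_congr rfl fun i _ => ?_
      rw [Finset.sum_comm]
      refine Finset.sum_congr rfl fun l _ => ?_
      by_cases hi : r i = ρ
      · by_cases hl : r l = ρ
        · simp only [hi, hl, if_true]
          have h1 := hB ρ (a, i) (b, l)
          simp only [star_mul] at h1
          rw [show star (v i) * (star (w a) * w b * v l) = star (v i) * star (w a) * (w b * v l) by
            noncomm_ring, h1, Finset.sum_smul]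
          refine Finset.sum_congr rfl fun t _ => ?_
          rw [star_smul, smul_mul_smul_comm]
          congr 1
          rw [star_mul, star_star]
          have : u i * star (u ρ) * (u ρ * star (u l)) = u i * (star (u ρ) * u ρ) * star (u l) := by
            noncomm_ring
          rw [this, ← hi, hu3, hu2]
        · simp [hl]
      · simp [hi]
    simp only [e1]
    symm
    rw [Finset.sum_comm]
    refine Finset.sum_congr rfl fun i _ => ?_
    rw [Finset.sum_comm]
    refine Finset.sum_congr rfl fun l _ => ?_
    rw [Finset.sum_ite_eq]
    simp [eq_comm]
  have hEC : ∀ a ∈ C, j (E a) = a := by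
    intro a ha
    have e1 : j (E a) = ∑ i, ∑ k, (v i * star (v i)) * a * (v k * star (v k)) := by
      rw [hE, map_sum]
      refine Finset.sum_congr rfl fun i _ => ?_
      rw [map_sum]
      refine Finset.sum_congr rfl fun k _ => ?_
      have e2 : v i * star (v i) * a * (v k * star (v k)) =
        v i * (star (v i) * a * v k) * star (v k) := by noncomm_ring
      split_ifs with h
      · obtain ⟨c, hc⟩ := H.coef a ha i k h
        rw [e2, ← mul_assoc, hc, map_smul, map_smul, ω1, hmul, hstar, hu, hu, mul_smul_comm,
          H.mul_rep, smul_mul_assoc, smul_eq_mul, mul_one]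
      · rw [e2, H.cross a ha i k h]; simp
    rw [e1]
    simp only [← Finset.mul_sum, ← Finset.sum_mul]
    rw [H.unit a ha, H.unit_right a ha]
  have hE1 : ‖E 1‖ ≤ 1 := by
    rw [← hnorm]
    have e1 : j (E 1) = ∑ i, v i * star (v i) := by
      rw [hE, map_sum]
      refine Finset.sum_congr rfl fun i _ => ?_
      rw [Finset.sum_eq_single i]
      · simp [H.self, ω1, hmul, hstar, hu]
      · intro k _ hk
        rw [one_mul, H.off i k hk.symm]; simp
      · simp
    rw [e1]
    apply IsStarProjection.nrm
    have hm : ∑ i, v i * star (v i) ∈ C :=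
      sum_mem fun i _ => mul_mem (H.mem i) (star_mem (H.mem i))
    exact ⟨H.unit _ hm, by simp [IsSelfAdjoint, star_sum]⟩
  exact ⟨G, iG, j, E, hfd, hmul, hstar, hnorm, hCP, cp_contr E hCP hE1, hEC⟩
end CE


section ND
variable {A : Type u} [CStarAlgebra A]

theorem nuc_wit [PartialOrder A] [StarOrderedRing A] (C : Fin 2 → NonUnitalStarSubalgebra ℂ A)
    (hfd : ∀ i, FiniteDimensional ℂ (C i)) (s : Fin 2 → A) (hs : ∀ i, ‖s i‖ ≤ 1) (X : Finset A)
    {δ ε : ℝ} (hδ : 5 * δ ≤ ε)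
    (h1 : ∀ x ∈ X, ∀ i, ∃ c ∈ C i, ‖star (s i) * x * s i - c‖ < δ)
    (h2 : ∀ x ∈ X, ‖∑ i, star (s i) * x * s i - x‖ < δ) :
    ∃ (F : Fin 2 → Type) (instF : ∀ i, NonUnitalCStarAlgebra (F i)),
      @NucDimWitness A _ 1 X ε F instF := by
  choose G iG j E hGfd hmul hstar hnorm hCP hcon hEC using fun i => exists_E (C i)
  refine ⟨G, iG, hGfd, ?_⟩
  let ψi : ∀ i, A →ₗ[ℂ] G i := fun i =>
    E i ∘ₗ (LinearMap.mulLeft ℂ (star (s i))) ∘ₗ LinearMap.mulRight ℂ (s i)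
  have hψi : ∀ i a, ψi i a = E i (star (s i) * a * s i) := fun i a => by
    simp [ψi, mul_assoc]
  let ψ : A →ₗ[ℂ] (∀ i, G i) := LinearMap.pi ψi
  let φ : (∀ i, G i) →ₗ[ℂ] A := ∑ i, j i ∘ₗ LinearMap.proj i
  have hφ : ∀ f, φ f = ∑ i, j i (f i) := fun f => by simp [φ]
  have hs2 : ∀ i a, ‖star (s i) * a * s i‖ ≤ ‖a‖ := fun i a => by
    refine (norm_mul_le _ _).trans ?_
    have := norm_mul_le (star (s i)) a
    rw [norm_star] at this
    have h3 := mul_le_mul_of_nonneg_right (hs i) (norm_nonneg a)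
    have h4 := mul_le_mul_of_nonneg_left (hs i) (norm_nonneg (star (s i) * a))
    linarith
  have hφs : ∀ i (x : G i), φ (Pi.single i x) = j i x := by
    intro i x
    rw [hφ, Finset.sum_eq_single i]
    · simp
    · intro k _ hk
      simp [Pi.single_eq_of_ne hk]
    · simp
  refine ⟨ψ, φ, ?_, ?_, ?_, ?_, ?_⟩
  · have hcp : ∀ i, IsCP (ψi i) := by
      intro i
      apply cp_row
      intro k w
      have := hCP i k _ (MatIsPos.row fun a => w a * s i)
      convert this using 1
      ext a b
      simp [hψi, mul_assoc]
    intro k x hx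
    choose Y hY using fun i => hcp i k x hx
    refine ⟨Matrix.of fun a b => fun i => Y i a b, ?_⟩
    ext a b i
    have := congrFun (congrFun (hY i) a) b
    simp only [Matrix.map_apply, Matrix.mul_apply, Matrix.star_apply] at this
    simp [Matrix.mul_apply, ψ, this, Finset.sum_apply]
  · intro a
    rw [pi_norm_le_iff_of_nonneg (norm_nonneg a)]
    intro i
    change ‖ψi i a‖ ≤ _
    rw [hψi]
    exact (hcon i _).trans (hs2 i a)
  · rintro k _ ⟨y, rfl⟩
    have := MatIsPos.sum Finset.univ (fun i => star (Matrix.of fun a b => j i (y a b i)) *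
      (Matrix.of fun a b => j i (y a b i))) (fun i _ => ⟨_, rfl⟩)
    convert this using 1
    ext a b
    simp only [Matrix.map_apply, hφ, Matrix.sum_apply, Matrix.mul_apply, Matrix.star_apply,
      Finset.sum_apply, map_sum, Pi.mul_apply, Pi.star_apply, hmul, hstar, Matrix.of_apply]
  · intro i
    refine ⟨fun x => ?_, fun x y _ _ hxy => ?_⟩
    · rw [hφs, hnorm]
    · rw [hφs, hφs, ← hmul, hxy, map_zero]
  · intro x hx
    have e1 : φ (ψ x) = ∑ i, j i (E i (star (s i) * x * s i)) := by
      rw [hφ]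
      exact Finset.sum_congr rfl fun i _ => by rw [← hψi]; rfl
    have e2 : ∀ i, ‖j i (E i (star (s i) * x * s i)) - star (s i) * x * s i‖ < 2 * δ := by
      intro i
      obtain ⟨c, hc, hcx⟩ := h1 x hx i
      have : j i (E i (star (s i) * x * s i)) - star (s i) * x * s i =
        j i (E i (star (s i) * x * s i - c)) - (star (s i) * x * s i - c) := by
        rw [map_sub, map_sub, hEC i c hc]; abel
      rw [this]
      have h3 := norm_sub_le (j i (E i (star (s i) * x * s i - c))) (star (s i) * x * s i - c)
      rw [hnorm] at h3
      have := hcon i (star (s i) * x * s i - c)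
      linarith
    have e3 : φ (ψ x) - x = (j 0 (E 0 (star (s 0) * x * s 0)) - star (s 0) * x * s 0) +
      (j 1 (E 1 (star (s 1) * x * s 1)) - star (s 1) * x * s 1) +
      (∑ i, star (s i) * x * s i - x) := by
      rw [e1, Fin.sum_univ_two, Fin.sum_univ_two]; abel
    rw [e3]
    have h3 := norm_add₃_le (a := j 0 (E 0 (star (s 0) * x * s 0)) - star (s 0) * x * s 0)
      (b := j 1 (E 1 (star (s 1) * x * s 1)) - star (s 1) * x * s 1)
      (c := ∑ i, star (s i) * x * s i - x)
    have := e2 0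
    have := e2 1
    have := h2 x hx
    linarith

theorem nuc_of_W [PartialOrder A] [StarOrderedRing A] (hW : WeakCRLeOne A) : NuclearDimLE 1 A := by
  intro X ε hε
  have hδ : 0 < ε / 20 := by positivity
  have hc1 : ContinuousOn Real.sqrt (Set.Icc 0 1) := Real.continuous_sqrt.continuousOn
  have hc2 : ContinuousOn (fun x => Real.sqrt (1 - x)) (Set.Icc 0 1) := by fun_prop
  choose e1 he1 hh1 using fun x : A => cfc_comm x Real.sqrt hc1 hδ
  choose e2 he2 hh2 using fun x : A => cfc_comm x (fun x => Real.sqrt (1 - x)) hc2 hδ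
  obtain ⟨η, hη, hη1⟩ : ∃ η > 0, ∀ x ∈ X, η ≤ e1 x ∧ η ≤ e2 x := by
    clear * - he1 he2
    classical
    induction X using Finset.induction_on with
    | empty => exact ⟨1, one_pos, by simp⟩
    | insert a s ha ih =>
      obtain ⟨η, h0, h⟩ := ih
      refine ⟨min η (min (e1 a) (e2 a)), lt_min h0 (lt_min (he1 a) (he2 a)), ?_⟩
      intro x hx
      rcases Finset.mem_insert.1 hx with rfl | hx
      · simp
      · have := h x hx
        exact ⟨(min_le_left _ _).trans this.1, (min_le_left _ _).trans this.2⟩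
  obtain ⟨C, D, hC, hD, h, ⟨z, hz⟩, hn, hcom, hhC, hhD⟩ := hW X (min η (ε / 20)) (lt_min hη hδ)
  have h0 : 0 ≤ h := by rw [hz]; exact star_mul_self_nonneg z
  have h1 : h ≤ 1 := le_one_of h0 hn
  have hsp := spec_Icc h0 h1
  obtain ⟨a, ha⟩ : ∃ a, a = cfc Real.sqrt h := ⟨_, rfl⟩
  obtain ⟨b, hb⟩ : ∃ b, b = cfc (fun x => Real.sqrt (1 - x)) h := ⟨_, rfl⟩
  have hsa : IsSelfAdjoint h := IsSelfAdjoint.of_nonneg h0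
  have haa : a * a = h := by
    rw [ha, ← cfc_mul (R := ℝ) _ _ h (hc1.mono hsp) (hc1.mono hsp)]
    conv_rhs => rw [← cfc_id ℝ h]
    exact cfc_congr fun x hx => Real.mul_self_sqrt (hsp _ hx).1
  have hbb : b * b = 1 - h := by
    rw [hb, ← cfc_mul (R := ℝ) _ _ h (hc2.mono hsp) (hc2.mono hsp)]
    have : cfc (fun x : ℝ => 1 - x) h = 1 - h := by
      rw [cfc_sub (R := ℝ) (fun _ => 1) (fun x => x) h, cfc_const_one ℝ h, cfc_id' ℝ h]
    rw [← this]
    exact cfc_congr fun x hx => Real.mul_self_sqrt (sub_nonneg.2 (hsp _ hx).2)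
  have hsa1 : star a = a := by
    rw [ha]; exact (cfc_predicate Real.sqrt h : IsSelfAdjoint _).star_eq
  have hsb1 : star b = b := by
    rw [hb]; exact (cfc_predicate (fun x => Real.sqrt (1 - x)) h : IsSelfAdjoint _).star_eq
  have hna : ‖a‖ ≤ 1 := by
    have : ‖a‖ * ‖a‖ ≤ 1 := by rw [← CStarRing.norm_star_mul_self, hsa1, haa]; exact hn
    nlinarith [norm_nonneg a]
  have hnb : ‖b‖ ≤ 1 := by
    have : ‖b‖ * ‖b‖ ≤ 1 := by
      rw [← CStarRing.norm_star_mul_self, hsb1, hbb]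
      exact norm_le_one_of (sub_nonneg.2 h1) (by simpa using h0)
    nlinarith [norm_nonneg b]
  have ka : ∀ x ∈ X, ‖a * x * a - h * x‖ ≤ ε / 20 := by
    intro x hx
    have := hh1 x h h0 h1 ((hcom x hx).le.trans ((min_le_left _ _).trans (hη1 x hx).1))
    rw [← ha] at this
    have e : a * x * a - h * x = - (a * (a * x - x * a)) := by rw [← haa]; noncomm_ring
    rw [e, norm_neg]
    refine (norm_mul_le _ _).trans ?_
    nlinarith [norm_nonneg (a * x - x * a)]
  have kb : ∀ x ∈ X, ‖b * x * b - (1 - h) * x‖ ≤ ε / 20 := by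
    intro x hx
    have := hh2 x h h0 h1 ((hcom x hx).le.trans ((min_le_left _ _).trans (hη1 x hx).2))
    rw [← hb] at this
    have e : b * x * b - (1 - h) * x = - (b * (b * x - x * b)) := by rw [← hbb]; noncomm_ring
    rw [e, norm_neg]
    refine (norm_mul_le _ _).trans ?_
    nlinarith [norm_nonneg (b * x - x * b)]
  refine nuc_wit ![C, D] ?_ ![a, b] ?_ X (δ := ε / 5) (ε := ε) (by linarith) ?_ ?_
  · intro i; fin_cases i
    · exact hC
    · exact hD
  · intro i; fin_cases i
    · exact hna
    · exact hnb
  · intro x hx i; fin_cases i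
    · obtain ⟨c, hc, hcx⟩ := hhC x hx
      refine ⟨c, hc, ?_⟩
      change ‖star a * x * a - c‖ < _
      rw [hsa1]
      have := norm_sub_le_norm_sub_add_norm_sub (a * x * a) (h * x) c
      have := ka x hx
      have := min_le_right η (ε / 20)
      linarith
    · obtain ⟨c, hc, hcx⟩ := hhD x hx
      refine ⟨c, hc, ?_⟩
      change ‖star b * x * b - c‖ < _
      rw [hsb1]
      have := norm_sub_le_norm_sub_add_norm_sub (b * x * b) ((1 - h) * x) c
      have := kb x hx
      have := min_le_right η (ε / 20)
      linarith
  · intro x hx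
    rw [Fin.sum_univ_two]
    change ‖star a * x * a + star b * x * b - x‖ < _
    rw [hsa1, hsb1]
    have e : a * x * a + b * x * b - x = (a * x * a - h * x) + (b * x * b - (1 - h) * x) := by
      noncomm_ring
    rw [e]
    have := norm_add_le (a * x * a - h * x) (b * x * b - (1 - h) * x)
    have := ka x hx
    have := kb x hx
    linarith
end ND


section OZ
variable {A : Type u} [CStarAlgebra A]

theorem spectral_decomp {F : Type*} [NonUnitalCStarAlgebra F] [FiniteDimensional ℂ F]
    (x : F) (hx : IsSelfAdjoint x) : ∃ (S : Finset ℝ) (p : ℝ → F), (∀ l, IsStarProjection (p l)) ∧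
      (∀ l m, l ≠ m → p l * p m = 0) ∧ x = ∑ l ∈ S, l • p l := by
  classical
  have hfin := finite_quasispectrum_of_fd x
  let g : ℝ → ℝ → ℝ := fun l t => if t = l ∧ l ≠ 0 then 1 else 0
  have hc : ∀ f : ℝ → ℝ, ContinuousOn f (quasispectrum ℝ x) := fun f => hfin.continuousOn f
  have hg0 : ∀ l, g l 0 = 0 := fun l => by
    simp only [g]; rw [if_neg]; rintro ⟨h1, h2⟩; exact h2 h1.symm
  refine ⟨hfin.toFinset, fun l => cfcₙ (g l) x, ?_, ?_, ?_⟩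
  · intro l
    refine ⟨?_, cfcₙ_predicate (g l) x⟩
    rw [IsIdempotentElem, ← cfcₙ_mul _ _ x (hc _) (hg0 l) (hc _) (hg0 l)]
    apply cfcₙ_congr
    intro t ht
    by_cases h : t = l ∧ l ≠ 0 <;> simp [g, h]
  · intro l m hlm
    change cfcₙ (g l) x * cfcₙ (g m) x = 0
    rw [← cfcₙ_mul _ _ x (hc _) (hg0 l) (hc _) (hg0 m), ← cfcₙ_zero ℝ x]
    apply cfcₙ_congr
    intro t ht
    by_cases h : t = l
    · subst h; simp [g, hlm]
    · simp [g, h]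
  · have : ∀ l, l • cfcₙ (g l) x = cfcₙ (fun t => l • g l t) x := fun l =>
      (cfcₙ_smul l (g l) x (hc _) (hg0 l)).symm
    simp only [this]
    rw [← cfcₙ_sum _ _ _ (fun i _ => hc _) (fun i _ => by simp [hg0])]
    conv_lhs => rw [← cfcₙ_id ℝ x]
    apply cfcₙ_congr
    intro t ht
    simp only [Finset.sum_apply, id]
    rw [Finset.sum_eq_single t]
    · by_cases h : t = 0 <;> simp [g, h]
    · intro b _ hb
      simp [g, hb.symm]
    · intro h; exact absurd (hfin.mem_toFinset.2 ht) h

theorem oz_mul {F : Type v} [NonUnitalCStarAlgebra F] [FiniteDimensional ℂ F] (φ : F →ₗ[ℂ] A)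
    (hCP : IsCP φ)
    (hoz : ∀ x y : F, (∃ u, x = star u * u) → (∃ v, y = star v * v) → x * y = 0 → φ x * φ y = 0)
    (u : F) (hu : ∀ x, u * x = x) (hus : star u = u) (a b : F) :
    φ a * φ b = φ (a * b) * φ u := by
  classical
  have hu' : ∀ x, x * u = x := fun x => by
    have := congrArg star (hu (star x))
    simpa [hus] using this
  have hpu : ∀ p, IsStarProjection p → φ p * φ p = φ p * φ u ∧ φ p * φ p = φ u * φ p := by
    intro p hp
    have h1 : IsStarProjection (u - p) := ⟨by
      rw [IsIdempotentElem, sub_mul, mul_sub, mul_sub, hu, hu, hu', hp.1.eq]; abel, by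
      rw [IsSelfAdjoint, star_sub, hus, hp.2.star_eq]⟩
    have hsq : ∀ q : F, IsStarProjection q → ∃ v, q = star v * v := fun q hq =>
      ⟨q, by rw [hq.2.star_eq, hq.1.eq]⟩
    have h2 := hoz p (u - p) (hsq _ hp) (hsq _ h1) (by rw [mul_sub, hu', hp.1.eq, sub_self])
    have h3 := hoz (u - p) p (hsq _ h1) (hsq _ hp) (by rw [sub_mul, hu, hp.1.eq, sub_self])
    rw [map_sub, mul_sub, sub_eq_zero] at h2
    rw [map_sub, sub_mul, sub_eq_zero] at h3
    exact ⟨h2.symm, h3.symm⟩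
  have hrs : ∀ (l : ℝ) x, φ (l • x) = l • φ x := fun l x => by
    rw [← Complex.coe_smul, map_smul, Complex.coe_smul]
  have hsa : ∀ x, IsSelfAdjoint x → φ x * φ u = φ u * φ x ∧ φ x * φ x = φ (x * x) * φ u := by
    intro x hx
    obtain ⟨S, p, hp, hpp, hxs⟩ := spectral_decomp x hx
    have hx2 : x * x = ∑ l ∈ S, (l * l) • p l := by
      rw [hxs, Finset.sum_mul_sum]
      refine Finset.sum_congr rfl fun l hl => ?_
      rw [Finset.sum_eq_single l]
      · rw [smul_mul_smul_comm, (hp l).1.eq]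
      · intro m _ hm
        rw [smul_mul_smul_comm, hpp l m hm.symm, smul_zero]
      · exact fun h => absurd hl h
    have hφx : φ x = ∑ l ∈ S, l • φ (p l) := by
      rw [hxs, map_sum]; simp only [hrs]
    constructor
    · rw [hφx, Finset.sum_mul, Finset.mul_sum]
      refine Finset.sum_congr rfl fun l _ => ?_
      rw [smul_mul_assoc, mul_smul_comm, ← (hpu _ (hp l)).1, (hpu _ (hp l)).2]
    · rw [hx2, map_sum, hφx, Finset.sum_mul_sum, Finset.sum_mul]
      refine Finset.sum_congr rfl fun l hl => ?_
      rw [Finset.sum_eq_single l]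
      · rw [smul_mul_smul_comm, (hpu _ (hp l)).1, hrs, smul_mul_assoc]
      · intro m _ hm
        have hsq : ∀ q : F, IsStarProjection q → ∃ v, q = star v * v := fun q hq =>
          ⟨q, by rw [hq.2.star_eq, hq.1.eq]⟩
        rw [smul_mul_smul_comm, hoz _ _ (hsq _ (hp l)) (hsq _ (hp m)) (hpp l m hm.symm), smul_zero]
      · exact fun h => absurd hl h
  have key : ∀ x y, IsSelfAdjoint x → φ (star y) * φ x = φ (star y * x) * φ u := by
    intro x y hx
    obtain ⟨Y, hY⟩ := hCP 3 _ (MatIsPos.row ![u, x, y])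
    have e : ∀ i j, φ (star (![u, x, y] i) * ![u, x, y] j) = ∑ t, star (Y t i) * Y t j := by
      intro i j
      have := congrFun (congrFun hY i) j
      simpa [Matrix.mul_apply] using this
    have e00 := e 0 0
    have e01 := e 0 1
    have e10 := e 1 0
    have e11 := e 1 1
    have e20 := e 2 0
    have e21 := e 2 1
    simp only [Matrix.cons_val_zero, Matrix.cons_val_one, Matrix.cons_val, hus, hu, hu', hx.star_eq,
      Fin.sum_univ_three] at e00 e01 e10 e11 e20 e21
    have hstarx : star (φ x) = φ x := by
      conv_lhs => rw [e01]
      rw [e10]; simp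
    have hstaru : star (φ u) = φ u := by
      conv_lhs => rw [e00]
      rw [e00]; simp
    have hD : ∀ t, Y t 1 * φ u = Y t 0 * φ x := by
      have hsum : ∑ t, star (Y t 1 * φ u - Y t 0 * φ x) * (Y t 1 * φ u - Y t 0 * φ x) = 0 := by
        have e2 : ∑ t, star (Y t 1 * φ u - Y t 0 * φ x) * (Y t 1 * φ u - Y t 0 * φ x) =
          φ u * φ (x * x) * φ u - φ u * φ x * φ x - φ x * φ x * φ u + φ x * φ u * φ x := by
          conv_rhs => rw [e11]
          rw [Fin.sum_univ_three]
          simp only [star_sub, star_mul, hstarx, hstaru]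
          have f1 : φ u * φ x * φ x = φ u * (star (Y 0 1) * Y 0 0 + star (Y 1 1) * Y 1 0 +
            star (Y 2 1) * Y 2 0) * φ x := by rw [← e10]
          have f2 : φ x * φ x * φ u = φ x * (star (Y 0 0) * Y 0 1 + star (Y 1 0) * Y 1 1 +
            star (Y 2 0) * Y 2 1) * φ u := by rw [← e01]
          have f3 : φ x * φ u * φ x = φ x * (star (Y 0 0) * Y 0 0 + star (Y 1 0) * Y 1 0 +
            star (Y 2 0) * Y 2 0) * φ x := by rw [← e00]
          rw [f1, f2, f3]
          noncomm_ring
        rw [e2]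
        obtain ⟨g1, g2⟩ := hsa x hx
        rw [mul_assoc (φ u) (φ (x * x)), ← g2]
        have g3 : φ x * φ x * φ u = φ x * φ u * φ x := by rw [mul_assoc, g1, ← mul_assoc, g1]
        rw [g3]
        noncomm_ring
      letI := CStarAlgebra.spectralOrder A
      haveI := CStarAlgebra.spectralOrderedRing A
      intro t
      have := (Finset.sum_eq_zero_iff_of_nonneg
        (fun t _ => star_mul_self_nonneg (Y t 1 * φ u - Y t 0 * φ x))).1 hsum t (Finset.mem_univ t)
      rw [CStarRing.star_mul_self_eq_zero_iff] at this
      exact sub_eq_zero.1 this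
    rw [e21, e20]
    have f : ∀ t, star (Y t 2) * Y t 1 * φ u = star (Y t 2) * Y t 0 * φ x := fun t => by
      rw [mul_assoc, hD, mul_assoc]
    simp only [add_mul, f]
  have key2 := fun x => key x (star a)
  simp only [star_star] at key2
  have hb := realPart_add_I_smul_imaginaryPart b
  rw [← hb]
  simp only [map_add, map_smul, mul_add, mul_smul_comm, add_mul, smul_mul_assoc]
  rw [key2 _ (realPart b).2, key2 _ (imaginaryPart b).2]
end OZ


section CA
variable {A : Type u} [CStarAlgebra A]

theorem fd_of_gens (T : Set A) (hT : T.Finite) (hm : ∀ x ∈ T, ∀ y ∈ T, x * y = 0 ∨ x * y ∈ T)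
    (hs : ∀ x ∈ T, star x ∈ T) :
    ∃ C : NonUnitalStarSubalgebra ℂ A, FiniteDimensional ℂ C ∧ ∀ x ∈ T, x ∈ C := by
  let S := Submodule.span ℂ T
  have hmul : ∀ x ∈ S, ∀ y ∈ S, x * y ∈ S := by
    intro x hx y hy
    induction hx using Submodule.span_induction with
    | zero => simp
    | add a b _ _ h1 h2 => rw [add_mul]; exact add_mem h1 h2
    | smul c a _ h1 => rw [smul_mul_assoc]; exact Submodule.smul_mem _ _ h1
    | mem a ha =>
      induction hy using Submodule.span_induction with
      | zero => simp
      | add c b _ _ h1 h2 => rw [mul_add]; exact add_mem h1 h2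
      | smul c b _ h1 => rw [mul_smul_comm]; exact Submodule.smul_mem _ _ h1
      | mem b hb =>
        rcases hm a ha b hb with h | h
        · rw [h]; exact zero_mem _
        · exact Submodule.subset_span h
  have hst : ∀ x ∈ S, star x ∈ S := by
    intro x hx
    induction hx using Submodule.span_induction with
    | zero => simp
    | add a b _ _ h1 h2 => rw [star_add]; exact add_mem h1 h2
    | smul c a _ h1 => rw [star_smul]; exact Submodule.smul_mem _ _ h1
    | mem a ha => exact Submodule.subset_span (hs a ha)
  refine ⟨{ S with mul_mem' := fun {a b} ha hb => hmul a ha b hb,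
                   star_mem' := fun {a} ha => hst a ha }, ?_, fun x hx => Submodule.subset_span hx⟩
  change FiniteDimensional ℂ S
  exact FiniteDimensional.span_of_finite ℂ hT

theorem cone_approx [PartialOrder A] [StarOrderedRing A] (hR : RealRankZero A) (k : A)
    (hk : IsSelfAdjoint k) {ε : ℝ} (hε : 0 < ε) :
    ∃ (X : A) (S : Finset ℝ) (q : ℝ → A), (∀ l, IsStarProjection (q l)) ∧
      (∀ l m, l ≠ m → q l * q m = 0) ∧
      (∀ l ∈ S, star (k * X) * (k * X) * q l = q l) ∧
      ‖k - (k * X) * (∑ l ∈ S, l • q l) * star (k * X)‖ < ε := by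
  classical
  obtain ⟨c, hc⟩ : ∃ c, c = ε / 4 := ⟨_, rfl⟩
  obtain ⟨M, hM⟩ : ∃ M, M = ‖k‖ + ε := ⟨_, rfl⟩
  have hM0 : 0 < M := by rw [hM]; positivity
  have hc0 : 0 < c := by rw [hc]; positivity
  obtain ⟨κ, hκ⟩ : ∃ κ, κ = min (1 / 6) (ε / (200 * M)) := ⟨_, rfl⟩
  have hκ0 : 0 < κ := by rw [hκ]; positivity
  have hκ1 : κ ≤ 1 / 6 := by rw [hκ]; exact min_le_left _ _
  have hκ2 : κ * M ≤ ε / 200 := by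
    have : κ ≤ ε / (200 * M) := by rw [hκ]; exact min_le_right _ _
    calc κ * M ≤ ε / (200 * M) * M := by gcongr
      _ = ε / 200 := by field_simp
  obtain ⟨b, hb, hfin, hkb⟩ := hR k hk (c * κ) (by positivity)
  have hcont : ∀ f : ℝ → ℝ, ContinuousOn f (spectrum ℝ b) := fun f => hfin.continuousOn f
  have hmulc : ∀ f g : ℝ → ℝ, cfc f b * cfc g b = cfc (fun x => f x * g x) b := fun f g =>
    (cfc_mul f g b (hcont f) (hcont g)).symm
  have hsac : ∀ f : ℝ → ℝ, star (cfc f b) = cfc f b := fun f =>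
    (cfc_predicate f b : IsSelfAdjoint _).star_eq
  obtain ⟨q, hq⟩ : ∃ q : ℝ → A, ∀ l, q l = cfc (fun x => if x = l then (1 : ℝ) else 0) b :=
    ⟨_, fun _ => rfl⟩
  obtain ⟨P, hP⟩ : ∃ P, P = cfc (fun x : ℝ => if c < |x| then (1 : ℝ) else 0) b := ⟨_, rfl⟩
  obtain ⟨g, hg⟩ : ∃ g, g = cfc (fun x : ℝ => if c < |x| then x⁻¹ else 0) b := ⟨_, rfl⟩
  obtain ⟨S, hS⟩ : ∃ S : Finset ℝ, S = hfin.toFinset.filter (fun x => c < |x|) := ⟨_, rfl⟩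
  have hPp : IsStarProjection P := ⟨by
    rw [IsIdempotentElem, hP, hmulc]
    exact cfc_congr fun x hx => by by_cases h : c < |x| <;> simp [h], by
    rw [hP]; exact hsac _⟩
  have hgP : g * P = g := by
    rw [hP, hg, hmulc]
    exact cfc_congr fun x hx => by by_cases h : c < |x| <;> simp [h]
  have hbg : b * g = P := by
    rw [hP, hg, mul_cfc hb _ (hcont _)]
    refine cfc_congr fun x hx => ?_
    by_cases h : c < |x|
    · have : x ≠ 0 := by rintro rfl; simp at h; linarith
      simp [h, this]
    · simp [h]
  have hgn : ‖g‖ ≤ 1 / c := by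
    rw [hg]
    refine norm_cfc_le (by positivity) fun x hx => ?_
    by_cases h : c < |x|
    · simp only [h, if_true, norm_inv, Real.norm_eq_abs, one_div]
      gcongr
    · simp only [h, if_false, norm_zero]; positivity
  have hsum : ∑ l ∈ S, l • q l = b * P := by
    rw [hP, mul_cfc hb _ (hcont _)]
    have : ∀ l, l • q l = cfc (fun x => l • (if x = l then (1 : ℝ) else 0)) b := fun l => by
      rw [hq, cfc_smul l _ b (hcont _)]
    simp only [this]
    rw [← cfc_sum _ _ _ (fun i _ => hcont _)]
    refine cfc_congr fun x hx => ?_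
    simp only [Finset.sum_apply]
    by_cases h : c < |x|
    · rw [Finset.sum_eq_single x]
      · simp [h]
      · intro m _ hm; simp [hm.symm]
      · intro h'; exact absurd (by rw [hS, Finset.mem_filter]; exact ⟨hfin.mem_toFinset.2 hx, h⟩) h'
    · simp only [h, if_false, mul_zero]
      refine Finset.sum_eq_zero fun m hm => ?_
      have : x ≠ m := by
        rintro rfl
        rw [hS, Finset.mem_filter] at hm
        exact h hm.2
      simp [this]
  have hbbP : ‖b - b * P‖ ≤ c := by
    have : b - b * P = cfc (fun x : ℝ => x - x * (if c < |x| then (1 : ℝ) else 0)) b := by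
      rw [cfc_sub (fun x : ℝ => x) _ b (hcont _) (hcont _), cfc_id' ℝ b, hP, mul_cfc hb _ (hcont _)]
    rw [this]
    refine norm_cfc_le hc0.le fun x hx => ?_
    by_cases h : c < |x|
    · simp [h, hc0.le]
    · simp only [h, if_false, mul_zero, sub_zero, Real.norm_eq_abs]
      exact not_lt.1 h
  have hbP : b * P = P * b := by
    have h1 : star (b * P) = b * P := by
      rw [hP, mul_cfc hb _ (hcont _)]; exact hsac _
    rw [star_mul, hb.star_eq, hPp.2.star_eq] at h1
    exact h1.symm
  -- the approximate inverse
  obtain ⟨t, ht⟩ : ∃ t, t = k * g := ⟨_, rfl⟩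
  have htP : t * P = t := by rw [ht, mul_assoc, hgP]
  have ht1 : ‖t - P‖ ≤ κ := by
    have : t - P = (k - b) * g := by rw [ht, ← hbg, sub_mul]
    rw [this]
    refine (norm_mul_le _ _).trans ?_
    calc ‖k - b‖ * ‖g‖ ≤ (c * κ) * (1 / c) := by gcongr
      _ = κ := by field_simp
  have hPn := hPp.nrm
  have htn : ‖t‖ ≤ 2 := by
    have := norm_le_norm_add_norm_sub' t P
    linarith
  have htt : ‖star t * t - P‖ ≤ 3 * κ := by
    have e : star t * t - P = star t * (t - P) + star (t - P) * P := by
      rw [mul_sub, star_sub, sub_mul, hPp.2.star_eq, hPp.1.eq]; abel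
    rw [e]
    refine (norm_add_le _ _).trans ?_
    have h1 := norm_mul_le (star t) (t - P)
    have h2 := norm_mul_le (star (t - P)) P
    rw [norm_star] at h1 h2
    have h3 : ‖t‖ * ‖t - P‖ ≤ 2 * κ := by gcongr
    have h4 : ‖t - P‖ * ‖P‖ ≤ κ * 1 := by gcongr
    linarith
  have hPt : P * star t = star t := by
    have := congrArg star htP
    rwa [star_mul, hPp.2.star_eq] at this
  have hlow : (1 / 2 : ℝ) • P ≤ star t * t := by
    have := corner_le hPp (e := P - star t * t)
      (hPp.2.sub (IsSelfAdjoint.star_mul_self t)) (by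
        rw [mul_sub, sub_mul, hPp.1.eq, hPp.1.eq, ← mul_assoc, hPt, mul_assoc, htP])
      (r := 1 / 2) (by rw [norm_sub_rev]; linarith)
    rw [← sub_nonneg] at this ⊢
    refine this.trans (le_of_eq ?_)
    module
  obtain ⟨V, w, hV1, hV2, -, hV4⟩ := corner hPp htP (by norm_num) hlow
  have hVX : k * (g * w) = V := by rw [hV2, ht, mul_assoc]
  have hVP : ‖V - P‖ ≤ 13 * κ := by
    have h1 := hV4 (by linarith)
    have h2 := norm_sub_le_norm_sub_add_norm_sub V t P
    have h3 : 2 * ‖t‖ * ‖star t * t - P‖ ≤ 2 * 2 * (3 * κ) := by gcongr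
    linarith
  have hVn : ‖V‖ ≤ 1 := by
    have : ‖V‖ * ‖V‖ ≤ 1 := by rw [← CStarRing.norm_star_mul_self, hV1]; exact hPn
    nlinarith [norm_nonneg V]
  refine ⟨g * w, S, q, ?_, ?_, ?_, ?_⟩
  · intro l
    refine ⟨?_, by rw [hq]; exact hsac _⟩
    rw [IsIdempotentElem, hq, hmulc]
    exact cfc_congr fun x hx => by by_cases h : x = l <;> simp [h]
  · intro l m hlm
    rw [hq, hq, hmulc, ← cfc_zero ℝ b]
    refine cfc_congr fun x hx => ?_
    by_cases h : x = l
    · subst h; simp [hlm]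
    · simp [h]
  · intro l hl
    rw [hVX, hV1, hP, hq, hmulc]
    refine cfc_congr fun x hx => ?_
    by_cases h : x = l
    · subst h
      rw [hS, Finset.mem_filter] at hl
      simp [hl.2]
    · simp [h]
  · rw [hVX, hsum]
    have e : k - V * (b * P) * star V = (k - b) + (b - b * P) -
        ((V - P) * (b * P) * star V + (b * P) * star (V - P)) := by
      have h1 : b * P * P = b * P := by rw [mul_assoc, hPp.1.eq]
      have h2 : P * (b * P) = b * P := by rw [hbP, ← mul_assoc, hPp.1.eq]
      rw [star_sub, hPp.2.star_eq, sub_mul, sub_mul, mul_sub, h1, h2]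
      abel
    rw [e]
    have hbn : ‖b‖ ≤ M := by
      have := norm_le_norm_add_norm_sub k b
      have : c * κ ≤ c * (1 / 6) := by gcongr
      rw [hM]; linarith
    have hbPn : ‖b * P‖ ≤ M := by
      refine (norm_mul_le _ _).trans ?_
      calc ‖b‖ * ‖P‖ ≤ M * 1 := by gcongr
        _ = M := mul_one M
    have n1 : ‖(V - P) * (b * P) * star V‖ ≤ 13 * κ * M * 1 := by
      refine (norm_mul_le _ _).trans ?_
      rw [norm_star]
      have := norm_mul_le (V - P) (b * P)
      have : ‖(V - P) * (b * P)‖ ≤ 13 * κ * M := this.trans (by gcongr)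
      gcongr
    have n2 : ‖(b * P) * star (V - P)‖ ≤ M * (13 * κ) := by
      refine (norm_mul_le _ _).trans ?_
      rw [norm_star]
      gcongr
    have n3 := norm_sub_le ((k - b) + (b - b * P))
      ((V - P) * (b * P) * star V + (b * P) * star (V - P))
    have n4 := norm_add_le (k - b) (b - b * P)
    have n5 := norm_add_le ((V - P) * (b * P) * star V) ((b * P) * star (V - P))
    have : c * κ ≤ c * (1 / 6) := by gcongr
    nlinarith
end CA


section OA
variable {A : Type u} [CStarAlgebra A]

theorem cp_star {F : Type v} {B : Type w} [NonUnitalCStarAlgebra F] [NonUnitalCStarAlgebra B]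
    (φ : F →ₗ[ℂ] B) (hCP : IsCP φ)
    (u : F) (hu : ∀ x, x * u = x) (hus : star u = u) (x : F) : φ (star x) = star (φ x) := by
  have hu' : u * x = x := by
    have := congrArg star (hu (star x))
    simpa [hus] using this
  obtain ⟨Y, hY⟩ := hCP 2 _ (MatIsPos.row ![u, x])
  have e : ∀ i j, φ (star (![u, x] i) * ![u, x] j) = ∑ t, star (Y t i) * Y t j := by
    intro i j
    have := congrFun (congrFun hY i) j
    simpa [Matrix.mul_apply] using this
  have e01 := e 0 1
  have e10 := e 1 0
  simp only [Matrix.cons_val_zero, Matrix.cons_val_one, Matrix.cons_val, hus, hu, hu',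
    Fin.sum_univ_two] at e01 e10
  rw [e10, e01]; simp

theorem oz_approx [PartialOrder A] [StarOrderedRing A] (hR : RealRankZero A)
    {F : Type v} [NonUnitalCStarAlgebra F] [FiniteDimensional ℂ F] (φ : F →ₗ[ℂ] A)
    (hCP : IsCP φ)
    (hoz : ∀ x y : F, (∃ u, x = star u * u) → (∃ v, y = star v * v) → x * y = 0 → φ x * φ y = 0)
    (Y : Finset F) {ε : ℝ} (hε : 0 < ε) :
    ∃ C : NonUnitalStarSubalgebra ℂ A, FiniteDimensional ℂ C ∧
      ∀ y ∈ Y, MemEps ε (C : Set A) (φ y) := by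
  classical
  obtain ⟨ι, _, r, v, H, hu⟩ := exists_matUnits F
  have hus := IsPreMU.star_unit v
  have hu' : ∀ x, x * IsPreMU.unit v = x := fun x => by
    have := congrArg star (hu (star x))
    simpa [hus] using this
  have hmul := oz_mul φ hCP hoz _ hu hus
  have hst := cp_star φ hCP _ hu' hus
  obtain ⟨Hh, hHh⟩ : ∃ Hh, Hh = φ (IsPreMU.unit v) := ⟨_, rfl⟩
  rw [← hHh] at hmul
  -- coefficients
  have hcoef : ∀ y : F, ∀ i j, ∃ c : ℂ, r i = r j → star (v i) * y * v j = c • v (r i) := by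
    intro y i j
    by_cases h : r i = r j
    · obtain ⟨c, hc⟩ := H.min i (star (v i) * y * v j)
      refine ⟨c, fun _ => ?_⟩
      rw [← hc]
      have h1 : v j * v (r i) = v j := by rw [h, H.mul_rep]
      have h2 : v (r i) * (star (v i) * y * v j) * v (r i) =
        (v (r i) * star (v i)) * y * (v j * v (r i)) := by noncomm_ring
      rw [h2, H.rep_mul_star, h1]
    · exact ⟨0, fun h' => absurd h' h⟩
  choose c hc using hcoef
  have hexp : ∀ y : F, y = ∑ i, ∑ j, if r i = r j then c y i j • (v i * star (v j)) else 0 := by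
    intro y
    have e1 : y = IsPreMU.unit v * y * IsPreMU.unit v := by rw [hu, hu']
    conv_lhs => rw [e1]
    rw [IsPreMU.unit, Finset.sum_mul, Finset.sum_mul]
    refine Finset.sum_congr rfl fun i _ => ?_
    rw [Finset.mul_sum]
    refine Finset.sum_congr rfl fun j _ => ?_
    have e2 : v i * star (v i) * y * (v j * star (v j)) =
      v i * (star (v i) * y * v j) * star (v j) := by noncomm_ring
    rw [e2]
    split_ifs with h
    · rw [hc y i j h, mul_smul_comm, H.mul_rep, smul_mul_assoc]
    · have : star (v i) * y * v j = v (r i) * (star (v i) * y * v j) * v (r j) := by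
        rw [← mul_assoc, ← mul_assoc, H.rep_mul_star, mul_assoc _ (v j), H.mul_rep]
      rw [this, H.cross i j h]; simp
  -- tolerance
  obtain ⟨K, hK0, hK⟩ : ∃ K : ℝ, 0 ≤ K ∧ ∀ y ∈ Y, ∑ i, ∑ j, ‖c y i j‖ ≤ K := by
    refine ⟨∑ y ∈ Y, ∑ i, ∑ j, ‖c y i j‖, by positivity, fun y hy => ?_⟩
    exact Finset.single_le_sum (f := fun y => ∑ i, ∑ j, ‖c y i j‖) (fun _ _ => by positivity) hy
  obtain ⟨δ, hδ⟩ : ∃ δ, δ = ε / (K + 1) := ⟨_, rfl⟩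
  have hδ0 : 0 < δ := by rw [hδ]; positivity
  have hKδ : K * δ < ε := by
    have : (K + 1) * δ = ε := by rw [hδ]; field_simp
    linarith
  have hksa : ∀ i, star (φ (v (r i))) = φ (v (r i)) := fun i => by rw [← hst, H.sa]
  choose X S q hq1 hq2 hq3 hq4 using fun i =>
    cone_approx hR (φ (v (r i))) (hksa i) hδ0
  obtain ⟨V, hV⟩ : ∃ V : ι → A, ∀ i, V i = φ (v i) * X (r i) := ⟨_, fun _ => rfl⟩
  have hbb : ∀ i, star (φ (v i)) * φ (v i) = φ (v (r i)) * φ (v (r i)) := fun i => by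
    rw [← hst, hmul, hmul, H.self, H.idem]
  have hV1 : ∀ i j, i ≠ j → star (V i) * V j = 0 := by
    intro i j hij
    have : star (φ (v i)) * φ (v j) = 0 := by rw [← hst, hmul, H.off i j hij]; simp
    rw [hV, hV, star_mul, mul_assoc, ← mul_assoc (star (φ (v i))), this]; simp
  have hV2 : ∀ i, ∀ l ∈ S (r i), star (V i) * V i * q (r i) l = q (r i) l := by
    intro i l hl
    have e := hq3 (r i) l hl
    rw [H.rr] at e
    rw [hV, star_mul]
    have e2 : star (X (r i)) * star (φ (v i)) * (φ (v i) * X (r i)) =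
      star (X (r i)) * (star (φ (v i)) * φ (v i)) * X (r i) := by noncomm_ring
    rw [e2, hbb]
    rw [star_mul, hksa] at e
    have e3 : star (X (r i)) * (φ (v (r i)) * φ (v (r i))) * X (r i) =
      star (X (r i)) * φ (v (r i)) * (φ (v (r i)) * X (r i)) := by noncomm_ring
    rw [e3]; exact e
  obtain ⟨C, hCfd, hCT⟩ := fd_of_gens
    {x : A | ∃ i j, ∃ l ∈ S (r i), r i = r j ∧ V i * q (r i) l * star (V j) = x} (by
      refine Set.Finite.subset (Set.finite_iUnion fun i : ι => Set.finite_iUnion fun j : ι =>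
        (S (r i)).finite_toSet.image fun l => V i * q (r i) l * star (V j)) ?_
      rintro x ⟨i, j, l, hl, -, rfl⟩
      simp only [Set.mem_iUnion]
      exact ⟨i, j, l, hl, rfl⟩) (by
      rintro _ ⟨i, j, l, hl, hij, rfl⟩ _ ⟨i', j', l', hl', hij', rfl⟩
      have e : V i * q (r i) l * star (V j) * (V i' * q (r i') l' * star (V j')) =
        V i * q (r i) l * (star (V j) * V i' * q (r i') l') * star (V j') := by noncomm_ring
      rw [e]
      by_cases h : j = i'
      · subst h
        rw [hV2 j l' hl', ← hij]
        by_cases h2 : l = l'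
        · subst h2
          right
          rw [mul_assoc (V i), (hq1 (r i) l).1.eq]
          exact ⟨i, j', l, hl, hij.trans hij', rfl⟩
        · left
          rw [mul_assoc (V i), hq2 (r i) l l' h2]; simp
      · left
        rw [hV1 j i' h]; simp) (by
      rintro _ ⟨i, j, l, hl, hij, rfl⟩
      refine ⟨j, i, l, hij ▸ hl, hij.symm, ?_⟩
      rw [star_mul, star_mul, star_star, (hq1 (r i) l).2.star_eq, hij, mul_assoc])
  have hap : ∀ i j, r i = r j → ∃ s ∈ C, ‖φ (v i * star (v j)) - s‖ ≤ δ := by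
    intro i j hij
    obtain ⟨s, hs⟩ : ∃ s, s = ∑ l ∈ S (r i), l • q (r i) l := ⟨_, rfl⟩
    refine ⟨V i * s * star (V j), ?_, ?_⟩
    · rw [hs, Finset.mul_sum, Finset.sum_mul]
      refine sum_mem fun l hl => ?_
      rw [mul_smul_comm, smul_mul_assoc, ← Complex.coe_smul]
      exact SMulMemClass.smul_mem _ (hCT _ ⟨i, j, l, hl, hij, rfl⟩)
    · obtain ⟨k, hk⟩ : ∃ k, k = φ (v (r i)) := ⟨_, rfl⟩
      obtain ⟨R, hRd⟩ : ∃ R, R = X (r i) * s * star (X (r i)) := ⟨_, rfl⟩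
      obtain ⟨a, ha⟩ : ∃ a, a = φ (v i * star (v j)) := ⟨_, rfl⟩
      obtain ⟨x, hx⟩ : ∃ x, x = φ (v i) := ⟨_, rfl⟩
      obtain ⟨y, hy⟩ : ∃ y, y = φ (v j) := ⟨_, rfl⟩
      have hss : star s = s := by
        rw [hs, star_sum]
        exact Finset.sum_congr rfl fun l _ => by
          rw [star_smul, (hq1 (r i) l).2.star_eq]; simp
      have hRs : star R = R := by rw [hRd]; simp [hss, mul_assoc]
      have hks : star k = k := by rw [hk, hksa]
      have hkR : ‖k - k * R * k‖ ≤ δ := by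
        have := hq4 (r i)
        rw [H.rr, ← hs, ← hk] at this
        have e0 : k * R * k = k * X (r i) * s * star (k * X (r i)) := by
          rw [hRd, star_mul, hks]; noncomm_ring
        rw [e0]; exact this.le
      have e1 : V i * s * star (V j) = x * R * star y := by
        rw [hV, hV, ← hij, hRd, hx, hy, star_mul]; noncomm_ring
      have e2 : star a * a = y * star y := by
        rw [ha, hy, ← hst, ← hst, hmul, hmul]
        congr 2
        rw [star_mul, star_star]
        have : v j * star (v i) * (v i * star (v j)) = v j * (star (v i) * v i) * star (v j) := by
          noncomm_ring
        rw [this, H.self, hij, H.mul_rep]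
      have e3 : star a * x = y * k := by
        rw [ha, hy, hk, hx, ← hst, hmul, hmul, star_mul, star_star, mul_assoc, H.self]
      have e4 : star x * a = k * star y := by
        have := congrArg star e3
        simpa [hks] using this
      have e5 : star x * x = k * k := by rw [hx, hk, hbb]
      have e6 : star y * y = k * k := by rw [hy, hk, hij, hbb]
      obtain ⟨E, hE⟩ : ∃ E, E = (1 - k * R) * star y := ⟨_, rfl⟩
      rw [e1, ← ha]
      have e7 : star (a - x * R * star y) * (a - x * R * star y) = star E * E := by
        have : star (a - x * R * star y) * (a - x * R * star y) = star a * a -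
          star a * x * R * star y - y * R * (star x * a) + y * R * (star x * x) * R * star y := by
          rw [star_sub, star_mul, star_mul, star_star, hRs]; noncomm_ring
        rw [this, e2, e3, e4, e5, hE]
        simp only [star_mul, star_sub, star_star, star_one, hRs, hks]
        noncomm_ring
      have e8 : E * star E = (k - k * R * k) * star (k - k * R * k) := by
        have : E * star E = (1 - k * R) * (star y * y) * (1 - R * k) := by
          rw [hE]
          simp only [star_mul, star_sub, star_star, star_one, hRs, hks]
          noncomm_ring
        rw [this, e6]
        simp only [star_mul, star_sub, star_star, star_one, hRs, hks]
        noncomm_ring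
      have e9 : ‖a - x * R * star y‖ * ‖a - x * R * star y‖ =
          ‖k - k * R * k‖ * ‖k - k * R * k‖ := by
        rw [← CStarRing.norm_star_mul_self, e7, CStarRing.norm_star_mul_self,
          ← CStarRing.norm_self_mul_star, e8, CStarRing.norm_self_mul_star]
      have := (mul_self_inj_of_nonneg (norm_nonneg _) (norm_nonneg _)).1 e9
      rw [this]; exact hkR
  choose! s hs1 hs2 using hap
  refine ⟨C, hCfd, fun y hy => ⟨∑ i, ∑ j, if r i = r j then c y i j • s i j else 0, ?_, ?_⟩⟩
  · refine sum_mem fun i _ => sum_mem fun j _ => ?_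
    split_ifs with h
    · exact SMulMemClass.smul_mem _ (hs1 i j h)
    · exact zero_mem _
  · refine lt_of_le_of_lt ?_ hKδ
    have e : φ y = ∑ i, ∑ j, if r i = r j then c y i j • φ (v i * star (v j)) else 0 := by
      conv_lhs => rw [hexp y]
      rw [map_sum]
      refine Finset.sum_congr rfl fun i _ => ?_
      rw [map_sum]
      refine Finset.sum_congr rfl fun j _ => ?_
      split_ifs <;> simp
    rw [e, ← Finset.sum_sub_distrib]
    have : ∑ i, ∑ j, ‖c y i j‖ * δ ≤ K * δ := by
      simp only [← Finset.sum_mul]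
      exact mul_le_mul_of_nonneg_right (hK y hy) hδ0.le
    refine le_trans ?_ this
    refine norm_sum_le_of_le _ fun i _ => ?_
    rw [← Finset.sum_sub_distrib]
    refine norm_sum_le_of_le _ fun j _ => ?_
    split_ifs with h
    · rw [← smul_sub, norm_smul]
      exact mul_le_mul_of_nonneg_left (hs2 i j h) (norm_nonneg _)
    · simp; positivity
end OA


section OA
variable {A : Type u} [CStarAlgebra A]

/-- Quantitative multiplicative-domain estimate. -/
theorem cp_defect [PartialOrder A] [StarOrderedRing A] (θ : A →ₗ[ℂ] A) (hθ : IsCP θ)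
    (h1 : ‖θ 1‖ ≤ 1) (x Q : A)
    (hQ : Q = star x * θ 1 * x - star x * θ x - star (θ x) * x + θ (star x * x)) :
    0 ≤ Q ∧ ∀ η : ℝ, 0 ≤ η → ‖Q‖ ≤ η * η → ‖θ 1 * x - θ x‖ ≤ 2 * η := by
  obtain ⟨Y, hY⟩ := hθ 2 _ (MatIsPos.row ![1, x])
  have e : ∀ i j, θ (star (![1, x] i) * ![1, x] j) = ∑ t, star (Y t i) * Y t j := by
    intro i j
    have := congrFun (congrFun hY i) j
    simpa [Matrix.mul_apply] using this
  have e00 := e 0 0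
  have e01 := e 0 1
  have e11 := e 1 1
  simp only [Matrix.cons_val_zero, Matrix.cons_val_one, Matrix.cons_val, star_one, one_mul, mul_one,
    Fin.sum_univ_two] at e00 e01 e11
  obtain ⟨D, hD⟩ : ∃ D : Fin 2 → A, ∀ t, D t = Y t 0 * x - Y t 1 := ⟨_, fun _ => rfl⟩
  have hQD : Q = star (D 0) * D 0 + star (D 1) * D 1 := by
    rw [hQ, e00, e01, e11, hD, hD]
    simp only [star_sub, star_mul, star_add, star_star]
    noncomm_ring
  have hp : ∀ a : A, 0 ≤ star a * a := fun a => star_mul_self_nonneg a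
  refine ⟨by rw [hQD]; exact add_nonneg (hp _) (hp _), fun η hη hn => ?_⟩
  have hDn : ∀ t, ‖D t‖ ≤ η := by
    intro t
    have hle : star (D t) * D t ≤ Q := by
      rw [hQD]
      fin_cases t
      · exact le_add_of_nonneg_right (hp _)
      · exact le_add_of_nonneg_left (hp _)
    have := CStarAlgebra.norm_le_norm_of_nonneg_of_le (hp _) hle
    rw [CStarRing.norm_star_mul_self] at this
    exact abs_le_of_sq_le_sq' (by nlinarith) hη |>.2
  have hYn : ∀ t, ‖Y t 0‖ ≤ 1 := by
    intro t
    have hle : star (Y t 0) * Y t 0 ≤ θ 1 := by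
      rw [e00]
      fin_cases t
      · exact le_add_of_nonneg_right (hp _)
      · exact le_add_of_nonneg_left (hp _)
    have := CStarAlgebra.norm_le_norm_of_nonneg_of_le (hp _) hle
    rw [CStarRing.norm_star_mul_self] at this
    exact abs_le_of_sq_le_sq' (by nlinarith) zero_le_one |>.2
  have hf : θ 1 * x - θ x = star (Y 0 0) * D 0 + star (Y 1 0) * D 1 := by
    rw [e00, e01, hD, hD]; noncomm_ring
  have hm : ∀ t, ‖star (Y t 0) * D t‖ ≤ η := by
    intro t
    refine (norm_mul_le _ _).trans ?_
    rw [norm_star]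
    calc ‖Y t 0‖ * ‖D t‖ ≤ 1 * η :=
          mul_le_mul (hYn t) (hDn t) (norm_nonneg _) zero_le_one
      _ = η := one_mul _
  rw [hf]
  refine (norm_add_le _ _).trans ?_
  linarith [hm 0, hm 1]

theorem single_isCP {F : Fin 2 → Type} [∀ i, NonUnitalCStarAlgebra (F i)]
    (φ : (∀ i, F i) →ₗ[ℂ] A) (hφ : IsCP φ) (i : Fin 2) :
    IsCP (φ ∘ₗ LinearMap.single ℂ F i) := by
  rintro k _ ⟨y, rfl⟩
  have := hφ k ((star y * y).map (Pi.single i)) ⟨y.map (Pi.single i), by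
    ext a b j
    rcases eq_or_ne j i with rfl | hj
    · simp [Matrix.mul_apply]
    · simp [Matrix.mul_apply, hj]⟩
  rw [Matrix.map_map] at this
  exact this

theorem proj_isCP {F : Fin 2 → Type} [∀ i, NonUnitalCStarAlgebra (F i)]
    (ψ : A →ₗ[ℂ] (∀ i, F i)) (hψ : IsCP ψ) (i : Fin 2) :
    IsCP (LinearMap.proj i ∘ₗ ψ) := by
  intro k x hx
  obtain ⟨y, hy⟩ := hψ k x hx
  refine ⟨y.map fun f => f i, ?_⟩
  ext a b
  have := congrFun (congrFun (congrFun hy a) b) i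
  simpa [Matrix.mul_apply] using this

theorem comp_isCP {F : Type v} {B : Type w} [NonUnitalCStarAlgebra F] [NonUnitalCStarAlgebra B]
    (φ : F →ₗ[ℂ] B) (hφ : IsCP φ) (ψ : A →ₗ[ℂ] F) (hψ : IsCP ψ) : IsCP (φ ∘ₗ ψ) := by
  intro k x hx
  have := hφ k _ (hψ k x hx)
  rw [Matrix.map_map] at this
  exact this

theorem W_of_nuc [PartialOrder A] [StarOrderedRing A] (hN : NuclearDimLE 1 A)
    (hR : RealRankZero A) : WeakCRLeOne A := by
  classical
  intro X ε hε
  obtain ⟨M, hM0, hM⟩ : ∃ M : ℝ, 0 ≤ M ∧ ∀ x ∈ X, ‖x‖ ≤ M :=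
    ⟨∑ x ∈ X, ‖x‖, by positivity, fun x hx =>
      Finset.single_le_sum (f := fun x => ‖x‖) (fun _ _ => norm_nonneg _) hx⟩
  obtain ⟨η, hη⟩ : ∃ η, η = ε / 8 := ⟨_, rfl⟩
  have hη0 : 0 < η := by rw [hη]; positivity
  obtain ⟨δ, hδ0, hδ1, hδ2⟩ : ∃ δ : ℝ, 0 < δ ∧ δ * (M * M + 2 * M + 1) ≤ η * η ∧ δ * M ≤ η := by
    have hp : 0 < M * M + 2 * M + 1 := by positivity
    have hp' : 0 < M + 1 := by positivity
    refine ⟨min (η * η / (M * M + 2 * M + 1)) (η / (M + 1)), by positivity, ?_, ?_⟩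
    · exact (le_div_iff₀ hp).1 (min_le_left _ _)
    · have := (le_div_iff₀ hp').1 (min_le_right (η * η / (M * M + 2 * M + 1)) (η / (M + 1)))
      have h0 : 0 < min (η * η / (M * M + 2 * M + 1)) (η / (M + 1)) := by positivity
      nlinarith
  obtain ⟨X1, hX1⟩ : ∃ X1 : Finset A, X1 = X ∪ X.image star := ⟨_, rfl⟩
  obtain ⟨F, instF, hfd, ψ, φ, hψ, hψn, hφ, hoz, hap⟩ :=
    hN (insert 1 (X1 ∪ X1.image fun x => star x * x)) δ hδ0
  obtain ⟨Φ, hΦ⟩ : ∃ Φ : ∀ i : Fin 2, F i →ₗ[ℂ] A, ∀ i, Φ i = φ ∘ₗ LinearMap.single ℂ F i :=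
    ⟨_, fun _ => rfl⟩
  have hΦs : ∀ i x, Φ i x = φ (Pi.single i x) := fun i x => by rw [hΦ]; rfl
  have hΦcp : ∀ i, IsCP (Φ i) := fun i => by rw [hΦ]; exact single_isCP φ hφ i
  obtain ⟨θ, hθ⟩ : ∃ θ : Fin 2 → (A →ₗ[ℂ] A), ∀ i, θ i = Φ i ∘ₗ (LinearMap.proj i ∘ₗ ψ) :=
    ⟨_, fun _ => rfl⟩
  have hθs : ∀ i x, θ i x = Φ i (ψ x i) := fun i x => by rw [hθ]; rfl
  have hθcp : ∀ i, IsCP (θ i) := fun i => by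
    rw [hθ]; exact comp_isCP _ (hΦcp i) _ (proj_isCP ψ hψ i)
  have hsum : ∀ x, θ 0 x + θ 1 x = φ (ψ x) := by
    intro x
    rw [hθs, hθs, hΦs, hΦs, ← map_add]
    congr 1
    ext j
    fin_cases j <;> simp
  have hone : ‖(1 : A)‖ ≤ 1 := by
    have : ‖(1 : A)‖ * ‖(1 : A)‖ = ‖(1 : A)‖ := by
      rw [← CStarRing.norm_star_mul_self]; simp
    nlinarith [norm_nonneg (1 : A)]
  have hθ1 : ∀ i, ‖θ i 1‖ ≤ 1 := by
    intro i
    rw [hθs, hΦs]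
    exact ((hoz i).1 _).trans (((norm_le_pi_norm (ψ 1) i).trans (hψn 1)).trans hone)
  have hstar : ∀ i x, θ i (star x) = star (θ i x) := fun i x =>
    cp_star (θ i) (hθcp i) 1 (fun _ => mul_one _) (star_one A) x
  have a1 : ‖θ 0 1 + θ 1 1 - 1‖ ≤ δ := by rw [hsum]; exact (hap 1 (by simp)).le
  -- main estimate
  have key : ∀ x ∈ X1, ∀ i, ‖θ i 1 * x - θ i x‖ ≤ 2 * η := by
    intro x hx
    have hxM : ‖x‖ ≤ M := by
      rw [hX1, Finset.mem_union, Finset.mem_image] at hx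
      rcases hx with hx | ⟨y, hy, rfl⟩
      · exact hM x hx
      · rw [norm_star]; exact hM y hy
    have a2 : ‖θ 0 x + θ 1 x - x‖ ≤ δ := by rw [hsum]; exact (hap x (by simp [hx])).le
    have a3 : ‖θ 0 (star x * x) + θ 1 (star x * x) - star x * x‖ ≤ δ := by
      rw [hsum]
      refine (hap _ ?_).le
      rw [Finset.mem_insert, Finset.mem_union, Finset.mem_image]
      exact Or.inr (Or.inr ⟨x, hx, rfl⟩)
    obtain ⟨Q, hQ⟩ : ∃ Q : Fin 2 → A, ∀ i, Q i = star x * θ i 1 * x - star x * θ i x -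
      star (θ i x) * x + θ i (star x * x) := ⟨_, fun _ => rfl⟩
    have hc := fun i => cp_defect (θ i) (hθcp i) (hθ1 i) x (Q i) (hQ i)
    have hs : Q 0 + Q 1 = star x * (θ 0 1 + θ 1 1 - 1) * x - star x * (θ 0 x + θ 1 x - x) -
        star (θ 0 x + θ 1 x - x) * x + (θ 0 (star x * x) + θ 1 (star x * x) - star x * x) := by
      rw [hQ, hQ, star_sub, star_add]; noncomm_ring
    have hb : ‖Q 0 + Q 1‖ ≤ η * η := by
      refine le_trans ?_ hδ1
      rw [hs]
      have b1 : ‖star x * (θ 0 1 + θ 1 1 - 1) * x‖ ≤ M * δ * M := by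
        refine (norm_mul_le _ _).trans (mul_le_mul ((norm_mul_le _ _).trans ?_) hxM
          (norm_nonneg _) (by positivity))
        rw [norm_star]
        exact mul_le_mul hxM a1 (norm_nonneg _) hM0
      have b2 : ‖star x * (θ 0 x + θ 1 x - x)‖ ≤ M * δ := by
        refine (norm_mul_le _ _).trans ?_
        rw [norm_star]
        exact mul_le_mul hxM a2 (norm_nonneg _) hM0
      have b3 : ‖star (θ 0 x + θ 1 x - x) * x‖ ≤ δ * M := by
        refine (norm_mul_le _ _).trans ?_
        rw [norm_star]
        exact mul_le_mul a2 hxM (norm_nonneg _) hδ0.le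
      have c1 := norm_add_le (star x * (θ 0 1 + θ 1 1 - 1) * x - star x * (θ 0 x + θ 1 x - x) -
        star (θ 0 x + θ 1 x - x) * x) (θ 0 (star x * x) + θ 1 (star x * x) - star x * x)
      have c2 := norm_sub_le (star x * (θ 0 1 + θ 1 1 - 1) * x - star x * (θ 0 x + θ 1 x - x))
        (star (θ 0 x + θ 1 x - x) * x)
      have c3 := norm_sub_le (star x * (θ 0 1 + θ 1 1 - 1) * x) (star x * (θ 0 x + θ 1 x - x))
      nlinarith
    intro i
    refine (hc i).2 η hη0.le (le_trans ?_ hb)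
    refine CStarAlgebra.norm_le_norm_of_nonneg_of_le (hc i).1 ?_
    fin_cases i
    · exact le_add_of_nonneg_right (hc 1).1
    · exact le_add_of_nonneg_left (hc 0).1
  have hoa := fun i => oz_approx hR (Φ i) (hΦcp i) (fun x y hx hy hxy => by
    rw [hΦs, hΦs]; exact (hoz i).2 x y hx hy hxy) (X.image fun x => ψ x i) hη0
  obtain ⟨C, hC, hCa⟩ := hoa 0
  obtain ⟨D, hD, hDa⟩ := hoa 1
  have hX : ∀ x ∈ X, x ∈ X1 := fun x hx => by rw [hX1]; exact Finset.mem_union_left _ hx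
  refine ⟨C, D, hC, hD, θ 0 1, ?_, hθ1 0, ?_, ?_, ?_⟩
  · obtain ⟨Y, hY⟩ := hθcp 0 1 _ (MatIsPos.row ![1])
    have := congrFun (congrFun hY 0) 0
    exact ⟨Y 0 0, by simpa [Matrix.mul_apply] using this⟩
  · intro x hx
    have k1 := key x (hX x hx) 0
    have k2 := key (star x) (by
      rw [hX1]; exact Finset.mem_union_right _ (Finset.mem_image_of_mem _ hx)) 0
    rw [← norm_star] at k2
    have h1 : star (θ 0 1) = θ 0 1 := by rw [← hstar, star_one]
    rw [star_sub, star_mul, star_star, h1, hstar, star_star] at k2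
    have : θ 0 1 * x - x * θ 0 1 = (θ 0 1 * x - θ 0 x) - (x * θ 0 1 - θ 0 x) := by abel
    rw [this]
    have := norm_sub_le (θ 0 1 * x - θ 0 x) (x * θ 0 1 - θ 0 x)
    linarith
  · intro x hx
    obtain ⟨s, hs, hs'⟩ := hCa _ (Finset.mem_image_of_mem _ hx)
    rw [← hθs] at hs'
    refine ⟨s, hs, ?_⟩
    have k1 := key x (hX x hx) 0
    have := norm_sub_le_norm_sub_add_norm_sub (θ 0 1 * x) (θ 0 x) s
    linarith
  · intro x hx
    obtain ⟨s, hs, hs'⟩ := hDa _ (Finset.mem_image_of_mem _ hx)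
    rw [← hθs] at hs'
    refine ⟨s, hs, ?_⟩
    have k1 := key x (hX x hx) 1
    have e : (1 - θ 0 1) * x - s = -((θ 0 1 + θ 1 1 - 1) * x) + ((θ 1 1 * x - θ 1 x) +
      (θ 1 x - s)) := by noncomm_ring
    rw [e]
    have b1 : ‖(θ 0 1 + θ 1 1 - 1) * x‖ ≤ δ * M :=
      (norm_mul_le _ _).trans (mul_le_mul a1 (hM x hx) (norm_nonneg _) hδ0.le)
    have c1 := norm_add_le (-((θ 0 1 + θ 1 1 - 1) * x)) ((θ 1 1 * x - θ 1 x) + (θ 1 x - s))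
    have c2 := norm_add_le (θ 1 1 * x - θ 1 x) (θ 1 x - s)
    rw [norm_neg] at c1
    linarith
end OA


end Helpers


/-- Theorem 1.3 / Theorem 3.2 of the paper.  For a separable, unital,
simple C*-algebra `A`, the following are equivalent: (i) `A` has nuclear dimension at most
one and real rank zero; (ii) `A` has weak complexity rank at most one. -/
theorem nucdim_one_and_rr0_iff_weakCRLeOne
    (A : Type u) [CStarAlgebra A] [TopologicalSpace.SeparableSpace A]
    (hsimple : IsSimpleCStarAlgebra A) :
    (NuclearDimLE 1 A ∧ RealRankZero A) ↔ WeakCRLeOne A := by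
  letI := CStarAlgebra.spectralOrder A
  haveI := CStarAlgebra.spectralOrderedRing A
  exact ⟨fun h => W_of_nuc h.1 h.2, fun hW => ⟨nuc_of_W hW, rr0_of_W hW hsimple⟩⟩
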